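/- Let ℓ > 2 and let W be the Weyl group of type E_n for (n,ℓ) ∈ {(6,5), (7,5), (7,7), (8,7)}. Then the number of irreducible complex characters of W equals: 25, 60, 60, 112 respectively; and moreover |Irr(W)| equals the sum z(k·Out_F(S)) + z(k·Out_F(T)) + z(k·Out_F(E)) with the outer automizer groups as follows — for (6,5): C_4×C_2, W(E_6), SL_2(5).2 with defect-zero counts 8, 15, 2; for (7,5): C_4×C_2×S_3, W(E_7), SL_2(5).2×S_3 with counts 24, 30, 6; for (7,7): C_6×C_2, W(E_7), SL_2(7).2 with counts 12, 46, 2; for (8,7): C_6×(C_2)^2, W(E_8), SL_2(7).2×C_2 with counts 24, 84, 4. In particular, e.g. for (8,7): z(k(C_6×C_2^2)) = 24, z(k W(E_8)) = 84 (the number of 7-defect-zero characters of W(E_8)), z(k(SL_2(7).2×C_2)) = 4, and 24+84+4 = 112 = |Irr(W(E_8))|. -/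

import Mathlib

open CategoryTheory

/-- `χ : G → ℂ` is the character of an irreducible complex representation of `G`. -/
def IsIrrChar (G : Type) [Group G] (χ : G → ℂ) : Prop :=
  ∃ V : FDRep ℂ G, Simple V ∧ χ = fun g => FDRep.character V g

/-- `χ` is an irreducible character of `G` of `ℓ`-defect zero, i.e. `ℓ ∤ |G|/χ(1)`. -/
def IsDefectZeroChar (ℓ : ℕ) (G : Type) [Group G] (χ : G → ℂ) : Prop :=
  IsIrrChar G χ ∧ ∃ d : ℕ, χ 1 = (d : ℂ) ∧ ¬ (ℓ ∣ Nat.card G / d)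

/-- The number of irreducible complex characters of `G`. -/
noncomputable def numIrr (G : Type) [Group G] : ℕ :=
  Nat.card {χ : G → ℂ // IsIrrChar G χ}

/-- The number of irreducible complex characters of `G` of `ℓ`-defect zero
(`= z(kG)`, the number of projective simple `kG`-modules). -/
noncomputable def numDefectZero (ℓ : ℕ) (G : Type) [Group G] : ℕ :=
  Nat.card {χ : G → ℂ // IsDefectZeroChar ℓ G χ}

/-- `X` is an extension `SL_2(ℓ).2` of `SL_2(ℓ)` by `C_2`. -/
def IsExtSL2 (ℓ : ℕ) (X : Type) [Group X] : Prop :=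
  ∃ Nn : Subgroup X, Nn.Normal ∧ Nn.index = 2 ∧
    Nonempty (Nn ≃* Matrix.SpecialLinearGroup (Fin 2) (ZMod ℓ))

/-- The Weyl groups of types `E₆`, `E₇`, `E₈` (as Coxeter groups). -/
abbrev WE6 := CoxeterMatrix.E₆.Group
abbrev WE7 := CoxeterMatrix.E₇.Group
abbrev WE8 := CoxeterMatrix.E₈.Group


set_option linter.all false

/-! ## Part I : elementary character theory -/
section CharTheory

variable {G : Type} [Group G]

/-- `f` is the character of some finite dimensional complex representation. -/
def IsChar (f : G → ℂ) : Prop :=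
  ∃ V : FDRep ℂ G, f = fun g => FDRep.character V g

theorem isChar_of_rep {V : Type} [AddCommGroup V] [Module ℂ V] [FiniteDimensional ℂ V]
    (ρ : Representation ℂ G V) : IsChar (G := G) (fun g => LinearMap.trace ℂ V (ρ g)) :=
  ⟨FDRep.of ρ, rfl⟩

theorem IsIrrChar.isChar {f : G → ℂ} (h : IsIrrChar G f) : IsChar f := by
  obtain ⟨V, _, h⟩ := h
  exact ⟨V, h⟩

/-- matrix representations give characters -/
theorem isChar_of_matrix {n : Type} [Fintype n] [DecidableEq n] (ρ : G →* Matrix n n ℂ) :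
    IsChar (G := G) (fun g => (ρ g).trace) := by
  have := isChar_of_rep (G := G) (V := n → ℂ)
    ((Matrix.toLinAlgEquiv' (R := ℂ) (n := n)).toAlgHom.toMonoidHom.comp ρ)
  convert this using 2
  symm
  exact Matrix.trace_toLin'_eq _

theorem IsChar.conj {f : G → ℂ} (h : IsChar f) (g x : G) : f (x * g * x⁻¹) = f g := by
  obtain ⟨V, rfl⟩ := h
  exact FDRep.char_conj V g x

theorem IsChar.mul {f g : G → ℂ} (hf : IsChar f) (hg : IsChar g) : IsChar (f * g) := by
  obtain ⟨V, rfl⟩ := hf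
  obtain ⟨W, rfl⟩ := hg
  obtain h := isChar_of_rep (G := G) (Representation.tprod V.ρ W.ρ)
  convert h using 1
  ext g
  exact (LinearMap.trace_tensorProduct' (V.ρ g) (W.ρ g)).symm

/-- restriction to the image of a commuting idempotent -/
theorem isChar_of_idem {V : Type} [AddCommGroup V] [Module ℂ V] [FiniteDimensional ℂ V]
    (ρ : Representation ℂ G V) (P : V →ₗ[ℂ] V) (hP : P ∘ₗ P = P)
    (hc : ∀ g, P ∘ₗ ρ g = ρ g ∘ₗ P) :
    ∃ σ : Representation ℂ G (LinearMap.range P),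
      ∀ g, LinearMap.trace ℂ _ (σ g) = LinearMap.trace ℂ V (P ∘ₗ ρ g) := by
  have hinv : ∀ g, ∀ x ∈ LinearMap.range P, ρ g x ∈ LinearMap.range P := by
    rintro g _ ⟨y, rfl⟩
    exact ⟨ρ g y, LinearMap.congr_fun (hc g) y⟩
  refine ⟨{ toFun := fun g => (ρ g).restrict (hinv g), map_one' := ?_, map_mul' := ?_ }, ?_⟩
  · ext x; simp
  · intro a b; ext x; simp
  · intro g
    have e1 : (ρ g).restrict (hinv g) = P.rangeRestrict ∘ₗ (ρ g ∘ₗ (LinearMap.range P).subtype) := by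
      ext ⟨x, y, rfl⟩
      simp only [LinearMap.coe_restrict_apply, LinearMap.comp_apply, Submodule.subtype_apply]
      change _ = P _
      have := LinearMap.congr_fun (hc g) y
      have h2 := LinearMap.congr_fun hP (ρ g y)
      simp only [LinearMap.comp_apply] at this h2
      rw [← this, h2]
    change LinearMap.trace ℂ _ ((ρ g).restrict (hinv g)) = _
    rw [e1, LinearMap.trace_comp_comm']
    have e2 : (LinearMap.range P).subtype ∘ₗ P.rangeRestrict = P := by ext; simp
    rw [LinearMap.comp_assoc, e2, ← hc]

/-- the exterior square of a function -/
noncomputable def lam2 (f : G → ℂ) : G → ℂ := fun g => (f g * f g - f (g * g)) / 2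

theorem trace_comm_tensor {V : Type} [AddCommGroup V] [Module ℂ V] [FiniteDimensional ℂ V]
    (A B : V →ₗ[ℂ] V) :
    LinearMap.trace ℂ _ ((TensorProduct.comm ℂ V V).toLinearMap ∘ₗ TensorProduct.map A B)
      = LinearMap.trace ℂ V (B ∘ₗ A) := by
  classical
  let b := Module.finBasis ℂ V
  rw [LinearMap.trace_eq_matrix_trace ℂ (b.tensorProduct b), LinearMap.trace_eq_matrix_trace ℂ b,
    LinearMap.toMatrix_comp b b b, Matrix.trace, Matrix.trace, Fintype.sum_prod_type]
  refine Finset.sum_congr rfl fun i _ => ?_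
  rw [Matrix.diag_apply, Matrix.mul_apply]
  refine Finset.sum_congr rfl fun j _ => ?_
  rw [Matrix.diag_apply, LinearMap.toMatrix_apply, LinearMap.toMatrix_apply,
    LinearMap.toMatrix_apply]
  simp [Module.Basis.tensorProduct_apply]
  exact mul_comm _ _

theorem IsChar.lam2 {f : G → ℂ} (hf : IsChar f) : IsChar (lam2 f) := by
  obtain ⟨V, rfl⟩ := hf
  let T := (TensorProduct.comm ℂ V V).toLinearMap
  have hT : T ∘ₗ T = LinearMap.id := by
    apply TensorProduct.ext'; intro x y; simp [T]
  let P : TensorProduct ℂ V V →ₗ[ℂ] TensorProduct ℂ V V := (1/2 : ℂ) • (LinearMap.id - T)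
  have hP : P ∘ₗ P = P := by
    simp only [P, LinearMap.smul_comp, LinearMap.comp_smul, LinearMap.sub_comp, LinearMap.comp_sub,
      LinearMap.id_comp, LinearMap.comp_id, hT]
    module
  obtain ⟨σ, hσ⟩ := isChar_of_idem (G := G) (Representation.tprod V.ρ V.ρ) P hP (by
    intro g
    apply TensorProduct.ext'; intro x y
    simp [P, T])
  obtain h := isChar_of_rep σ
  convert h using 1
  ext g
  rw [hσ g]
  simp only [P, LinearMap.smul_comp, LinearMap.sub_comp, LinearMap.id_comp, map_smul, map_sub]
  have h1 := LinearMap.trace_tensorProduct' (V.ρ g) (V.ρ g)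
  have h2 := trace_comm_tensor (V.ρ g) (V.ρ g)
  change _ = (1/2 : ℂ) • (LinearMap.trace ℂ _ (TensorProduct.map (V.ρ g) (V.ρ g)) -
    LinearMap.trace ℂ _ ((TensorProduct.comm ℂ V V).toLinearMap ∘ₗ
      TensorProduct.map (V.ρ g) (V.ρ g)))
  rw [h1, h2]
  have h3 : (V.ρ g) ∘ₗ (V.ρ g) = V.ρ (g * g) := by rw [map_mul]; rfl
  rw [h3]
  simp only [_root_.lam2, FDRep.character, smul_eq_mul]
  ring

variable [Fintype G]

/-- the (bilinear) inner product of class functions -/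
noncomputable def ip (f g : G → ℂ) : ℂ := (Nat.card G : ℂ)⁻¹ * ∑ x, f x * g x⁻¹

theorem cardG_ne : (Nat.card G : ℂ) ≠ 0 := by
  exact_mod_cast Nat.card_pos.ne'

theorem ip_add_left (f g h : G → ℂ) : ip (f + g) h = ip f h + ip g h := by
  simp [ip, add_mul, Finset.sum_add_distrib, mul_add]

theorem ip_neg_left (f h : G → ℂ) : ip (-f) h = -ip f h := by
  simp [ip]

theorem ip_smul_left (c : ℂ) (f h : G → ℂ) : ip (c • f) h = c * ip f h := by
  simp only [ip, Pi.smul_apply, smul_eq_mul, mul_assoc, ← Finset.mul_sum]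
  ring

theorem ip_comm (f g : G → ℂ) : ip f g = ip g f := by
  unfold ip
  congr 1
  refine Fintype.sum_equiv (Equiv.inv G) _ _ fun x => ?_
  simp [mul_comm]

theorem ip_add_right (f g h : G → ℂ) : ip h (f + g) = ip h f + ip h g := by
  rw [ip_comm, ip_add_left, ip_comm f, ip_comm g]

theorem ip_neg_right (f h : G → ℂ) : ip h (-f) = -ip h f := by
  rw [ip_comm, ip_neg_left, ip_comm]

theorem ip_smul_right (c : ℂ) (f h : G → ℂ) : ip h (c • f) = c * ip h f := by
  rw [ip_comm, ip_smul_left, ip_comm]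

theorem ip_sub_left (f g h : G → ℂ) : ip (f - g) h = ip f h - ip g h := by
  rw [sub_eq_add_neg, ip_add_left, ip_neg_left, sub_eq_add_neg]

theorem ip_sub_right (f g h : G → ℂ) : ip h (f - g) = ip h f - ip h g := by
  rw [ip_comm, ip_sub_left, ip_comm f, ip_comm g]

theorem ip_sum_left {ι : Type} (s : Finset ι) (f : ι → G → ℂ) (h : G → ℂ) :
    ip (∑ i ∈ s, f i) h = ∑ i ∈ s, ip (f i) h := by
  classical
  induction s using Finset.induction_on with
  | empty => simp [ip]
  | insert a s ha ih => rw [Finset.sum_insert ha, ip_add_left, ih, Finset.sum_insert ha]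

theorem ip_sum_right {ι : Type} (s : Finset ι) (f : ι → G → ℂ) (h : G → ℂ) :
    ip h (∑ i ∈ s, f i) = ∑ i ∈ s, ip h (f i) := by
  rw [ip_comm, ip_sum_left]
  exact Finset.sum_congr rfl fun i _ => ip_comm _ _

theorem IsChar.ip_nat {f g : G → ℂ} (hf : IsChar f) (hg : IsChar g) : ∃ n : ℕ, ip f g = n := by
  obtain ⟨V, rfl⟩ := hf
  obtain ⟨W, rfl⟩ := hg
  haveI := invertibleOfNonzero (cardG_ne (G := G))
  exact ⟨_, Representation.card_inv_mul_sum_char_mul_char_eq_finrank W.ρ V.ρ⟩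

theorem isIrrChar_iff {f : G → ℂ} : IsIrrChar G f ↔ IsChar f ∧ ip f f = 1 := by
  have key : ∀ V : FDRep ℂ G, Simple V ↔
      ip (fun g => FDRep.character V g) (fun g => FDRep.character V g) = 1 := by
    intro V
    rw [FDRep.simple_iff_char_is_norm_one, ip, inv_mul_eq_one₀ cardG_ne, eq_comm]
  constructor
  · rintro ⟨V, hs, rfl⟩
    exact ⟨⟨V, rfl⟩, (key V).1 hs⟩
  · rintro ⟨⟨V, rfl⟩, h⟩
    exact ⟨V, (key V).2 h, rfl⟩

theorem IsIrrChar.ip_self {f : G → ℂ} (h : IsIrrChar G f) : ip f f = 1 := (isIrrChar_iff.1 h).2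

theorem IsIrrChar.ip_ne {f g : G → ℂ} (hf : IsIrrChar G f) (hg : IsIrrChar G g) (h : f ≠ g) :
    ip f g = 0 := by
  obtain ⟨V, hs, rfl⟩ := hf
  obtain ⟨W, hs', rfl⟩ := hg
  haveI := invertibleOfNonzero (cardG_ne (G := G))
  have := FDRep.char_orthonormal V W
  rw [if_neg] at this
  · exact this
  · rintro ⟨i⟩
    exact h (funext fun g => congrFun (FDRep.char_iso i) g)

theorem IsChar.val_one {f : G → ℂ} (h : IsChar f) : ∃ d : ℕ, f 1 = d := by
  obtain ⟨V, rfl⟩ := h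
  exact ⟨_, FDRep.char_one V⟩

theorem IsIrrChar.val_one {f : G → ℂ} (h : IsIrrChar G f) : ∃ d : ℕ, 0 < d ∧ f 1 = d := by
  have hc := h.isChar
  have h1 := h.ip_self
  obtain ⟨V, rfl⟩ := hc
  refine ⟨_, ?_, FDRep.char_one V⟩
  by_contra h0
  have h0 : Module.finrank ℂ V = 0 := by omega
  have : ∀ g, FDRep.character V g = 0 := by
    intro g
    haveI := Module.finrank_zero_iff.1 h0
    have : V.ρ g = 0 := Subsingleton.elim _ _
    simp [FDRep.character, this]
  simp [ip, this] at h1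

variable (G) in
/-- characters of irreducible representations (unbundled version) -/
def irrSet : Set (G → ℂ) := {χ | ∃ (V : Type) (_ : AddCommGroup V) (_ : Module ℂ V)
  (_ : FiniteDimensional ℂ V) (ρ : Representation ℂ G V), ρ.IsIrreducible ∧
    χ = fun g => LinearMap.trace ℂ V (ρ g)}

theorem irrSet_irr {f : G → ℂ} (h : f ∈ irrSet G) : IsIrrChar G f := by
  obtain ⟨V, _, _, _, ρ, hi, rfl⟩ := h
  haveI := invertibleOfNonzero (cardG_ne (G := G))
  have hn := Representation.char_orthonormal ρ ρ
  rw [if_pos ⟨Representation.Equiv.refl ρ⟩] at hn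
  exact isIrrChar_iff.2 ⟨isChar_of_rep ρ, hn⟩

/-- complete reducibility -/
theorem rep_mem_closure' (n : ℕ) : ∀ (V : Type) [AddCommGroup V] [Module ℂ V]
    [FiniteDimensional ℂ V] (ρ : Representation ℂ G V), Module.finrank ℂ V ≤ n →
    (fun g => LinearMap.trace ℂ V (ρ g)) ∈ AddSubmonoid.closure (irrSet G) := by
  haveI := invertibleOfNonzero (cardG_ne (G := G))
  haveI : NeZero (Nat.card G : ℂ) := ⟨cardG_ne⟩
  induction n with
  | zero =>
    intro V _ _ _ ρ h
    have : (fun g => LinearMap.trace ℂ V (ρ g)) = 0 := by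
      haveI := Module.finrank_zero_iff.1 (Nat.le_zero.1 h)
      ext g
      have : ρ g = 0 := Subsingleton.elim _ _
      simp [this]
    rw [this]; exact zero_mem _
  | succ n ih =>
    intro V _ _ _ ρ h
    rcases Nat.lt_or_ge (Module.finrank ℂ V) (n + 1) with h' | h'
    · exact ih V ρ (by omega)
    by_cases hi : ρ.IsIrreducible
    · apply AddSubmonoid.subset_closure
      exact ⟨V, _, _, inferInstance, ρ, hi, rfl⟩
    · have hnt : Nontrivial V := Module.nontrivial_of_finrank_pos (R := ℂ) (by omega)
      have : ∃ p : Subrepresentation ρ, p ≠ ⊥ ∧ p ≠ ⊤ := by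
        by_contra hcon
        push Not at hcon
        apply hi
        have hbt : (⊥ : Subrepresentation ρ) ≠ ⊤ := by
          intro e
          have e2 : (⊥ : Subrepresentation ρ).toSubmodule = (⊤ : Subrepresentation ρ).toSubmodule := by
            rw [e]
          exact bot_ne_top (α := Submodule ℂ V) e2
        haveI : Nontrivial (Subrepresentation ρ) := ⟨⊥, ⊤, hbt⟩
        exact ⟨fun p => or_iff_not_imp_left.2 (hcon p)⟩
      obtain ⟨p, hp, hp'⟩ := this
      obtain ⟨q, hq⟩ := ComplementedLattice.exists_isCompl p
      have hpq : IsCompl p.toSubmodule q.toSubmodule := by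
        constructor
        · rw [disjoint_iff, ← Subrepresentation.toSubmodule_inf, hq.inf_eq_bot]; rfl
        · rw [codisjoint_iff, ← Subrepresentation.toSubmodule_sup, hq.sup_eq_top]; rfl
      let P := p.toSubmodule.projection q.toSubmodule hpq
      have hP : P ∘ₗ P = P := by
        ext x
        simp [P]
      have hc : ∀ g, P ∘ₗ ρ g = ρ g ∘ₗ P := by
        intro g
        ext x
        obtain ⟨y, hy, z, hz, rfl⟩ := Submodule.mem_sup.1
          (show x ∈ p.toSubmodule ⊔ q.toSubmodule by rw [hpq.sup_eq_top]; trivial)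
        have h1 : ∀ y ∈ p.toSubmodule, P y = y := fun y hy =>
          (Submodule.projection_eq_self_iff hpq y).2 hy
        have h2 : ∀ z ∈ q.toSubmodule, P z = 0 := fun z hz =>
          (Submodule.projection_apply_eq_zero_iff hpq).2 hz
        simp only [LinearMap.comp_apply, map_add, h1 y hy, h2 z hz,
          h1 _ (p.apply_mem_toSubmodule g hy), h2 _ (q.apply_mem_toSubmodule g hz), map_zero]
      have hP2 : (LinearMap.id - P) ∘ₗ (LinearMap.id - P) = LinearMap.id - P := by
        simp [LinearMap.sub_comp, LinearMap.comp_sub, hP]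
      obtain ⟨σ, hσ⟩ := isChar_of_idem ρ P hP hc
      obtain ⟨τ, hτ⟩ := isChar_of_idem ρ (LinearMap.id - P) hP2
        (fun g => by simp [LinearMap.sub_comp, LinearMap.comp_sub, hc])
      have hrP : LinearMap.range P = p.toSubmodule := Submodule.range_projection hpq
      have hkP : LinearMap.ker P = q.toSubmodule := Submodule.ker_projection hpq
      have hr1 : LinearMap.range P ≠ ⊤ := by
        rw [hrP]
        intro e
        exact hp' (Subrepresentation.toSubmodule_injective e)
      have hr2 : LinearMap.range (LinearMap.id - P) ≠ ⊤ := by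
        intro e
        have hk : LinearMap.range (LinearMap.id - P) ≤ LinearMap.ker P := by
          rintro _ ⟨x, rfl⟩
          have := LinearMap.congr_fun hP x
          simp only [LinearMap.comp_apply] at this
          simp [this]
        rw [e, hkP, top_le_iff] at hk
        have hd := hpq.inf_eq_bot
        rw [hk, inf_top_eq] at hd
        exact hp (Subrepresentation.toSubmodule_injective hd)
      have f1 := Submodule.finrank_lt hr1
      have f2 := Submodule.finrank_lt hr2
      have m1 := ih _ σ (by omega)
      have m2 := ih _ τ (by omega)
      convert add_mem m1 m2 using 1
      ext g
      simp only [Pi.add_apply, hσ, hτ, LinearMap.sub_comp, map_sub, LinearMap.id_comp]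
      ring

theorem IsIrrChar.mem_irrSet {f : G → ℂ} (h : IsIrrChar G f) : f ∈ irrSet G := by
  by_contra hcon
  have hmem : f ∈ AddSubmonoid.closure (irrSet G) := by
    obtain ⟨V, rfl⟩ := h.isChar
    exact rep_mem_closure' _ V V.ρ le_rfl
  have key : ip f f = 0 := by
    refine AddSubmonoid.closure_induction (motive := fun x _ => ip f x = 0) ?_ ?_ ?_ hmem
    · intro x hx
      exact h.ip_ne (irrSet_irr hx) (fun e => hcon (e ▸ hx))
    · simp [ip]
    · intro x y _ _ hx hy; rw [ip_add_right, hx, hy, add_zero]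
  rw [h.ip_self] at key
  exact one_ne_zero key

theorem IsChar.mem_closure {f : G → ℂ} (h : IsChar f) :
    f ∈ AddSubmonoid.closure {χ : G → ℂ | IsIrrChar G χ} := by
  obtain ⟨V, rfl⟩ := h
  exact AddSubmonoid.closure_mono (fun _ h => irrSet_irr h) (rep_mem_closure' _ V V.ρ le_rfl)

variable (G) in
theorem irr_finite : {χ : G → ℂ | IsIrrChar G χ}.Finite := by
  have hli : LinearIndependent ℂ (fun χ : {χ : G → ℂ | IsIrrChar G χ} => (χ : G → ℂ)) := by
    rw [linearIndependent_iff']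
    intro s c hc i hi
    have := congrArg (fun f => ip f (i : G → ℂ)) hc
    simp only [ip_sum_left, ip_smul_left] at this
    rw [Finset.sum_eq_single i] at this
    · rw [i.2.ip_self] at this
      simpa [ip] using this
    · intro j _ hj
      rw [IsIrrChar.ip_ne j.2 i.2 (fun e => hj (Subtype.ext e)), mul_zero]
    · intro h; exact absurd hi h
  have := hli.finite
  exact this

variable (G) in
/-- the finset of irreducible characters -/
noncomputable def irrs : Finset (G → ℂ) := (irr_finite G).toFinset

theorem mem_irrs {f : G → ℂ} : f ∈ irrs G ↔ IsIrrChar G f := by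
  simp [irrs]

variable (G) in
/-- virtual characters -/
def vchars : AddSubgroup (G → ℂ) := AddSubgroup.closure {χ : G → ℂ | IsIrrChar G χ}

theorem IsIrrChar.mem_vchars {f : G → ℂ} (h : IsIrrChar G f) : f ∈ vchars G :=
  AddSubgroup.subset_closure h

theorem IsChar.mem_vchars {f : G → ℂ} (h : IsChar f) : f ∈ vchars G := by
  have h := h.mem_closure
  have : AddSubmonoid.closure {χ : G → ℂ | IsIrrChar G χ} ≤ (vchars G).toAddSubmonoid :=
    (AddSubmonoid.closure_le).2 AddSubgroup.subset_closure
  exact this h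

theorem vchars_mul {f g : G → ℂ} (hf : f ∈ vchars G) (hg : g ∈ vchars G) : f * g ∈ vchars G := by
  refine AddSubgroup.closure_induction ?_ ?_ ?_ ?_ hf
  · intro a ha
    refine AddSubgroup.closure_induction ?_ ?_ ?_ ?_ hg
    · intro b hb
      exact (IsChar.mul (IsIrrChar.isChar ha) (IsIrrChar.isChar hb)).mem_vchars
    · rw [mul_zero]; exact zero_mem _
    · intro x y _ _ hx hy; rw [mul_add]; exact add_mem hx hy
    · intro x _ hx; rw [mul_neg]; exact neg_mem hx
  · rw [zero_mul]; exact zero_mem _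
  · intro x y _ _ hx hy; rw [add_mul]; exact add_mem hx hy
  · intro x _ hx; rw [neg_mul]; exact neg_mem hx

theorem vchars_lam2 {f : G → ℂ} (hf : f ∈ vchars G) : lam2 f ∈ vchars G := by
  refine AddSubgroup.closure_induction ?_ ?_ ?_ ?_ hf
  · intro a ha
    exact (IsIrrChar.isChar ha).lam2.mem_vchars
  · have : lam2 (0 : G → ℂ) = 0 := by ext; simp [lam2]
    rw [this]; exact zero_mem _
  · intro x y hx' hy' hx hy
    have : lam2 (x + y) = lam2 x + lam2 y + x * y := by
      ext; simp only [lam2, Pi.add_apply, Pi.mul_apply]; ring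
    rw [this]; exact add_mem (add_mem hx hy) (vchars_mul hx' hy')
  · intro x hx' hx
    have : lam2 (-x) = x * x - lam2 x := by
      ext; simp only [lam2, Pi.neg_apply, Pi.sub_apply, Pi.mul_apply]; ring
    rw [this]; exact sub_mem (vchars_mul hx' hx') hx

theorem vchars_conj {f : G → ℂ} (hf : f ∈ vchars G) (g x : G) : f (x * g * x⁻¹) = f g := by
  refine AddSubgroup.closure_induction ?_ ?_ ?_ ?_ hf
  · intro a ha; exact (IsIrrChar.isChar ha).conj g x
  · rfl
  · intro a b _ _ ha hb; simp only [Pi.add_apply, ha, hb]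
  · intro a _ ha; simp only [Pi.neg_apply, ha]

theorem ip_irr {χ ψ : G → ℂ} (h : IsIrrChar G χ) (h' : IsIrrChar G ψ) [Decidable (χ = ψ)] :
    ip χ ψ = if χ = ψ then 1 else 0 := by
  split_ifs with e
  · subst e; exact h.ip_self
  · exact h.ip_ne h' e

/-- expansion of a virtual character -/
theorem vchars_expand {f : G → ℂ} (hf : f ∈ vchars G) : f = ∑ χ ∈ irrs G, ip f χ • χ := by
  classical
  refine AddSubgroup.closure_induction (p := fun f _ => f = ∑ χ ∈ irrs G, ip f χ • χ)
    ?_ ?_ ?_ ?_ hf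
  · intro a ha
    rw [Finset.sum_eq_single a]
    · rw [IsIrrChar.ip_self ha, one_smul]
    · intro b hb hne
      rw [IsIrrChar.ip_ne ha (mem_irrs.1 hb) hne.symm, zero_smul]
    · intro h; exact absurd (mem_irrs.2 ha) h
  · simp [ip]
  · intro x y _ _ hx hy
    simp only [ip_add_left, add_smul, Finset.sum_add_distrib, ← hx, ← hy]
  · intro x _ hx
    simp only [ip_neg_left, neg_smul, Finset.sum_neg_distrib, ← hx]

theorem vchars_ip_int {f g : G → ℂ} (hf : f ∈ vchars G) (hg : g ∈ vchars G) :
    ∃ n : ℤ, ip f g = n := by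
  refine AddSubgroup.closure_induction (p := fun f _ => ∃ n : ℤ, ip f g = n) ?_ ?_ ?_ ?_ hf
  · intro a ha
    refine AddSubgroup.closure_induction (p := fun g _ => ∃ n : ℤ, ip a g = n) ?_ ?_ ?_ ?_ hg
    · intro b hb
      obtain ⟨n, hn⟩ := (IsIrrChar.isChar ha).ip_nat (IsIrrChar.isChar hb)
      exact ⟨n, by simp [hn]⟩
    · exact ⟨0, by simp [ip]⟩
    · rintro x y _ _ ⟨m, hm⟩ ⟨n, hn⟩; exact ⟨m + n, by simp [ip_add_right, hm, hn]⟩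
    · rintro x _ ⟨m, hm⟩; exact ⟨-m, by simp [ip_neg_right, hm]⟩
  · exact ⟨0, by simp [ip]⟩
  · rintro x y _ _ ⟨m, hm⟩ ⟨n, hn⟩; exact ⟨m + n, by simp [ip_add_left, hm, hn]⟩
  · rintro x _ ⟨m, hm⟩; exact ⟨-m, by simp [ip_neg_left, hm]⟩

theorem vchars_ip {f g : G → ℂ} (hf : f ∈ vchars G) (hg : g ∈ vchars G) :
    ip f g = ∑ χ ∈ irrs G, ip f χ * ip g χ := by
  conv_lhs => rw [vchars_expand hf]
  rw [ip_sum_left]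
  refine Finset.sum_congr rfl fun χ _ => ?_
  rw [ip_smul_left, ip_comm χ g]

/-- norm one virtual characters of positive degree are irreducible -/
theorem irr_of_norm_one {f : G → ℂ} (hf : f ∈ vchars G) (hn : ip f f = 1) (d : ℕ) (hd : f 1 = d) :
    IsIrrChar G f := by
  classical
  have hInt : ∀ χ : G → ℂ, ∃ n : ℤ, IsIrrChar G χ → ip f χ = n := by
    intro χ
    by_cases h : IsIrrChar G χ
    · obtain ⟨n, hn⟩ := vchars_ip_int hf h.mem_vchars
      exact ⟨n, fun _ => hn⟩
    · exact ⟨0, fun h' => absurd h' h⟩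
  choose c hc using hInt
  have h1 : ∑ χ ∈ irrs G, c χ * c χ = 1 := by
    have := vchars_ip hf hf
    rw [hn] at this
    have h2 : (1 : ℂ) = ∑ χ ∈ irrs G, (c χ : ℂ) * c χ := by
      rw [this]
      exact Finset.sum_congr rfl fun χ h => by rw [hc χ (mem_irrs.1 h)]
    exact_mod_cast h2.symm
  have hex : ∃ χ ∈ irrs G, c χ ≠ 0 := by
    by_contra hcon
    push Not at hcon
    rw [Finset.sum_eq_zero (fun χ h => by rw [hcon χ h, mul_zero])] at h1
    exact absurd h1 (by norm_num)
  obtain ⟨χ, hχ, hne⟩ := hex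
  have hge : ∀ n : ℤ, n ≠ 0 → 1 ≤ n * n := by
    intro n hn
    have := mul_self_pos.2 hn
    omega
  have hsum := Finset.add_sum_erase (irrs G) (fun χ => c χ * c χ) hχ
  have hnn : ∀ ψ ∈ (irrs G).erase χ, 0 ≤ c ψ * c ψ := fun ψ _ => mul_self_nonneg _
  have hs0 : ∑ ψ ∈ (irrs G).erase χ, c ψ * c ψ = 0 := by
    have := Finset.sum_nonneg hnn
    have := hge _ hne
    simp only [h1] at hsum
    omega
  have hz := (Finset.sum_eq_zero_iff_of_nonneg hnn).1 hs0
  have hc1 : c χ * c χ = 1 := by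
    simp only [h1, hs0] at hsum; omega
  have hfe : f = (c χ : ℂ) • χ := by
    conv_lhs => rw [vchars_expand hf]
    rw [Finset.sum_eq_single χ]
    · rw [hc χ (mem_irrs.1 hχ)]
    · intro ψ hψ hne'
      have := hz ψ (Finset.mem_erase.2 ⟨hne', hψ⟩)
      rw [hc ψ (mem_irrs.1 hψ), mul_self_eq_zero.1 this]; simp
    · intro h; exact absurd hχ h
  rcases mul_self_eq_one_iff.1 hc1 with h | h
  · rw [h] at hfe
    rw [hfe]; simpa using mem_irrs.1 hχ
  · exfalso
    obtain ⟨e, he, he'⟩ := (mem_irrs.1 hχ).val_one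
    have := congrFun hfe 1
    rw [hd, h] at this
    simp only [Pi.smul_apply, he', smul_eq_mul] at this
    have h3 : (d : ℤ) = -1 * (e : ℤ) := by
      have h4 : ((d : ℤ) : ℂ) = ((-1 * (e : ℤ) : ℤ) : ℂ) := by push_cast; simpa using this
      exact_mod_cast h4
    omega

/-- the regular character -/
noncomputable def regc : G → ℂ := by
  classical exact fun g => if g = 1 then (Nat.card G : ℂ) else 0

theorem ip_regc (f : G → ℂ) : ip f regc = f 1 := by
  classical
  unfold ip regc
  rw [Finset.sum_eq_single 1]
  · have := cardG_ne (G := G)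
    simp; field_simp
  · intro b _ hb
    simp [hb]
  · simp

theorem regc_isChar : IsChar (regc (G := G)) := by
  classical
  have h := isChar_of_matrix (G := G) (n := G)
    { toFun := fun g => Matrix.of fun a b => if a = g * b then (1 : ℂ) else 0
      map_one' := by ext a b; simp [Matrix.one_apply]
      map_mul' := by
        intro g h
        ext a b
        simp [Matrix.mul_apply, mul_assoc] }
  convert h using 1
  ext g
  simp only [Matrix.trace, regc, MonoidHom.coe_mk, OneHom.coe_mk, Matrix.diag_apply,
    Matrix.of_apply]
  split_ifs with hg
  · subst hg; simp
  · rw [Finset.sum_eq_zero]; intro x _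
    rw [if_neg]; intro e; apply hg
    exact (mul_eq_right.1 e.symm)

theorem regc_expand : regc (G := G) = ∑ χ ∈ irrs G, χ 1 • χ := by
  conv_lhs => rw [vchars_expand (regc_isChar (G := G)).mem_vchars]
  refine Finset.sum_congr rfl fun χ _ => ?_
  rw [ip_comm, ip_regc]

/-- completeness criterion -/
theorem irr_complete {ι : Type} (s : Finset ι) (X : ι → G → ℂ) (hX : ∀ i ∈ s, IsIrrChar G (X i))
    (c : ι → ℂ) (hreg : ∑ i ∈ s, c i • X i = regc) {χ : G → ℂ} (hχ : IsIrrChar G χ) :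
    ∃ i ∈ s, χ = X i := by
  by_contra hcon
  push Not at hcon
  have h1 := ip_regc χ
  rw [← hreg, ip_sum_right, Finset.sum_eq_zero] at h1
  · obtain ⟨d, hd, h⟩ := hχ.val_one
    rw [h] at h1
    have : d = 0 := by exact_mod_cast h1.symm
    omega
  · intro i hi
    rw [ip_smul_right, hχ.ip_ne (hX i hi) (hcon i hi), mul_zero]

theorem numIrr_eq {ι : Type} [Fintype ι] (X : ι → G → ℂ) (hX : ∀ i, IsIrrChar G (X i))
    (hinj : Function.Injective X) (c : ι → ℂ) (hreg : ∑ i, c i • X i = regc) :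
    numIrr G = Fintype.card ι := by
  rw [numIrr, ← Nat.card_eq_fintype_card]
  symm
  refine Nat.card_congr (Equiv.ofBijective (fun i => ⟨X i, hX i⟩) ⟨?_, ?_⟩)
  · intro i j h
    exact hinj (congrArg Subtype.val h)
  · rintro ⟨χ, hχ⟩
    obtain ⟨i, _, hi⟩ := irr_complete Finset.univ X (fun i _ => hX i) c hreg hχ
    exact ⟨i, Subtype.ext hi.symm⟩

theorem numDefectZero_eq (l : ℕ) {ι : Type} [Fintype ι] (X : ι → G → ℂ) (hX : ∀ i, IsIrrChar G (X i))
    (hinj : Function.Injective X) (c : ι → ℂ) (hreg : ∑ i, c i • X i = regc)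
    (deg : ι → ℕ) (hdeg : ∀ i, X i 1 = deg i) :
    numDefectZero l G = (Finset.univ.filter fun i => ¬ l ∣ Nat.card G / deg i).card := by
  rw [numDefectZero, ← Fintype.card_subtype, ← Nat.card_eq_fintype_card]
  symm
  refine Nat.card_congr (Equiv.ofBijective (fun i => ⟨X i.1, hX i.1, deg i.1, hdeg i.1, i.2⟩) ⟨?_, ?_⟩)
  · intro i j h
    exact Subtype.ext (hinj (congrArg Subtype.val h))
  · rintro ⟨χ, hχ, d, hd, hd'⟩
    obtain ⟨i, _, rfl⟩ := irr_complete Finset.univ X (fun i _ => hX i) c hreg hχ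
    have : deg i = d := by
      have h := (hdeg i).symm.trans hd
      exact_mod_cast h
    exact ⟨⟨i, by rw [this]; exact hd'⟩, rfl⟩

end CharTheory

/-! ## Tables, products and small groups -/
section Tables

theorem IsChar.comp {G H : Type} [Group G] [Group H] {f : G → ℂ} (h : IsChar f) (φ : H →* G) :
    IsChar (fun x => f (φ x)) := by
  obtain ⟨V, rfl⟩ := h
  exact isChar_of_rep (G := H) (V := V) (V.ρ.comp φ)

/-- a complete table of irreducible characters of `G` -/
structure CTable (G : Type) [Group G] [Fintype G] (ι : Type) [Fintype ι] where
  /-- the rows -/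
  X : ι → G → ℂ
  irr : ∀ i, IsIrrChar G (X i)
  inj : Function.Injective X
  /-- the degrees -/
  deg : ι → ℕ
  deg_eq : ∀ i, X i 1 = deg i
  reg : ∑ i, (deg i : ℂ) • X i = regc

theorem CTable.numIrr {G : Type} [Group G] [Fintype G] {ι : Type} [Fintype ι] (T : CTable G ι) :
    numIrr G = Fintype.card ι := numIrr_eq T.X T.irr T.inj _ T.reg

theorem CTable.numDefectZero {G : Type} [Group G] [Fintype G] {ι : Type} [Fintype ι]
    (T : CTable G ι) (l : ℕ) :
    numDefectZero l G = (Finset.univ.filter fun i => ¬ l ∣ Nat.card G / T.deg i).card :=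
  numDefectZero_eq l T.X T.irr T.inj _ T.reg T.deg T.deg_eq

theorem CTable.card {G : Type} [Group G] [Fintype G] {ι : Type} [Fintype ι]
    (T : CTable G ι) : ∑ i, T.deg i * T.deg i = Nat.card G := by
  have := congrFun T.reg 1
  simp only [Finset.sum_apply, Pi.smul_apply, smul_eq_mul, T.deg_eq, regc, if_true] at this
  exact_mod_cast this

/-- the table of all irreducible characters -/
noncomputable def fullTable (G : Type) [Group G] [Fintype G] : CTable G (irrs G) where
  X := fun χ => χ.1
  irr := fun χ => mem_irrs.1 χ.2
  inj := Subtype.val_injective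
  deg := fun χ => (mem_irrs.1 χ.2).val_one.choose
  deg_eq := fun χ => (mem_irrs.1 χ.2).val_one.choose_spec.2
  reg := by
    rw [regc_expand]
    rw [← Finset.sum_coe_sort (irrs G)]
    refine Finset.sum_congr rfl fun χ _ => ?_
    rw [← (mem_irrs.1 χ.2).val_one.choose_spec.2]

theorem ip_prod {G H : Type} [Group G] [Group H] [Fintype G] [Fintype H] (f f' : G → ℂ)
    (g g' : H → ℂ) : ip (fun x : G × H => f x.1 * g x.2) (fun x => f' x.1 * g' x.2)
      = ip f f' * ip g g' := by
  unfold ip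
  rw [Nat.card_prod, Nat.cast_mul, mul_inv, mul_mul_mul_comm, Finset.sum_mul_sum,
    Fintype.sum_prod_type]
  congr 1
  refine Finset.sum_congr rfl fun x _ => Finset.sum_congr rfl fun y _ => ?_
  simp only [Prod.fst_inv, Prod.snd_inv]
  ring

/-- the table of a direct product -/
noncomputable def CTable.prod {G H : Type} [Group G] [Group H] [Fintype G] [Fintype H]
    {ι κ : Type} [Fintype ι] [Fintype κ] (T : CTable G ι) (U : CTable H κ) :
    CTable (G × H) (ι × κ) where
  X := fun i x => T.X i.1 x.1 * U.X i.2 x.2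
  irr := fun i => by
    rw [isIrrChar_iff]
    refine ⟨?_, ?_⟩
    · exact ((T.irr i.1).isChar.comp (MonoidHom.fst G H)).mul
        ((U.irr i.2).isChar.comp (MonoidHom.snd G H))
    · rw [ip_prod, (T.irr i.1).ip_self, (U.irr i.2).ip_self, one_mul]
  inj := by
    rintro ⟨i, j⟩ ⟨i', j'⟩ h
    simp only at h
    have h1 := ip_prod (T.X i) (T.X i') (U.X j) (U.X j')
    have h2 := ip_prod (T.X i') (T.X i') (U.X j') (U.X j')
    rw [h, h2, (T.irr i').ip_self, (U.irr j').ip_self, one_mul] at h1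
    have e1 : T.X i = T.X i' := by
      by_contra hne
      rw [(T.irr i).ip_ne (T.irr i') hne, zero_mul] at h1
      exact one_ne_zero h1
    have e2 : U.X j = U.X j' := by
      by_contra hne
      rw [(U.irr j).ip_ne (U.irr j') hne, mul_zero] at h1
      exact one_ne_zero h1
    rw [T.inj e1, U.inj e2]
  deg := fun i => T.deg i.1 * U.deg i.2
  deg_eq := fun i => by simp [T.deg_eq, U.deg_eq]
  reg := by
    classical
    ext ⟨x, y⟩
    have hT := congrFun T.reg x
    have hU := congrFun U.reg y
    simp only [Finset.sum_apply, Pi.smul_apply, smul_eq_mul] at hT hU ⊢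
    have : regc (x, y) = regc x * regc y := by
      simp only [regc, Prod.mk_eq_one, Nat.card_prod]
      split_ifs <;> simp_all
    rw [this, ← hT, ← hU, Finset.sum_mul_sum, Fintype.sum_prod_type]
    refine Finset.sum_congr rfl fun i _ => Finset.sum_congr rfl fun j _ => ?_
    push_cast; ring

theorem abelian_deg {G : Type} [CommGroup G] [Fintype G] {χ : G → ℂ} (h : IsIrrChar G χ) :
    χ 1 = 1 := by
  obtain ⟨V, _, _, _, ρ, hi, rfl⟩ := h.mem_irrSet
  have := Representation.IsIrreducible.finrank_eq_one_of_isMulCommutative ρ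
  simp [this]

theorem abelian_fullTable_deg (G : Type) [CommGroup G] [Fintype G] (i : irrs G) :
    (fullTable G).deg i = 1 := by
  have h := (fullTable G).deg_eq i
  rw [abelian_deg ((fullTable G).irr i)] at h
  exact_mod_cast h.symm

theorem abelian_card (G : Type) [CommGroup G] [Fintype G] :
    Fintype.card (irrs G) = Nat.card G := by
  have := (fullTable G).card
  simpa [abelian_fullTable_deg] using this

theorem abelian_numDefectZero (l : ℕ) (G : Type) [CommGroup G] [Fintype G]
    (h : ¬ l ∣ Nat.card G) : numDefectZero l G = Nat.card G := by
  rw [(fullTable G).numDefectZero, Finset.filter_true_of_mem]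
  · rw [Finset.card_univ, abelian_card]
  · intro i _
    rwa [abelian_fullTable_deg, Nat.div_one]

theorem ip_intCast {G : Type} [Group G] [Fintype G] (F H : G → ℤ) (n : ℤ)
    (h : ∑ x, F x * H x⁻¹ = n * Fintype.card G) :
    ip (fun x => (F x : ℂ)) (fun x => (H x : ℂ)) = n := by
  unfold ip
  rw [inv_mul_eq_iff_eq_mul₀ cardG_ne, Nat.card_eq_fintype_card]
  have := congrArg (fun z : ℤ => (z : ℂ)) h
  push_cast at this
  rw [this, mul_comm]

/-- permutation characters -/
theorem isChar_perm {G : Type} [Group G] {n : Type} [Fintype n] [DecidableEq n]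
    (a : G → n → n) (h1 : ∀ x, a 1 x = x) (hm : ∀ g h x, a (g * h) x = a g (a h x)) :
    IsChar (fun g => (((Finset.univ.filter fun x => a g x = x).card : ℤ) : ℂ)) := by
  have h := isChar_of_matrix (G := G) (n := n)
    { toFun := fun g => Matrix.of fun i j => if i = a g j then (1 : ℂ) else 0
      map_one' := by ext a b; simp [Matrix.one_apply, h1]
      map_mul' := by
        intro g h
        ext a b
        simp [Matrix.mul_apply, hm] }
  convert h using 1
  ext g
  simp only [Matrix.trace, MonoidHom.coe_mk, OneHom.coe_mk, Matrix.diag_apply, Matrix.of_apply]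
  rw [Finset.sum_boole]
  simp only [eq_comm]
  norm_cast

theorem isChar_hom {G : Type} [Group G] (φ : G →* ℤˣ) : IsChar (fun g => (((φ g : ℤˣ) : ℤ) : ℂ)) := by
  have h := isChar_of_matrix (G := G) (n := Fin 1)
    { toFun := fun g => Matrix.of fun i j => (((φ g : ℤˣ) : ℤ) : ℂ)
      map_one' := by ext a b; simp [Matrix.one_apply, Subsingleton.elim a b]
      map_mul' := by
        intro g h
        ext a b
        simp [Matrix.mul_apply] }
  convert h using 1
  ext g
  simp [Matrix.trace]

theorem isChar_one {G : Type} [Group G] : IsChar (fun _ : G => (1 : ℂ)) := by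
  have := isChar_hom (1 : G →* ℤˣ)
  simpa using this

/-- integer valued table rows of `S₃` -/
def s3X : Fin 3 → Equiv.Perm (Fin 3) → ℤ
  | 0, _ => 1
  | 1, g => (Equiv.Perm.sign g : ℤ)
  | 2, g => (Finset.univ.filter fun x => g x = x).card - 1

theorem s3X_irr (i : Fin 3) : IsIrrChar (Equiv.Perm (Fin 3)) (fun g => (s3X i g : ℂ)) := by
  have hmem : (fun g => (s3X i g : ℂ)) ∈ vchars (Equiv.Perm (Fin 3)) := by
    have h0 := (isChar_one (G := Equiv.Perm (Fin 3))).mem_vchars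
    have h1 := (isChar_hom (Equiv.Perm.sign (α := Fin 3))).mem_vchars
    have h2 := (isChar_perm (G := Equiv.Perm (Fin 3)) (n := Fin 3) (fun g x => g x)
      (fun x => rfl) (fun g h x => rfl)).mem_vchars
    fin_cases i
    · simpa [s3X] using h0
    · simpa [s3X] using h1
    · convert sub_mem h2 h0 using 1
      ext g; simp [s3X]
  have hn := ip_intCast (s3X i) (s3X i) 1 (by clear hmem; revert i; decide)
  refine irr_of_norm_one hmem (by simpa using hn) (s3X i 1).toNat ?_
  have : s3X i 1 = ((s3X i 1).toNat : ℤ) := by clear hn hmem; revert i; decide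
  exact_mod_cast congrArg (fun z : ℤ => (z : ℂ)) this

/-- the table of `S₃` -/
noncomputable def s3Table : CTable (Equiv.Perm (Fin 3)) (Fin 3) where
  X := fun i g => (s3X i g : ℂ)
  irr := s3X_irr
  inj := by
    intro i j h
    have h2 : s3X i = s3X j := by
      ext g
      have h3 : ((s3X i g : ℤ) : ℂ) = ((s3X j g : ℤ) : ℂ) := congrFun h g
      exact_mod_cast h3
    clear h
    revert i j; decide
  deg := ![1, 1, 2]
  deg_eq := by
    intro i
    have : s3X i 1 = ((![1, 1, 2] : Fin 3 → ℕ) i : ℤ) := by revert i; decide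
    exact_mod_cast congrArg (fun z : ℤ => (z : ℂ)) this
  reg := by
    ext g
    have : ∑ i, ((![1, 1, 2] : Fin 3 → ℕ) i : ℤ) * s3X i g = if g = 1 then 6 else 0 := by
      revert g; decide
    have h := congrArg (fun z : ℤ => (z : ℂ)) this
    simp only [Finset.sum_apply, Pi.smul_apply, smul_eq_mul, regc]
    push_cast at h
    rw [h]
    simp [Nat.card_eq_fintype_card, Fintype.card_perm, Nat.factorial]

theorem prod_numDefectZero {G H : Type} [Group G] [Group H] [Fintype G] [Fintype H]
    {ι κ : Type} [Fintype ι] [Fintype κ] (T : CTable G ι) (U : CTable H κ) (l : ℕ) (hl : l.Prime)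
    (hT : ∀ i, T.deg i ∣ Nat.card G) (hU : ∀ j, U.deg j ∣ Nat.card H) (hH : ¬ l ∣ Nat.card H) :
    _root_.numDefectZero l (G × H) = _root_.numDefectZero l G * Fintype.card κ := by
  rw [T.numDefectZero, (T.prod U).numDefectZero]
  have : (Finset.univ.filter fun i : ι × κ => ¬ l ∣ Nat.card (G × H) / (T.prod U).deg i) =
      (Finset.univ.filter fun i => ¬ l ∣ Nat.card G / T.deg i) ×ˢ (Finset.univ : Finset κ) := by
    ext ⟨i, j⟩
    simp only [Finset.mem_filter, Finset.mem_univ, true_and, Finset.mem_product, and_true]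
    change ¬ l ∣ Nat.card (G × H) / (T.deg i * U.deg j) ↔ _
    rw [Nat.card_prod, ← Nat.div_mul_div_comm (hT i) (hU j), hl.dvd_mul]
    have : ¬ l ∣ Nat.card H / U.deg j := fun h => hH (h.trans (Nat.div_dvd_of_dvd (hU j)))
    tauto
  rw [this, Finset.card_product, Finset.card_univ]

theorem s3_deg_dvd (j : Fin 3) : s3Table.deg j ∣ Nat.card (Equiv.Perm (Fin 3)) := by
  rw [Nat.card_eq_fintype_card, Fintype.card_perm]
  revert j
  simp only [s3Table]
  decide

theorem card_mult (A : Type) [Fintype A] : Nat.card (Multiplicative A) = Fintype.card A := by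
  rw [Nat.card_congr Multiplicative.toAdd, Nat.card_eq_fintype_card]

theorem small_6_5 : numDefectZero 5 (Multiplicative (ZMod 4 × ZMod 2)) = 8 := by
  have hc : Nat.card (Multiplicative (ZMod 4 × ZMod 2)) = 8 := by
    rw [card_mult]; simp [ZMod.card]
  rw [abelian_numDefectZero 5 _ (by rw [hc]; decide), hc]

theorem small_7_7 : numDefectZero 7 (Multiplicative (ZMod 6 × ZMod 2)) = 12 := by
  have hc : Nat.card (Multiplicative (ZMod 6 × ZMod 2)) = 12 := by
    rw [card_mult]; simp [ZMod.card]
  rw [abelian_numDefectZero 7 _ (by rw [hc]; decide), hc]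

theorem small_8_7 : numDefectZero 7 (Multiplicative (ZMod 6 × ZMod 2 × ZMod 2)) = 24 := by
  have hc : Nat.card (Multiplicative (ZMod 6 × ZMod 2 × ZMod 2)) = 24 := by
    rw [card_mult]; simp [ZMod.card]
  rw [abelian_numDefectZero 7 _ (by rw [hc]; decide), hc]

theorem card_S3 : Nat.card (Equiv.Perm (Fin 3)) = 6 := by
  simp [Nat.card_eq_fintype_card, Fintype.card_perm, Nat.factorial]

theorem small_7_5 :
    numDefectZero 5 (Multiplicative (ZMod 4 × ZMod 2) × Equiv.Perm (Fin 3)) = 24 := by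
  rw [prod_numDefectZero (fullTable _) s3Table 5 (by norm_num)
    (fun i => by rw [abelian_fullTable_deg]; exact one_dvd _) s3_deg_dvd
    (by rw [card_S3]; decide), small_6_5]
  simp

end Tables

/-! ## Extensions of degree two -/
section Ext2

variable {S X : Type} [Group S] [Group X] [Fintype S] [Fintype X]

theorem isChar_hom_complex {G : Type} [Group G] (φ : G →* ℂ) : IsChar (fun g => φ g) := by
  have h := isChar_of_matrix (G := G) (n := Fin 1)
    { toFun := fun g => Matrix.of fun i j => φ g
      map_one' := by ext a b; simp [Matrix.one_apply, Subsingleton.elim a b]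
      map_mul' := by
        intro a b
        ext i k
        simp [Matrix.mul_apply] }
  simpa [Matrix.trace] using h

theorem ext2_card (j : S →* X) (hj : Function.Injective j) (hi : j.range.index = 2) :
    Nat.card X = 2 * Nat.card S := by
  rw [← Subgroup.index_mul_card j.range, hi]
  congr 1
  exact (Nat.card_congr (MonoidHom.ofInjective hj).toEquiv).symm

/-- the sign character of an index two subgroup -/
noncomputable def ext2_sgn (N : Subgroup X) (hi : N.index = 2) : X →* ℤˣ := by
  classical
  exact
  { toFun := fun x => if x ∈ N then 1 else -1
    map_one' := by simp
    map_mul' := by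
      intro a b
      have := Subgroup.mul_mem_iff_of_index_two hi (a := a) (b := b)
      by_cases ha : a ∈ N <;> by_cases hb : b ∈ N <;> simp [ha, hb, this] }

theorem ext2_sum (j : S →* X) (hj : Function.Injective j) (F : X → ℂ) [DecidablePred (· ∈ j.range)] :
    ∑ x, (if x ∈ j.range then F x else 0) = ∑ s, F (j s) := by
  rw [← Finset.sum_filter]
  symm
  refine Finset.sum_bij (fun s _ => j s) ?_ ?_ ?_ ?_
  · intro s _; simp
  · intro a _ b _ h; exact hj h
  · intro b hb
    obtain ⟨s, rfl⟩ := (Finset.mem_filter.1 hb).2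
    exact ⟨s, Finset.mem_univ _, rfl⟩
  · intro s _; rfl

theorem ext2_ip (j : S →* X) (hj : Function.Injective j) (hi : j.range.index = 2)
    (f : X → ℂ) :
    ip f f + ip f (f * fun x => (((ext2_sgn j.range hi x : ℤˣ) : ℤ) : ℂ))
      = ip (fun s => f (j s)) (fun s => f (j s)) := by
  classical
  unfold ip
  have h := ext2_sum j hj (fun x => f x * f x⁻¹)
  have hS := cardG_ne (G := S)
  simp only [map_inv] at h ⊢
  rw [← h, ext2_card j hj hi, ← mul_add, ← Finset.sum_add_distrib]
  push_cast
  rw [mul_inv, mul_comm (2:ℂ)⁻¹, mul_assoc]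
  congr 1
  rw [Finset.mul_sum]
  refine Finset.sum_congr rfl fun x _ => ?_
  simp only [Pi.mul_apply, ext2_sgn]
  by_cases hx : x ∈ j.range
  · have : x⁻¹ ∈ j.range := inv_mem hx
    simp only [MonoidHom.coe_mk, OneHom.coe_mk, hx, this, if_true]
    push_cast; ring
  · have : x⁻¹ ∉ j.range := fun h => hx (by simpa using inv_mem h)
    simp only [MonoidHom.coe_mk, OneHom.coe_mk, hx, this, if_false]
    push_cast; ring

theorem ext2_norm (j : S →* X) (hj : Function.Injective j) (hi : j.range.index = 2)
    {χ : X → ℂ} (h : IsIrrChar X χ) :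
    ip (fun s => χ (j s)) (fun s => χ (j s)) = 1 ∨ ip (fun s => χ (j s)) (fun s => χ (j s)) = 2 := by
  classical
  have hε := isChar_hom (ext2_sgn j.range hi)
  set e : X → ℂ := fun x => (((ext2_sgn j.range hi x : ℤˣ) : ℤ) : ℂ) with he
  have hee : ∀ x, e x * e x⁻¹ = 1 := by
    intro x
    simp only [he, map_inv]
    rw [← Int.cast_mul, ← Units.val_mul, mul_inv_cancel]
    simp
  have hirr : IsIrrChar X (χ * e) := by
    rw [isIrrChar_iff]
    refine ⟨h.isChar.mul hε, ?_⟩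
    rw [← h.ip_self]
    unfold ip
    congr 1
    refine Finset.sum_congr rfl fun x _ => ?_
    simp only [Pi.mul_apply]
    linear_combination (χ x * χ x⁻¹) * hee x
  rw [← ext2_ip j hj hi χ, h.ip_self, ip_irr h hirr]
  split_ifs
  · right; norm_num
  · left; norm_num

theorem ext2_sum_deg (j : S →* X) (hj : Function.Injective j) (hi : j.range.index = 2)
    (φ : S → ℂ) : ∑ χ ∈ irrs X, χ 1 * ip (fun s => χ (j s)) φ = 2 * φ 1 := by
  classical
  have h : (fun s => regc (j s)) = (2 : ℂ) • regc (G := S) := by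
    funext s
    have : j s = 1 ↔ s = 1 := by
      constructor
      · intro h; exact hj (by rw [h, map_one])
      · rintro rfl; simp
    simp only [regc, Pi.smul_apply, this, ext2_card j hj hi]
    split_ifs <;> simp
  have h2 : (fun s => regc (j s)) = ∑ χ ∈ irrs X, χ 1 • (fun s => χ (j s)) := by
    funext s
    rw [regc_expand]
    simp
  have h3 := congrArg (fun f => ip f φ) (h2.symm.trans h)
  simp only [ip_sum_left, ip_smul_left] at h3
  rw [h3, ip_comm, ip_regc]

/-- trichotomy for irreducible characters of a degree two extension -/
theorem ext2_class (j : S →* X) (hj : Function.Injective j) (hi : j.range.index = 2) (l : ℕ)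
    (D : Finset ℕ) (St : S → ℂ) (hSt : IsIrrChar S St) (hl : St 1 = l)
    (hD : ∀ φ, IsIrrChar S φ → φ ≠ St → ∃ d ∈ D, φ 1 = (d : ℂ)) (hlD : l ∉ D)
    {χ : X → ℂ} (h : IsIrrChar X χ) :
    (χ 1 = l ∧ ip (fun s => χ (j s)) St = 1) ∨
    (∃ d ∈ D, (χ 1 = (d : ℂ) ∨ χ 1 = ((2 * d : ℕ) : ℂ)) ∧ ip (fun s => χ (j s)) St = 0) := by
  classical
  have hr : IsChar (fun s => χ (j s)) := h.isChar.comp j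
  set r : S → ℂ := fun s => χ (j s) with hrdef
  have hr1 : r 1 = χ 1 := by simp [hrdef]
  rcases ext2_norm j hj hi h with hn | hn
  · have hirr : IsIrrChar S r := isIrrChar_iff.2 ⟨hr, hn⟩
    by_cases e : r = St
    · left
      rw [← hr1, e, hl]
      exact ⟨rfl, hSt.ip_self⟩
    · right
      obtain ⟨d, hd, hd1⟩ := hD r hirr e
      exact ⟨d, hd, Or.inl (by rw [← hr1, hd1]), hirr.ip_ne hSt e⟩
  · right
    change ip r r = 2 at hn
    -- multiplicities
    have hmul : ∀ φ, IsIrrChar S φ → ∃ n : ℕ, ip r φ = n := fun φ hφ => hr.ip_nat hφ.isChar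
    choose! m hm using hmul
    choose! dg hdg0 hdg using fun (χ : X → ℂ) (h : IsIrrChar X χ) => h.val_one
    choose! ds hds0 hds using fun (χ : S → ℂ) (h : IsIrrChar S χ) => h.val_one
    have hbound : ∀ φ, IsIrrChar S φ → dg χ * m φ ≤ 2 * ds φ := by
      intro φ hφ
      have h1 := ext2_sum_deg j hj hi φ
      have hm' : ∀ χ' : X → ℂ, ∃ n : ℕ, IsIrrChar X χ' → ip (fun s => χ' (j s)) φ = n := by
        intro χ'
        by_cases h' : IsIrrChar X χ'
        · obtain ⟨n, hn⟩ := (h'.isChar.comp j).ip_nat hφ.isChar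
          exact ⟨n, fun _ => hn⟩
        · exact ⟨0, fun h => absurd h h'⟩
      choose m' hm' using hm'
      have h2 : ∑ χ' ∈ irrs X, dg χ' * m' χ' = 2 * ds φ := by
        have : ((∑ χ' ∈ irrs X, dg χ' * m' χ' : ℕ) : ℂ) = ((2 * ds φ : ℕ) : ℂ) := by
          push_cast
          rw [← hds φ hφ, ← h1]
          refine Finset.sum_congr rfl fun χ' hχ' => ?_
          rw [hm' _ (mem_irrs.1 hχ'), hdg _ (mem_irrs.1 hχ')]
        exact_mod_cast this
      have h3 : m' χ = m φ := by
        have := (hm' χ h).symm.trans (hm φ hφ)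
        exact_mod_cast this
      rw [← h2, ← h3]
      exact Finset.single_le_sum (f := fun χ' => dg χ' * m' χ') (fun _ _ => Nat.zero_le _)
        (mem_irrs.2 h)
    have hsq : ∑ φ ∈ irrs S, m φ * m φ = 2 := by
      have := vchars_ip hr.mem_vchars hr.mem_vchars
      rw [hn] at this
      have h2 : ((∑ φ ∈ irrs S, m φ * m φ : ℕ) : ℂ) = ((2 : ℕ) : ℂ) := by
        push_cast
        rw [this]
        refine Finset.sum_congr rfl fun φ hφ => ?_
        rw [hm _ (mem_irrs.1 hφ)]
      exact_mod_cast h2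
    have hdeg : ∑ φ ∈ irrs S, m φ * ds φ = dg χ := by
      have := congrFun (vchars_expand hr.mem_vchars) 1
      rw [hr1, hdg χ h] at this
      have h2 : ((∑ φ ∈ irrs S, m φ * ds φ : ℕ) : ℂ) = ((dg χ : ℕ) : ℂ) := by
        push_cast
        rw [this, Finset.sum_apply]
        refine Finset.sum_congr rfl fun φ hφ => ?_
        rw [Pi.smul_apply, smul_eq_mul, hm _ (mem_irrs.1 hφ), hds _ (mem_irrs.1 hφ)]
      exact_mod_cast h2
    obtain ⟨φ, hφm, hφ0⟩ : ∃ φ ∈ irrs S, m φ * m φ ≠ 0 := by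
      apply Finset.exists_ne_zero_of_sum_ne_zero
      rw [hsq]; norm_num
    have hφ := mem_irrs.1 hφm
    have hφ1 : m φ = 1 := by
      have : m φ * m φ ≤ 2 := by
        rw [← hsq]
        exact Finset.single_le_sum (f := fun φ => m φ * m φ) (fun _ _ => Nat.zero_le _) hφm
      have : m φ < 2 := by nlinarith
      have : m φ ≠ 0 := by rintro h; simp [h] at hφ0
      omega
    have hle : ds φ ≤ dg χ := by
      rw [← hdeg]
      calc ds φ = m φ * ds φ := by rw [hφ1, one_mul]
        _ ≤ _ := Finset.single_le_sum (f := fun φ => m φ * ds φ) (fun _ _ => Nat.zero_le _) hφm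
    have hrφ : ip r φ = 1 := by rw [hm φ hφ, hφ1]; simp
    have hψ : IsIrrChar S (r - φ) := by
      refine irr_of_norm_one (sub_mem hr.mem_vchars hφ.mem_vchars) ?_ (dg χ - ds φ) ?_
      · rw [ip_sub_left, ip_sub_right, ip_sub_right, hn, ip_comm φ r, hrφ, hφ.ip_self]; norm_num
      · rw [Pi.sub_apply, hr1, hdg χ h, hds φ hφ, Nat.cast_sub hle]
    have hψ1 : m (r - φ) = 1 := by
      have := hm _ hψ
      rw [ip_sub_right, hn, hrφ] at this
      have h1 : ((m (r - φ) : ℕ) : ℂ) = ((1 : ℕ) : ℂ) := by rw [← this]; norm_num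
      exact_mod_cast h1
    have hdψ : ds (r - φ) + ds φ = dg χ := by
      have := hds _ hψ
      rw [Pi.sub_apply, hr1, hdg χ h, hds φ hφ] at this
      have h1 : ((ds (r - φ) + ds φ : ℕ) : ℂ) = ((dg χ : ℕ) : ℂ) := by
        push_cast; rw [← this]; ring
      exact_mod_cast h1
    have hb1 := hbound φ hφ
    have hb2 := hbound _ hψ
    rw [hφ1] at hb1
    rw [hψ1] at hb2
    have hde : ds (r - φ) = ds φ := by omega
    have hne : φ ≠ r - φ := by
      intro e
      have h1 : ip φ (r - φ) = 0 := by
        rw [ip_sub_right, ip_comm, hrφ, hφ.ip_self]; norm_num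
      rw [← e, hφ.ip_self] at h1
      exact one_ne_zero h1
    have key : ∀ a b, IsIrrChar S a → IsIrrChar S b → a ≠ b → ds a = ds b → a ≠ St := by
      intro a b ha hb hab hdab e
      obtain ⟨d, hd, hbd⟩ := hD b hb (fun e' => hab (e.trans e'.symm))
      have h1 := hds a ha
      rw [e, hl] at h1
      rw [hds b hb] at hbd
      have h1 : l = ds a := by rw [e]; exact_mod_cast h1
      have h2 : ds b = d := by exact_mod_cast hbd
      apply hlD
      rw [h1, hdab, h2]
      exact hd
    have hφS := key φ _ hφ hψ hne hde.symm
    have hψS := key _ φ hψ hφ hne.symm hde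
    obtain ⟨d, hd, hbd⟩ := hD φ hφ hφS
    refine ⟨d, hd, Or.inr ?_, ?_⟩
    · have h2 : ds φ = d := by exact_mod_cast (hds φ hφ).symm.trans hbd
      rw [hdg χ h, ← hdψ, hde, h2, two_mul]
    · have : r = φ + (r - φ) := by ring
      rw [this, ip_add_left, hφ.ip_ne hSt hφS, hψ.ip_ne hSt hψS, add_zero]

theorem ext2_main (j : S →* X) (hj : Function.Injective j) (hi : j.range.index = 2) (l : ℕ)
    (hl0 : 0 < l)
    (D : Finset ℕ) (St : S → ℂ) (hSt : IsIrrChar S St) (hl : St 1 = l)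
    (hD : ∀ φ, IsIrrChar S φ → φ ≠ St → ∃ d ∈ D, φ 1 = (d : ℂ)) (hlD : l ∉ D)
    (hlcard : ¬ l ∣ 2 * Nat.card S / l) (hldvd : l ∣ 2 * Nat.card S)
    (hDc : ∀ d ∈ D, d ∣ 2 * Nat.card S ∧ 2 * d ∣ 2 * Nat.card S ∧ l ∣ 2 * Nat.card S / d ∧
      l ∣ 2 * Nat.card S / (2 * d)) :
    numDefectZero l X = 2 ∧ ∀ i, (fullTable X).deg i ∣ Nat.card X := by
  classical
  have hcl := fun (χ : X → ℂ) (h : IsIrrChar X χ) => ext2_class j hj hi l D St hSt hl hD hlD h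
  have hcard := ext2_card j hj hi
  have hcl2 : ∀ i : irrs X, ((fullTable X).deg i = l ∧ ip (fun s => i.1 (j s)) St = 1) ∨
      (∃ d ∈ D, ((fullTable X).deg i = d ∨ (fullTable X).deg i = 2 * d) ∧
        ip (fun s => i.1 (j s)) St = 0) := by
    intro i
    have h1 : i.1 1 = ((fullTable X).deg i : ℂ) := (fullTable X).deg_eq i
    rcases hcl i.1 (mem_irrs.1 i.2) with ⟨h, h'⟩ | ⟨d, hd, h, h'⟩
    · left; rw [h1] at h; exact ⟨by exact_mod_cast h, h'⟩
    · right; rw [h1] at h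
      refine ⟨d, hd, ?_, h'⟩
      rcases h with h | h
      · left; exact_mod_cast h
      · right; exact_mod_cast h
  constructor
  · rw [(fullTable X).numDefectZero]
    have h1 := ext2_sum_deg j hj hi St
    rw [← Finset.sum_coe_sort] at h1
    have h2 : ∀ i : irrs X, i.1 1 * ip (fun s => i.1 (j s)) St
        = if ¬ l ∣ Nat.card X / (fullTable X).deg i then (l : ℂ) else 0 := by
      intro i
      have h1 : i.1 1 = ((fullTable X).deg i : ℂ) := (fullTable X).deg_eq i
      rcases hcl2 i with ⟨h, h'⟩ | ⟨d, hd, h, h'⟩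
      · rw [h', h1, h, hcard, if_pos hlcard, mul_one]
      · rw [h', mul_zero, if_neg]
        rw [not_not, hcard]
        rcases h with h | h <;> rw [h]
        · exact (hDc d hd).2.2.1
        · exact (hDc d hd).2.2.2
    rw [Finset.sum_congr rfl fun i _ => h2 i, ← Finset.sum_filter, Finset.sum_const, hl,
      nsmul_eq_mul] at h1
    have hl' : (l : ℂ) ≠ 0 := by exact_mod_cast hl0.ne'
    have := mul_right_cancel₀ hl' h1
    exact_mod_cast this
  · intro i
    rw [hcard]
    rcases hcl2 i with ⟨h, h'⟩ | ⟨d, hd, h, h'⟩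
    · rw [h]; exact hldvd
    · rcases h with h | h <;> rw [h]
      · exact (hDc d hd).1
      · exact (hDc d hd).2.1

end Ext2

/-! ## Degrees of the irreducible characters of `SL₂(5)` and `SL₂(7)` -/
section Proj

theorem vchars_proj {G A : Type} [Group G] [Group A] [Fintype G] [Fintype A] {f : G × A → ℂ}
    (hf : f ∈ vchars (G × A)) {ψ : A → ℂ} (hψ : ψ ∈ vchars A) :
    (fun g => ip (fun a => f (g, a)) ψ) ∈ vchars G := by
  have hf' : f ∈ AddSubgroup.closure {χ : G × A → ℂ | IsIrrChar (G × A) χ} := hf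
  induction hf' using AddSubgroup.closure_induction with
  | mem χ hχ =>
    let T := (fullTable G).prod (fullTable A)
    obtain ⟨i, -, rfl⟩ := irr_complete Finset.univ T.X (fun i _ => T.irr i) _ T.reg hχ
    obtain ⟨n, hn⟩ := vchars_ip_int ((fullTable A).irr i.2).mem_vchars hψ
    have : (fun g => ip (fun a => T.X i (g, a)) ψ) = n • (fullTable G).X i.1 := by
      funext g
      have : (fun a => T.X i (g, a)) = ((fullTable G).X i.1 g) • (fullTable A).X i.2 := by
        funext a
        rfl
      rw [this, ip_smul_left, hn]
      simp [mul_comm]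
    rw [this]
    exact zsmul_mem ((fullTable G).irr i.1).mem_vchars n
  | zero =>
    have : (fun g : G => ip (fun a : A => (0 : G × A → ℂ) (g, a)) ψ) = 0 := by
      funext g; simp [ip]
    rw [this]; exact zero_mem _
  | add a b ha' hb' ha hb =>
    have ha := ha ha'
    have hb := hb hb'
    have : (fun g : G => ip (fun x : A => (a + b) (g, x)) ψ)
        = (fun g : G => ip (fun x : A => a (g, x)) ψ) + (fun g : G => ip (fun x : A => b (g, x)) ψ) := by
      funext g
      rw [Pi.add_apply, ← ip_add_left]; rfl
    rw [this]; exact add_mem ha hb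
  | neg a ha' ha =>
    have ha := ha ha'
    have : (fun g : G => ip (fun x : A => (-a) (g, x)) ψ)
        = -(fun g : G => ip (fun x : A => a (g, x)) ψ) := by
      funext g
      rw [Pi.neg_apply, ← ip_neg_left]; rfl
    rw [this]; exact neg_mem ha

/-- the homomorphism from a cyclic group determined by an element -/
def cycHom {M : Type} [Monoid M] (n : ℕ) [NeZero n] (g : M) (hg : g ^ n = 1) :
    Multiplicative (ZMod n) →* M where
  toFun s := g ^ (s.toAdd).val
  map_one' := by simp
  map_mul' := by
    intro a b
    rw [toAdd_mul, ZMod.val_add, ← pow_add]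
    exact (pow_eq_pow_mod _ hg).symm

theorem cycHom_inv (n : ℕ) [NeZero n] (ζ : ℂ) (h : ζ ^ n = 1) (x : Multiplicative (ZMod n)) :
    cycHom n ζ⁻¹ (by rw [inv_pow, h, inv_one]) x⁻¹ = ζ ^ (x.toAdd).val := by
  have hζ : ζ ≠ 0 := by
    rintro rfl
    rw [zero_pow (NeZero.ne n)] at h
    exact zero_ne_one h
  have h1 : cycHom n ζ⁻¹ (by rw [inv_pow, h, inv_one]) x⁻¹ *
      cycHom n ζ⁻¹ (by rw [inv_pow, h, inv_one]) x = 1 := by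
    rw [← map_mul, inv_mul_cancel, map_one]
  have h2 : cycHom n ζ⁻¹ (by rw [inv_pow, h, inv_one]) x = (ζ ^ (x.toAdd).val)⁻¹ := by
    simp [cycHom, inv_pow]
  rw [h2] at h1
  have h3 : ζ ^ (x.toAdd).val ≠ 0 := pow_ne_zero _ hζ
  exact (mul_inv_eq_one₀ h3).1 h1

theorem cyc_sum (m : ℕ) (F : Multiplicative (ZMod (m + 1)) → ℂ) (H : ℕ → ℂ)
    (h : ∀ x : ZMod (m + 1), F (Multiplicative.ofAdd x) = H x.val) :
    ∑ x, F x = ∑ i ∈ Finset.range (m + 1), H i := by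
  rw [Finset.sum_range]
  exact Fintype.sum_equiv (Multiplicative.toAdd : _ ≃ Fin (m + 1)) _ _ fun x => h x

/-- multiplicity of a linear character in the restriction to a cyclic subgroup -/
theorem IsChar.cyc {G : Type} [Group G] {f : G → ℂ} (hf : IsChar f) (m : ℕ) (g : G)
    (hg : g ^ (m + 1) = 1) (ζ : ℂ) (hζ : ζ ^ (m + 1) = 1) :
    ∃ k : ℕ, ∑ i ∈ Finset.range (m + 1), f (g ^ i) * ζ ^ i = (m + 1 : ℕ) * k := by
  have h1 := hf.comp (cycHom (m + 1) g hg)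
  have h2 := isChar_hom_complex (cycHom (m + 1) ζ⁻¹ (by rw [inv_pow, hζ, inv_one]))
  obtain ⟨k, hk⟩ := h1.ip_nat h2
  refine ⟨k, ?_⟩
  rw [ip, inv_mul_eq_iff_eq_mul₀ cardG_ne, card_mult, ZMod.card] at hk
  rw [← hk]
  symm
  apply cyc_sum
  intro x
  rw [cycHom_inv (m + 1) ζ hζ]
  rfl

/-- projection of a character of a product with a cyclic group -/
theorem proj_cyc {G : Type} [Group G] [Fintype G] (m : ℕ)
    {f : G × Multiplicative (ZMod (m + 1)) → ℂ} (hf : IsChar f) (ζ : ℂ) (hζ : ζ ^ (m + 1) = 1)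
    (H : G → ℕ → ℂ) (hH : ∀ g (x : ZMod (m + 1)), f (g, Multiplicative.ofAdd x) = H g x.val) :
    (fun g => (∑ i ∈ Finset.range (m + 1), H g i * ζ ^ i) / (m + 1 : ℕ)) ∈ vchars G := by
  have h2 := isChar_hom_complex (cycHom (m + 1) ζ⁻¹ (by rw [inv_pow, hζ, inv_one]))
  have h := vchars_proj hf.mem_vchars h2.mem_vchars
  convert h using 2 with g
  rw [ip, card_mult, ZMod.card, div_eq_inv_mul]
  congr 1
  symm
  apply cyc_sum
  intro x
  rw [cycHom_inv (m + 1) ζ hζ, hH]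
  rfl

/-- a central involution acts by a sign on an irreducible character -/
theorem central_sign {G : Type} [Group G] [Fintype G] (z : G) (hz : z * z = 1)
    (hc : ∀ x, z * x = x * z) {χ : G → ℂ} (h : IsIrrChar G χ) :
    (∀ x, χ (z * x) = χ x) ∨ (∀ x, χ (z * x) = - χ x) := by
  have key : ∀ e : ℂ, e * e = 1 → IsChar (fun x => (χ x + e * χ (z * x)) / 2) := by
    intro e he
    obtain ⟨V, hV⟩ := h.isChar
    have hzz : V.ρ z ∘ₗ V.ρ z = LinearMap.id := by
      have := map_mul V.ρ z z
      rw [hz, map_one] at this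
      exact this.symm
    let P : V →ₗ[ℂ] V := (2⁻¹ : ℂ) • (LinearMap.id + e • V.ρ z)
    obtain ⟨σ, hσ⟩ := isChar_of_idem V.ρ P (by
      have h1 : ∀ v, V.ρ z (V.ρ z v) = v := fun v => LinearMap.congr_fun hzz v
      ext v
      simp only [P, LinearMap.comp_apply, LinearMap.smul_apply, LinearMap.add_apply,
        LinearMap.id_apply, map_smul, map_add, h1, smul_add, smul_smul]
      have : e * (2⁻¹ * (2⁻¹ * e)) = 4⁻¹ := by linear_combination 4⁻¹ * he
      match_scalars <;> first | ring1 | linear_combination 4⁻¹ * he) (by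
      intro g
      have h1 : ∀ v, V.ρ z (V.ρ g v) = V.ρ g (V.ρ z v) := by
        intro v
        have e1 := LinearMap.congr_fun (map_mul V.ρ z g) v
        have e2 := LinearMap.congr_fun (map_mul V.ρ g z) v
        rw [hc] at e1
        exact e1.symm.trans e2
      ext v
      simp only [P, LinearMap.comp_apply, LinearMap.smul_apply, LinearMap.add_apply,
        LinearMap.id_apply, map_smul, map_add, h1, smul_add])
    have h3 := isChar_of_rep σ
    convert h3 using 2 with x
    rw [hσ]
    have : P ∘ₗ V.ρ x = (2⁻¹ : ℂ) • (V.ρ x + e • V.ρ (z * x)) := by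
      rw [map_mul]
      ext v
      simp [P]
    rw [this, map_smul, map_add, map_smul, hV]
    simp only [FDRep.character, smul_eq_mul]
    ring
  have ha := key 1 (by norm_num)
  have hb := key (-1) (by norm_num)
  set a : G → ℂ := fun x => (χ x + 1 * χ (z * x)) / 2 with hadef
  set b : G → ℂ := fun x => (χ x + (-1) * χ (z * x)) / 2 with hbdef
  have hab : χ = a + b := by funext x; simp only [hadef, hbdef, Pi.add_apply]; ring
  obtain ⟨n1, h1⟩ := ha.ip_nat ha
  obtain ⟨n2, h2⟩ := hb.ip_nat hb
  obtain ⟨n3, h3⟩ := ha.ip_nat hb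
  have hs := h.ip_self
  rw [hab, ip_add_left, ip_add_right, ip_add_right, h1, h2, ip_comm b a, h3] at hs
  have hs' : n1 + n3 + (n3 + n2) = 1 := by exact_mod_cast hs
  have zero : ∀ f : G → ℂ, IsChar f → ip f f = 0 → f = 0 := by
    intro f hf h0
    by_contra hne
    have : ip (f + χ) (f + χ) = 1 + 2 * ip f χ := by
      rw [ip_add_left, ip_add_right, ip_add_right, h0, h.ip_self, ip_comm χ f]; ring
    have hexp := vchars_expand hf.mem_vchars
    apply hne
    rw [hexp]
    apply Finset.sum_eq_zero
    intro ψ hψ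
    have hψ := mem_irrs.1 hψ
    have hm : ∀ φ : G → ℂ, ∃ n : ℕ, IsIrrChar G φ → ip f φ = n := by
      intro φ
      by_cases h' : IsIrrChar G φ
      · obtain ⟨n, hn⟩ := hf.ip_nat h'.isChar
        exact ⟨n, fun _ => hn⟩
      · exact ⟨0, fun h => absurd h h'⟩
    choose m hm using hm
    have h4 := vchars_ip hf.mem_vchars hf.mem_vchars
    rw [h0] at h4
    have h5 : ∑ φ ∈ irrs G, m φ * m φ = 0 := by
      have : ((∑ φ ∈ irrs G, m φ * m φ : ℕ) : ℂ) = ((0 : ℕ) : ℂ) := by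
        push_cast
        rw [h4]
        exact Finset.sum_congr rfl fun φ hφ => by rw [hm _ (mem_irrs.1 hφ)]
      exact_mod_cast this
    have h6 := (Finset.sum_eq_zero_iff.1 h5) ψ (mem_irrs.2 hψ)
    have h7 : m ψ = 0 := by simpa using h6
    rw [hm ψ hψ, h7]; simp
  rcases (by omega : n1 = 0 ∨ n2 = 0) with h0 | h0
  · right
    have := zero a ha (by rw [h1, h0]; simp)
    intro x
    have hx := congrFun this x
    simp only [hadef, Pi.zero_apply] at hx
    linear_combination 2 * hx
  · left
    have := zero b hb (by rw [h2, h0]; simp)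
    intro x
    have hx := congrFun this x
    simp only [hbdef, Pi.zero_apply] at hx
    linear_combination (-2) * hx

/-- sum of squares of the degrees of characters with given central sign -/
theorem central_budget {G : Type} [Group G] [Fintype G] (z : G) (hz1 : z ≠ 1) (e : ℤ)
    (he : e = 1 ∨ e = -1)
    (hs : ∀ χ : G → ℂ, IsIrrChar G χ → (χ z = χ 1 ∨ χ z = -χ 1))
    (L : Finset (G → ℂ)) (hL : ∀ χ ∈ L, IsIrrChar G χ ∧ χ z = e * χ 1) (d : (G → ℂ) → ℕ)
    (hd : ∀ χ ∈ L, χ 1 = d χ) : 2 * ∑ χ ∈ L, d χ * d χ ≤ Nat.card G := by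
  classical
  have h1 := congrFun (regc_expand (G := G)) 1
  have h2 := congrFun (regc_expand (G := G)) z
  simp only [regc, if_true, if_neg hz1, Finset.sum_apply, Pi.smul_apply, smul_eq_mul] at h1 h2
  choose! D hD0 hD using fun (χ : G → ℂ) (h : IsIrrChar G χ) => h.val_one
  have h3 : ∀ χ ∈ irrs G, χ 1 * χ 1 + e * (χ 1 * χ z)
      = ((if χ z = e * χ 1 then 2 * (D χ * D χ) else 0 : ℕ) : ℂ) := by
    intro χ hχ
    have hχ := mem_irrs.1 hχ
    have h0 : χ 1 ≠ 0 := by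
      rw [hD χ hχ]; exact_mod_cast (hD0 χ hχ).ne'
    have hne : ¬ (χ 1 = - χ 1) := by
      intro h
      apply h0
      linear_combination (1/2) * h
    split_ifs with h
    · rw [h]
      push_cast
      rw [← hD χ hχ]
      rcases he with rfl | rfl <;> push_cast <;> ring
    · rcases he with rfl | rfl
      · rcases hs χ hχ with h' | h'
        · exact absurd (by rw [h']; simp) h
        · rw [h']; simp
      · rcases hs χ hχ with h' | h'
        · rw [h']; simp
        · exact absurd (by rw [h']; simp) h
  have h4 : ∑ χ ∈ irrs G, (χ 1 * χ 1 + e * (χ 1 * χ z)) = Nat.card G := by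
    rw [Finset.sum_add_distrib, ← h1, ← Finset.mul_sum, ← h2]; simp
  rw [Finset.sum_congr rfl h3, ← Nat.cast_sum] at h4
  have h5 : ∑ χ ∈ irrs G, (if χ z = e * χ 1 then 2 * (D χ * D χ) else 0) = Nat.card G := by
    exact_mod_cast h4
  rw [← h5, Finset.mul_sum]
  calc ∑ χ ∈ L, 2 * (d χ * d χ)
      = ∑ χ ∈ L, (if χ z = e * χ 1 then 2 * (D χ * D χ) else 0) := by
        refine Finset.sum_congr rfl fun χ hχ => ?_
        rw [if_pos (hL χ hχ).2]
        have := (hd χ hχ).symm.trans (hD χ (hL χ hχ).1)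
        have : d χ = D χ := by exact_mod_cast this
        rw [this]
    _ ≤ _ := by
        apply Finset.sum_le_sum_of_subset
        intro χ hχ
        exact mem_irrs.2 (hL χ hχ).1

/-- an irreducible character on which `i * i` acts as `-1`, `i` conjugate to its inverse -/
theorem even_degree {G : Type} [Group G] {χ : G → ℂ} (h : IsChar χ) (i g : G)
    (hi : i ^ 4 = 1) (hg : g * i * g⁻¹ = i ^ 3) (hodd : ∀ x, χ (i ^ 2 * x) = -χ x) :
    ∃ k : ℕ, χ 1 = (2 * k : ℕ) := by
  obtain ⟨k, hk⟩ := h.cyc 3 i hi Complex.I (by norm_num [pow_succ])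
  have h1 := h.conj i g
  rw [hg] at h1
  have h3 := hodd i
  rw [← pow_succ, h1] at h3
  have h0 : χ i = 0 := by linear_combination (1/2) * h3
  have h2 := hodd 1
  rw [mul_one] at h2
  simp only [Finset.sum_range_succ, Finset.sum_range_zero, pow_zero, pow_one, h1, h0, h2] at hk
  refine ⟨k, ?_⟩
  push_cast at hk ⊢
  have := Complex.I_sq
  rw [this] at hk
  linear_combination (1/2) * hk

end Proj

section SLTwo

/-- the special linear group -/
abbrev SLL (l : ℕ) := Matrix.SpecialLinearGroup (Fin 2) (ZMod l)

/-- evaluate a function of four entries -/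
def ev {l : ℕ} {β : Type} (K : ZMod l → ZMod l → ZMod l → ZMod l → β) (x : SLL l) : β :=
  K (x.1 0 0) (x.1 0 1) (x.1 1 0) (x.1 1 1)

theorem sl_det {l : ℕ} (x : SLL l) : x.1 0 0 * x.1 1 1 - x.1 0 1 * x.1 1 0 = 1 := by
  have := x.2
  rwa [Matrix.det_fin_two] at this

theorem ev_ext {l : ℕ} {β : Type} {K K' : ZMod l → ZMod l → ZMod l → ZMod l → β}
    (h : ∀ a b c d, a * d - b * c = 1 → K a b c d = K' a b c d) (x : SLL l) : ev K x = ev K' x :=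
  h _ _ _ _ (sl_det x)

theorem ev_inv {l : ℕ} {β : Type} (K : ZMod l → ZMod l → ZMod l → ZMod l → β) (x : SLL l) :
    ev K x⁻¹ = ev (fun a b c d => K d (-b) (-c) a) x := by
  rw [Matrix.SpecialLinearGroup.SL2_inv_expl]
  rfl

theorem ev_mul {l : ℕ} {β : Type} (K : ZMod l → ZMod l → ZMod l → ZMod l → β) (x y : SLL l) :
    ev K (x * y) = K (x.1 0 0 * y.1 0 0 + x.1 0 1 * y.1 1 0) (x.1 0 0 * y.1 0 1 + x.1 0 1 * y.1 1 1)
      (x.1 1 0 * y.1 0 0 + x.1 1 1 * y.1 1 0) (x.1 1 0 * y.1 0 1 + x.1 1 1 * y.1 1 1) := by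
  simp [ev, Matrix.mul_apply, Fin.sum_univ_two]

theorem sl_sum {l : ℕ} [NeZero l] (K : ZMod l → ZMod l → ZMod l → ZMod l → ℤ) :
    ∑ x : SLL l, ev K x
      = ∑ a : ZMod l, ∑ b : ZMod l, ∑ c : ZMod l, ∑ d : ZMod l,
        if a * d - b * c = 1 then K a b c d else 0 := by
  have h : ∑ q : ZMod l × ZMod l × ZMod l × ZMod l,
      (if q.1 * q.2.2.2 - q.2.1 * q.2.2.1 = 1 then K q.1 q.2.1 q.2.2.1 q.2.2.2 else 0)
      = ∑ x : SLL l, ev K x := by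
    rw [← Finset.sum_filter]
    symm
    refine Finset.sum_bij (fun x _ => (x.1 0 0, x.1 0 1, x.1 1 0, x.1 1 1)) ?_ ?_ ?_ ?_
    · intro x _
      simp only [Finset.mem_filter, Finset.mem_univ, true_and]
      exact sl_det x
    · intro x _ y _ h
      simp only [Prod.mk.injEq] at h
      apply Subtype.ext
      ext i j
      fin_cases i <;> fin_cases j <;> simp [h]
    · rintro ⟨a, b, c, d⟩ h
      simp only [Finset.mem_filter, Finset.mem_univ, true_and] at h
      refine ⟨⟨!![a, b; c, d], ?_⟩, Finset.mem_univ _, ?_⟩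
      · rw [Matrix.det_fin_two_of]; exact h
      · simp
    · intro x _
      rfl
  rw [← h]
  simp only [Fintype.sum_prod_type]

theorem sl_card {l : ℕ} [NeZero l] (n : ℕ)
    (h : ∑ a : ZMod l, ∑ b : ZMod l, ∑ c : ZMod l, ∑ d : ZMod l,
      (if a * d - b * c = 1 then 1 else 0 : ℤ) = n) : Fintype.card (SLL l) = n := by
  have := sl_sum (l := l) (fun _ _ _ _ => 1)
  rw [h] at this
  simp only [ev] at this
  rw [Finset.sum_const, Finset.card_univ] at this
  simpa using this

theorem sl_ip {l : ℕ} [NeZero l] (F H : ZMod l → ZMod l → ZMod l → ZMod l → ℤ) (n : ℤ) (N : ℕ)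
    (hN : Fintype.card (SLL l) = N)
    (h : ∑ a : ZMod l, ∑ b : ZMod l, ∑ c : ZMod l, ∑ d : ZMod l,
      (if a * d - b * c = 1 then F a b c d * H d (-b) (-c) a else 0) = n * N) :
    ip (fun x : SLL l => ((ev F x : ℤ) : ℂ)) (fun x : SLL l => ((ev H x : ℤ) : ℂ)) = n := by
  apply ip_intCast
  rw [hN, ← h, ← sl_sum]
  refine Finset.sum_congr rfl fun x _ => ?_
  rw [ev_inv]
  rfl

/-- the natural action on vectors -/
def slact {l : ℕ} (x : SLL l) (v : ZMod l × ZMod l) : ZMod l × ZMod l :=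
  (x.1 0 0 * v.1 + x.1 0 1 * v.2, x.1 1 0 * v.1 + x.1 1 1 * v.2)

theorem slact_one {l : ℕ} (v : ZMod l × ZMod l) : slact 1 v = v := by
  simp [slact]

theorem slact_mul {l : ℕ} (x y : SLL l) (v : ZMod l × ZMod l) :
    slact (x * y) v = slact x (slact y v) := by
  simp only [slact, Matrix.SpecialLinearGroup.coe_mul, Matrix.mul_apply, Fin.sum_univ_two]
  ext <;> simp <;> ring

/-- scalars times natural action -/
theorem sl_perm {l m : ℕ} [NeZero l] (γ : ZMod l) (hγ : γ ^ (m + 1) = 1)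
    (cc : ZMod l → ZMod l → ZMod l → ZMod l → ZMod l → ℤ)
    (hcc : ∀ a b c d : ZMod l, a * d - b * c = 1 → ∀ t : ZMod l, t ≠ 0 →
      ((Finset.univ.filter fun v : ZMod l × ZMod l =>
        t * (a * v.1 + b * v.2) = v.1 ∧ t * (c * v.1 + d * v.2) = v.2).card : ℤ)
        = 1 + ((m + 1 : ℕ) : ℤ) * cc t a b c d) (h01 : (1 : ZMod l) ≠ 0) (ζ : ℂ) (hζ : ζ ^ (m + 1) = 1) :
    (fun x : SLL l => (∑ i ∈ Finset.range (m + 1),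
      (1 + ((m + 1 : ℕ) : ℂ) * ((ev (cc (γ ^ i)) x : ℤ) : ℂ)) * ζ ^ i) / (m + 1 : ℕ))
      ∈ vchars (SLL l) := by
  have hγ0 : ∀ i : ℕ, γ ^ i ≠ 0 := by
    intro i h
    have : (γ ^ i) ^ (m + 1) = 1 := by rw [← pow_mul, mul_comm, pow_mul, hγ, one_pow]
    rw [h, zero_pow (by omega)] at this
    exact h01 this.symm
  have h1 := isChar_perm (G := SLL l × Multiplicative (ZMod (m + 1))) (n := ZMod l × ZMod l)
    (fun g v => (cycHom (m + 1) γ hγ g.2 * (slact g.1 v).1, cycHom (m + 1) γ hγ g.2 * (slact g.1 v).2))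
    (by intro v; simp [slact_one])
    (by
      intro g h v
      simp only [Prod.fst_mul, Prod.snd_mul, map_mul, slact_mul]
      simp only [slact]
      ext <;> simp <;> ring)
  refine proj_cyc m h1 ζ hζ
    (fun x i => 1 + ((m + 1 : ℕ) : ℂ) * ((ev (cc (γ ^ i)) x : ℤ) : ℂ)) ?_
  intro g x
  have h2 := hcc _ _ _ _ (sl_det g) (γ ^ x.val) (hγ0 _)
  have h3 : (Finset.univ.filter fun v : ZMod l × ZMod l =>
      (cycHom (m + 1) γ hγ (Multiplicative.ofAdd x) * (slact g v).1,
        cycHom (m + 1) γ hγ (Multiplicative.ofAdd x) * (slact g v).2) = v)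
      = (Finset.univ.filter fun v : ZMod l × ZMod l =>
        γ ^ x.val * (g.1 0 0 * v.1 + g.1 0 1 * v.2) = v.1 ∧
        γ ^ x.val * (g.1 1 0 * v.1 + g.1 1 1 * v.2) = v.2) := by
    ext v
    simp only [Finset.mem_filter, Finset.mem_univ, true_and, Prod.ext_iff]
    rfl
  rw [h3, h2]
  push_cast
  rfl

/-- central involution -/
def slz (l : ℕ) : SLL l := ⟨!![-1, 0; 0, -1], by simp [Matrix.det_fin_two_of]⟩

theorem slz_sq (l : ℕ) : slz l * slz l = 1 := by
  apply Subtype.ext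
  change (slz l).1 * (slz l).1 = 1
  ext i j
  fin_cases i <;> fin_cases j <;> simp [slz, Matrix.mul_apply]

theorem slz_comm (l : ℕ) (x : SLL l) : slz l * x = x * slz l := by
  apply Subtype.ext
  change (slz l).1 * x.1 = x.1 * (slz l).1
  ext i j
  fin_cases i <;> fin_cases j <;> simp [slz, Matrix.mul_apply, Fin.sum_univ_two]

theorem sl_sign {l : ℕ} [NeZero l] {χ : SLL l → ℂ} (h : IsIrrChar (SLL l) χ) :
    (∀ x, χ (slz l * x) = χ x) ∨ (∀ x, χ (slz l * x) = - χ x) :=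
  central_sign (slz l) (slz_sq l) (slz_comm l) h

theorem ev_z {l : ℕ} {β : Type} (K : ZMod l → ZMod l → ZMod l → ZMod l → β) (x : SLL l) :
    ev K (slz l * x) = ev (fun a b c d => K (-a) (-b) (-c) (-d)) x := by
  rw [ev_mul]
  simp [slz, ev]

theorem ev_one {l : ℕ} {β : Type} (K : ZMod l → ZMod l → ZMod l → ZMod l → β) :
    ev K (1 : SLL l) = K 1 0 0 1 := by
  simp [ev]

theorem ev_irr {l : ℕ} [NeZero l] (F : ZMod l → ZMod l → ZMod l → ZMod l → ℤ) (N : ℕ)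
    (hN : Fintype.card (SLL l) = N) (hF : (fun x : SLL l => ((ev F x : ℤ) : ℂ)) ∈ vchars (SLL l))
    (h : ∑ a : ZMod l, ∑ b : ZMod l, ∑ c : ZMod l, ∑ d : ZMod l,
      (if a * d - b * c = 1 then F a b c d * F d (-b) (-c) a else 0) = 1 * N) (d : ℕ)
    (hd : F 1 0 0 1 = d) : IsIrrChar (SLL l) (fun x : SLL l => ((ev F x : ℤ) : ℂ)) := by
  refine irr_of_norm_one hF ?_ d ?_
  · rw [sl_ip F F 1 N hN h]; simp
  · rw [ev_one, hd]; simp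

theorem ev_vchars_congr {l : ℕ} {F : ZMod l → ZMod l → ZMod l → ZMod l → ℤ} {f : SLL l → ℂ}
    (hf : f ∈ vchars (SLL l)) (h : ∀ x, f x = ((ev F x : ℤ) : ℂ)) :
    (fun x : SLL l => ((ev F x : ℤ) : ℂ)) ∈ vchars (SLL l) := by
  have : f = fun x : SLL l => ((ev F x : ℤ) : ℂ) := funext h
  rwa [← this]

/-! ### The prime five -/

/-- a fifth of the number of eigenvectors -/
def cc5 (t a b c d : ZMod 5) : ℤ := if a = t ∧ d = t ∧ b = 0 ∧ c = 0 then 6 else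
  if t * t - (a + d) * t + 1 = 0 then 1 else 0
def St5 (a b c d : ZMod 5) : ℤ := cc5 1 a b c d + cc5 4 a b c d + 2 * cc5 2 a b c d - 1
def Fo5 (a b c d : ZMod 5) : ℤ := cc5 1 a b c d + cc5 4 a b c d - 2 * cc5 2 a b c d
def Xf5 (a b c d : ZMod 5) : ℤ :=
  (St5 a b c d * St5 a b c d
    - St5 (a * a + b * c) (a * b + b * d) (c * a + d * c) (c * b + d * d)) / 2 - Fo5 a b c d

set_option maxRecDepth 100000 in
theorem N5 : ∀ a b c d : ZMod 5, a * d - b * c = 1 → ∀ t : ZMod 5, t ≠ 0 →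
      ((Finset.univ.filter fun v : ZMod 5 × ZMod 5 =>
        t * (a * v.1 + b * v.2) = v.1 ∧ t * (c * v.1 + d * v.2) = v.2).card : ℤ)
        = 1 + ((3 + 1 : ℕ) : ℤ) * cc5 t a b c d := by
  decide +kernel

theorem cc5_symm : ∀ a b c d : ZMod 5, a * d - b * c = 1 → cc5 3 a b c d = cc5 2 a b c d := by
  decide +kernel

theorem Xf5_eq : ∀ a b c d : ZMod 5, a * d - b * c = 1 → 2 * Xf5 a b c d =
    St5 a b c d * St5 a b c d
    - St5 (a * a + b * c) (a * b + b * d) (c * a + d * c) (c * b + d * d) - 2 * Fo5 a b c d := by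
  decide +kernel

theorem card5 : Fintype.card (SLL 5) = 120 := sl_card 120 (by decide +kernel)

theorem St5_vchar : (fun x : SLL 5 => ((ev St5 x : ℤ) : ℂ)) ∈ vchars (SLL 5) := by
  have h := sub_mem (sub_mem (sl_perm (l := 5) (m := 3) 2 (by decide) cc5 N5 (by decide) 1 (by simp))
    (isChar_one (G := SLL 5)).mem_vchars) (isChar_one (G := SLL 5)).mem_vchars
  refine ev_vchars_congr h fun x => ?_
  have h3 : ev (cc5 3) x = ev (cc5 2) x := ev_ext cc5_symm x
  have e : (2 : ZMod 5) ^ 2 = 4 := by decide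
  have e3 : (2 : ZMod 5) ^ 3 = 3 := by decide
  simp only [Finset.sum_range_succ, Finset.sum_range_zero, Pi.sub_apply, pow_zero, pow_one, e, e3,
    h3]
  have : ev St5 x = ev (cc5 1) x + ev (cc5 4) x + 2 * ev (cc5 2) x - 1 := rfl
  rw [this]
  push_cast
  ring

theorem Fo5_vchar : (fun x : SLL 5 => ((ev Fo5 x : ℤ) : ℂ)) ∈ vchars (SLL 5) := by
  have h := (sl_perm (l := 5) (m := 3) 2 (by decide) cc5 N5 (by decide) (-1) (by norm_num))
  refine ev_vchars_congr h fun x => ?_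
  have h3 : ev (cc5 3) x = ev (cc5 2) x := ev_ext cc5_symm x
  have e : (2 : ZMod 5) ^ 2 = 4 := by decide
  have e3 : (2 : ZMod 5) ^ 3 = 3 := by decide
  simp only [Finset.sum_range_succ, Finset.sum_range_zero, pow_zero, pow_one, e, e3, h3]
  have : ev Fo5 x = ev (cc5 1) x + ev (cc5 4) x - 2 * ev (cc5 2) x := rfl
  rw [this]
  push_cast
  ring

theorem Xf5_vchar : (fun x : SLL 5 => ((ev Xf5 x : ℤ) : ℂ)) ∈ vchars (SLL 5) := by
  refine ev_vchars_congr (sub_mem (vchars_lam2 St5_vchar) Fo5_vchar) fun x => ?_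
  have h := Xf5_eq _ _ _ _ (sl_det x)
  have h2 : ev St5 (x * x) = _ := ev_mul St5 x x
  simp only [lam2, Pi.sub_apply, h2]
  have h' := congrArg (fun n : ℤ => (n : ℂ)) h
  push_cast at h'
  have e1 : ev St5 x = St5 (x.1 0 0) (x.1 0 1) (x.1 1 0) (x.1 1 1) := rfl
  have e2 : ev Fo5 x = Fo5 (x.1 0 0) (x.1 0 1) (x.1 1 0) (x.1 1 1) := rfl
  have e3 : ev Xf5 x = Xf5 (x.1 0 0) (x.1 0 1) (x.1 1 0) (x.1 1 1) := rfl
  rw [e1, e2, e3]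
  linear_combination (-1/2) * h'

theorem sl5_main : IsIrrChar (SLL 5) (fun x : SLL 5 => ((ev St5 x : ℤ) : ℂ)) ∧
    ∀ φ, IsIrrChar (SLL 5) φ → φ ≠ (fun x : SLL 5 => ((ev St5 x : ℤ) : ℂ)) →
      ∃ d ∈ ({1, 2, 3, 4, 6} : Finset ℕ), φ 1 = (d : ℂ) := by
  classical
  have hSt : IsIrrChar (SLL 5) (fun x : SLL 5 => ((ev St5 x : ℤ) : ℂ)) :=
    ev_irr St5 120 card5 St5_vchar (by decide +kernel) 5 (by decide)
  have hXf : IsIrrChar (SLL 5) (fun x : SLL 5 => ((ev Xf5 x : ℤ) : ℂ)) :=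
    ev_irr Xf5 120 card5 Xf5_vchar (by decide +kernel) 4 (by decide)
  have hO : IsIrrChar (SLL 5) (fun x : SLL 5 => ((ev (fun _ _ _ _ => 1) x : ℤ) : ℂ)) :=
    ev_irr _ 120 card5 (by simpa [ev] using (isChar_one (G := SLL 5)).mem_vchars)
      (by decide +kernel) 1 (by decide)
  refine ⟨hSt, fun φ hφ hne => ?_⟩
  obtain ⟨d, hd0, hd⟩ := hφ.val_one
  have hz1 : slz 5 ≠ 1 := by decide +kernel
  have hsg : ∀ χ : SLL 5 → ℂ, IsIrrChar (SLL 5) χ → (χ (slz 5) = χ 1 ∨ χ (slz 5) = -χ 1) := by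
    intro χ h
    rcases sl_sign h with h | h
    · left; simpa using h 1
    · right; simpa using h 1
  have hcard : Nat.card (SLL 5) = 120 := by rw [Nat.card_eq_fintype_card, card5]
  rcases sl_sign hφ with hs | hs
  · -- even case
    by_cases e1 : φ = (fun x : SLL 5 => ((ev (fun _ _ _ _ => 1) x : ℤ) : ℂ))
    · refine ⟨1, by decide, ?_⟩
      rw [e1]; simp [ev]
    by_cases e4 : φ = (fun x : SLL 5 => ((ev Xf5 x : ℤ) : ℂ))
    · refine ⟨4, by decide, ?_⟩
      rw [e4]
      have : ev Xf5 (1 : SLL 5) = 4 := by rw [ev_one]; decide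
      simp [this]
    set o : SLL 5 → ℂ := (fun x : SLL 5 => ((ev (fun _ _ _ _ => 1) x : ℤ) : ℂ)) with ho
    set s : SLL 5 → ℂ := (fun x : SLL 5 => ((ev St5 x : ℤ) : ℂ)) with hs'
    set f : SLL 5 → ℂ := (fun x : SLL 5 => ((ev Xf5 x : ℤ) : ℂ)) with hf
    have o1 : o 1 = 1 := by simp [ho, ev]
    have s1 : s 1 = 5 := by
      have : ev St5 (1 : SLL 5) = 5 := by rw [ev_one]; decide
      simp [hs', this]
    have f1 : f 1 = 4 := by
      have : ev Xf5 (1 : SLL 5) = 4 := by rw [ev_one]; decide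
      simp [hf, this]
    have oz : o (slz 5) = 1 := by simp [ho, ev]
    have sz : s (slz 5) = 5 := by
      have : ev St5 (slz 5) = 5 := by decide +kernel
      simp [hs', this]
    have fz : f (slz 5) = 4 := by
      have : ev Xf5 (slz 5) = 4 := by decide +kernel
      simp [hf, this]
    have n1 : o ≠ s := by intro h; rw [h, s1] at o1; norm_num at o1
    have n2 : o ≠ f := by intro h; rw [h, f1] at o1; norm_num at o1
    have n3 : s ≠ f := by intro h; rw [h, f1] at s1; norm_num at s1
    have hb := central_budget (slz 5) hz1 1 (Or.inl rfl) hsg {φ, o, s, f} (by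
      intro χ hχ
      simp only [Finset.mem_insert, Finset.mem_singleton] at hχ
      rcases hχ with rfl | rfl | rfl | rfl
      · exact ⟨hφ, by simpa using hs 1⟩
      · exact ⟨hO, by rw [oz, o1]; simp⟩
      · exact ⟨hSt, by rw [sz, s1]; simp⟩
      · exact ⟨hXf, by rw [fz, f1]; simp⟩)
      (fun χ => if χ = φ then d else if χ = o then 1 else if χ = s then 5 else 4) (by
      intro χ hχ
      simp only [Finset.mem_insert, Finset.mem_singleton] at hχ
      rcases hχ with rfl | rfl | rfl | rfl
      · simp [hd]
      · simp [Ne.symm e1, o1]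
      · simp [Ne.symm hne, n1.symm, s1]
      · simp [Ne.symm e4, n2.symm, n3.symm, f1])
    rw [hcard, Finset.sum_insert (by simp [e1, hne, e4]), Finset.sum_insert (by simp [n1, n2]),
      Finset.sum_insert (by simp [n3]), Finset.sum_singleton] at hb
    simp only [if_true, Ne.symm e1, Ne.symm hne, Ne.symm e4, n1.symm, n2.symm, n3.symm, if_false] at hb
    have : d ≤ 4 := by nlinarith
    refine ⟨d, ?_, hd⟩
    interval_cases d <;> decide
  · -- odd case
    obtain ⟨k, hk⟩ := even_degree hφ.isChar (⟨!![0, 1; -1, 0], by decide⟩ : SLL 5)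
      ⟨!![0, 2; 2, 0], by decide⟩ (by decide +kernel) (by decide +kernel) (by
        intro x
        rw [← hs x]
        congr 2
        decide +kernel)
    have hb := central_budget (slz 5) hz1 (-1) (Or.inr rfl) hsg {φ} (by
      intro χ hχ
      rw [Finset.mem_singleton] at hχ
      subst hχ
      exact ⟨hφ, by simpa using hs 1⟩) (fun _ => d) (by
      intro χ hχ
      rw [Finset.mem_singleton] at hχ
      subst hχ
      exact hd)
    rw [hcard, Finset.sum_singleton] at hb
    have hdk : d = 2 * k := by exact_mod_cast hd.symm.trans hk
    have : k ≤ 3 := by nlinarith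
    refine ⟨d, ?_, hd⟩
    subst hdk
    interval_cases k <;> revert hd0 <;> decide

end SLTwo

section SLSeven

/-- a sixth of the number of eigenvectors -/
def cc7 (t a b c d : ZMod 7) : ℤ := if a = t ∧ d = t ∧ b = 0 ∧ c = 0 then 8 else
  if t * t - (a + d) * t + 1 = 0 then 1 else 0
def St7 (a b c d : ZMod 7) : ℤ :=
  cc7 1 a b c d + cc7 6 a b c d + 2 * cc7 3 a b c d + 2 * cc7 2 a b c d - 1
def Ea7 (a b c d : ZMod 7) : ℤ := cc7 1 a b c d + cc7 6 a b c d - cc7 3 a b c d - cc7 2 a b c d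
def Eb7 (a b c d : ZMod 7) : ℤ := cc7 1 a b c d - cc7 6 a b c d + cc7 3 a b c d - cc7 2 a b c d
def Nn7 (a b c d : ZMod 7) : ℤ := 1 + 6 * cc7 1 a b c d

set_option maxRecDepth 100000 in
theorem N7 : ∀ a b c d : ZMod 7, a * d - b * c = 1 → ∀ t : ZMod 7, t ≠ 0 →
      ((Finset.univ.filter fun v : ZMod 7 × ZMod 7 =>
        t * (a * v.1 + b * v.2) = v.1 ∧ t * (c * v.1 + d * v.2) = v.2).card : ℤ)
        = 1 + ((5 + 1 : ℕ) : ℤ) * cc7 t a b c d := by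
  decide +kernel

theorem cc7_symm : ∀ a b c d : ZMod 7, a * d - b * c = 1 →
    cc7 5 a b c d = cc7 3 a b c d ∧ cc7 4 a b c d = cc7 2 a b c d ∧
    cc7 6 a b c d = cc7 1 (-a) (-b) (-c) (-d) := by
  decide +kernel

theorem card7 : Fintype.card (SLL 7) = 336 := sl_card 336 (by decide +kernel)

theorem sl7_aux (ζ : ℂ) (hζ : ζ ^ 6 = 1) :
    (fun x : SLL 7 => (1 + ζ + ζ ^ 2 + ζ ^ 3 + ζ ^ 4 + ζ ^ 5) / 6 + ev (cc7 1) x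
      + (ζ + ζ ^ 5) * ev (cc7 3) x + (ζ ^ 2 + ζ ^ 4) * ev (cc7 2) x + ζ ^ 3 * ev (cc7 6) x)
      ∈ vchars (SLL 7) := by
  have h := (sl_perm (l := 7) (m := 5) 3 (by decide) cc7 N7 (by decide) ζ hζ)
  convert h using 2 with x
  have h5 : ev (cc7 5) x = ev (cc7 3) x := ev_ext (fun a b c d h => (cc7_symm a b c d h).1) x
  have h4 : ev (cc7 4) x = ev (cc7 2) x := ev_ext (fun a b c d h => (cc7_symm a b c d h).2.1) x
  have e2 : (3 : ZMod 7) ^ 2 = 2 := by decide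
  have e3 : (3 : ZMod 7) ^ 3 = 6 := by decide
  have e4 : (3 : ZMod 7) ^ 4 = 4 := by decide
  have e5 : (3 : ZMod 7) ^ 5 = 5 := by decide
  simp only [Finset.sum_range_succ, Finset.sum_range_zero, pow_zero, pow_one, e2, e3, e4, e5, h5, h4]
  push_cast
  ring

theorem St7_vchar : (fun x : SLL 7 => ((ev St7 x : ℤ) : ℂ)) ∈ vchars (SLL 7) := by
  have h := sub_mem (sub_mem (sl7_aux 1 (by norm_num))
    (isChar_one (G := SLL 7)).mem_vchars) (isChar_one (G := SLL 7)).mem_vchars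
  refine ev_vchars_congr h fun x => ?_
  have : ev St7 x = ev (cc7 1) x + ev (cc7 6) x + 2 * ev (cc7 3) x + 2 * ev (cc7 2) x - 1 := rfl
  rw [this]
  simp only [Pi.sub_apply]
  push_cast
  ring

theorem zeta3 : ∃ w : ℂ, w ^ 2 + w + 1 = 0 := by
  have h := (Complex.isPrimitiveRoot_exp 3 (by norm_num)).geom_sum_eq_zero (by norm_num)
  refine ⟨Complex.exp (2 * Real.pi * Complex.I / (3 : ℕ)), ?_⟩
  simp only [Finset.sum_range_succ, Finset.sum_range_zero, pow_zero, pow_one, zero_add] at h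
  rw [← h]
  ring

theorem Ea7_vchar : (fun x : SLL 7 => ((ev Ea7 x : ℤ) : ℂ)) ∈ vchars (SLL 7) := by
  obtain ⟨w, hw⟩ := zeta3
  have h3 : w ^ 3 = 1 := by linear_combination (w - 1) * hw
  refine ev_vchars_congr (sl7_aux w (by linear_combination (w ^ 3 + 1) * h3)) fun x => ?_
  have : ev Ea7 x = ev (cc7 1) x + ev (cc7 6) x - ev (cc7 3) x - ev (cc7 2) x := rfl
  rw [this]
  have h4 : w ^ 4 = w := by linear_combination w * h3
  have h5 : w ^ 5 = w ^ 2 := by linear_combination w ^ 2 * h3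
  rw [h3, h4, h5]
  push_cast
  linear_combination (1 / 3 + ((ev (cc7 3) x : ℤ) : ℂ) + ((ev (cc7 2) x : ℤ) : ℂ)) * hw

theorem Eb7_vchar : (fun x : SLL 7 => ((ev Eb7 x : ℤ) : ℂ)) ∈ vchars (SLL 7) := by
  obtain ⟨w, hw⟩ := zeta3
  have h3 : w ^ 3 = 1 := by linear_combination (w - 1) * hw
  refine ev_vchars_congr (sl7_aux (-w) (by linear_combination (w ^ 3 + 1) * h3)) fun x => ?_
  have : ev Eb7 x = ev (cc7 1) x - ev (cc7 6) x + ev (cc7 3) x - ev (cc7 2) x := rfl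
  rw [this]
  have h4 : w ^ 4 = w := by linear_combination w * h3
  have h5 : w ^ 5 = w ^ 2 := by linear_combination w ^ 2 * h3
  have e3 : (-w) ^ 3 = -1 := by linear_combination -h3
  have e4 : (-w) ^ 4 = w := by linear_combination h4
  have e5 : (-w) ^ 5 = -w ^ 2 := by linear_combination -h5
  rw [e3, e4, e5]
  push_cast
  linear_combination (- ((ev (cc7 3) x : ℤ) : ℂ) + ((ev (cc7 2) x : ℤ) : ℂ)) * hw

theorem Nn7_eq (x : SLL 7) : (Finset.univ.filter fun v => slact x v = v).card = ev Nn7 x := by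
  have h := N7 _ _ _ _ (sl_det x) 1 (by decide)
  simp only [one_mul] at h
  have : ev Nn7 x = 1 + 6 * cc7 1 (x.1 0 0) (x.1 0 1) (x.1 1 0) (x.1 1 1) := rfl
  rw [this]
  have h2 : (((5 + 1 : ℕ) : ℕ) : ℤ) = 6 := by norm_num
  rw [h2] at h
  rw [← h]
  congr 2
  ext v
  simp only [Finset.mem_filter, Finset.mem_univ, true_and, Prod.ext_iff, slact]

theorem Nn7_char : IsChar (fun x : SLL 7 => ((ev Nn7 x : ℤ) : ℂ)) := by
  have := isChar_perm (G := SLL 7) (n := ZMod 7 × ZMod 7) slact slact_one slact_mul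
  simpa only [Nn7_eq] using this

/-- the standard unipotent element -/
def u7 : SLL 7 := ⟨!![1, 1; 0, 1], by decide⟩

/-- powers of the standard unipotent element -/
def uu7 (b : ZMod 7) : SLL 7 := ⟨!![1, b; 0, 1], by simp [Matrix.det_fin_two_of]⟩

/-- a diagonal element -/
def g7 : SLL 7 := ⟨!![2, 0; 0, 4], by decide⟩

theorem g7_conj : g7 * u7 * g7⁻¹ = u7 ^ 4 := by decide +kernel

theorem u7_pow : ∀ b : ZMod 7, u7 ^ b.val = uu7 b := by
  decide +kernel

theorem u7_fix : ∀ i : Fin 7, slact (u7 ^ i.val)⁻¹ (1, 0) = (1, 0) := by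
  decide +kernel

theorem u7_inj : ∀ i j : Fin 7, u7 ^ i.val = u7 ^ j.val → i = j := by
  decide +kernel

theorem fix7 (y : SLL 7) (hy : slact y⁻¹ (1, 0) = (1, 0)) : uu7 (y.1 0 1) = y := by
  rw [Matrix.SpecialLinearGroup.SL2_inv_expl] at hy
  simp [slact] at hy
  have hdet := sl_det y
  rw [hy.1, hy.2] at hdet
  apply Subtype.ext
  ext i j
  fin_cases i <;> fin_cases j
  · simp at hdet; simp [hdet, uu7]
  · simp [uu7]
  · simp [hy.2, uu7]
  · simp [hy.1, uu7]

theorem trans7 : ∀ v : ZMod 7 × ZMod 7, v ≠ 0 → ∃ b d : ZMod 7, v.1 * d - b * v.2 = 1 := by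
  decide +kernel

theorem frob7 {φ : SLL 7 → ℂ} (hφ : IsChar φ) (h1 : ∑ x, φ x = 0)
    (h0 : ip φ (fun x : SLL 7 => ((ev Nn7 x : ℤ) : ℂ)) = 0) :
    ∑ i ∈ Finset.range 7, φ (u7 ^ i) = 0 := by
  classical
  have h2 : ∑ x, φ x * ((ev Nn7 x⁻¹ : ℤ) : ℂ) = 0 := by
    rw [ip, inv_mul_eq_iff_eq_mul₀ cardG_ne, mul_zero] at h0
    exact h0
  have h3 : ∀ v : ZMod 7 × ZMod 7, v ≠ 0 → ∑ x : SLL 7, (if slact x⁻¹ v = v then φ x else 0)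
      = ∑ i ∈ Finset.range 7, φ (u7 ^ i) := by
    intro v hv
    obtain ⟨b, d, hbd⟩ := trans7 v hv
    let g : SLL 7 := ⟨!![v.1, b; v.2, d], by rw [Matrix.det_fin_two_of]; exact hbd⟩
    have hg : slact g (1, 0) = v := by simp [slact, g]
    have e1 : ∑ x : SLL 7, (if slact x⁻¹ v = v then φ x else 0)
        = ∑ y : SLL 7, (if slact y⁻¹ (1, 0) = (1, 0) then φ y else 0) := by
      symm
      refine Fintype.sum_equiv (MulAut.conj g).toEquiv _ _ fun y => ?_
      simp only [MulEquiv.toEquiv_eq_coe, EquivLike.coe_coe, MulAut.conj_apply]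
      rw [hφ.conj]
      refine if_congr ?_ rfl rfl
      rw [mul_inv_rev, mul_inv_rev, inv_inv, ← hg, ← slact_mul]
      have : g * (y⁻¹ * g⁻¹) * g = g * y⁻¹ := by group
      rw [this, slact_mul]
      constructor
      · intro h; rw [h]
      · intro h
        have := congrArg (slact g⁻¹) h
        rwa [← slact_mul g⁻¹ g, ← slact_mul g⁻¹ g, inv_mul_cancel, slact_one, slact_one] at this
    rw [e1, ← Finset.sum_filter, Finset.sum_range]
    symm
    refine Finset.sum_bij (fun (i : Fin 7) _ => u7 ^ i.val) ?_ ?_ ?_ ?_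
    · intro i _
      simp only [Finset.mem_filter, Finset.mem_univ, true_and]
      exact u7_fix i
    · intro i _ j _ h
      exact u7_inj i j h
    · intro y hy
      simp only [Finset.mem_filter, Finset.mem_univ, true_and] at hy
      refine ⟨y.1 0 1, Finset.mem_univ _, ?_⟩
      exact (u7_pow (y.1 0 1)).trans (fix7 y hy)
    · intro i _
      rfl
  have h4 : ∑ x, φ x * ((ev Nn7 x⁻¹ : ℤ) : ℂ)
      = ∑ v : ZMod 7 × ZMod 7, ∑ x : SLL 7, (if slact x⁻¹ v = v then φ x else 0) := by
    rw [Finset.sum_comm]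
    refine Finset.sum_congr rfl fun x _ => ?_
    rw [← Nn7_eq, ← Finset.sum_filter, Finset.sum_const, nsmul_eq_mul, mul_comm]
    simp
  rw [h4, ← Finset.add_sum_erase _ _ (Finset.mem_univ (0 : ZMod 7 × ZMod 7)),
    Finset.sum_congr rfl (fun v hv => h3 v (Finset.ne_of_mem_erase hv)), Finset.sum_const] at h2
  have h5 : ∀ x : SLL 7, slact x⁻¹ 0 = 0 := by intro x; simp [slact]
  simp only [h5, if_true, h1, zero_add] at h2
  rw [nsmul_eq_mul, Finset.card_erase_of_mem (Finset.mem_univ _)] at h2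
  refine (mul_eq_zero.1 h2).resolve_left ?_
  rw [Finset.card_univ, Fintype.card_prod, ZMod.card]
  norm_num

theorem three_dvd7 {φ : SLL 7 → ℂ} (hφ : IsChar φ)
    (h0 : ∑ i ∈ Finset.range 7, φ (u7 ^ i) = 0) : ∃ k : ℕ, φ 1 = (3 * k : ℕ) := by
  have hprim := Complex.isPrimitiveRoot_exp 7 (by norm_num)
  set ζ := Complex.exp (2 * Real.pi * Complex.I / (7 : ℕ)) with hζ
  have h7 : ζ ^ 7 = 1 := hprim.pow_eq_one
  have hsum : 1 + ζ + ζ ^ 2 + ζ ^ 3 + ζ ^ 4 + ζ ^ 5 + ζ ^ 6 = 0 := by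
    have := hprim.geom_sum_eq_zero (by norm_num)
    simpa [Finset.sum_range_succ] using this
  have hu : u7 ^ 7 = 1 := by decide +kernel
  have hc : ∀ i : ℕ, φ (u7 ^ (4 * i)) = φ (u7 ^ i) := by
    intro i
    rw [pow_mul, ← g7_conj, conj_pow, hφ.conj]
  have c4 : φ (u7 ^ 4) = φ (u7 ^ 1) := hc 1
  have c2 : φ (u7 ^ 1) = φ (u7 ^ 2) := by
    have := hc 2
    rwa [show u7 ^ (4 * 2) = u7 ^ 1 from by decide +kernel] at this
  have c3 : φ (u7 ^ 5) = φ (u7 ^ 3) := by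
    have := hc 3
    rwa [show u7 ^ (4 * 3) = u7 ^ 5 from by decide +kernel] at this
  have c6 : φ (u7 ^ 3) = φ (u7 ^ 6) := by
    have := hc 6
    rwa [show u7 ^ (4 * 6) = u7 ^ 3 from by decide +kernel] at this
  obtain ⟨k1, hk1⟩ := hφ.cyc 6 u7 hu ζ h7
  obtain ⟨k2, hk2⟩ := hφ.cyc 6 u7 hu (ζ ^ 3) (by rw [← pow_mul, mul_comm, pow_mul, h7, one_pow])
  refine ⟨k1 + k2, ?_⟩
  have p8 : ζ ^ 9 = ζ ^ 2 := by linear_combination ζ ^ 2 * h7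
  have p12 : ζ ^ 12 = ζ ^ 5 := by linear_combination ζ ^ 5 * h7
  have p15 : ζ ^ 15 = ζ := by linear_combination (ζ ^ 8 + ζ) * h7
  have p18 : ζ ^ 18 = ζ ^ 4 := by linear_combination (ζ ^ 11 + ζ ^ 4) * h7
  simp only [Finset.sum_range_succ, Finset.sum_range_zero, zero_add, ← pow_mul, c4, c3, ← c2, ← c6]
    at hk1 hk2 h0
  norm_num only at hk1 hk2 h0
  simp only [p8, p12, p15, p18] at hk2
  simp only [pow_zero, pow_one] at hk1 hk2 h0
  push_cast at hk1 hk2 ⊢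
  linear_combination (3/7) * hk1 + (3/7) * hk2 + (1/7) * h0
    - (3/7) * (φ u7 + φ (u7 ^ 3)) * hsum

end SLSeven

section SLSevenMain

theorem char_budget {G : Type} [Group G] [Fintype G] {f : G → ℂ} (hf : IsChar f)
    (L : Finset (G → ℂ)) (m d : (G → ℂ) → ℕ)
    (hL : ∀ χ ∈ L, IsIrrChar G χ ∧ ip f χ = m χ ∧ χ 1 = d χ) (N : ℕ) (hN : f 1 = N) :
    ∑ χ ∈ L, m χ * d χ ≤ N := by
  classical
  choose! D hD0 hD using fun (χ : G → ℂ) (h : IsIrrChar G χ) => h.val_one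
  choose! M hM using fun (χ : G → ℂ) (h : IsIrrChar G χ) => hf.ip_nat h.isChar
  have h1 := congrFun (vchars_expand hf.mem_vchars) 1
  simp only [Finset.sum_apply, Pi.smul_apply, smul_eq_mul] at h1
  rw [hN, Finset.sum_congr rfl (fun χ hχ => by
    rw [hM χ (mem_irrs.1 hχ), hD χ (mem_irrs.1 hχ)])] at h1
  have h2 : N = ∑ χ ∈ irrs G, M χ * D χ := by exact_mod_cast h1
  rw [h2]
  calc ∑ χ ∈ L, m χ * d χ = ∑ χ ∈ L, M χ * D χ := by
        refine Finset.sum_congr rfl fun χ hχ => ?_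
        obtain ⟨a, b, c⟩ := hL χ hχ
        have e1 : m χ = M χ := by exact_mod_cast b.symm.trans (hM χ a)
        have e2 : d χ = D χ := by exact_mod_cast c.symm.trans (hD χ a)
        rw [e1, e2]
    _ ≤ _ := by
        apply Finset.sum_le_sum_of_subset
        intro χ hχ
        exact mem_irrs.2 (hL χ hχ).1

theorem Nn7_sum : ∀ a b c d : ZMod 7, a * d - b * c = 1 →
    Nn7 a b c d + Nn7 (-a) (-b) (-c) (-d) = 4 + 2 * St7 a b c d + 4 * Ea7 a b c d := by
  decide +kernel

theorem ip_z7 (φ N : SLL 7 → ℂ) (hs : ∀ x, φ (slz 7 * x) = φ x) :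
    ip φ (fun x => N (slz 7 * x)) = ip φ N := by
  unfold ip
  congr 1
  refine Fintype.sum_equiv (Equiv.mulLeft (slz 7)) _ _ fun x => ?_
  simp only [Equiv.coe_mulLeft, mul_inv_rev]
  rw [hs x]
  have : (slz 7)⁻¹ = slz 7 := inv_eq_of_mul_eq_one_left (slz_sq 7)
  rw [this, slz_comm]

/-- an element of order four -/
def i7 : SLL 7 := ⟨!![0, 1; -1, 0], by decide⟩

theorem isq7 : i7 ^ 2 = slz 7 := by decide +kernel

theorem dec_z7 : (fun x : SLL 7 => ((ev Nn7 x : ℤ) : ℂ)) +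
    (fun x : SLL 7 => ((ev Nn7 (slz 7 * x) : ℤ) : ℂ)) =
    (4 : ℂ) • (fun x : SLL 7 => ((ev (fun _ _ _ _ => 1) x : ℤ) : ℂ))
    + (2 : ℂ) • (fun x : SLL 7 => ((ev St7 x : ℤ) : ℂ))
    + (4 : ℂ) • (fun x : SLL 7 => ((ev Ea7 x : ℤ) : ℂ)) := by
  funext x
  have h := Nn7_sum _ _ _ _ (sl_det x)
  have hz := ev_z Nn7 x
  have h' := congrArg (fun n : ℤ => (n : ℂ)) h
  simp only [Pi.add_apply, Pi.smul_apply, smul_eq_mul, hz]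
  simp only [ev]
  push_cast at h' ⊢
  linear_combination h'

set_option maxHeartbeats 1000000 in
theorem sl7_main : IsIrrChar (SLL 7) (fun x : SLL 7 => ((ev St7 x : ℤ) : ℂ)) ∧
    ∀ φ, IsIrrChar (SLL 7) φ → φ ≠ (fun x : SLL 7 => ((ev St7 x : ℤ) : ℂ)) →
      ∃ d ∈ ({1, 2, 3, 4, 6, 8} : Finset ℕ), φ 1 = (d : ℂ) := by
  classical
  have hSt : IsIrrChar (SLL 7) (fun x : SLL 7 => ((ev St7 x : ℤ) : ℂ)) :=
    ev_irr St7 336 card7 St7_vchar (by decide +kernel) 7 (by decide)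
  have hEa : IsIrrChar (SLL 7) (fun x : SLL 7 => ((ev Ea7 x : ℤ) : ℂ)) :=
    ev_irr Ea7 336 card7 Ea7_vchar (by decide +kernel) 8 (by decide)
  have hEb : IsIrrChar (SLL 7) (fun x : SLL 7 => ((ev Eb7 x : ℤ) : ℂ)) :=
    ev_irr Eb7 336 card7 Eb7_vchar (by decide +kernel) 8 (by decide)
  have hO : IsIrrChar (SLL 7) (fun x : SLL 7 => ((ev (fun _ _ _ _ => 1) x : ℤ) : ℂ)) :=
    ev_irr _ 336 card7 (by simpa [ev] using (isChar_one (G := SLL 7)).mem_vchars)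
      (by decide +kernel) 1 (by decide)
  have iO := sl_ip Nn7 (fun _ _ _ _ => 1) 2 336 card7 (by decide +kernel)
  have iS := sl_ip Nn7 St7 1 336 card7 (by decide +kernel)
  have iA := sl_ip Nn7 Ea7 2 336 card7 (by decide +kernel)
  have iB := sl_ip Nn7 Eb7 2 336 card7 (by decide +kernel)
  refine ⟨hSt, fun φ hφ hne => ?_⟩
  obtain ⟨d, hd0, hd⟩ := hφ.val_one
  have hz1 : slz 7 ≠ 1 := by decide +kernel
  have hsg : ∀ χ : SLL 7 → ℂ, IsIrrChar (SLL 7) χ → (χ (slz 7) = χ 1 ∨ χ (slz 7) = -χ 1) := by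
    intro χ h
    rcases sl_sign h with h | h
    · left; simpa using h 1
    · right; simpa using h 1
  have hcard : Nat.card (SLL 7) = 336 := by rw [Nat.card_eq_fintype_card, card7]
  have hdec' := dec_z7
  set o : SLL 7 → ℂ := (fun x : SLL 7 => ((ev (fun _ _ _ _ => 1) x : ℤ) : ℂ)) with ho
  set s : SLL 7 → ℂ := (fun x : SLL 7 => ((ev St7 x : ℤ) : ℂ)) with hs'
  set f : SLL 7 → ℂ := (fun x : SLL 7 => ((ev Ea7 x : ℤ) : ℂ)) with hf
  set g : SLL 7 → ℂ := (fun x : SLL 7 => ((ev Eb7 x : ℤ) : ℂ)) with hg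
  have o1 : o 1 = 1 := by simp [ho, ev]
  have s1 : s 1 = 7 := by
    have : ev St7 (1 : SLL 7) = 7 := by rw [ev_one]; decide
    simp [hs', this]
  have f1 : f 1 = 8 := by
    have : ev Ea7 (1 : SLL 7) = 8 := by rw [ev_one]; decide
    simp [hf, this]
  have g1 : g 1 = 8 := by
    have : ev Eb7 (1 : SLL 7) = 8 := by rw [ev_one]; decide
    simp [hg, this]
  have oz : o (slz 7) = 1 := by simp [ho, ev]
  have sz : s (slz 7) = 7 := by
    have : ev St7 (slz 7) = 7 := by decide +kernel
    simp [hs', this]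
  have fz : f (slz 7) = 8 := by
    have : ev Ea7 (slz 7) = 8 := by decide +kernel
    simp [hf, this]
  have gz : g (slz 7) = -8 := by
    have : ev Eb7 (slz 7) = -8 := by decide +kernel
    simp [hg, this]
  have n1 : o ≠ s := by intro h; rw [h, s1] at o1; norm_num at o1
  have n2 : o ≠ f := by intro h; rw [h, f1] at o1; norm_num at o1
  have n3 : s ≠ f := by intro h; rw [h, f1] at s1; norm_num at s1
  have n4 : o ≠ g := by intro h; rw [h, g1] at o1; norm_num at o1
  have n5 : s ≠ g := by intro h; rw [h, g1] at s1; norm_num at s1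
  have n6 : f ≠ g := by intro h; rw [h, gz] at fz; norm_num at fz
  by_cases e1 : φ = o
  · exact ⟨1, by decide, by rw [e1, o1]; simp⟩
  by_cases e4 : φ = f
  · exact ⟨8, by decide, by rw [e4, f1]; simp⟩
  by_cases e5 : φ = g
  · exact ⟨8, by decide, by rw [e5, g1]; simp⟩
  have hφsum : ∑ x, φ x = 0 := by
    have := hφ.ip_ne hO e1
    rw [ip, inv_mul_eq_iff_eq_mul₀ cardG_ne, mul_zero] at this
    simpa [ho, ev] using this
  have hthree : ip φ (fun x : SLL 7 => ((ev Nn7 x : ℤ) : ℂ)) = 0 → ∃ k : ℕ, d = 3 * k := by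
    intro h
    obtain ⟨k, hk⟩ := three_dvd7 hφ.isChar (frob7 hφ.isChar hφsum h)
    exact ⟨k, by exact_mod_cast hd.symm.trans hk⟩
  rcases sl_sign hφ with hs | hs
  · -- even case
    have hb := central_budget (slz 7) hz1 1 (Or.inl rfl) hsg {φ, o, s, f} (by
      intro χ hχ
      simp only [Finset.mem_insert, Finset.mem_singleton] at hχ
      rcases hχ with rfl | rfl | rfl | rfl
      · exact ⟨hφ, by simpa using hs 1⟩
      · exact ⟨hO, by rw [oz, o1]; simp⟩
      · exact ⟨hSt, by rw [sz, s1]; simp⟩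
      · exact ⟨hEa, by rw [fz, f1]; simp⟩)
      (fun χ => if χ = φ then d else if χ = o then 1 else if χ = s then 7 else 8) (by
      intro χ hχ
      simp only [Finset.mem_insert, Finset.mem_singleton] at hχ
      rcases hχ with rfl | rfl | rfl | rfl
      · simp [hd]
      · simp [Ne.symm e1, o1]
      · simp [Ne.symm hne, n1.symm, s1]
      · simp [Ne.symm e4, n2.symm, n3.symm, f1])
    rw [hcard, Finset.sum_insert (by simp [e1, hne, e4]), Finset.sum_insert (by simp [n1, n2]),
      Finset.sum_insert (by simp [n3]), Finset.sum_singleton] at hb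
    simp only [if_true, Ne.symm e1, Ne.symm hne, Ne.symm e4, n1.symm, n2.symm, n3.symm, if_false] at hb
    have hd7 : d ≤ 7 := by
      by_contra h
      have : 8 * 8 ≤ d * d := Nat.mul_le_mul (by omega) (by omega)
      omega
    set N : SLL 7 → ℂ := (fun x : SLL 7 => ((ev Nn7 x : ℤ) : ℂ)) with hN
    have hNz : ip φ (fun x => N (slz 7 * x)) = ip φ N := ip_z7 φ N hs
    have h0 : ip φ N + ip φ N = 0 := by
      have := congrArg (ip φ) hdec'
      rw [ip_add_right, ip_add_right, ip_add_right, show ip φ (fun x : SLL 7 => ((ev Nn7 (slz 7 * x) : ℤ) : ℂ)) = ip φ N from hNz, ip_smul_right, ip_smul_right,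
        ip_smul_right, hφ.ip_ne hO e1, hφ.ip_ne hSt hne, hφ.ip_ne hEa e4] at this
      rw [this]; simp
    obtain ⟨k, hk⟩ := hthree (by linear_combination (1/2) * h0)
    refine ⟨d, ?_, hd⟩
    have : k ≤ 2 := by omega
    subst hk
    interval_cases k <;> revert hd0 <;> decide
  · -- odd case
    obtain ⟨k, hk⟩ := even_degree hφ.isChar i7
      ⟨!![2, 3; 3, -2], by decide⟩ (by decide +kernel) (by decide +kernel) (by
        intro x
        rw [← hs x, isq7])
    have hb := central_budget (slz 7) hz1 (-1) (Or.inr rfl) hsg {φ, g} (by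
      intro χ hχ
      simp only [Finset.mem_insert, Finset.mem_singleton] at hχ
      rcases hχ with rfl | rfl
      · exact ⟨hφ, by simpa using hs 1⟩
      · exact ⟨hEb, by rw [gz, g1]; simp⟩) (fun χ => if χ = φ then d else 8) (by
      intro χ hχ
      simp only [Finset.mem_insert, Finset.mem_singleton] at hχ
      rcases hχ with rfl | rfl
      · simp [hd]
      · simp [Ne.symm e5, g1])
    rw [hcard, Finset.sum_insert (by simp [e5]), Finset.sum_singleton] at hb
    simp only [if_true, Ne.symm e5, if_false] at hb
    have hdk : d = 2 * k := by exact_mod_cast hd.symm.trans hk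
    have hk5 : k ≤ 5 := by
      by_contra h
      have : 12 * 12 ≤ d * d := Nat.mul_le_mul (by omega) (by omega)
      omega
    have hne10 : k ≠ 5 := by
      rintro rfl
      obtain ⟨m, hm⟩ := Nn7_char.ip_nat hφ.isChar
      by_cases hm0 : m = 0
      · obtain ⟨k, hk⟩ := hthree (by rw [ip_comm, hm, hm0]; simp)
        omega
      have hN1 : ((ev Nn7 (1 : SLL 7) : ℤ) : ℂ) = (49 : ℕ) := by
        have : ev Nn7 (1 : SLL 7) = 49 := by rw [ev_one]; decide
        rw [this]; norm_num
      have := char_budget Nn7_char {φ, o, s, f, g}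
        (fun χ => if χ = φ then m else if χ = o then 2 else if χ = s then 1 else 2)
        (fun χ => if χ = φ then d else if χ = o then 1 else if χ = s then 7 else 8)
        (by
          intro χ hχ
          simp only [Finset.mem_insert, Finset.mem_singleton] at hχ
          rcases hχ with rfl | rfl | rfl | rfl | rfl
          · exact ⟨hφ, by simp [hm], by simp [hd]⟩
          · exact ⟨hO, by simp [Ne.symm e1, iO], by simp [Ne.symm e1, o1]⟩
          · exact ⟨hSt, by simp [Ne.symm hne, n1.symm, iS], by simp [Ne.symm hne, n1.symm, s1]⟩
          · exact ⟨hEa, by simp [Ne.symm e4, n2.symm, n3.symm, iA],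
              by simp [Ne.symm e4, n2.symm, n3.symm, f1]⟩
          · exact ⟨hEb, by simp [Ne.symm e5, n4.symm, n5.symm, iB],
              by simp [Ne.symm e5, n4.symm, n5.symm, g1]⟩) 49 hN1
      rw [Finset.sum_insert (by simp [e1, hne, e4, e5]), Finset.sum_insert (by simp [n1, n2, n4]),
        Finset.sum_insert (by simp [n3, n5]), Finset.sum_insert (by simp [n6]),
        Finset.sum_singleton] at this
      simp only [if_true, Ne.symm e1, Ne.symm hne, Ne.symm e4, Ne.symm e5, n1.symm, n2.symm,
        n3.symm, n4.symm, n5.symm, if_false] at this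
      have hm1 : 1 ≤ m := by omega
      rw [hdk] at this
      omega
    refine ⟨d, ?_, hd⟩
    subst hdk
    have : k ≤ 4 := by omega
    interval_cases k <;> revert hd0 <;> decide

end SLSevenMain

section Ext

theorem ext_hom {l : ℕ} {X : Type} [Group X] (h : IsExtSL2 l X) :
    ∃ j : SLL l →* X, Function.Injective j ∧ j.range.index = 2 := by
  obtain ⟨N, hn, hi, ⟨e⟩⟩ := h
  refine ⟨N.subtype.comp e.symm.toMonoidHom, ?_, ?_⟩
  · exact (Subtype.val_injective).comp e.symm.injective
  · refine Eq.trans (congrArg Subgroup.index ?_) hi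
    ext x
    constructor
    · rintro ⟨y, rfl⟩
      exact (e.symm y).2
    · intro hx
      exact ⟨e ⟨x, hx⟩, by simp⟩

theorem ext_5 {X : Type} [Group X] [Fintype X] (h : IsExtSL2 5 X) :
    numDefectZero 5 X = 2 ∧ ∀ i, (fullTable X).deg i ∣ Nat.card X := by
  obtain ⟨j, hj, hi⟩ := ext_hom h
  have hc : Nat.card (SLL 5) = 120 := by rw [Nat.card_eq_fintype_card, card5]
  have h1 : ((ev St5 (1 : SLL 5) : ℤ) : ℂ) = ((5 : ℕ) : ℂ) := by
    have : ev St5 (1 : SLL 5) = 5 := by rw [ev_one]; decide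
    rw [this]; norm_num
  exact ext2_main j hj hi 5 (by norm_num) {1, 2, 3, 4, 6} _ sl5_main.1 h1 sl5_main.2 (by decide)
    (by rw [hc]; decide) (by rw [hc]; decide) (by rw [hc]; decide)

theorem ext_7 {X : Type} [Group X] [Fintype X] (h : IsExtSL2 7 X) :
    numDefectZero 7 X = 2 ∧ ∀ i, (fullTable X).deg i ∣ Nat.card X := by
  obtain ⟨j, hj, hi⟩ := ext_hom h
  have hc : Nat.card (SLL 7) = 336 := by rw [Nat.card_eq_fintype_card, card7]
  have h1 : ((ev St7 (1 : SLL 7) : ℤ) : ℂ) = ((7 : ℕ) : ℂ) := by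
    have : ev St7 (1 : SLL 7) = 7 := by rw [ev_one]; decide
    rw [this]; norm_num
  exact ext2_main j hj hi 7 (by norm_num) {1, 2, 3, 4, 6, 8} _ sl7_main.1 h1 sl7_main.2 (by decide)
    (by rw [hc]; decide) (by rw [hc]; decide) (by rw [hc]; decide)

theorem claim_6_5 (X : Type) [Group X] [Finite X] (h : IsExtSL2 5 X) : numDefectZero 5 X = 2 := by
  haveI := Fintype.ofFinite X
  exact (ext_5 h).1

theorem claim_7_5 (X : Type) [Group X] [Finite X] (h : IsExtSL2 5 X) :
    numDefectZero 5 (X × Equiv.Perm (Fin 3)) = 6 := by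
  haveI := Fintype.ofFinite X
  rw [prod_numDefectZero (fullTable _) s3Table 5 (by norm_num) (ext_5 h).2 s3_deg_dvd
    (by rw [card_S3]; decide), (ext_5 h).1]
  simp

theorem claim_7_7 (X : Type) [Group X] [Finite X] (h : IsExtSL2 7 X) : numDefectZero 7 X = 2 := by
  haveI := Fintype.ofFinite X
  exact (ext_7 h).1

theorem claim_8_7 (X : Type) [Group X] [Finite X] (h : IsExtSL2 7 X) :
    numDefectZero 7 (X × Multiplicative (ZMod 2)) = 4 := by
  haveI := Fintype.ofFinite X
  rw [prod_numDefectZero (fullTable _) (fullTable _) 7 (by norm_num) (ext_7 h).2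
    (fun i => by rw [abelian_fullTable_deg]; exact one_dvd _)
    (by rw [card_mult]; decide), (ext_7 h).1, abelian_card, card_mult]
  simp

end Ext

/-! ## Part III : the Weyl groups -/

section Tits

/-- Cartan matrix of type `E₈`. -/
def cC : Matrix (Fin 8) (Fin 8) ℤ :=
  !![2, 0, -1, 0, 0, 0, 0, 0;
     0, 2, 0, -1, 0, 0, 0, 0;
     -1, 0, 2, -1, 0, 0, 0, 0;
     0, -1, -1, 2, -1, 0, 0, 0;
     0, 0, 0, -1, 2, -1, 0, 0;
     0, 0, 0, 0, -1, 2, -1, 0;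
     0, 0, 0, 0, 0, -1, 2, -1;
     0, 0, 0, 0, 0, 0, -1, 2]

theorem cC_symm : ∀ i j, cC i j = cC j i := by
  intro i j; fin_cases i <;> fin_cases j <;> rfl
theorem cC_diag : ∀ i, cC i i = 2 := by
  intro i; fin_cases i <;> rfl

/-- The linear form attached to a simple coroot. -/
def phiC (i : Fin 8) : (Fin 8 → ℤ) →ₗ[ℤ] ℤ := (LinearMap.proj i).comp (Matrix.mulVecLin cC)

/-- The simple basis vectors. -/
def eC (i : Fin 8) : Fin 8 → ℤ := Pi.single i 1

theorem phiC_e (i j : Fin 8) : phiC i (eC j) = cC i j := by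
  simp [phiC, eC]

/-- The simple reflections. -/
def rC (i : Fin 8) : Module.End ℤ (Fin 8 → ℤ) := LinearMap.id - (phiC i).smulRight (eC i)

theorem rC_apply (i : Fin 8) (v : Fin 8 → ℤ) : rC i v = v - phiC i v • eC i := by
  simp [rC]

theorem rC_sq (i : Fin 8) : rC i * rC i = 1 := by
  ext1 j
  ext1
  simp only [LinearMap.comp_apply, Module.End.mul_apply, rC_apply, map_sub, map_smul, phiC_e, cC_diag,
    Module.End.one_apply]
  module

theorem rC_comm (i j : Fin 8) (h : cC i j = 0) : rC i * rC j = rC j * rC i := by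
  refine LinearMap.ext fun v => ?_
  have h' : cC j i = 0 := by rw [cC_symm, h]
  simp only [Module.End.mul_apply, rC_apply, map_sub, map_smul, phiC_e, h, h']
  module

theorem rC_braid (i j : Fin 8) (h : cC i j = -1) : rC i * rC j * rC i = rC j * rC i * rC j := by
  refine LinearMap.ext fun v => ?_
  have h' : cC j i = -1 := by rw [cC_symm, h]
  simp only [Module.End.mul_apply, rC_apply, map_sub, map_smul, phiC_e, h, h', cC_diag, smul_eq_mul]
  module

/-- A simply laced Coxeter matrix realised by part of the `E₈` diagram. -/
structure SubE {n : ℕ} (M : CoxeterMatrix (Fin n)) (e : Fin n → Fin 8) : Prop where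
  inj : Function.Injective e
  ent : ∀ i j, i ≠ j → (M i j = 2 ∧ cC (e i) (e j) = 0) ∨ (M i j = 3 ∧ cC (e i) (e j) = -1)

variable {n : ℕ} {M : CoxeterMatrix (Fin n)} {e : Fin n → Fin 8} (hE : SubE M e)

theorem rC_liftable (hE : SubE M e) : M.IsLiftable (fun i => rC (e i)) := by
  intro i j
  by_cases hij : i = j
  · subst hij
    rw [M.diagonal, pow_one, rC_sq]
  · rcases hE.ent i j hij with ⟨h1, h2⟩ | ⟨h1, h2⟩
    · rw [h1, pow_two, mul_assoc, ← mul_assoc (rC (e j)), ← rC_comm _ _ h2, mul_assoc, rC_sq, mul_one,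
        rC_sq]
    · rw [h1, pow_succ, pow_two]
      have := rC_braid _ _ h2
      calc rC (e i) * rC (e j) * (rC (e i) * rC (e j)) * (rC (e i) * rC (e j))
          = (rC (e i) * rC (e j) * rC (e i)) * (rC (e j) * rC (e i) * rC (e j)) := by
            simp only [mul_assoc]
        _ = (rC (e i) * rC (e j) * rC (e i)) * (rC (e i) * rC (e j) * rC (e i)) := by rw [← this]
        _ = rC (e i) * rC (e j) * (rC (e i) * rC (e i)) * rC (e j) * rC (e i) := by
            simp only [mul_assoc]
        _ = 1 := by
            rw [rC_sq, mul_one, mul_assoc (rC (e i)), rC_sq, mul_one, rC_sq]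

/-- The geometric representation (extended to the `E₈` lattice). -/
noncomputable def rhoC : M.Group →* Module.End ℤ (Fin 8 → ℤ) :=
  M.toCoxeterSystem.lift ⟨_, rC_liftable hE⟩

/-- simple reflections of the abstract group -/
noncomputable def sG (M : CoxeterMatrix (Fin n)) (i : Fin n) : M.Group := M.toCoxeterSystem.simple i

theorem rhoC_simple (i : Fin n) : rhoC hE (sG M i) = rC (e i) :=
  M.toCoxeterSystem.lift_apply_simple (rC_liftable hE) i

/-- length function -/
noncomputable def lenG (M : CoxeterMatrix (Fin n)) (w : M.Group) : ℕ := M.toCoxeterSystem.length w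

theorem lenG_step (w : M.Group) (i : Fin n) :
    lenG M (w * sG M i) = lenG M w + 1 ∨ lenG M (w * sG M i) + 1 = lenG M w :=
  M.toCoxeterSystem.length_mul_simple w i

theorem sG_sq (i : Fin n) : sG M i * sG M i = 1 := M.toCoxeterSystem.simple_mul_simple_self i

theorem sG_cancel (w : M.Group) (i : Fin n) : w * sG M i * sG M i = w := by
  rw [mul_assoc, sG_sq, mul_one]

theorem sG_comm (i j : Fin n) (h : M i j = 2) : sG M i * sG M j = sG M j * sG M i := by
  have := M.toCoxeterSystem.simple_mul_simple_pow i j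
  rw [h, pow_two] at this
  change sG M i * sG M j * (sG M i * sG M j) = 1 at this
  calc sG M i * sG M j = sG M i * sG M j * 1 := by rw [mul_one]
    _ = (sG M i * sG M j) * (sG M i * (sG M j * sG M j) * sG M i) := by
      rw [sG_sq, mul_one (sG M i), sG_sq]
    _ = (sG M i * sG M j * (sG M i * sG M j)) * (sG M j * sG M i) := by
      simp only [mul_assoc]
    _ = _ := by rw [this, one_mul]

theorem sG_braid (i j : Fin n) (h : M i j = 3) :
    sG M i * sG M j * sG M i = sG M j * sG M i * sG M j := by
  have := M.toCoxeterSystem.simple_mul_simple_pow i j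
  rw [h, pow_succ, pow_two] at this
  change sG M i * sG M j * (sG M i * sG M j) * (sG M i * sG M j) = 1 at this
  have h2 : (sG M i * sG M j * sG M i) * (sG M j * sG M i * sG M j) = 1 := by
    rw [← this]; simp only [mul_assoc]
  have h3 : (sG M j * sG M i * sG M j) * (sG M j * sG M i * sG M j) = 1 := by
    calc _ = sG M j * sG M i * (sG M j * sG M j) * sG M i * sG M j := by simp only [mul_assoc]
      _ = 1 := by rw [sG_sq, mul_one, mul_assoc (sG M j), sG_sq, mul_one, sG_sq]
  exact mul_right_cancel (h2.trans h3.symm)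

theorem tits (m : ℕ) : ∀ (w : M.Group), lenG M w = m → ∀ s : Fin n, lenG M w < lenG M (w * sG M s) →
    ∀ k, 0 ≤ rhoC hE w (eC (e s)) k := by
  induction m using Nat.strong_induction_on with
  | _ m ih =>
  intro w hw s hs k
  by_cases h1 : w = 1
  · subst h1
    rw [map_one, Module.End.one_apply, eC]
    by_cases hk : k = e s
    · subst hk; simp
    · simp [hk]
  obtain ⟨t, ht⟩ := M.toCoxeterSystem.exists_rightDescent_of_ne_one h1
  change lenG M (w * sG M t) < lenG M w at ht
  have hst : s ≠ t := by rintro rfl; omega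
  obtain ⟨w', hw'⟩ : ∃ w', w' = w * sG M t := ⟨_, rfl⟩
  have hww : w = w' * sG M t := by rw [hw', sG_cancel]
  have hl : lenG M w' + 1 = lenG M w := by
    have := lenG_step w t
    rw [← hw'] at this ht
    omega
  have hlt : lenG M w' < lenG M (w' * sG M t) := by rw [← hww]; omega
  rcases hE.ent t s hst.symm with ⟨hm, hc⟩ | ⟨hm, hc⟩
  · have hr : rhoC hE w (eC (e s)) = rhoC hE w' (eC (e s)) := by
      rw [hww, map_mul, rhoC_simple, Module.End.mul_apply, rC_apply, phiC_e, hc, zero_smul, sub_zero]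
    rw [hr]
    refine ih (lenG M w') (by omega) w' rfl s ?_ k
    have e1 : w' * sG M s = w * sG M s * sG M t := by
      rw [hw', mul_assoc, sG_comm t s hm, mul_assoc]
    have := lenG_step (w * sG M s) t
    rw [← e1] at this
    omega
  · have hr : rhoC hE w (eC (e s)) = rhoC hE w' (eC (e s)) + rhoC hE w' (eC (e t)) := by
      rw [hww, map_mul, rhoC_simple, Module.End.mul_apply, rC_apply, phiC_e, hc, neg_one_smul,
        sub_neg_eq_add, map_add]
    by_cases hs' : lenG M w' < lenG M (w' * sG M s)
    · rw [hr]
      exact add_nonneg (ih (lenG M w') (by omega) w' rfl s hs' k) (ih (lenG M w') (by omega) w' rfl t hlt k)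
    · obtain ⟨w'', hw''⟩ : ∃ w'', w'' = w' * sG M s := ⟨_, rfl⟩
      have hww' : w' = w'' * sG M s := by rw [hw'', sG_cancel]
      have hl' : lenG M w'' + 1 = lenG M w' := by
        have := lenG_step w' s
        rw [← hw''] at this hs'
        omega
      have hc' : cC (e s) (e t) = -1 := by rw [cC_symm, hc]
      have hr' : rhoC hE w (eC (e s)) = rhoC hE w'' (eC (e t)) := by
        rw [hr, hww', map_mul, rhoC_simple, Module.End.mul_apply, Module.End.mul_apply, ← map_add, rC_apply,
          rC_apply, phiC_e, phiC_e, hc', cC_diag]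
        congr 1
        module
      rw [hr']
      refine ih (lenG M w'') (by omega) w'' rfl t ?_ k
      have e1 : w * sG M s = w'' * sG M t * sG M s * sG M t := by
        rw [hww, hww', mul_assoc, mul_assoc, ← mul_assoc (sG M s), ← sG_braid t s hm]
        simp only [mul_assoc]
      have h2 := lenG_step (w'' * sG M t) s
      have h3 := lenG_step (w'' * sG M t * sG M s) t
      rw [← e1] at h3
      have h4 := lenG_step w'' t
      omega

theorem rhoC_faithful (w : M.Group) (h : ∀ s : Fin n, rhoC hE w (eC (e s)) = eC (e s)) : w = 1 := by
  by_contra h1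
  obtain ⟨t, ht⟩ := M.toCoxeterSystem.exists_rightDescent_of_ne_one h1
  change lenG M (w * sG M t) < lenG M w at ht
  have hl : lenG M (w * sG M t) < lenG M (w * sG M t * sG M t) := by rw [sG_cancel]; exact ht
  have h2 := tits hE _ (w * sG M t) rfl t hl (e t)
  rw [map_mul, rhoC_simple, Module.End.mul_apply, rC_apply, phiC_e, cC_diag] at h2
  have h3 : eC (e t) - (2 : ℤ) • eC (e t) = - eC (e t) := by module
  rw [h3, map_neg, h t] at h2
  simp [eC] at h2

theorem group_ind {p : M.Group → Prop} (one : p 1) (mul : ∀ i w, p w → p (sG M i * w)) (w : M.Group) : p w :=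
  M.toCoxeterSystem.simple_induction_left w one (fun w i h => mul i w h)

/-- The invariant form. -/
def bC (v w : Fin 8 → ℤ) : ℤ := ∑ i, v i * phiC i w

theorem phiC_apply (i : Fin 8) (w : Fin 8 → ℤ) : phiC i w = ∑ j, cC i j * w j := by
  simp [phiC, Matrix.mulVec, dotProduct]

theorem bC_symm (v w : Fin 8 → ℤ) : bC v w = bC w v := by
  simp only [bC, phiC_apply, Finset.mul_sum]
  rw [Finset.sum_comm]
  refine Finset.sum_congr rfl fun i _ => Finset.sum_congr rfl fun j _ => ?_
  rw [cC_symm]; ring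

theorem bC_sub (u v w : Fin 8 → ℤ) : bC (u - v) w = bC u w - bC v w := by
  simp only [bC, Pi.sub_apply, sub_mul, Finset.sum_sub_distrib]

theorem bC_smul (a : ℤ) (v w : Fin 8 → ℤ) : bC (a • v) w = a * bC v w := by
  simp only [bC, Pi.smul_apply, smul_eq_mul, Finset.mul_sum, mul_assoc]

theorem bC_e (i : Fin 8) (w : Fin 8 → ℤ) : bC (eC i) w = phiC i w := by
  simp [bC, eC, Pi.single_apply]

theorem bC_r (i : Fin 8) (v w : Fin 8 → ℤ) : bC (rC i v) (rC i w) = bC v w := by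
  rw [rC_apply, rC_apply, bC_sub, bC_symm v, bC_symm (_ • _), bC_sub, bC_sub, bC_smul, bC_smul,
    bC_symm w, bC_e, bC_symm w, bC_symm (eC i), bC_smul, bC_smul, bC_symm v, bC_e, bC_e, phiC_e, cC_diag]
  ring

theorem bC_rho (g : M.Group) : ∀ (v w : Fin 8 → ℤ), bC (rhoC hE g v) (rhoC hE g w) = bC v w := by
  refine group_ind (p := fun g => ∀ (v w : Fin 8 → ℤ), bC (rhoC hE g v) (rhoC hE g w) = bC v w) ?_ ?_ g
  · intro v w; simp
  · intro i g ih v w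
    rw [map_mul, rhoC_simple, Module.End.mul_apply, Module.End.mul_apply, bC_r, ih]

/-- trace of the geometric representation -/
noncomputable def trC (g : M.Group) : ℤ := ∑ i, rhoC hE g (eC i) i

end Tits

/-! ### Kernel-friendly encodings of the root system -/

/-- evaluate the first argument before passing it on -/
def forceN {α : Type} (n : ℕ) (f : ℕ → α) : α := Nat.rec (f 0) (fun k _ => f (Nat.succ k)) n
/-- bit `j` of `M` -/
def tbN (M j : ℕ) : ℕ := Nat.mod (Nat.shiftRight M j) 2
/-- byte `j` of `p` -/
def getB (p j : ℕ) : ℕ := Nat.mod (Nat.shiftRight p (Nat.mul 8 j)) 256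
/-- number with given digits -/
def foldD (B : ℕ) (a : ℕ → ℕ) : ℕ :=
  Nat.rec 0 (fun k r => Nat.add (Nat.mul B r) (a (Nat.sub 239 k))) 240
/-- composition of packed permutations -/
def compP (p q : ℕ) : ℕ := foldD 256 fun j => getB p (getB q j)
def gen0P : ℕ := 0xefeeedecebeae9e7e8e5e6e3e4e0e1e2dddedfd9dbdadcd4d7d6d5d8d3d2d1d0cfcecdcccbcac9c8c7c1c5c4c3c2c6bbbfbebdbcc0b5b4b8b7b6bab9afaeb1b0b3b2a9a8a7aaadacaba2a09fa3a6a1a5a49a98979b9e999d9c929094939691958a888d8c8b8f898e828685848387817a7f7e7d7c7b807900777675747372716f706d6e6b6c68696a656667616362645c5f5e5d605b5a595857565554535251504f494d4c4b4a4e4347464544483d3c403f3e4241373639383b3a31302f323534332a28272b2e292d2c22201f23262125241a181c1b1e191d12101514131711160a0e0d0c0b0f09020706050403080178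
def gen1P : ℕ := 0xefeeedecebe9eae6e5e8e7e4e3e2e1e0dfdedddcd7dad9d8dbd3d5d4d6cfced0d2d1cac9cbcdccc4c3c6c5c8c7bdc1c0bfbec2b6bbbab9b8b7bcb5b4b3b2b1b0afaea6acabaaa2a8a7ad9ea4a3a99b9a9fa5969ca1a09392979d8f9499988b8a95878d8c919083828e86858489887b807f7e7d7c817a0178777675747371726e6d706f6c6b6a6968676665645f626160635b5d5c5e5756585a5952515355544c4b4e4d504f45494847464a3e434241403f443d3c3b3a393837362e3433322a302f35262c2b312322272d1e2429281b1a1f25171c212013121d0f151419180b0a160e0d0c111003080706050409027900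
def gen2P : ℕ := 0xefeeedecebe8e6eae7e9e5e4e1e2e3dedfe0dadcdbddd5d8d7d6d9d0d3d2d1d4cfcecdccc6cac9c8c7cbc0c4c3c2c1c5bab9bdbcbbbfbeb3b2b6b5b4b8b7acabafaeadb1b0a4a1a8a7a6a5aa9c9ba9999f9e9da3a293a091979695949a8b98898f8e8d8c92839081878685848a7b88787f7e7d7c820279807776757473706e726f716d6c696a6b666768626463655d605f5e61585b5a595c575655544e5251504f53484c4b4a494d424145444347463b3a3e3d3c403f343337363539382c29302f2e2d32242331212726252b2a1b28191f1e1d1c22132011171615141a0b18090f0e0d0c12031000070605040a7a0108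
def gen3P : ℕ := 0xefeeedeceaebe9e8e7e4e3e6e5e2e1e0dfdbdddcded6d9d8d7dad1d4d3d2d5cccbcecdd0cfc5c9c8c7c6cabfbec2c1c0c4c3b7bcbbbab9b8bdb0b5b4adb2b1b6a9aeb3a5abaaafa0a7a6ac9da3a2a1a8989ea495949a999f90969c9b8c9291978f8e8d93848a89888086858b7c7a79877f7e7d830382817877767574727371706f6c6b6e6d6a696867636564665e61605f62595c5b5a5d5453565558574d51504f4e5247464a49484c4b3f444342414045383d3c353a393e31363b2d333237282f2e34252b2a293020262c1d1c222127181e2423141a191f1716151b0c121110080e0d130402010f0706050b7b0a0900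
def gen4P : ℕ := 0xefeeedebeceae9e8e7e6e5e2e0e4dee3dfe1dddcdbdad9d8d7d2d5d4cfd6cdd0d3cad1c7cbcec3c8ccc6c5c4c9c2c1c0b8bebdbcbbb3b9bfb1b6afb4baacb7aab5a8adb2a4b0a9ae9fa6a5aba3a2a1a0a79e9d9c9b9a999897968e8d93929188879594858b8281908f868c7d7b8a89807f7e8404837a797877767573747271706f6e6d6a686c666b67696564636261605f5a5d5c575e55585b52594f53564b50544e4d4c514a494840464544433b4147393e373c42343f323d30353a2c383136272e2d332b2a29282f262524232221201f1e16151b1a19100f1d1c0d130a0918170e14050312110807060c7c0b020100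
def gen5P : ℕ := 0xefeeecedebeae9e8e7e6e5e4e3dfe1dde2dae0dcd6ded9d8d3dbd5d4d7d2d1d0cfcec8cccbc4c9cdc2c6bfcabdc7c1bac5b7c3bcb5c0b2b8beb6bbaeb3b9b1b0afb4adacaba3a9a8a7a6a59caaa2a1a0979e95a49b9a99909f8f9d94938a8998968e868c83929188878d7e7c8b8281807f8505847b7a797877767475737271706f6e6d6c6b6769656a6268645e6661605b635d5c5f5a595857565054534c51554a4e4752454f49424d3f4b443d483a40463e43363b413938373c3534332b31302f2e2d24322a29281f261d2c232221182717251c1b1211201e160e140b1a19100f150604130a0908070d7d0c03020100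
def gen6P : ℕ := 0xefedeeecebeae9e8e7e6e5e4e3e2e1e0dcded9dfdbd5ddd8d7d1dad4cecdd6d0cad3d2ccc5cfc9c8c7c0cbc4c3bcbbc6bfbeb6c2c1bab9b8b0bdb5b4b3abaab7afa7ada4b2b1a99faea69daca3a2a198a896a59c9b9291a0979e95948b9a99908f8e8d84938a8988877f7d8c838281808606857c7b7a797877757674737271706f6e6d6c6b6a696864666167635d65605f59625c56555e58525b5a544d5751504f48534c4b44434e47463e4a4942414038453d3c3b33323f372f352c3a393127362e25342b2a2920301e2d24231a19281f261d1c132221181716150c1b1211100f0705140b0a09080e7e0d0403020100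
def gen7P : ℕ := 0xeeefedecebeae9e8e7e6e5e4e3e2e1e0dfdeddd8dbdad4dcd7d6d0d9d3d2ccd5cfc9c7d1cbc3cec2cdc6bebdcac8c1b9b7c5c4bcb4b2c0b1bfb6aebbacbab8b0a8b5a5b3abaaa0afa79eada4a39a99a99fa69d9c93a2a1989796958c9b9291908f8e85948b8a8988877e8d848382818007867d7c7b7a797876777574737271706f6e6d6c6b6a69686766656063625c645f5e58615b5a545d57514f59534b564a554e4645525049413f4d4c443c3a4839473e364334424038303d2d3b333228372f26352c2b222131272e25241b2a29201f1e1d14231a191817160d1c131211100f06150c0b0a09087f0e050403020100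
/-- packed generators -/
def gnP (i : ℕ) : ℕ :=
  match i with
  | 0 => gen0P | 1 => gen1P | 2 => gen2P | 3 => gen3P
  | 4 => gen4P | 5 => gen5P | 6 => gen6P | _ => gen7P
/-- packed identity -/
def idP : ℕ := 0xefeeedecebeae9e8e7e6e5e4e3e2e1e0dfdedddcdbdad9d8d7d6d5d4d3d2d1d0cfcecdcccbcac9c8c7c6c5c4c3c2c1c0bfbebdbcbbbab9b8b7b6b5b4b3b2b1b0afaeadacabaaa9a8a7a6a5a4a3a2a1a09f9e9d9c9b9a999897969594939291908f8e8d8c8b8a898887868584838281807f7e7d7c7b7a797877767574737271706f6e6d6c6b6a696867666564636261605f5e5d5c5b5a595857565554535251504f4e4d4c4b4a494847464544434241403f3e3d3c3b3a393837363534333231302f2e2d2c2b2a292827262524232221201f1e1d1c1b1a191817161514131211100f0e0d0c0b0a09080706050403020100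
/-- coefficients of the positive roots -/
def vecP : ℕ := 0x234564321345643212456432123564321234643212345432123454221234533212345331123453221234532112344322123443211233432212344221123343211223432212334221122343211123432212333221122342211123432101234322123332111223322111234221012343211223321112223221112332210123422112223211112332111122322101233221122222111122321101233211111232210122322112222111112222111112321101223211011232211222211011222111111222110122221101123211001232211122211011122111012221111111221101122211001232111112211001222110111121110112211101112211001222111111211001122110111111110111211100122111001122111111111001112110001221101111110101111111001121110001221111111100111110100111111000112110011111010011111100012111111110000111110001111010001111100001211000111101000111111111000001111000001111000011101000011110000111010000111111100000011100000011100000011100000110100000111000001101110000000110000000110000000110000000110000001010000001011000000001000000001000000001000000001000000001000000001000000001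
/-- adjacency rows -/
def rowsP : ℕ := 0x7ffffeeeed738d28a2460810204080000000000000000000000000000000bfffeddd9ace629651214608102040000000000000000000000000000080dfff5bb376a95a510c90a146081020000000000000000000000000004040effab77b5314b4e5488810a1860810000000000000000000000000202020f7e5f735a59c314a95189080418608000000000000000000000010101010fb9dbb5639a4d18326292121410106000000000000000000000808080808fc7db398ce38e1c3044c4444848504000000000000000000020202020202fcd6dd6731c5160c38323222420203000000000000000000040404040404fd2b6e7731861830c3838383030202000000000000000000404040808101fb36d5a9c659264c18505848888809000000000000000002010101010006facb66b9c61a2870c1848c8c0c0c08000000000000000020202020400103f74e99ca5a61c68528606070901111000000000000000081008080010608f6b32ada5a22c8b142850515141014000000000000000810101000408209ef51d984ace9430a3470604060a121000000000000002040800081060810f1f84ceb52430e3448820a1a1a1810000000000000010204080000418504eeac6a94acaa491287058504212424000000000000040408001020820811df54354c8954a58e30685020c0c141000000000000081000808106081020e9e70ca5a4cb0a1891128a0a282228000000000000808100080021840114dea9865c8916a1a2c30d0481054444000000000001020008102042081021bf548322653195492c583060c08181000000000002001041010608102040e59f40c638e34a1022232312303022000000000010204000081080848c08d9e2e06d8156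242cd1021a88024a48000000000020400104002144001124bea9303265309961868c81850504840000000000400204102042081020417f549011128c72c71c387060c08101000000000002082082060810204080e27f4808ce6b4a1000444c5c3830200000000001041000000810a1430202d59aac0e194684a462230231124052000000000408004004108044088428b9e2560365111c68889298820a0a880000000008004082002144001021447ea92301128c70d345898585050404000000000041040820420810204081d27aa4c0ca52a4a440444c1894485000000000208010000410a102410222cd85ec40a9c6010ab32302006162420000000042000041088000448c1810b59a1a6071219c212a82213302109200000000800820021100440800a44879e24530128c32545990928a0a0a08000000000820810022440010204184ca65e48c0c5a210a91444c0820e448000000021000100108802123021012b27a12aa06318c6108c408548c1890000000040084000211210200412242ad855a2605a11908a612a1026102a2000000080200208440004408940850759a09530284529548a1232312101200000000841001088044080020c488c61da8cc8062c182226544103061440000002100001040089090820a0a08aa6552a0e0390948845488442884a8000000401004008440210221120052727a0199500862d54880444c9c18100000000421000108a20200006142829d80b66620149528a20a10a143428200000080020842100000444c1830206d854915300c52121531a302412222000000084010842000440810844890c156cccc8803060c30624a18306041000002100000104104888185050404a61d1a826c01c901264421542011a4000004010004200451001288020a489a60b628c500a568804c188084cc880000080010804210002123021030226a654191868062521510c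44c08a4280000004201008420220200310240925d80a55511803086512912a14302420000008044210800004408542810a0c0ab6ccc88400830c3070e1830604000001100000010410c183060c08101a15658a264600e08285228522810a10000201000042082410904810504449618b24a493005a1224c003184419400004001008802101110820a082228661d09901aa8029304216544103124000004200110042880021880024a885a60a519821c00c651085488848c480000080220210800220221122010a23d801333318400410c98b1a3430202000000888842000000444c18306040a0ab4aa264230030828689162810a0000081000004208610285020c081419152946a4151802c284218308248910001001000884012050185040124246156498112c940141830624a1830210000220001108120820c00810544848e05b204ad30800aa64c000061c58400020001120002144880020a1a18105618a1581a04e007402944219401540000402024010808801288022802a83a601331461830010c9890c48c8c0800000844084200002223021030604290aa266a41128c00c286089106489000040100008842021430604040a12160ab4891128a4a004181870e183020000090000110850820481020c0c1818944d424a5510500b052180060c2890008001012004091408105051410145152854912442680582052289208510001020024200900860481042104a44e05a114888c61801529440041a5440002002240010c20088208120a1890361813125220d0c00c882165841114000044048042000891020a0820624888a16624a51209280306888021468800100100120042850820606090111150aa2459120620b4018106891608500004100024210108245020406081a185149846296185080262203060418300200011020820504180848c0c0c084944c50580cc220e0130520840a2490008020240208821028401150410943152112352011645009030628a1811000120048802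0102830504002164442e05131024a851430018a144418524000204480042042440020a1812485084892a4629228920a007011121408600400101020822441810504888880948a16415808e2012d001868801264800101002402184012840207080119130aa023352001871480081870e1810000480048840010a3060400060e14182549088cc71850820044850a0c1810080001110841010418183830302024514894418c44286300162205021430020022044100860808488840c0c8829445121248912481c00b04248822900082048080280a0420504111440541e00b3100114b1c3040010a1c585040002488000430a1000020a1a38302082292288cc32892082400c1424448401000101108412041830322242020381824c6621430c28a2000a1222428202000110020860c30408444484850444892854188640924320070111204600401020441104480850184088888928a142312488185085900186090628001080480840848420604030904151425481888a4862861060044890a1410080022221001820828281830302822514190230a152012c3001624011230020240880122020c1040c88044c48194095210114344c181800a0c28a09000908800822481002050514303024806244a8c4530c2880460018284888040001101084508304292121410106422920988a0a60924105400c14244401001022210114082812302242028341824c4510c602145123000a1222420200120044308141044c004484858424890a1230a058110681a007011026004084088050240c1040580880c84918a0263101143060c1889001070e0800140880086142002060605030312122541180462942410c5060048891210080244401060020c3030281034242151091421104948528283001c2011300214080840a081081048c0c282428801a08ca48638c202246080030509008000111008c30421518908041860840624489824a221451004e001828480400120221209101260821214101862229029046284851048485400c1424010084440144040c3022122042424321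82482330811a100892a3000a12220200a0088810a182004c440084c54414882252110490a1428901a007001600444080844902081050484828a029125091084210a4c5084850600489110081480420820810830383022122220d0491042184110a34383020018303002a00884202083040840c1c1c181080054884ac630908a24608100060a010000111120430c5488810a1860810401a08c81a42429440214618003050080012202510114884189080418688206240a146090a500890884e0018280400a0440904818222290021414146122822184210a0e1408c0485800c140104480420c10208303222026022231182046311041424488212a3000a12020500808c2841020444444420a5240c81221421841102870981814006060052008842410604084048589818110a4491008418214a14585040c00509008a084210020830428303131210128000a44c89528528a24608102000c020000111128852510c90a1460810204005488488ca4212112146083000601000122241109461088810a1860890201a088252214a11088021561800300800a4048114210a9108108041c6481062042942102464488018888e00180405080428a04102262121006121260a21221084182142850c848405800c01120842104106042822223212101309804425218410089112928243000a021800884a20c08100444454941114061491000820c18324686060c0800500a2442100020830c1828a8a0a0a088000122265318d28a246081020400040000111128c6296512146081020404000a44c884620865121460810600020001222642118410c90a1460810a02005488024a94a100410a1462830001000a4480114a4a4400810a1864850101a004a520084a54880003196180008054004a488010a9510800061a628086044218418204891109888088e00041808421820c08122212131101116060922100820c183060d0505050500014244210041060c18121a0a0a0a0905800846318410002223232343020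002600088c618204000444c4c8c8c08015491000041060c38707060c0810000a9221000020830c38585850504040000000000000000000000000000007ffffeeeed738d28a2460810204080000000000000000000000000000080bfffeddd9ace629651214608102040000000000000000000000000004040dfff5bb376a95a510c90a146081020000000000000000000000000202020effab77b5314b4e5488810a1860810000000000000000000000010101010f7e5f735a59c314a95189080418608000000000000000000000808080808fb9dbb5639a4d18326292121410106000000000000000000020202020202fc7db398ce38e1c3044c4444848504000000000000000000040404040404fcd6dd6731c5160c38323222420203000000000000000000404040808101fd2b6e7731861830c3838383030202000000000000000002010101010006fb36d5a9c659264c18505848888809000000000000000020202020400103facb66b9c61a2870c1848c8c0c0c08000000000000000081008080010608f74e99ca5a61c68528606070901111000000000000000810101000408209f6b32ada5a22c8b142850515141014000000000000002040800081060810ef51d984ace9430a3470604060a121000000000000010204080000418504f1f84ceb52430e3448820a1a1a1810000000000000040408001020820811eeac6a94acaa491287058504212424000000000000081000808106081020df54354c8954a58e30685020c0c141000000000000808100080021840114e9e70ca5a4cb0a1891128a0a282228000000000001020008102042081021dea9865c8916a1a2c30d0481054444000000000002001041010608102040bf548322653195492c583060c08181000000000010204000081080848c08e59f40c638e34a1022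232312303022000000000020400104002144001124d9e2e06d8156242cd1021a88024a48000000000040020410204208102041bea9303265309961868c81850504840000000000020820820608102040807f549011128c72c71c387060c081010000000001041000000810a1430202e27f4808ce6b4a1000444c5c383020000000000408004004108044088428d59aac0e194684a462230231124052000000000800408200214400102144b9e2560365111c68889298820a0a880000000000410408204208102040817ea92301128c70d34589858505040400000000208010000410a102410222d27aa4c0ca52a4a440444c189448500000000042000041088000448c1810cd85ec40a9c6010ab323020061624200000000800820021100440800a448b59a1a6071219c212a82213302109200000000082081002244001020418479e24530128c32545990928a0a0a08000000021000100108802123021012ca65e48c0c5a210a91444c0820e448000000040084000211210200412242b27a12aa06318c6108c408548c1890000000080200208440004408940850ad855a2605a11908a612a1026102a200000000841001088044080020c488759a09530284529548a123231210120000002100001040089090820a0a08c61da8cc8062c18222654410306144000000401004008440210221120052aa6552a0e0390948845488442884a80000000421000108a2020000614282727a0199500862d54880444c9c181000000080020842100000444c1830209d80b66620149528a20a10a14342820000000840108420004408108448906d854915300c52121531a302412222000002100000104104888185050404c156cccc8803060c30624a18306041000004010004200451001288020a48a61d1a826c01c901264421542011a40000080010804210002123021030229a60b628c500a568804c188084c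c880000004201008420220200310240926a654191868062521510c44c08a4280000008044210800004408542810a05d80a55511803086512912a143024200001100000010410c183060c08101c0ab6ccc88400830c3070e18306040000020100004208241090481050444a15658a264600e08285228522810a100004001008802101110820a0822289618b24a493005a1224c0031844194000004200110042880021880024a88661d09901aa80293042165441031240000080220210800220221122010a25a60a519821c00c651085488848c48000000888842000000444c183060403d801333318400410c98b1a3430202000081000004208610285020c08141a0ab4aa264230030828689162810a00001001000884012050185040124249152946a4151802c284218308248910000220001108120820c00810544846156498112c940141830624a18302100020001120002144880020a1a18108e05b204ad30800aa64c000061c5840000402024010808801288022802a85618a1581a04e007402944219401540000084408420000222302103060423a601331461830010c9890c48c8c0800040100008842021430604040a12190aa266a41128c00c2860891064890000090000110850820481020c0c18160ab4891128a4a004181870e1830200008001012004091408105051410148944d424a5510500b052180060c2890001020024200900860481042104a45152854912442680582052289208510002002240010c20088208120a18904e05a114888c61801529440041a544000044048042000891020a08206248361813125220d0c00c88216584111400100100120042850820606090111188a16624a5120928030688802146880004100024210108245020406081a150aa2459120620b40181068916085000200011020820504180848c0c0c088514984629618508026220306041830008020240208821028401150410944944c50580cc220e0130520840a2490001200488020102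830504002164443152112352011645009030628a1811000204480042042440020a181248502e05131024a851430018a14441852400400101020822441810504888880984892a4629228920a007011121408600101002402184012840207080119148a16415808e2012d0018688012648000480048840010a3060400060e14130aa023352001871480081870e181000800011108410104181838303020282549088cc71850820044850a0c1810020022044100860808488840c0c884514894418c442863001622050214300082048080280a04205041114405429445121248912481c00b0424882290002488000430a1000020a1a3830201e00b3100114b1c3040010a1c5850401000101108412041830322242020382292288cc32892082400c1424448402000110020860c30408444484850481824c6621430c28a2000a1222428200401020441104480850184088888944892854188640924320070111204600108048084084842060403090415128a142312488185085900186090628008002222100182082828183030282425481888a4862861060044890a1410020240880122020c1040c88044c482514190230a152012c300162401123000908800822481002050514303024194095210114344c181800a0c28a09040001101084508304292121410106806244a8c4530c2880460018284888010010222101140828123022420283422920988a0a60924105400c1424440200120044308141044c004484858441824c4510c602145123000a122242004084088050240c1040580880c84924890a1230a058110681a00701102600140880086142002060605030312118a0263101143060c1889001070e080080244401060020c303028103424222541180462942410c50600488912100214080840a081081048c0c282428151091421104948528283001c2011308000111008c304215189080418608801a08ca48638c202246080030509004001202212091012608212141018640624489824a221451004e00182848010084440144040c3022122042424322290290462848510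48485400c14240200a0088810a182004c440084c5442182482330811a100892a3000a122200444080844902081050484828a02914882252110490a1428901a0070016008148042082081083038302212222125091084210a4c508485060048911002a00884202083040840c1c1c18100d0491042184110a3438302001830310000111120430c5488810a186081080054884ac630908a24608100060a0080012202510114884189080418688401a08c81a424294402146180030500400a0440904818222290021414146206240a146090a500890884e0018280104480420c1020830322202602223122822184210a0e1408c0485800c14020500808c2841020444444420a5241182046311041424488212a3000a120052008842410604084048589818110c8122142184110287098181400606008a084210020830428303131210120a4491008418214a14585040c0050920000111128852510c90a1460810208000a44c89528528a24608102000c01000122241109461088810a18608904005488488ca4212112146083000600800a4048114210a9108108041c648201a088252214a11088021561800300405080428a04102262121006121261062042942102464488018888e00180112084210410604282222321210130a21221084182142850c848405800c021800884a20c0810044445494111409804425218410089112928243000a00a2442100020830c1828a8a0a0a08061491000820c18324686060c0800540000111128c6296512146081020408000122265318d28a246081020400020001222642118410c90a1460810a04000a44c88462086512146081060001000a4480114a4a4400810a18648502005488024a94a100410a14628300008054004a488010a9510800061a628101a004a520084a548800031961800041808421820c08122212131101116086044218418204891109888088e00014244210041060c18121a0a0a0a09060922100820c183060d050505050002600088c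618204000444c4c8c8c0805800846318410002223232343020000a9221000020830c3858585050404015491000041060c38707060c08100
/-- coefficients of the positive roots -/
def cfP (j i : ℕ) : ℕ := Nat.mod (Nat.shiftRight vecP (Nat.add (Nat.mul 32 j) (Nat.mul 4 i))) 16
/-- coefficients of all roots -/
def vecN (j i : ℕ) : ℤ := if j < 120 then (cfP j i : ℤ) else - (cfP (j - 120) i : ℤ)
/-- adjacency rows -/
def rowP (f : ℕ) : ℕ := Nat.mod (Nat.shiftRight rowsP (Nat.mul 240 f)) 0x1000000000000000000000000000000000000000000000000000000000000
/-- positive part of the form -/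
def ipA (f j : ℕ) : ℕ := Nat.mul 2 (Nat.add (Nat.add (Nat.add (Nat.add (Nat.add (Nat.add (Nat.add (Nat.mul (cfP f 0) (cfP j 0))
    (Nat.mul (cfP f 1) (cfP j 1)))
    (Nat.mul (cfP f 2) (cfP j 2)))
    (Nat.mul (cfP f 3) (cfP j 3)))
    (Nat.mul (cfP f 4) (cfP j 4)))
    (Nat.mul (cfP f 5) (cfP j 5)))
    (Nat.mul (cfP f 6) (cfP j 6)))
    (Nat.mul (cfP f 7) (cfP j 7)))
/-- negative part of the form -/
def ipB (f j : ℕ) : ℕ := Nat.add (Nat.add (Nat.add (Nat.add (Nat.add (Nat.add (Nat.add (Nat.add (Nat.add (Nat.add (Nat.add (Nat.add (Nat.add (Nat.mul (cfP f 0) (cfP j 2))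
    (Nat.mul (cfP f 2) (cfP j 0)))
    (Nat.mul (cfP f 2) (cfP j 3)))
    (Nat.mul (cfP f 3) (cfP j 2)))
    (Nat.mul (cfP f 1) (cfP j 3)))
    (Nat.mul (cfP f 3) (cfP j 1)))
    (Nat.mul (cfP f 3) (cfP j 4)))
    (Nat.mul (cfP f 4) (cfP j 3)))
    (Nat.mul (cfP f 4) (cfP j 5)))
    (Nat.mul (cfP f 5) (cfP j 4)))
    (Nat.mul (cfP f 5) (cfP j 6)))
    (Nat.mul (cfP f 6) (cfP j 5)))
    (Nat.mul (cfP f 6) (cfP j 7)))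
    (Nat.mul (cfP f 7) (cfP j 6))
/-- check of one entry of the adjacency table -/
def chkR (f j a b : ℕ) : Bool :=
  Nat.beq (tbN (rowP f) j) (cond (Nat.beq a (b + 1)) 1 0) &&
  Nat.beq (tbN (rowP (f + 120)) (j + 120)) (cond (Nat.beq a (b + 1)) 1 0) &&
  Nat.beq (tbN (rowP f) (j + 120)) (cond (Nat.beq b (a + 1)) 1 0) &&
  Nat.beq (tbN (rowP (f + 120)) j) (cond (Nat.beq b (a + 1)) 1 0) &&
  (!(Nat.beq a (b + 2)) || Nat.beq f j) && !(Nat.beq b (a + 2))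
/-- bounded universal quantifier -/
def allN (n : ℕ) (f : ℕ → Bool) : Bool := Nat.rec true (fun k r => f k && r) n

theorem allN_spec {n : ℕ} {f : ℕ → Bool} (h : allN n f = true) : ∀ k < n, f k = true := by
  induction n with
  | zero => intro k hk; omega
  | succ n ih =>
    have h' : (f n && allN n f) = true := h
    rw [Bool.and_eq_true] at h'
    intro k hk
    rcases Nat.lt_succ_iff_lt_or_eq.1 hk with h1 | h1
    · exact ih h'.2 k h1
    · rw [h1]; exact h'.1

theorem forceN_eq {α : Type} (n : ℕ) (f : ℕ → α) : forceN n f = f n := by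
  cases n <;> rfl

theorem chkR_all : allN 120 (fun f => allN 120 fun j => forceN (ipA f j) fun a => forceN (ipB f j) fun b =>
    chkR f j a b) = true := by
  decide +kernel

theorem chkG_all : allN 240 (fun j => allN 8 fun i => forceN (getB (gnP i) j) fun j' => Nat.blt j' 240 &&
    allN 8 fun k => cond (Nat.beq k i) true (decide (vecN j' k = vecN j k))) = true := by
  decide +kernel

theorem chkG0 : allN 240 (fun j => decide (vecN (getB (gnP 0) j) 0 + vecN j 0 = vecN j 2)) = true := by
  decide +kernel

theorem chkG1 : allN 240 (fun j => decide (vecN (getB (gnP 1) j) 1 + vecN j 1 = vecN j 3)) = true := by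
  decide +kernel

theorem chkG2 : allN 240 (fun j => decide (vecN (getB (gnP 2) j) 2 + vecN j 2 = vecN j 0 + vecN j 3)) = true := by
  decide +kernel

theorem chkG3 : allN 240 (fun j => decide (vecN (getB (gnP 3) j) 3 + vecN j 3 = vecN j 1 + vecN j 2 + vecN j 4)) = true := by
  decide +kernel

theorem chkG4 : allN 240 (fun j => decide (vecN (getB (gnP 4) j) 4 + vecN j 4 = vecN j 3 + vecN j 5)) = true := by
  decide +kernel

theorem chkG5 : allN 240 (fun j => decide (vecN (getB (gnP 5) j) 5 + vecN j 5 = vecN j 4 + vecN j 6)) = true := by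
  decide +kernel

theorem chkG6 : allN 240 (fun j => decide (vecN (getB (gnP 6) j) 6 + vecN j 6 = vecN j 5 + vecN j 7)) = true := by
  decide +kernel

theorem chkG7 : allN 240 (fun j => decide (vecN (getB (gnP 7) j) 7 + vecN j 7 = vecN j 6)) = true := by
  decide +kernel

theorem chkId : allN 240 (fun j => Nat.beq (getB idP j) j) = true := by decide +kernel

theorem chkS : allN 8 (fun j => allN 8 fun k => decide (vecN j k = if j = k then 1 else 0)) = true := by
  decide +kernel

theorem chkD : allN 240 (fun j => decide (2 * (vecN j 0 * vecN j 0 + vecN j 1 * vecN j 1 + vecN j 2 * vecN j 2 + vecN j 3 * vecN j 3 + vecN j 4 * vecN j 4 + vecN j 5 * vecN j 5 + vecN j 6 * vecN j 6 + vecN j 7 * vecN j 7) -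
    2 * (vecN j 0 * vecN j 2 + vecN j 2 * vecN j 3 + vecN j 1 * vecN j 3 + vecN j 3 * vecN j 4 + vecN j 4 * vecN j 5 + vecN j 5 * vecN j 6 + vecN j 6 * vecN j 7) = 2)) = true := by
  decide +kernel

/-! ### The action on roots -/

theorem natBeq_iff (a b : ℕ) : Nat.beq a b = true ↔ a = b := by rw [Nat.beq_eq]

theorem natBeq_false (a b : ℕ) : Nat.beq a b = false ↔ a ≠ b := by
  rw [← Bool.not_eq_true, natBeq_iff]


section Roots

/-- the roots as vectors -/
def vecF (j : Fin 240) : Fin 8 → ℤ := fun k => vecN j k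

theorem fin120 (j : Fin 240) : ((j + 120 : Fin 240) : ℕ) = (j + 120) % 240 := by
  rw [Fin.val_add]; rfl

theorem vecF_neg (j : Fin 240) : vecF (j + 120) = - vecF j := by
  ext k
  simp only [vecF, Pi.neg_apply, fin120, vecN]
  have := j.2
  by_cases h : (j : ℕ) < 120
  · have h1 : ((j : ℕ) + 120) % 240 = j + 120 := Nat.mod_eq_of_lt (by omega)
    rw [h1, if_neg (by omega), if_pos h, Nat.add_sub_cancel]
  · have h1 : ((j : ℕ) + 120) % 240 = j - 120 := by omega
    rw [h1, if_pos (by omega), if_neg h, neg_neg]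

theorem neg_neg_fin (j : Fin 240) : j + 120 + 120 = j := by
  apply Fin.ext
  rw [fin120, fin120]
  have := j.2
  omega

theorem vecF_simple (i : Fin 8) (j : Fin 240) (h : (j : ℕ) = i) : vecF j = eC i := by
  ext k
  have h1 := allN_spec (allN_spec chkS i i.2) k k.2
  rw [decide_eq_true_eq] at h1
  rw [vecF, h, h1, eC, Pi.single_apply]
  by_cases hk : i = k
  · subst hk; simp
  · rw [if_neg (fun h' => hk (Fin.ext h')), if_neg (Ne.symm hk)]

theorem bC_pos (f j : ℕ) (hf : f < 120) (hj : j < 120) :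
    bC (fun k => vecN f k) (fun k => vecN j k) = (ipA f j : ℤ) - ipB f j := by
  simp only [bC, phiC_apply, Fin.sum_univ_eight, vecN, if_pos hf, if_pos hj, cC]
  have ea : ipA f j = 2 * (cfP f 0 * cfP j 0 + cfP f 1 * cfP j 1 + cfP f 2 * cfP j 2 + cfP f 3 * cfP j 3 +
    cfP f 4 * cfP j 4 + cfP f 5 * cfP j 5 + cfP f 6 * cfP j 6 + cfP f 7 * cfP j 7) := rfl
  have eb : ipB f j = cfP f 0 * cfP j 2 + cfP f 2 * cfP j 0 + cfP f 2 * cfP j 3 + cfP f 3 * cfP j 2 +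
    cfP f 1 * cfP j 3 + cfP f 3 * cfP j 1 + cfP f 3 * cfP j 4 + cfP f 4 * cfP j 3 +
    cfP f 4 * cfP j 5 + cfP f 5 * cfP j 4 + cfP f 5 * cfP j 6 + cfP f 6 * cfP j 5 +
    cfP f 6 * cfP j 7 + cfP f 7 * cfP j 6 := rfl
  rw [ea, eb]
  push_cast
  simp [-mul_eq_mul_left_iff]
  ring

theorem chkR_spec (f j : ℕ) (hf : f < 120) (hj : j < 120) : chkR f j (ipA f j) (ipB f j) = true := by
  have h := allN_spec (allN_spec chkR_all f hf) j hj
  rwa [forceN_eq, forceN_eq] at h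

theorem bC_neg_left (v w : Fin 8 → ℤ) : bC (-v) w = - bC v w := by
  rw [← neg_one_smul ℤ v, bC_smul]; ring

theorem bC_neg_right (v w : Fin 8 → ℤ) : bC v (-w) = - bC v w := by
  rw [bC_symm, bC_neg_left, bC_symm]

/-- Every root is plus or minus a positive one. -/
theorem root_cases (j : Fin 240) : (j : ℕ) < 120 ∨ ∃ i : Fin 240, (i : ℕ) < 120 ∧ j = i + 120 := by
  by_cases h : (j : ℕ) < 120
  · exact Or.inl h
  · refine Or.inr ⟨j + 120, ?_, (neg_neg_fin j).symm⟩
    rw [fin120]; have := j.2; omega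

theorem row_pp (f j : Fin 240) (hf : (f : ℕ) < 120) (hj : (j : ℕ) < 120) :
    (tbN (rowP f) j = if bC (vecF f) (vecF j) = 1 then 1 else 0) ∧
    (tbN (rowP (f + 120 : Fin 240)) (j + 120 : Fin 240) = if bC (vecF f) (vecF j) = 1 then 1 else 0) ∧
    (tbN (rowP f) (j + 120 : Fin 240) = if bC (vecF f) (vecF j) = -1 then 1 else 0) ∧
    (tbN (rowP (f + 120 : Fin 240)) j = if bC (vecF f) (vecF j) = -1 then 1 else 0) ∧
    (bC (vecF f) (vecF j) = 2 → f = j) ∧ bC (vecF f) (vecF j) ≠ -2 := by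
  have hb : bC (vecF f) (vecF j) = (ipA f j : ℤ) - ipB f j := bC_pos f j hf hj
  have hc := chkR_spec f j hf hj
  have ef : ((f + 120 : Fin 240) : ℕ) = f + 120 := by rw [fin120]; omega
  have ej : ((j + 120 : Fin 240) : ℕ) = j + 120 := by rw [fin120]; omega
  rw [hb, ef, ej]
  generalize ipA f j = a at *
  generalize ipB f j = b at *
  simp only [chkR, Bool.and_eq_true, Nat.beq_eq, Bool.or_eq_true, Bool.not_eq_true'] at hc
  obtain ⟨⟨⟨⟨⟨h1, h2⟩, h3⟩, h4⟩, h5⟩, h6⟩ := hc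
  have k1 : (cond (Nat.beq a (b + 1)) 1 0 : ℕ) = if ((a : ℤ) - b = 1) then 1 else 0 := by
    by_cases h : a = b + 1
    · rw [(natBeq_iff _ _).2 h, if_pos (by omega)]; rfl
    · rw [if_neg (by omega)]
      rw [show Nat.beq a (b + 1) = false from (natBeq_false _ _).2 h]; rfl
  have k2 : (cond (Nat.beq b (a + 1)) 1 0 : ℕ) = if ((a : ℤ) - b = -1) then 1 else 0 := by
    by_cases h : b = a + 1
    · rw [(natBeq_iff _ _).2 h, if_pos (by omega)]; rfl
    · rw [if_neg (by omega)]
      rw [show Nat.beq b (a + 1) = false from (natBeq_false _ _).2 h]; rfl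
  rw [k1] at h1 h2
  rw [k2] at h3 h4
  refine ⟨h1, h2, h3, h4, fun h => ?_, fun h => ?_⟩
  · rcases h5 with h5 | h5
    · exact absurd (by omega : a = b + 2) ((natBeq_false _ _).1 h5)
    · exact Fin.ext h5
  · exact (natBeq_false _ _).1 h6 (by omega)

theorem row_spec (f j : Fin 240) : tbN (rowP f) j = if bC (vecF f) (vecF j) = 1 then 1 else 0 := by
  have hn : ∀ x : ℤ, (-x = 1) ↔ (x = -1) := fun x => ⟨by omega, by omega⟩
  rcases root_cases f with hf | ⟨f', hf, rfl⟩ <;> rcases root_cases j with hj | ⟨j', hj, rfl⟩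
  · exact (row_pp f j hf hj).1
  · rw [(row_pp f j' hf hj).2.2.1, vecF_neg, bC_neg_right]; exact if_congr (hn _).symm rfl rfl
  · rw [(row_pp f' j hf hj).2.2.2.1, vecF_neg, bC_neg_left]; exact if_congr (hn _).symm rfl rfl
  · rw [(row_pp f' j' hf hj).2.1, vecF_neg, vecF_neg, bC_neg_left, bC_neg_right, neg_neg]

theorem bC_two (f j : Fin 240) (h : bC (vecF f) (vecF j) = 2) : f = j := by
  rcases root_cases f with hf | ⟨f', hf, rfl⟩ <;> rcases root_cases j with hj | ⟨j', hj, rfl⟩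
  · exact (row_pp f j hf hj).2.2.2.2.1 h
  · rw [vecF_neg, bC_neg_right] at h
    exact absurd (by omega) (row_pp f j' hf hj).2.2.2.2.2
  · rw [vecF_neg, bC_neg_left] at h
    exact absurd (by omega) (row_pp f' j hf hj).2.2.2.2.2
  · rw [vecF_neg, vecF_neg, bC_neg_left, bC_neg_right, neg_neg] at h
    rw [(row_pp f' j' hf hj).2.2.2.2.1 h]

theorem bC_self (j : Fin 240) : bC (vecF j) (vecF j) = 2 := by
  have h := allN_spec chkD j j.2
  rw [decide_eq_true_eq] at h
  rw [← h]
  simp only [bC, phiC_apply, Fin.sum_univ_eight, cC, vecF]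
  simp
  ring

theorem vecF_inj : Function.Injective vecF := by
  intro i j h
  apply bC_two
  rw [h, bC_self]

theorem rC_vec (i : Fin 8) (j : Fin 240) :
    ∃ j' : Fin 240, (j' : ℕ) = getB (gnP i) j ∧ vecF j' = rC i (vecF j) := by
  have h1 := allN_spec (allN_spec chkG_all j j.2) i i.2
  rw [forceN_eq, Bool.and_eq_true] at h1
  obtain ⟨h1, h2⟩ := h1
  have h3 : getB (gnP i) j < 240 := by
    have : Nat.ble (getB (gnP i) j + 1) 240 = true := h1
    exact Nat.le_of_ble_eq_true this
  refine ⟨⟨_, h3⟩, rfl, ?_⟩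
  ext k
  rw [rC_apply, Pi.sub_apply, Pi.smul_apply, eC, Pi.single_apply]
  by_cases hk : k = i
  · subst hk
    rw [if_pos rfl, smul_eq_mul, mul_one, phiC_apply]
    simp only [vecF, Fin.sum_univ_eight, cC]
    have g0 := allN_spec chkG0 j j.2
    have g1 := allN_spec chkG1 j j.2
    have g2 := allN_spec chkG2 j j.2
    have g3 := allN_spec chkG3 j j.2
    have g4 := allN_spec chkG4 j j.2
    have g5 := allN_spec chkG5 j j.2
    have g6 := allN_spec chkG6 j j.2
    have g7 := allN_spec chkG7 j j.2
    rw [decide_eq_true_eq] at g0 g1 g2 g3 g4 g5 g6 g7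
    clear h1 h2 h3
    fin_cases k <;> simp <;> linarith
  · rw [if_neg hk, smul_zero, sub_zero]
    have h4 := allN_spec h2 k k.2
    rw [(natBeq_false _ _).2 (fun h => hk (Fin.ext h))] at h4
    exact of_decide_eq_true h4

variable {n : ℕ} {M : CoxeterMatrix (Fin n)} {e : Fin n → Fin 8} (hE : SubE M e)

theorem rho_vec (g : M.Group) : ∀ j : Fin 240, ∃ j' : Fin 240, vecF j' = rhoC hE g (vecF j) := by
  refine group_ind (p := fun g => ∀ j : Fin 240, ∃ j' : Fin 240, vecF j' = rhoC hE g (vecF j)) ?_ ?_ g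
  · intro j; exact ⟨j, by simp⟩
  · intro i g ih j
    obtain ⟨j', h⟩ := ih j
    obtain ⟨j'', -, h'⟩ := rC_vec (e i) j'
    exact ⟨j'', by rw [h', h, map_mul, rhoC_simple, Module.End.mul_apply]⟩

/-- the permutation of the roots -/
noncomputable def sig (g : M.Group) (j : Fin 240) : Fin 240 := (rho_vec hE g j).choose

theorem vec_sig (g : M.Group) (j : Fin 240) : vecF (sig hE g j) = rhoC hE g (vecF j) :=
  (rho_vec hE g j).choose_spec

theorem sig_one (j : Fin 240) : sig hE 1 j = j := by
  apply vecF_inj; rw [vec_sig, map_one, Module.End.one_apply]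

theorem sig_mul (g h : M.Group) (j : Fin 240) : sig hE (g * h) j = sig hE g (sig hE h j) := by
  apply vecF_inj; rw [vec_sig, vec_sig, vec_sig, map_mul, Module.End.mul_apply]

theorem sig_inv (g : M.Group) (j : Fin 240) : sig hE g⁻¹ (sig hE g j) = j := by
  rw [← sig_mul, inv_mul_cancel, sig_one]

theorem sig_inv' (g : M.Group) (j : Fin 240) : sig hE g (sig hE g⁻¹ j) = j := by
  rw [← sig_mul, mul_inv_cancel, sig_one]

theorem sig_simple (i : Fin n) (j : Fin 240) : (sig hE (sG M i) j : ℕ) = getB (gnP (e i)) j := by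
  obtain ⟨j', h1, h2⟩ := rC_vec (e i) j
  rw [← h1]
  congr 1
  apply vecF_inj
  rw [vec_sig, rhoC_simple, h2]

theorem sig_neg (g : M.Group) (j : Fin 240) : sig hE g (j + 120) = sig hE g j + 120 := by
  apply vecF_inj
  rw [vec_sig, vecF_neg, vecF_neg, map_neg, vec_sig]

theorem row_sig (g : M.Group) (f j : Fin 240) :
    tbN (rowP (sig hE g f)) (sig hE g j) = tbN (rowP f) j := by
  rw [row_spec, row_spec, vec_sig, vec_sig, bC_rho]

theorem sig_faithful (g : M.Group) (h : ∀ (s : Fin n) (j : Fin 240), (j : ℕ) = e s → sig hE g j = j) :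
    g = 1 := by
  apply rhoC_faithful hE
  intro s
  have hlt : ((e s : Fin 8) : ℕ) < 240 := by have := (e s).2; omega
  have h1 := h s ⟨_, hlt⟩ rfl
  have h2 := vec_sig hE g ⟨_, hlt⟩
  rw [h1, vecF_simple (e s) _ rfl] at h2
  exact h2.symm

theorem sig_injective : Function.Injective (sig hE) := by
  intro g h hgh
  have : g⁻¹ * h = 1 := by
    apply sig_faithful hE
    intro s j _
    rw [sig_mul, ← hgh, sig_inv]
  exact (inv_mul_eq_one.1 this)

theorem group_finite (hE : SubE M e) : Finite M.Group := Finite.of_injective _ (sig_injective hE)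

end Roots

/-! ### Packed arithmetic -/

section Packed

theorem tbN_eq (M j : ℕ) : tbN M j = M / 2 ^ j % 2 := by
  change (M >>> j) % 2 = _
  rw [Nat.shiftRight_eq_div_pow]

theorem tbN_lt (M j : ℕ) : tbN M j < 2 := by rw [tbN_eq]; omega

theorem tbN_testBit (M j : ℕ) : tbN M j = (M.testBit j).toNat := by
  rw [tbN_eq, Nat.toNat_testBit]

theorem getB_eq (p j : ℕ) : getB p j = p / 256 ^ j % 256 := by
  change (p >>> (8 * j)) % 256 = _
  rw [Nat.shiftRight_eq_div_pow, pow_mul]; norm_num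

theorem foldG_digit (B : ℕ) (a : ℕ → ℕ) (hB : 0 < B) (ha : ∀ j < 240, a j < B) (k : ℕ) (hk : k ≤ 240) :
    ∀ j < k, (Nat.rec 0 (fun k r => Nat.add (Nat.mul B r) (a (Nat.sub 239 k))) k : ℕ) / B ^ j % B =
      a (240 - k + j) := by
  induction k with
  | zero => intro j hj; omega
  | succ k ih =>
    intro j hj
    set r : ℕ := Nat.rec 0 (fun k r => Nat.add (Nat.mul B r) (a (Nat.sub 239 k))) k with hr
    change (B * r + a (239 - k)) / B ^ j % B = _
    have hlt := ha (239 - k) (by omega)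
    cases j with
    | zero =>
      rw [pow_zero, Nat.div_one, Nat.mul_add_mod, Nat.mod_eq_of_lt hlt]
      congr 1
      omega
    | succ j =>
      rw [pow_succ', ← Nat.div_div_eq_div_mul, Nat.mul_add_div hB, Nat.div_eq_of_lt hlt, add_zero,
        ih (by omega) j (by omega)]
      congr 1
      omega

theorem foldD_digit (B : ℕ) (a : ℕ → ℕ) (hB : 0 < B) (ha : ∀ j < 240, a j < B) (j : ℕ) (hj : j < 240) :
    foldD B a / B ^ j % B = a j := by
  have := foldG_digit B a hB ha 240 le_rfl j hj
  rw [Nat.sub_self, zero_add] at this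
  exact this

theorem getB_comp (p q j : ℕ) (hj : j < 240) : getB (compP p q) j = getB p (getB q j) := by
  rw [getB_eq]
  exact foldD_digit 256 (fun j => getB p (getB q j)) (by norm_num)
    (fun j _ => by simp only [getB_eq]; omega) j hj

/-- mask with prescribed bits -/
def mkM (a : ℕ → ℕ) : ℕ := foldD 2 a

theorem tbN_mkM (a : ℕ → ℕ) (ha : ∀ j < 240, a j < 2) (j : ℕ) (hj : j < 240) : tbN (mkM a) j = a j := by
  rw [tbN_eq]
  exact foldD_digit 2 a (by norm_num) ha j hj

/-- finite sums -/
def sumN (n : ℕ) (f : ℕ → ℕ) : ℕ := Nat.rec 0 (fun k r => Nat.add r (f k)) n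

theorem sumN_eq (n : ℕ) (f : ℕ → ℕ) : sumN n f = ∑ k ∈ Finset.range n, f k := by
  induction n with
  | zero => rfl
  | succ n ih =>
    rw [Finset.sum_range_succ, ← ih]; rfl

/-- all 240 bits -/
def fullM : ℕ := 0xffffffffffffffffffffffffffffffffffffffffffffffffffffffffffff

theorem tbN_full (j : ℕ) (hj : j < 240) : tbN fullM j = 1 := by
  rw [tbN_testBit, show fullM = 2 ^ 240 - 1 by norm_num [fullM], Nat.testBit_two_pow_sub_one]
  simp [hj]

/-- the part of the bits agreeing with bit `b` -/
def selP (M b : ℕ) : ℕ := Nat.rec (Nat.xor fullM M) (fun _ _ => M) (tbN M b)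

theorem tbN_sel (M b x : ℕ) (hx : x < 240) (h : tbN M x = tbN M b) : tbN (selP M b) x = 1 := by
  have h2 := tbN_lt M b
  have h3 : tbN M b = 0 ∨ tbN M b = 1 := by omega
  rcases h3 with h3 | h3
  · have : selP M b = fullM ^^^ M := by rw [selP, h3]; rfl
    have hf := tbN_full x hx
    rw [h3] at h
    rw [tbN_testBit] at h hf
    rw [this, tbN_testBit, Nat.testBit_xor]
    cases hh : M.testBit x <;> cases hg : fullM.testBit x <;> simp_all
  · have : selP M b = M := by rw [selP, h3]; rfl
    rw [this, h, h3]

/-- candidates for the image of `b` -/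
def candP (Ms : List ℕ) (b : ℕ) : ℕ := List.foldr (fun M r => Nat.land (selP M b) r) fullM Ms

theorem tbN_cand (Ms : List ℕ) (b x : ℕ) (hx : x < 240) (h : ∀ M ∈ Ms, tbN M x = tbN M b) :
    tbN (candP Ms b) x = 1 := by
  induction Ms with
  | nil => exact tbN_full x hx
  | cons M Ms ih =>
    have h1 := ih fun M' hM' => h M' (List.mem_cons_of_mem _ hM')
    have h2 := tbN_sel M b x hx (h M List.mem_cons_self)
    have : candP (M :: Ms) b = selP M b &&& candP Ms b := rfl
    rw [this, tbN_testBit, Nat.testBit_and]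
    rw [tbN_testBit] at h1 h2
    cases hh : (selP M b).testBit x <;> cases hg : (candP Ms b).testBit x <;> simp_all

theorem card_mask (M : ℕ) : (Finset.univ.filter fun j : Fin 240 => tbN M j = 1).card ≤ sumN 240 (tbN M) := by
  rw [sumN_eq, Finset.card_filter, ← Fin.sum_univ_eq_sum_range]
  refine Finset.sum_le_sum fun j _ => ?_
  split_ifs with h
  · rw [h]
  · exact Nat.zero_le _

/-- upper bound for a stabiliser, by a chain of orbits -/
def bndP (p : ℕ) : List ℕ → List ℕ → ℕ
  | [], _ => 1
  | b :: bs, Ms => Nat.mul (forceN (candP Ms b) fun m => sumN 240 (tbN m))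
      (forceN (getB p b) fun f1 => forceN (getB p f1) fun f2 => forceN (getB p f2) fun f3 =>
       forceN (rowP b) fun r0 => forceN (rowP f1) fun r1 =>
       forceN (rowP f2) fun r2 => forceN (rowP f3) fun r3 =>
       forceN (rowP (Nat.mod (Nat.add b 120) 240)) fun s0 =>
       forceN (rowP (Nat.mod (Nat.add f1 120) 240)) fun s1 =>
       forceN (rowP (Nat.mod (Nat.add f2 120) 240)) fun s2 =>
       forceN (rowP (Nat.mod (Nat.add f3 120) 240)) fun s3 =>
        bndP p bs (r0 :: r1 :: r2 :: r3 :: s0 :: s1 :: s2 :: s3 :: Ms))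

/-- neighbours of their image -/
def mskA (p : ℕ) : ℕ := mkM fun j => tbN (rowP j) (getB p j)
/-- fixed points -/
def mskZ (p : ℕ) : ℕ := mkM fun j => cond (Nat.beq (getB p j) j) 1 0
/-- neighbours of minus their image -/
def mskM (p : ℕ) : ℕ := mkM fun j => tbN (rowP (Nat.mod (Nat.add j 120) 240)) (getB p j)

end Packed

section Bound

variable {n : ℕ} {M : CoxeterMatrix (Fin n)} {e : Fin n → Fin 8} (hE : SubE M e)

/-- `p` encodes the permutation induced by `g` -/
def RepP (g : M.Group) (p : ℕ) : Prop := ∀ j : Fin 240, getB p j = sig hE g j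

theorem RepP.one : RepP hE 1 idP := by
  intro j
  rw [sig_one]
  exact (natBeq_iff _ _).1 (allN_spec chkId j j.2)

theorem RepP.mul {g h : M.Group} {p q : ℕ} (hg : RepP hE g p) (hh : RepP hE h q) :
    RepP hE (g * h) (compP p q) := by
  intro j
  rw [getB_comp _ _ _ j.2, hh j, hg, sig_mul]

theorem RepP.simple (i : Fin n) : RepP hE (sG M i) (gnP (e i)) := fun j => (sig_simple hE i j).symm

/-- elements of the centraliser fixing the listed roots -/
def PS (g : M.Group) (L : List (Fin 240)) (h : M.Group) : Prop := g * h = h * g ∧ ∀ b ∈ L, sig hE h b = b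

theorem PS_sig {g h : M.Group} {L : List (Fin 240)} (H : PS hE g L h) (j : Fin 240) :
    sig hE h (sig hE g j) = sig hE g (sig hE h j) := by
  rw [← sig_mul, ← sig_mul, H.1]

open Classical in
theorem fiber_bound [Fintype M.Group] (g : M.Group) (L : List (Fin 240)) (b : Fin 240) (C : Finset (Fin 240))
    (hC : ∀ h, PS hE g L h → sig hE h b ∈ C) :
    (Finset.univ.filter (PS hE g L)).card ≤ C.card * (Finset.univ.filter (PS hE g (b :: L))).card := by
  rw [mul_comm]
  refine Finset.card_le_mul_card_image_of_maps_to (f := fun h => sig hE h b) ?_ _ ?_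
  · intro h hh
    exact hC h (Finset.mem_filter.1 hh).2
  · intro y hy
    rcases Finset.eq_empty_or_nonempty
      (Finset.filter (fun a => sig hE a b = y) (Finset.univ.filter (PS hE g L))) with h0 | ⟨h0, hh0⟩
    · rw [h0]; simp
    · simp only [Finset.mem_filter, Finset.mem_univ, true_and] at hh0
      obtain ⟨⟨hc, hL⟩, hb⟩ := hh0
      refine Finset.card_le_card_of_injOn (fun a => h0⁻¹ * a) ?_ (fun a _ a' _ h => mul_left_cancel h)
      intro a ha
      simp only [Finset.coe_filter, Finset.mem_filter, Finset.mem_univ, true_and, Set.mem_setOf_eq] at ha ⊢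
      obtain ⟨⟨hc', hL'⟩, hb'⟩ := ha
      refine ⟨?_, ?_⟩
      · have h1 : g * h0⁻¹ = h0⁻¹ * g := by
          rw [eq_inv_mul_iff_mul_eq, ← mul_assoc, ← hc, mul_assoc, mul_inv_cancel, mul_one]
        rw [← mul_assoc, h1, mul_assoc, hc', mul_assoc]
      · intro x hx
        rw [sig_mul]
        rcases List.mem_cons.1 hx with rfl | hx
        · rw [hb', ← hb, sig_inv]
        · rw [hL' x hx]
          conv_lhs => rw [← hL x hx, sig_inv]

open Classical in
theorem bndP_spec [Fintype M.Group] {g : M.Group} {p : ℕ} (hp : RepP hE g p) (bs : List (Fin 240)) :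
    ∀ (L : List (Fin 240)) (Ms : List ℕ),
    (∀ M' ∈ Ms, ∀ h, PS hE g L h → ∀ j : Fin 240, tbN M' (sig hE h j) = tbN M' j) →
    (∀ (s : Fin n) (j : Fin 240), (j : ℕ) = e s → j ∈ L ∨ j ∈ bs) →
    (Finset.univ.filter (PS hE g L)).card ≤ bndP p (bs.map (Fin.val : Fin 240 → ℕ)) Ms := by
  induction bs with
  | nil =>
    intro L Ms _ hs
    change _ ≤ 1
    rw [Finset.card_le_one]
    have key : ∀ a, PS hE g L a → a = 1 := by
      intro a ha
      apply sig_faithful hE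
      intro s j hj
      rcases hs s j hj with h | h
      · exact ha.2 j h
      · simp at h
    intro a ha b hb
    rw [key a (Finset.mem_filter.1 ha).2, key b (Finset.mem_filter.1 hb).2]
  | cons b bs ih =>
    intro L Ms hM hs
    rw [List.map_cons, bndP]
    simp only [forceN_eq]
    refine le_trans (fiber_bound hE g L b
      (Finset.univ.filter fun j : Fin 240 => tbN (candP Ms b) j = 1) ?_) ?_
    · intro h hh
      rw [Finset.mem_filter]
      exact ⟨Finset.mem_univ _, tbN_cand Ms b _ (sig hE h b).2 fun M' hM' => hM M' hM' h hh b⟩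
    · refine Nat.mul_le_mul (card_mask _) ?_
      refine ih (b :: L) _ ?_ ?_
      · have hrow : ∀ (f : Fin 240), (∀ h, PS hE g (b :: L) h → sig hE h f = f) →
            ∀ h, PS hE g (b :: L) h → ∀ j : Fin 240, tbN (rowP f) (sig hE h j) = tbN (rowP f) j := by
          intro f hf h hh j
          conv_lhs => rw [← hf h hh]
          rw [row_sig]
        have hneg : ∀ f : Fin 240, ((f : ℕ).add 120).mod 240 = ((f + 120 : Fin 240) : ℕ) :=
          fun f => (fin120 f).symm
        have f0 : ∀ h, PS hE g (b :: L) h → sig hE h b = b := fun h hh => hh.2 b List.mem_cons_self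
        have f1 : ∀ h, PS hE g (b :: L) h → sig hE h (sig hE g b) = sig hE g b := fun h hh => by
          rw [PS_sig hE hh, f0 h hh]
        have f2 : ∀ h, PS hE g (b :: L) h → sig hE h (sig hE g (sig hE g b)) = sig hE g (sig hE g b) :=
          fun h hh => by rw [PS_sig hE hh, f1 h hh]
        have f3 : ∀ h, PS hE g (b :: L) h → sig hE h (sig hE g (sig hE g (sig hE g b))) =
            sig hE g (sig hE g (sig hE g b)) :=
          fun h hh => by rw [PS_sig hE hh, f2 h hh]
        have fn : ∀ f : Fin 240, (∀ h, PS hE g (b :: L) h → sig hE h f = f) →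
            (∀ h, PS hE g (b :: L) h → sig hE h (f + 120) = f + 120) := fun f hf h hh => by
          rw [sig_neg, hf h hh]
        intro M' hM'
        rw [hp b, hp, hp, hneg, hneg, hneg, hneg] at hM'
        simp only [List.mem_cons] at hM'
        rcases hM' with rfl | rfl | rfl | rfl | rfl | rfl | rfl | rfl | hM'
        · exact hrow _ f0
        · exact hrow _ f1
        · exact hrow _ f2
        · exact hrow _ f3
        · exact hrow _ (fn _ f0)
        · exact hrow _ (fn _ f1)
        · exact hrow _ (fn _ f2)
        · exact hrow _ (fn _ f3)
        · intro h hh j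
          exact hM M' hM' h ⟨hh.1, fun x hx => hh.2 x (List.mem_cons_of_mem _ hx)⟩ j
      · intro s j hj
        rcases hs s j hj with h | h
        · exact Or.inl (List.mem_cons_of_mem _ h)
        · rcases List.mem_cons.1 h with rfl | h
          · exact Or.inl List.mem_cons_self
          · exact Or.inr h

theorem mskA_inv {g h : M.Group} {p : ℕ} (hp : RepP hE g p) (hc : g * h = h * g) (j : Fin 240) :
    tbN (mskA p) (sig hE h j) = tbN (mskA p) j := by
  have hs : ∀ j : Fin 240, tbN (mskA p) j = tbN (rowP j) (sig hE g j) := fun j => by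
    rw [mskA, tbN_mkM _ (fun j _ => tbN_lt _ _) j j.2, hp j]
  rw [hs, hs, ← PS_sig hE (L := []) ⟨hc, by simp⟩, row_sig]

theorem mskM_inv {g h : M.Group} {p : ℕ} (hp : RepP hE g p) (hc : g * h = h * g) (j : Fin 240) :
    tbN (mskM p) (sig hE h j) = tbN (mskM p) j := by
  have hs : ∀ j : Fin 240, tbN (mskM p) j = tbN (rowP (j + 120 : Fin 240)) (sig hE g j) := fun j => by
    rw [mskM, tbN_mkM _ (fun j _ => tbN_lt _ _) j j.2, hp j, fin120]; rfl
  rw [hs, hs, ← PS_sig hE (L := []) ⟨hc, by simp⟩, ← sig_neg, row_sig]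

theorem mskZ_inv {g h : M.Group} {p : ℕ} (hp : RepP hE g p) (hc : g * h = h * g) (j : Fin 240) :
    tbN (mskZ p) (sig hE h j) = tbN (mskZ p) j := by
  have hs : ∀ j : Fin 240, tbN (mskZ p) j = if sig hE g j = j then 1 else 0 := fun j => by
    rw [mskZ, tbN_mkM _ (fun j _ => by cases Nat.beq (getB p j) j <;> simp) j j.2, hp j]
    by_cases hj : sig hE g j = j
    · rw [hj, (natBeq_iff _ _).2 rfl, if_pos rfl]; rfl
    · rw [(natBeq_false _ _).2 (fun h' => hj (Fin.ext h')), if_neg hj]; rfl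
  rw [hs, hs, ← PS_sig hE (L := []) ⟨hc, by simp⟩]
  refine if_congr ⟨fun h' => ?_, fun h' => by rw [h']⟩ rfl rfl
  rw [← sig_inv hE h (sig hE g j), h', sig_inv]

/-- masks checked to be invariant under the generators are invariant -/
theorem mask_inv (Mk : ℕ)
    (hm : ∀ i : Fin n, ∀ j < 240, tbN Mk (getB (gnP (e i)) j) = tbN Mk j) (g : M.Group) :
    ∀ j : Fin 240, tbN Mk (sig hE g j) = tbN Mk j := by
  refine group_ind (p := fun g => ∀ j : Fin 240, tbN Mk (sig hE g j) = tbN Mk j) ?_ ?_ g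
  · intro j; rw [sig_one]
  · intro i g ih j
    rw [sig_mul, sig_simple, hm i _ (sig hE g j).2, ih]

/-- all the masks used -/
def masks (cols : List ℕ) (a1 z1 m1 a2 z2 m2 : ℕ) : List ℕ := a1 :: z1 :: m1 :: a2 :: z2 :: m2 :: cols

open Classical in
theorem cent_bound [Fintype M.Group] {g : M.Group} {p p2 : ℕ} (hp : RepP hE g p) (hp2 : RepP hE (g * g) p2)
    (cols : List ℕ) (hcols : ∀ M' ∈ cols, ∀ (h : M.Group) (j : Fin 240), tbN M' (sig hE h j) = tbN M' j)
    (bs : List (Fin 240)) (hs : ∀ (s : Fin n) (j : Fin 240), (j : ℕ) = e s → j ∈ bs) :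
    (Finset.univ.filter fun h : M.Group => g * h = h * g).card ≤ bndP p (bs.map (Fin.val : Fin 240 → ℕ))
      (masks cols (mskA p) (mskZ p) (mskM p) (mskA p2) (mskZ p2) (mskM p2)) := by
  have h0 : (Finset.univ.filter fun h : M.Group => g * h = h * g) = Finset.univ.filter (PS hE g []) := by
    ext h; simp [PS]
  rw [h0]
  refine bndP_spec hE hp bs [] _ ?_ (fun s j hj => Or.inr (hs s j hj))
  intro M' hM' h hh j
  have h2 : g * g * h = h * (g * g) := by rw [mul_assoc, hh.1, ← mul_assoc, hh.1, mul_assoc]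
  simp only [masks, List.mem_cons] at hM'
  rcases hM' with rfl | rfl | rfl | rfl | rfl | rfl | hM'
  · exact mskA_inv hE hp hh.1 j
  · exact mskZ_inv hE hp hh.1 j
  · exact mskM_inv hE hp hh.1 j
  · exact mskA_inv hE hp2 h2 j
  · exact mskZ_inv hE hp2 h2 j
  · exact mskM_inv hE hp2 h2 j
  · exact hcols M' hM' h j

end Bound

/-! ### From class representatives and rows to the character table -/

section Counting

variable {G : Type} [Group G] [Fintype G]

open Classical in
theorem class_lower (g : G) (N : ℕ) (h : (Finset.univ.filter fun x : G => g * x = x * g).card ≤ N) :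
    Fintype.card G ≤ N * (Finset.univ.filter fun x : G => ∃ y, y * g * y⁻¹ = x).card := by
  refine Finset.card_le_mul_card_image_of_maps_to (f := fun y => y * g * y⁻¹) ?_ _ ?_
  · intro y _
    rw [Finset.mem_filter]
    exact ⟨Finset.mem_univ _, y, rfl⟩
  · intro x hx
    refine le_trans ?_ h
    obtain ⟨y0, hy0⟩ := (Finset.mem_filter.1 hx).2
    refine Finset.card_le_card_of_injOn (fun a => y0⁻¹ * a) ?_ (fun a _ a' _ h => mul_left_cancel h)
    intro a ha
    simp only [Finset.coe_filter, Finset.mem_univ, true_and, Set.mem_setOf_eq] at ha ⊢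
    have h1 : y0 * g = a * g * a⁻¹ * y0 := by rw [ha, ← hy0]; group
    have h2 : g = y0⁻¹ * a * g * a⁻¹ * y0 := by
      calc g = y0⁻¹ * (y0 * g) := by group
        _ = _ := by rw [h1]; group
    calc g * (y0⁻¹ * a) = (y0⁻¹ * a * g * a⁻¹ * y0) * (y0⁻¹ * a) := by rw [← h2]
      _ = y0⁻¹ * a * g := by group

open Classical in
theorem counting {m : ℕ} (N : ℕ) (hN : 0 < N) (g : Fin m → G) (cent z : Fin m → ℕ) (c0 : Fin m) (hg0 : g c0 = 1)
    (hc0 : cent c0 = N)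
    (hcent : ∀ c, (Finset.univ.filter fun x : G => g c * x = x * g c).card ≤ cent c)
    (hz : ∀ c, z c * cent c = N) (hsum : ∑ c, z c = N)
    (hsep : ∀ c c' y, y * g c * y⁻¹ = g c' → c = c') :
    Nat.card G = N ∧ (∀ x, ∃ c y, y * g c * y⁻¹ = x) ∧
      ∀ f : G → ℂ, (∀ x y, f (y * x * y⁻¹) = f x) → ∑ x, f x = ∑ c, (z c : ℂ) * f (g c) := by
  set K : Fin m → Finset G := fun c => Finset.univ.filter fun x : G => ∃ y, y * g c * y⁻¹ = x with hK
  have hdis : ∀ c c', c ≠ c' → Disjoint (K c) (K c') := by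
    intro c c' hne
    rw [Finset.disjoint_left]
    intro x hx hx'
    obtain ⟨y, hy⟩ := (Finset.mem_filter.1 hx).2
    obtain ⟨y', hy'⟩ := (Finset.mem_filter.1 hx').2
    apply hne
    refine hsep c c' (y'⁻¹ * y) ?_
    calc y'⁻¹ * y * g c * (y'⁻¹ * y)⁻¹ = y'⁻¹ * (y * g c * y⁻¹) * y' := by group
      _ = g c' := by rw [hy, ← hy']; group
  have hlow : ∀ c, Fintype.card G * z c ≤ (K c).card * N := by
    intro c
    have := class_lower (g c) (cent c) (hcent c)
    calc Fintype.card G * z c ≤ cent c * (K c).card * z c := Nat.mul_le_mul_right _ this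
      _ = (K c).card * (z c * cent c) := by ring
      _ = _ := by rw [hz]
  have hU : (Finset.univ.biUnion K).card = ∑ c, (K c).card :=
    Finset.card_biUnion fun c _ c' _ h => hdis c c' h
  have hup : ∑ c, (K c).card ≤ Fintype.card G := by rw [← hU]; exact Finset.card_le_univ _
  have hs1 : ∑ c, Fintype.card G * z c = Fintype.card G * N := by rw [← Finset.mul_sum, hsum]
  have hs2 : ∑ c, (K c).card * N ≤ Fintype.card G * N := by
    rw [← Finset.sum_mul]; exact Nat.mul_le_mul_right _ hup
  have hs3 : ∑ c, Fintype.card G * z c ≤ ∑ c, (K c).card * N := Finset.sum_le_sum fun c _ => hlow c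
  have heq : ∀ c, Fintype.card G * z c = (K c).card * N := by
    intro c
    exact (Finset.sum_eq_sum_iff_of_le (fun c _ => hlow c)).1 (le_antisymm hs3 (hs1 ▸ hs2)) c (Finset.mem_univ c)
  have hK0 : (K c0).card = 1 := by
    rw [Finset.card_eq_one]
    refine ⟨1, ?_⟩
    ext x
    simp [hK, hg0, eq_comm]
  have hz0 : z c0 = 1 := by
    have := hz c0
    rw [hc0] at this
    exact Nat.eq_of_mul_eq_mul_right hN (by rw [this, one_mul])
  have hcard : Fintype.card G = N := by
    have := heq c0
    rwa [hz0, hK0, mul_one, one_mul] at this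
  have hKz : ∀ c, (K c).card = z c := by
    intro c
    have := heq c
    rw [hcard, mul_comm] at this
    exact (Nat.eq_of_mul_eq_mul_right hN this).symm
  have huniv : Finset.univ.biUnion K = Finset.univ := by
    rw [← Finset.card_eq_iff_eq_univ, hU, hcard, ← hsum]
    exact Finset.sum_congr rfl fun c _ => hKz c
  refine ⟨by rw [Nat.card_eq_fintype_card, hcard], ?_, ?_⟩
  · intro x
    have hx : x ∈ Finset.univ.biUnion K := by rw [huniv]; exact Finset.mem_univ x
    obtain ⟨c, -, hc⟩ := Finset.mem_biUnion.1 hx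
    exact ⟨c, (Finset.mem_filter.1 hc).2⟩
  · intro f hf
    rw [← huniv, Finset.sum_biUnion fun c _ c' _ h => hdis c c' h]
    refine Finset.sum_congr rfl fun c _ => ?_
    rw [Finset.sum_congr rfl (g := fun _ => f (g c)), Finset.sum_const, hKz, nsmul_eq_mul]
    intro x hx
    obtain ⟨y, hy⟩ := (Finset.mem_filter.1 hx).2
    rw [← hy, hf]

open Classical in
theorem table_of {m : ℕ} (N : ℕ) (hN : 0 < N) (g : Fin m → G) (cent z : Fin m → ℕ) (c0 : Fin m) (hg0 : g c0 = 1)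
    (hc0 : cent c0 = N)
    (hcent : ∀ c, (Finset.univ.filter fun x : G => g c * x = x * g c).card ≤ cent c)
    (hz : ∀ c, z c * cent c = N) (hsum : ∑ c, z c = N)
    {K : Type} (V : K → Fin m → ℤ)
    (hV : ∀ k, ∃ f ∈ vchars G, (∀ x, f x⁻¹ = f x) ∧ ∀ c, f (g c) = (V k c : ℂ))
    (hsep : ∀ c c', (∀ k, V k c = V k c') → c = c')
    (r : Fin m → K)
    (hnorm : ∀ i, ∑ c, (z c : ℤ) * (V (r i) c * V (r i) c) = N)
    (hreg : ∀ c, ∑ i, V (r i) c0 * V (r i) c = if c = c0 then (N : ℤ) else 0)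
    (d : Fin m → ℕ) (hd : ∀ i, V (r i) c0 = d i) (hd0 : ∀ i, 0 < d i) :
    Nat.card G = N ∧ ∃ T : CTable G (Fin m), ∀ i, T.deg i = d i := by
  choose f hf hsym hval using hV
  obtain ⟨hcard, hcov, hInt⟩ := counting N hN g cent z c0 hg0 hc0 hcent hz hsum (by
    intro c c' y h
    apply hsep
    intro k
    have := vchars_conj (hf k) (g c) y
    rw [h, hval, hval] at this
    exact_mod_cast this.symm)
  refine ⟨hcard, ?_⟩
  have hNC : (N : ℂ) ≠ 0 := by exact_mod_cast hN.ne'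
  have h1 : ∀ i, f (r i) 1 = (d i : ℂ) := by
    intro i
    have := hval (r i) c0
    rw [hg0, hd] at this
    exact_mod_cast this
  have hirr : ∀ i, IsIrrChar G (f (r i)) := by
    intro i
    refine irr_of_norm_one (hf _) ?_ (d i) (h1 i)
    have h2 := hInt (fun x => f (r i) x * f (r i) x⁻¹) (by
      intro x y
      have e1 := vchars_conj (hf (r i)) x y
      rw [hsym, hsym, e1])
    rw [ip, h2, hcard]
    have h3 : ∑ c, (z c : ℂ) * (f (r i) (g c) * f (r i) (g c)⁻¹) = (N : ℂ) := by
      have := hnorm i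
      have h4 : ((∑ c, (z c : ℤ) * (V (r i) c * V (r i) c) : ℤ) : ℂ) = ((N : ℤ) : ℂ) := by rw [this]
      push_cast at h4
      rw [← h4]
      refine Finset.sum_congr rfl fun c _ => ?_
      rw [hsym, hval]
    rw [h3, inv_mul_cancel₀ hNC]
  have hregc : ∑ i, (d i : ℂ) • f (r i) = regc := by
    ext x
    obtain ⟨c, y, hx⟩ := hcov x
    simp only [Finset.sum_apply, Pi.smul_apply, smul_eq_mul]
    have h2 : ∑ i, (d i : ℂ) * f (r i) x = if c = c0 then (N : ℂ) else 0 := by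
      have h4 : ((∑ i, V (r i) c0 * V (r i) c : ℤ) : ℂ) = ((if c = c0 then (N : ℤ) else 0 : ℤ) : ℂ) := by
        rw [hreg]
      push_cast at h4
      rw [← h4]
      refine Finset.sum_congr rfl fun i _ => ?_
      rw [← hx, vchars_conj (hf _), hval, hd]
      push_cast
      rfl
    rw [h2, regc, hcard]
    have h5 : x = 1 ↔ c = c0 := by
      constructor
      · intro hx1
        apply hsep
        intro k
        have e1 := vchars_conj (hf k) (g c) y
        rw [hx, hx1, ← hg0, hval, hval] at e1
        exact_mod_cast e1.symm
      · rintro rfl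
        rw [← hx, hg0]; simp
    exact if_congr h5.symm rfl rfl
  have hinj : Function.Injective (fun i => f (r i)) := by
    intro i j hij
    by_contra hne
    have h2 := ip_regc (f (r i))
    rw [← hregc, ip_sum_right, h1] at h2
    have h3 : ∀ k, ip (f (r i)) ((d k : ℂ) • f (r k)) = ((if f (r i) = f (r k) then d k else 0 : ℕ) : ℂ) := by
      intro k
      rw [ip_smul_right, ip_irr (hirr i) (hirr k)]
      split_ifs <;> simp
    rw [Finset.sum_congr rfl fun k _ => h3 k] at h2
    have h4 : ∑ k, (if f (r i) = f (r k) then d k else 0) = d i := by exact_mod_cast h2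
    have h5 : ∑ k ∈ ({i, j} : Finset (Fin m)), (if f (r i) = f (r k) then d k else 0) ≤
        ∑ k, (if f (r i) = f (r k) then d k else 0) :=
      Finset.sum_le_sum_of_subset (Finset.subset_univ _)
    rw [h4, Finset.sum_pair hne, if_pos rfl, if_pos hij] at h5
    have := hd0 j
    omega
  exact ⟨{ X := fun i => f (r i), irr := hirr, inj := hinj, deg := d, deg_eq := h1, reg := hregc }, fun _ => rfl⟩

end Counting

/-! ### Class functions read off from packed permutations -/

section Stats

/-- inverse of the Cartan matrix -/
def dC : Matrix (Fin 8) (Fin 8) ℤ :=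
  !![4, 5, 7, 10, 8, 6, 4, 2;
     5, 8, 10, 15, 12, 9, 6, 3;
     7, 10, 14, 20, 16, 12, 8, 4;
     10, 15, 20, 30, 24, 18, 12, 6;
     8, 12, 16, 24, 20, 15, 10, 5;
     6, 9, 12, 18, 15, 12, 8, 4;
     4, 6, 8, 12, 10, 8, 6, 3;
     2, 3, 4, 6, 5, 4, 3, 2]

theorem dC_symm : ∀ i j, dC i j = dC j i := by
  intro i j; fin_cases i <;> fin_cases j <;> rfl

theorem dC_mul : ∀ i j, ∑ k, dC i k * cC k j = if i = j then 1 else 0 := by decide +kernel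

variable {n : ℕ} {M : CoxeterMatrix (Fin n)} {e : Fin n → Fin 8} (hE : SubE M e)

theorem coord_eq (v : Fin 8 → ℤ) (i : Fin 8) : v i = ∑ k, dC i k * bC v (eC k) := by
  have : ∀ k, bC v (eC k) = ∑ j, cC k j * v j := by
    intro k; rw [bC_symm, bC_e, phiC_apply]
  simp only [this, Finset.mul_sum]
  rw [Finset.sum_comm]
  have h2 : ∀ j, ∑ k, dC i k * (cC k j * v j) = (if i = j then 1 else 0) * v j := by
    intro j
    rw [← dC_mul, Finset.sum_mul]
    exact Finset.sum_congr rfl fun k _ => by ring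
  simp only [h2]
  simp

theorem trC_inv (g : M.Group) : trC hE g⁻¹ = trC hE g := by
  have h : ∀ (v w : Fin 8 → ℤ), bC (rhoC hE g⁻¹ v) w = bC v (rhoC hE g w) := by
    intro v w
    have := bC_rho hE g (rhoC hE g⁻¹ v) w
    rw [← Module.End.mul_apply, ← map_mul, mul_inv_cancel, map_one, Module.End.one_apply] at this
    exact this.symm
  simp only [trC]
  rw [Finset.sum_congr rfl fun i _ => coord_eq (rhoC hE g⁻¹ (eC i)) i,
    Finset.sum_congr rfl fun i _ => coord_eq (rhoC hE g (eC i)) i, Finset.sum_comm]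
  refine Finset.sum_congr rfl fun i _ => Finset.sum_congr rfl fun j _ => ?_
  rw [h, bC_symm, dC_symm]

theorem isChar_trC : IsChar (fun g : M.Group => ((trC hE g : ℤ) : ℂ)) := by
  have h := isChar_of_matrix
    (((Int.castRingHom ℂ).mapMatrix : Matrix (Fin 8) (Fin 8) ℤ →+* Matrix (Fin 8) (Fin 8) ℂ).toMonoidHom.comp
      (((LinearMap.toMatrixAlgEquiv' : ((Fin 8 → ℤ) →ₗ[ℤ] (Fin 8 → ℤ)) ≃ₐ[ℤ] Matrix (Fin 8) (Fin 8) ℤ) :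
        _ →* Matrix (Fin 8) (Fin 8) ℤ).comp (rhoC hE)))
  convert h using 2 with g
  simp [trC, Matrix.trace, eC, LinearMap.toMatrixAlgEquiv'_apply, LinearMap.toMatrix'_apply]

/-- evaluate an integer first -/
def forceZ {α : Type} (z : ℤ) (f : ℤ → α) : α :=
  match z with
  | Int.ofNat k => forceN k fun k => f (Int.ofNat k)
  | Int.negSucc k => forceN k fun k => f (Int.negSucc k)

theorem forceZ_eq {α : Type} (z : ℤ) (f : ℤ → α) : forceZ z f = f z := by
  cases z with
  | ofNat k => exact forceN_eq k fun k => f (Int.ofNat k)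
  | negSucc k => exact forceN_eq k fun k => f (Int.negSucc k)

/-- forced sum -/
def addZ (x y : ℤ) : ℤ := forceZ x fun x => forceZ y fun y => forceZ (Int.add x y) fun z => z
/-- forced product -/
def mulZ (x y : ℤ) : ℤ := forceZ x fun x => forceZ y fun y => forceZ (Int.mul x y) fun z => z

theorem addZ_eq (x y : ℤ) : addZ x y = x + y := by simp only [addZ, forceZ_eq]; rfl
theorem mulZ_eq (x y : ℤ) : mulZ x y = x * y := by simp only [mulZ, forceZ_eq]; rfl

/-- forced finite sums -/
def sumZ (n : ℕ) (f : ℕ → ℤ) : ℤ := Nat.rec 0 (fun k r => addZ r (f k)) n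

theorem sumZ_eq (n : ℕ) (f : ℕ → ℤ) : sumZ n f = ∑ k ∈ Finset.range n, f k := by
  induction n with
  | zero => rfl
  | succ n ih =>
    rw [Finset.sum_range_succ, ← ih]
    exact addZ_eq _ _

/-- a real valued virtual character computed from packed permutations -/
def Stat [Fintype M.Group] (st : ℕ → ℤ) : Prop :=
  ∃ f ∈ vchars M.Group, (∀ x, f x⁻¹ = f x) ∧ ∀ g p, RepP hE g p → f g = ((st p : ℤ) : ℂ)

/-- trace -/
def trS (p : ℕ) : ℤ := sumZ 8 fun i => vecN (getB p i) i

theorem trS_spec {g : M.Group} {p : ℕ} (hp : RepP hE g p) : trS p = trC hE g := by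
  rw [trS, sumZ_eq, ← Fin.sum_univ_eq_sum_range (fun i => vecN (getB p i) i), trC]
  refine Finset.sum_congr rfl fun i _ => ?_
  have hi : (i : ℕ) < 240 := by omega
  have h := hp ⟨i, hi⟩
  rw [← vecF_simple i ⟨i, hi⟩ rfl, ← vec_sig]
  change vecN (getB p i) i = vecN (sig hE g ⟨i, hi⟩) i
  rw [← h]

theorem stat_tr [Fintype M.Group] : Stat hE trS :=
  ⟨_, (isChar_trC hE).mem_vchars, fun x => by simp only [trC_inv], fun g p hp => by rw [trS_spec hE hp]⟩

/-- fixed points in a mask -/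
def fixS (Mk p : ℕ) : ℕ := sumN 240 fun j => Nat.mul (tbN Mk j) (cond (Nat.beq (getB p j) j) 1 0)

/-- fixed pairs in a mask -/
def fixN (Mk p : ℕ) : ℕ := sumN 120 fun j => Nat.mul (tbN Mk j) (cond (Nat.beq (Nat.mod (getB p j) 120) j) 1 0)

theorem card_sub {N : ℕ} (P : Fin N → Prop) [DecidablePred P] (Q : {j : Fin N // P j} → Prop) [DecidablePred Q]
    (a : ℕ → ℕ) (h : ∀ j : Fin N, a j = if h : P j then (if Q ⟨j, h⟩ then 1 else 0) else 0) :
    (Finset.univ.filter Q).card = sumN N a := by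
  rw [sumN_eq, ← Fin.sum_univ_eq_sum_range, Finset.card_filter]
  rw [Finset.sum_congr rfl fun j _ => h j]
  have h1 : (∑ j : Fin N, if h : P j then (if Q ⟨j, h⟩ then 1 else 0) else 0) =
      ∑ j ∈ Finset.univ.filter P, if h : P j then (if Q ⟨j, h⟩ then 1 else 0) else 0 := by
    rw [Finset.sum_filter]
    refine Finset.sum_congr rfl fun j _ => ?_
    by_cases hj : P j <;> simp [hj]
  rw [h1]
  refine Eq.trans ?_ (Finset.sum_subtype (p := P) (F := inferInstance) (Finset.univ.filter P) (fun x => by simp) _).symm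
  refine Finset.sum_congr rfl fun j _ => ?_
  rw [dif_pos j.2]

theorem stat_fix [Fintype M.Group] (Mk : ℕ) (hm : ∀ (g : M.Group) (j : Fin 240), tbN Mk (sig hE g j) = tbN Mk j) :
    Stat hE (fun p => (fixS Mk p : ℤ)) := by
  let act : M.Group → {j : Fin 240 // tbN Mk j = 1} → {j : Fin 240 // tbN Mk j = 1} :=
    fun g j => ⟨sig hE g j.1, by rw [hm]; exact j.2⟩
  have a1 : ∀ x, act 1 x = x := fun x => Subtype.ext (sig_one hE x.1)
  have am : ∀ g h x, act (g * h) x = act g (act h x) := fun g h x => Subtype.ext (sig_mul hE g h x.1)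
  refine ⟨_, (isChar_perm act a1 am).mem_vchars, ?_, ?_⟩
  · intro g
    have : (Finset.univ.filter fun x => act g⁻¹ x = x) = Finset.univ.filter fun x => act g x = x := by
      refine Finset.filter_congr fun x _ => ⟨fun h => ?_, fun h => ?_⟩
      · rw [← h, ← am, mul_inv_cancel, a1, h]
      · rw [← h, ← am, inv_mul_cancel, a1, h]
    simp only [this]
  · intro g p hp
    have h : (Finset.univ.filter fun x => act g x = x).card = fixS Mk p := by
      refine card_sub _ _ _ fun j => ?_
      change tbN Mk j * cond (Nat.beq (getB p j) j) 1 0 = _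
      rw [hp j]
      by_cases h1 : tbN Mk j = 1
      · rw [dif_pos h1, h1, one_mul]
        have : (act g ⟨j, h1⟩ = ⟨j, h1⟩) ↔ (sig hE g j : ℕ) = j := by
          rw [Subtype.ext_iff, Fin.ext_iff]
        by_cases h2 : (sig hE g j : ℕ) = j
        · rw [if_pos (this.2 h2), (natBeq_iff _ _).2 h2]; rfl
        · rw [if_neg (fun h => h2 (this.1 h)), (natBeq_false _ _).2 h2]; rfl
      · have := tbN_lt Mk j
        rw [dif_neg h1, show tbN Mk j = 0 by omega, zero_mul]
    simp only [h]

/-- the pair of a root -/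
def prF (j : Fin 240) : Fin 120 := ⟨j % 120, Nat.mod_lt _ (by norm_num)⟩
/-- the positive root of a pair -/
def psF (j : Fin 120) : Fin 240 := ⟨j, by omega⟩

theorem pr_ps (j : Fin 120) : prF (psF j) = j := Fin.ext (Nat.mod_eq_of_lt j.2)

theorem ps_pr (j : Fin 240) : psF (prF j) = j ∨ psF (prF j) = j + 120 := by
  rw [Fin.ext_iff, Fin.ext_iff, fin120]
  change (j : ℕ) % 120 = j ∨ (j : ℕ) % 120 = (j + 120) % 240
  have := j.2
  omega

theorem pr_neg (j : Fin 240) : prF (j + 120) = prF j := by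
  rw [Fin.ext_iff]
  change ((j + 120 : Fin 240) : ℕ) % 120 = j % 120
  rw [fin120]
  omega

theorem stat_fixN [Fintype M.Group] (Mk : ℕ) (hm : ∀ (g : M.Group) (j : Fin 240), tbN Mk (sig hE g j) = tbN Mk j)
    (hn : ∀ j < 120, tbN Mk (j + 120) = tbN Mk j) :
    Stat hE (fun p => (fixN Mk p : ℤ)) := by
  have hps : ∀ j : Fin 240, tbN Mk (psF (prF j)) = tbN Mk j := by
    intro j
    change tbN Mk ((j : ℕ) % 120) = tbN Mk j
    have hj := j.2
    by_cases h : (j : ℕ) < 120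
    · rw [Nat.mod_eq_of_lt h]
    · have := hn (j - 120) (by omega)
      rw [show (j : ℕ) - 120 + 120 = j by omega] at this
      rw [this, show (j : ℕ) % 120 = j - 120 by omega]
  let act : M.Group → {j : Fin 120 // tbN Mk j = 1} → {j : Fin 120 // tbN Mk j = 1} :=
    fun g j => ⟨prF (sig hE g (psF j.1)), by
      have := hps (sig hE g (psF j.1))
      rw [hm] at this
      exact this.trans j.2⟩
  have a1 : ∀ x, act 1 x = x := fun x => Subtype.ext (by
    change prF (sig hE 1 (psF x.1)) = x.1
    rw [sig_one, pr_ps])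
  have am : ∀ g h x, act (g * h) x = act g (act h x) := fun g h x => Subtype.ext (by
    change prF (sig hE (g * h) (psF x.1)) = prF (sig hE g (psF (prF (sig hE h (psF x.1)))))
    rw [sig_mul]
    rcases ps_pr (sig hE h (psF x.1)) with h1 | h1
    · rw [h1]
    · rw [h1, sig_neg, pr_neg])
  refine ⟨_, (isChar_perm act a1 am).mem_vchars, ?_, ?_⟩
  · intro g
    have : (Finset.univ.filter fun x => act g⁻¹ x = x) = Finset.univ.filter fun x => act g x = x := by
      refine Finset.filter_congr fun x _ => ⟨fun h => ?_, fun h => ?_⟩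
      · rw [← h, ← am, mul_inv_cancel, a1, h]
      · rw [← h, ← am, inv_mul_cancel, a1, h]
    simp only [this]
  · intro g p hp
    have h : (Finset.univ.filter fun x => act g x = x).card = fixN Mk p := by
      refine card_sub _ _ _ fun j => ?_
      change tbN Mk j * cond (Nat.beq (getB p j % 120) j) 1 0 = _
      have hpj : getB p j = sig hE g (psF j) := hp (psF j)
      rw [hpj]
      by_cases h1 : tbN Mk j = 1
      · rw [dif_pos h1, h1, one_mul]
        have : (act g ⟨j, h1⟩ = ⟨j, h1⟩) ↔ (sig hE g (psF j) : ℕ) % 120 = j := by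
          rw [Subtype.ext_iff, Fin.ext_iff]; rfl
        by_cases h2 : (sig hE g (psF j) : ℕ) % 120 = j
        · rw [if_pos (this.2 h2), (natBeq_iff _ _).2 h2]; rfl
        · rw [if_neg (fun h => h2 (this.1 h)), (natBeq_false _ _).2 h2]; rfl
      · have := tbN_lt Mk j
        rw [dif_neg h1, show tbN Mk j = 0 by omega, zero_mul]
    simp only [h]

/-- sign character -/
noncomputable def sgG (M : CoxeterMatrix (Fin n)) : M.Group →* ℤˣ :=
  M.toCoxeterSystem.lift ⟨fun _ => -1, fun i j => by simp⟩

theorem sgG_simple (i : Fin n) : sgG M (sG M i) = -1 :=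
  M.toCoxeterSystem.lift_apply_simple (f := fun _ => (-1 : ℤˣ)) (fun i j => by simp) i

end Stats

/-! ### Checking a character table -/

section Check

/-- packed table field -/
def fE (r c : ℕ) : ℕ := Nat.mod (Nat.shiftRight r (Nat.mul 16 c)) 65536
/-- table entry -/
def entZ (r c : ℕ) : ℤ := forceN (fE r c) fun x => forceZ (Int.subNatNat x 32768) fun z => z

theorem entZ_eq (r c : ℕ) : entZ r c = (fE r c : ℤ) - 32768 := by
  rw [entZ, forceN_eq, forceZ_eq, Int.subNatNat_eq_coe]; rfl

/-- data for one group -/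
structure Dat where
  m : ℕ
  N : ℕ
  wd : List ℕ
  cent : List ℕ
  bs : List ℕ
  cols : List ℕ
  mA : ℕ
  mB : ℕ
  rows : List ℕ
  certs : List (List ℕ)

/-- row `k` -/
def Dat.rw (D : Dat) (k : ℕ) : ℕ := D.rows.getD k 0

/-- permutation of a packed word -/
def permGo (n fuel : ℕ) : ℕ → ℕ → ℕ :=
  Nat.rec (fun _ p => p) (fun _ ih w p => cond (Nat.ble w 1) p
    (forceN (compP p (gnP (Nat.mod (Nat.mod w 8) n))) fun p' => forceN (Nat.div w 8) fun w' => ih w' p')) fuel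

/-- length of a packed word -/
def lenGo (fuel : ℕ) : ℕ → ℕ :=
  Nat.rec (fun _ => 0) (fun _ ih w => cond (Nat.ble w 1) 0 (Nat.succ (ih (Nat.div w 8)))) fuel

theorem permGo_spec {n : ℕ} {M : CoxeterMatrix (Fin n)} {hn : n ≤ 8} (h0 : 0 < n) (hE : SubE M (Fin.castLE hn))
    (fuel : ℕ) : ∀ (w p : ℕ) (g : M.Group), RepP hE g p → ∃ g' : M.Group, RepP hE g' (permGo n fuel w p) ∧
      sgG M g' = sgG M g * (-1) ^ lenGo fuel w := by
  induction fuel with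
  | zero => intro w p g hg; exact ⟨g, hg, by simp [lenGo]⟩
  | succ k ih =>
    intro w p g hg
    have e1 : permGo n (k + 1) w p = cond (Nat.ble w 1) p
      (forceN (compP p (gnP (Nat.mod (Nat.mod w 8) n))) fun p' => forceN (Nat.div w 8) fun w' => permGo n k w' p') := rfl
    have e2 : lenGo (k + 1) w = cond (Nat.ble w 1) 0 (Nat.succ (lenGo k (Nat.div w 8))) := rfl
    rw [e1, e2]
    cases hw : Nat.ble w 1 with
    | true => exact ⟨g, hg, by simp⟩
    | false =>
      simp only [cond_false, forceN_eq]
      let i : Fin n := ⟨w % 8 % n, Nat.mod_lt _ h0⟩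
      have h1 : RepP hE (g * sG M i) (compP p (gnP (w % 8 % n))) := RepP.mul hE hg (RepP.simple hE i)
      obtain ⟨g', h2, h3⟩ := ih (Nat.div w 8) _ _ h1
      refine ⟨g', h2, ?_⟩
      rw [h3, map_mul, sgG_simple, Nat.succ_eq_add_one, pow_succ]
      rw [mul_assoc, mul_comm (-1 : ℤˣ)]

/-- unpack a list of roots -/
def unp (fuel : ℕ) : ℕ → List ℕ :=
  Nat.rec (fun _ => []) (fun _ ih w => cond (Nat.ble w 1) []
    (forceN (Nat.mod (Nat.mod w 256) 240) fun x => forceN (Nat.div w 256) fun w' => x :: ih w')) fuel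

theorem unp_spec (fuel : ℕ) : ∀ w, ∃ L : List (Fin 240), unp fuel w = L.map (Fin.val : Fin 240 → ℕ) := by
  induction fuel with
  | zero => intro w; exact ⟨[], rfl⟩
  | succ k ih =>
    intro w
    have e1 : unp (k + 1) w = cond (Nat.ble w 1) []
      (forceN (Nat.mod (Nat.mod w 256) 240) fun x => forceN (Nat.div w 256) fun w' => x :: unp k w') := rfl
    rw [e1]
    cases hw : Nat.ble w 1 with
    | true => exact ⟨[], rfl⟩
    | false =>
      obtain ⟨L, hL⟩ := ih (w / 256)
      refine ⟨⟨w % 256 % 240, Nat.mod_lt _ (by norm_num)⟩ :: L, ?_⟩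
      simp only [cond_false, forceN_eq, List.map_cons]
      exact congrArg _ hL

/-- membership -/
def memN (s : ℕ) : List ℕ → Bool
  | [] => false
  | x :: xs => cond (Nat.beq x s) true (memN s xs)

theorem memN_spec (s : ℕ) (L : List ℕ) (h : memN s L = true) : s ∈ L := by
  induction L with
  | nil => simp [memN] at h
  | cons x xs ih =>
    rw [memN] at h
    cases hx : Nat.beq x s with
    | true => rw [(natBeq_iff _ _).1 hx]; exact List.mem_cons_self
    | false => rw [hx] at h; exact List.mem_cons_of_mem _ (ih h)

/-- permutation of class `c` -/
def Dat.perm (D : Dat) (n c : ℕ) : ℕ := forceN (D.wd.getD c 1) fun w => permGo n 200 w idP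

/-- twice the alternating square -/
def alt2 (x y : ℤ) : ℤ := addZ (mulZ x x) (mulZ (-1) y)

/-- base rows at one class -/
def chkBase (D : Dat) (c p p2 p4 : ℕ) : Bool :=
  decide (entZ (D.rw 0) c = 1) &&
  decide (entZ (D.rw 1) c = cond (Nat.beq (Nat.mod (lenGo 200 (D.wd.getD c 1)) 2) 0) 1 (-1)) &&
  decide (entZ (D.rw 2) c = trS p) &&
  decide (entZ (D.rw 3) c = (fixN D.mA p : ℤ)) &&
  decide (entZ (D.rw 4) c = (fixS D.mA p : ℤ)) &&
  decide (entZ (D.rw 5) c = (fixS D.mB p : ℤ)) &&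
  decide (mulZ 2 (entZ (D.rw 6) c) = alt2 (entZ (D.rw 2) c) (trS p2)) &&
  decide (mulZ 2 (entZ (D.rw 7) c) = alt2 (entZ (D.rw 3) c) (fixN D.mA p2 : ℤ)) &&
  decide (mulZ 2 (entZ (D.rw 8) c) = alt2 (entZ (D.rw 5) c) (fixS D.mB p2 : ℤ)) &&
  decide (mulZ 4 (entZ (D.rw 9) c) = addZ (mulZ 2 (mulZ (entZ (D.rw 6) c) (entZ (D.rw 6) c)))
    (mulZ (-1) (alt2 (trS p2) (trS p4))))

/-- centraliser bound at one class -/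
def chkCent (D : Dat) (n c p p2 : ℕ) : Bool :=
  forceN (mskA p) fun a1 => forceN (mskZ p) fun z1 => forceN (mskM p) fun m1 =>
  forceN (mskA p2) fun a2 => forceN (mskZ p2) fun z2 => forceN (mskM p2) fun m2 =>
  forceN (D.bs.getD c 1) fun w =>
    allN n (fun s => memN s (unp 30 w)) &&
    Nat.ble (bndP p (unp 30 w) (masks D.cols a1 z1 m1 a2 z2 m2)) (D.cent.getD c 0)

/-- all checks at one class -/
def chkCls (D : Dat) (n c : ℕ) : Bool :=
  forceN (D.perm n c) fun p => forceN (compP p p) fun p2 => forceN (compP p2 p2) fun p4 =>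
    chkBase D c p p2 p4 && chkCent D n c p p2

/-- masks are invariant -/
def chkMask (n Mk : ℕ) : Bool :=
  allN n fun i => allN 240 fun j => Nat.beq (tbN Mk (getB (gnP i) j)) (tbN Mk j)

/-- all masks -/
def chkMasks (D : Dat) (n : ℕ) : Bool :=
  chkMask n D.mA && chkMask n D.mB && D.cols.all (chkMask n) &&
  allN 120 fun j => Nat.beq (tbN D.mA (Nat.add j 120)) (tbN D.mA j)

/-- one derived row -/
def chkRow (D : Dat) (k : ℕ) (R : ℕ) : List ℕ → (ℕ → ℤ) → Bool
  | [], acc => allN D.m fun c => decide (acc c = entZ R c)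
  | t :: ts, acc => Nat.blt (Nat.mod t 256) k && (Nat.blt (Nat.mod (Nat.div t 256) 256) k &&
      (forceN (D.rw (Nat.mod t 256)) fun A => forceN (D.rw (Nat.mod (Nat.div t 256) 256)) fun B =>
      forceZ (Int.subNatNat (Nat.div t 65536) 1024) fun q =>
        chkRow D k R ts fun c => addZ (acc c) (mulZ q (mulZ (entZ A c) (entZ B c)))))

/-- all derived rows -/
def chkRows (D : Dat) : List (List ℕ) → ℕ → Bool
  | [], _ => true
  | t :: ts, k => (forceN (D.rw k) fun R => chkRow D k R t fun _ => 0) && (forceN (Nat.succ k) fun k' => chkRows D ts k')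

/-- separation of columns -/
def sepR (c c' : ℕ) : List ℕ → Bool
  | [] => false
  | r :: rs => cond (Nat.beq (fE r c) (fE r c')) (sepR c c' rs) true

/-- class sizes -/
def Dat.z (D : Dat) (c : ℕ) : ℕ := Nat.div D.N (D.cent.getD c 0)

/-- degrees -/
def Dat.d (D : Dat) (i : ℕ) : ℕ := Nat.sub (fE (D.rw (Nat.add 10 i)) 0) 32768

/-- global checks -/
def chkTab (D : Dat) : Bool :=
  Nat.beq (D.wd.getD 0 1) 1 && Nat.beq (D.cent.getD 0 0) D.N && Nat.blt 0 D.N && Nat.blt 0 D.m &&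
  Nat.beq D.rows.length (Nat.add 10 D.m) && Nat.beq D.certs.length D.m &&
  allN D.m (fun c => Nat.beq (Nat.mul (D.z c) (D.cent.getD c 0)) D.N) &&
  Nat.beq (sumN D.m D.z) D.N &&
  allN D.m (fun i => Nat.blt 32768 (fE (D.rw (Nat.add 10 i)) 0)) &&
  allN D.m (fun c => allN c fun c' => sepR c c' D.rows)

/-- norms -/
def chkNorm (D : Dat) : Bool :=
  allN D.m fun i => forceN (D.rw (Nat.add 10 i)) fun R =>
    decide (sumZ D.m (fun c => mulZ (Int.ofNat (D.z c)) (mulZ (entZ R c) (entZ R c))) = Int.ofNat D.N)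

/-- the regular character -/
def chkReg (D : Dat) : Bool :=
  allN D.m fun c =>
    decide (sumZ D.m (fun i => forceN (D.rw (Nat.add 10 i)) fun R => mulZ (entZ R 0) (entZ R c)) =
      cond (Nat.beq c 0) (Int.ofNat D.N) 0)

/-- number of defect zero characters -/
def cntD (D : Dat) (l : ℕ) : ℕ :=
  sumN D.m fun i => cond (Nat.beq (Nat.mod (Nat.div D.N (D.d i)) l) 0) 0 1

end Check

/-! ### From checks to the character table -/

section Main

variable {n : ℕ} {M : CoxeterMatrix (Fin n)} {hn : n ≤ 8} (hE : SubE M (Fin.castLE hn))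

theorem chkMask_spec {Mk : ℕ} (h : chkMask n Mk = true) (g : M.Group) (j : Fin 240) :
    tbN Mk (sig hE g j) = tbN Mk j :=
  mask_inv hE Mk (fun i j hj => (natBeq_iff _ _).1 (allN_spec (allN_spec h i i.2) j hj)) g j

/-- realised rows -/
def Rz {G : Type} [Group G] [Fintype G] (m : ℕ) (g : ℕ → G) (V : ℕ → ℤ) : Prop :=
  ∃ f ∈ vchars G, (∀ x, f x⁻¹ = f x) ∧ ∀ c < m, f (g c) = ((V c : ℤ) : ℂ)

theorem Rz.zero {G : Type} [Group G] [Fintype G] (m : ℕ) (g : ℕ → G) : Rz m g fun _ => 0 :=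
  ⟨0, zero_mem _, fun _ => rfl, fun _ _ => by simp⟩

theorem Rz.add {G : Type} [Group G] [Fintype G] {m : ℕ} {g : ℕ → G} {V W : ℕ → ℤ} (hV : Rz m g V) (hW : Rz m g W) :
    Rz m g fun c => V c + W c := by
  obtain ⟨f, h1, h2, h3⟩ := hV
  obtain ⟨f', h1', h2', h3'⟩ := hW
  refine ⟨f + f', add_mem h1 h1', fun x => ?_, fun c hc => ?_⟩
  · simp only [Pi.add_apply, h2, h2']
  · simp only [Pi.add_apply, h3 c hc, h3' c hc]; push_cast; rfl

theorem Rz.mul {G : Type} [Group G] [Fintype G] {m : ℕ} {g : ℕ → G} {V W : ℕ → ℤ} (hV : Rz m g V) (hW : Rz m g W) :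
    Rz m g fun c => V c * W c := by
  obtain ⟨f, h1, h2, h3⟩ := hV
  obtain ⟨f', h1', h2', h3'⟩ := hW
  refine ⟨f * f', vchars_mul h1 h1', fun x => ?_, fun c hc => ?_⟩
  · simp only [Pi.mul_apply, h2, h2']
  · simp only [Pi.mul_apply, h3 c hc, h3' c hc]; push_cast; rfl

theorem Rz.smul {G : Type} [Group G] [Fintype G] {m : ℕ} {g : ℕ → G} {V : ℕ → ℤ} (q : ℤ) (hV : Rz m g V) :
    Rz m g fun c => q * V c := by
  obtain ⟨f, h1, h2, h3⟩ := hV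
  refine ⟨q • f, zsmul_mem h1 q, fun x => ?_, fun c hc => ?_⟩
  · simp only [Pi.smul_apply, h2]
  · simp only [Pi.smul_apply, h3 c hc, zsmul_eq_mul]; push_cast; rfl

theorem Rz.congr {G : Type} [Group G] [Fintype G] {m : ℕ} {g : ℕ → G} {V W : ℕ → ℤ} (hV : Rz m g V)
    (h : ∀ c < m, V c = W c) : Rz m g W := by
  obtain ⟨f, h1, h2, h3⟩ := hV
  exact ⟨f, h1, h2, fun c hc => by rw [h3 c hc, h c hc]⟩

theorem chkRow_spec {G : Type} [Group G] [Fintype G] {g : ℕ → G} (D : Dat) (k R : ℕ)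
    (hk : ∀ j < k, Rz D.m g (entZ (D.rw j))) (ts : List ℕ) :
    ∀ acc : ℕ → ℤ, Rz D.m g acc → chkRow D k R ts acc = true → Rz D.m g (entZ R) := by
  induction ts with
  | nil =>
    intro acc ha h
    rw [chkRow] at h
    exact ha.congr fun c hc => of_decide_eq_true (allN_spec h c hc)
  | cons t ts ih =>
    intro acc ha h
    rw [chkRow, Bool.and_eq_true, Bool.and_eq_true, forceN_eq, forceN_eq, forceZ_eq] at h
    obtain ⟨h1, h2, h3⟩ := h
    refine ih _ ?_ h3
    have e1 := hk _ (Nat.le_of_ble_eq_true h1)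
    have e2 := hk _ (Nat.le_of_ble_eq_true h2)
    exact (ha.add ((e1.mul e2).smul _)).congr fun c _ => by rw [addZ_eq, mulZ_eq, mulZ_eq]

theorem chkRows_spec {G : Type} [Group G] [Fintype G] {g : ℕ → G} (D : Dat) (ts : List (List ℕ)) :
    ∀ k, (∀ j < k, Rz D.m g (entZ (D.rw j))) → chkRows D ts k = true →
      ∀ j < k + ts.length, Rz D.m g (entZ (D.rw j)) := by
  induction ts with
  | nil => intro k hk _ j hj; exact hk j hj
  | cons t ts ih =>
    intro k hk h j hj
    rw [chkRows, Bool.and_eq_true, forceN_eq, forceN_eq] at h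
    refine ih (k + 1) ?_ h.2 j (by rw [List.length_cons] at hj; omega)
    intro i hi
    by_cases hik : i < k
    · exact hk i hik
    · have : i = k := by omega
      subst this
      exact chkRow_spec D i _ hk t _ (Rz.zero _ _) h.1

theorem Stat.rz [Fintype M.Group] {st : ℕ → ℤ} (h : Stat hE st) {m : ℕ} {g : ℕ → M.Group} {p : ℕ → ℕ}
    (hp : ∀ c, RepP hE (g c) (p c)) {V : ℕ → ℤ} (hV : ∀ c < m, V c = st (p c)) : Rz m g V := by
  obtain ⟨f, h1, h2, h3⟩ := h
  exact ⟨f, h1, h2, fun c hc => by rw [h3 _ _ (hp c), hV c hc]⟩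

theorem lam2_symm {G : Type} [Group G] {f : G → ℂ} (h : ∀ x, f x⁻¹ = f x) (x : G) : lam2 f x⁻¹ = lam2 f x := by
  simp only [lam2]
  rw [h, ← mul_inv_rev, h]

theorem Stat.lam [Fintype M.Group] {st : ℕ → ℤ} (h : Stat hE st) {m : ℕ} {g : ℕ → M.Group} {p : ℕ → ℕ}
    (hp : ∀ c, RepP hE (g c) (p c)) {V : ℕ → ℤ}
    (hV : ∀ c < m, 2 * V c = st (p c) * st (p c) - st (compP (p c) (p c))) : Rz m g V := by
  obtain ⟨f, h1, h2, h3⟩ := h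
  refine ⟨lam2 f, vchars_lam2 h1, lam2_symm h2, fun c hc => ?_⟩
  have h4 := congrArg (Int.cast : ℤ → ℂ) (hV c hc)
  push_cast at h4
  simp only [lam2]
  rw [h3 _ _ (hp c), h3 _ _ (RepP.mul hE (hp c) (hp c)), ← h4]
  ring

theorem Stat.lam_lam [Fintype M.Group] {st : ℕ → ℤ} (h : Stat hE st) {m : ℕ} {g : ℕ → M.Group} {p : ℕ → ℕ}
    (hp : ∀ c, RepP hE (g c) (p c)) {V U : ℕ → ℤ}
    (hU : ∀ c < m, 2 * U c = st (p c) * st (p c) - st (compP (p c) (p c)))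
    (hV : ∀ c < m, 4 * V c = 2 * (U c * U c) - (st (compP (p c) (p c)) * st (compP (p c) (p c)) -
      st (compP (compP (p c) (p c)) (compP (p c) (p c))))) : Rz m g V := by
  obtain ⟨f, h1, h2, h3⟩ := h
  refine ⟨lam2 (lam2 f), vchars_lam2 (vchars_lam2 h1), lam2_symm (lam2_symm h2), fun c hc => ?_⟩
  have h4 := congrArg (Int.cast : ℤ → ℂ) (hV c hc)
  have h5 := congrArg (Int.cast : ℤ → ℂ) (hU c hc)
  push_cast at h4 h5
  have h6 := RepP.mul hE (hp c) (hp c)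
  simp only [lam2]
  rw [h3 _ _ (hp c), h3 _ _ h6, h3 _ _ (RepP.mul hE h6 h6), ← h5]
  linear_combination (-1 / 4 : ℂ) * h4

theorem alt2_eq (x y : ℤ) : alt2 x y = x * x - y := by rw [alt2, addZ_eq, mulZ_eq, mulZ_eq]; ring

theorem sepR_spec (c c' : ℕ) (L : List ℕ) (h : sepR c c' L = true) : ∃ k < L.length, fE (L.getD k 0) c ≠ fE (L.getD k 0) c' := by
  induction L with
  | nil => simp [sepR] at h
  | cons r rs ih =>
    rw [sepR] at h
    cases hr : Nat.beq (fE r c) (fE r c') with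
    | true =>
      rw [hr] at h
      obtain ⟨k, hk, h1⟩ := ih h
      exact ⟨k + 1, by simpa using hk, by simpa using h1⟩
    | false => exact ⟨0, by simp, by simpa using (natBeq_false _ _).1 hr⟩

theorem main_tab {n : ℕ} {M : CoxeterMatrix (Fin n)} {hn : n ≤ 8} (h0 : 0 < n) (hE : SubE M (Fin.castLE hn)) (D : Dat) (h1 : chkTab D = true) (h2 : chkNorm D = true) (h3 : chkReg D = true)
    (h4 : chkMasks D n = true) (h5 : chkRows D D.certs 10 = true)
    (h6 : allN D.m (fun c => chkCls D n c) = true) :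
    numIrr M.Group = D.m ∧ ∀ l, numDefectZero l M.Group = cntD D l := by
  classical
  haveI := group_finite hE
  letI : Fintype M.Group := Fintype.ofFinite _
  simp only [chkTab, Bool.and_eq_true] at h1
  obtain ⟨⟨⟨⟨⟨⟨⟨⟨⟨t1, t2⟩, t3⟩, t4⟩, t5⟩, t6⟩, t7⟩, t8⟩, t9⟩, t10⟩ := h1
  simp only [chkMasks, Bool.and_eq_true] at h4
  obtain ⟨⟨⟨m1, m2⟩, m3⟩, m4⟩ := h4
  rw [natBeq_iff] at t1 t2 t5 t6 t8
  have t3' : 0 < D.N := Nat.le_of_ble_eq_true t3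
  have t4' : 0 < D.m := Nat.le_of_ble_eq_true t4
  -- class representatives
  have hw : ∀ c, ∃ g : M.Group, RepP hE g (D.perm n c) ∧ sgG M g = (-1) ^ lenGo 200 (D.wd.getD c 1) := by
    intro c
    obtain ⟨g, a, b⟩ := permGo_spec h0 hE 200 (D.wd.getD c 1) idP 1 (RepP.one hE)
    refine ⟨g, ?_, by rw [b, map_one, one_mul]⟩
    rw [Dat.perm, forceN_eq]; exact a
  choose g hg hs using hw
  have hg0 : g 0 = 1 := by
    apply sig_injective hE
    funext j
    have e1 := hg 0 j
    have e2 : D.perm n 0 = idP := by rw [Dat.perm, forceN_eq, t1]; rfl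
    rw [e2, RepP.one hE j] at e1
    exact Fin.ext e1.symm
  have hcls : ∀ c < D.m, chkBase D c (D.perm n c) (compP (D.perm n c) (D.perm n c))
      (compP (compP (D.perm n c) (D.perm n c)) (compP (D.perm n c) (D.perm n c))) = true ∧
      chkCent D n c (D.perm n c) (compP (D.perm n c) (D.perm n c)) = true := by
    intro c hc
    have := allN_spec h6 c hc
    rw [chkCls, forceN_eq, forceN_eq, forceN_eq, Bool.and_eq_true] at this
    exact this
  have hb := fun c hc => (hcls c hc).1
  simp only [chkBase, Bool.and_eq_true, decide_eq_true_eq, alt2_eq, mulZ_eq, addZ_eq] at hb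
  have i1 := chkMask_spec hE m1
  have i2 := chkMask_spec hE m2
  have sV := stat_tr hE
  have sN := stat_fixN hE D.mA i1 (fun j hj => (natBeq_iff _ _).1 (allN_spec m4 j hj))
  have sA := stat_fix hE D.mA i1
  have sB := stat_fix hE D.mB i2
  -- all rows are realised
  have hbase : ∀ j < 10, Rz D.m g (entZ (D.rw j)) := by
    intro j hj
    interval_cases j
    · exact ⟨_, isChar_one.mem_vchars, fun _ => rfl, fun c hc => by rw [(hb c hc).1.1.1.1.1.1.1.1.1]; simp⟩
    · refine ⟨_, (isChar_hom (sgG M)).mem_vchars, fun x => by simp, fun c hc => ?_⟩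
      rw [(hb c hc).1.1.1.1.1.1.1.1.2, hs]
      rcases Nat.mod_two_eq_zero_or_one (lenGo 200 (D.wd.getD c 1)) with h | h
      · have h' : Nat.mod (lenGo 200 (D.wd.getD c 1)) 2 = 0 := h
        rw [h', (Nat.even_iff.2 h).neg_one_pow]; simp
      · have h' : Nat.mod (lenGo 200 (D.wd.getD c 1)) 2 = 1 := h
        rw [h', (Nat.odd_iff.2 h).neg_one_pow, show Nat.beq 1 0 = false from rfl]; simp
    · exact sV.rz hE hg fun c hc => (hb c hc).1.1.1.1.1.1.1.2
    · exact sN.rz hE hg fun c hc => (hb c hc).1.1.1.1.1.1.2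
    · exact sA.rz hE hg fun c hc => (hb c hc).1.1.1.1.1.2
    · exact sB.rz hE hg fun c hc => (hb c hc).1.1.1.1.2
    · refine sV.lam hE hg fun c hc => ?_
      rw [(hb c hc).1.1.1.2, (hb c hc).1.1.1.1.1.1.1.2]
    · refine sN.lam hE hg fun c hc => ?_
      rw [(hb c hc).1.1.2, (hb c hc).1.1.1.1.1.1.2]
    · refine sB.lam hE hg fun c hc => ?_
      rw [(hb c hc).1.2, (hb c hc).1.1.1.1.2]
    · refine sV.lam_lam hE hg (U := entZ (D.rw 6)) (fun c hc => ?_) fun c hc => ?_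
      · rw [(hb c hc).1.1.1.2, (hb c hc).1.1.1.1.1.1.1.2]
      · rw [(hb c hc).2]; ring
  have hrows := chkRows_spec D D.certs 10 hbase h5
  rw [t6] at hrows
  -- centralisers
  have hcent : ∀ c : Fin D.m, (Finset.univ.filter fun x : M.Group => g c * x = x * g c).card ≤ D.cent.getD c 0 := by
    intro c
    have h := (hcls c c.2).2
    rw [chkCent] at h
    simp only [forceN_eq] at h
    rw [Bool.and_eq_true] at h
    obtain ⟨L, hL⟩ := unp_spec 30 (D.bs.getD c 1)
    rw [hL] at h
    refine le_trans ?_ (Nat.le_of_ble_eq_true h.2)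
    have hs' : ∀ (s : Fin n) (j : Fin 240), (j : ℕ) = (Fin.castLE hn s : Fin 8) → j ∈ L := by
      intro s j hj
      have h7 := memN_spec _ _ (allN_spec h.1 s s.2)
      obtain ⟨x, hx, hxs⟩ := List.mem_map.1 h7
      have : x = j := Fin.ext (by rw [hxs, hj]; rfl)
      rwa [← this]
    convert cent_bound hE (hg c) (RepP.mul hE (hg c) (hg c)) D.cols
      (fun M' hM' => chkMask_spec hE (List.all_eq_true.1 m3 M' hM')) L hs'
  have hpos : ∀ i < D.m, 32768 < fE (D.rw (10 + i)) 0 := fun i hi => Nat.le_of_ble_eq_true (allN_spec t9 i hi)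
  have hsep : ∀ c c' : ℕ, c < D.m → c' < c → ∃ k < 10 + D.m, entZ (D.rw k) c ≠ entZ (D.rw k) c' := by
    intro c c' hc hc'
    obtain ⟨k, hk, h7⟩ := sepR_spec c c' _ (allN_spec (allN_spec t10 c hc) c' hc')
    refine ⟨k, by rw [t5] at hk; exact hk, fun h8 => h7 ?_⟩
    rw [entZ_eq, entZ_eq] at h8
    have : fE (D.rw k) c = fE (D.rw k) c' := by omega
    exact this
  obtain ⟨hcard, T, hT⟩ := table_of (G := M.Group) D.N t3' (fun c : Fin D.m => g c) (fun c => D.cent.getD c 0)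
    (fun c => D.z c) ⟨0, t4'⟩ hg0 t2 hcent (fun c => (natBeq_iff _ _).1 (allN_spec t7 c c.2))
    (by rw [← t8, sumN_eq, Fin.sum_univ_eq_sum_range (fun c => D.z c)])
    (K := Fin (10 + D.m)) (fun k c => entZ (D.rw k) c)
    (fun k => by
      obtain ⟨f, a, b, c⟩ := hrows k k.2
      exact ⟨f, a, b, fun x => c x x.2⟩)
    (fun c c' h => by
      rcases lt_trichotomy c c' with h7 | h7 | h7
      · obtain ⟨k, hk, h8⟩ := hsep c' c c'.2 h7
        exact absurd (h ⟨k, hk⟩).symm h8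
      · exact h7
      · obtain ⟨k, hk, h8⟩ := hsep c c' c.2 h7
        exact absurd (h ⟨k, hk⟩) h8)
    (fun i => ⟨10 + i, by omega⟩)
    (fun i => by
      have := allN_spec h2 i i.2
      rw [forceN_eq, decide_eq_true_eq, sumZ_eq] at this
      simp only [mulZ_eq] at this
      exact (Fin.sum_univ_eq_sum_range (fun c => (D.z c : ℤ) * (entZ (D.rw (10 + i)) c * entZ (D.rw (10 + i)) c)) D.m).trans this)
    (fun c => by
      have := allN_spec h3 c c.2
      rw [decide_eq_true_eq, sumZ_eq] at this
      simp only [mulZ_eq, forceN_eq] at this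
      refine (Fin.sum_univ_eq_sum_range (fun i => entZ (D.rw (10 + i)) 0 * entZ (D.rw (10 + i)) c) D.m).trans
        (this.trans ?_)
      by_cases hc : (c : ℕ) = 0
      · rw [if_pos (Fin.ext hc), (natBeq_iff _ _).2 hc]; rfl
      · rw [if_neg (fun h => hc (congrArg Fin.val h)), (natBeq_false _ _).2 hc]; rfl)
    (fun i => D.d i)
    (fun i => by
      have := hpos i i.2
      change entZ (D.rw (10 + i)) 0 = ((fE (D.rw (10 + i)) 0 - 32768 : ℕ) : ℤ)
      rw [entZ_eq, Nat.cast_sub this.le]; rfl)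
    (fun i => by
      have := hpos i i.2
      change 0 < fE (D.rw (10 + i)) 0 - 32768
      omega)
  refine ⟨by rw [T.numIrr, Fintype.card_fin], fun l => ?_⟩
  rw [T.numDefectZero, Finset.card_filter, cntD, sumN_eq, ← Fin.sum_univ_eq_sum_range
    (fun i => cond (Nat.beq (Nat.mod (Nat.div D.N (D.d i)) l) 0) 0 1)]
  refine Finset.sum_congr rfl fun i _ => ?_
  rw [hT, hcard]
  change _ = cond (Nat.beq (D.N / D.d i % l) 0) 0 1
  by_cases h : l ∣ D.N / D.d i
  · rw [if_neg (not_not.2 h), (natBeq_iff _ _).2 (Nat.mod_eq_zero_of_dvd h)]; rfl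
  · rw [if_pos h, (natBeq_false _ _).2 (fun h' => h (Nat.dvd_of_mod_eq_zero h'))]; rfl

end Main

/-! ### The table for `E_6` -/

/-- data for `E_6` -/
def rows6 : List ℕ :=
  [0x8001800180018001800180018001800180018001800180018001800180018001800180018001800180018001800180018001,
    0x800180017fff8001800180017fff800180017fff7fff7fff7fff800180018001800180017fff7fff7fff800180017fff8001,
    0x7fff800080008000800380028003800480018000800180028002800180028003800280038003800280048004800580068008,
    0x800080038006800c800080008000800080008001800180008001800280038000800280018004800480028008800680108024,
    0x800080008000800080008000800080008000800080008000800280008006800080028002800680028004800c800c801e8048,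
    0x80008000800180038000800080018003800080008000800180008001800080038001800280038003800580078009800f801b,
    0x80017fff7ffe7ffc80058001800480087fff7fff7fff800080017ffe800180028000800380027ffe80068004800a800e801c,
    0x80008003800e8036800080007fff7ffa80007fff800080007fff7fff80037ffd7ffe800080057ff67ffe800e800f806e8276,
    0x800080007ffd7ff78000800080008003800080007fff7fff80007ffc800080007ffd800180007ff78009800b80248063815f,
    0x8000800080007ffa800c8000800980227ffe80007fff7ffc80007ffd80007ffd7ffe80037ffd7ff480107ffa802d8054817a,
    0x8001800180018001800180018001800180018001800180018001800180018001800180018001800180018001800180018001,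
    0x800180017fff8001800180017fff800180017fff7fff7fff7fff800180018001800180017fff7fff7fff800180017fff8001,
    0x7ffd7ffe7ffe7ffe80018000800180027fff7ffe7fff800080007fff80008001800080018001800080028002800380048006,
    0x80028001800280047ffe7fff7fff800080008001800080007fff80017fff80018000800080018002800280048005800a8014,
    0x8006800280017fff80028000800180038000800280007fff80007fff80007fff7fff80007fff7ffd80017fff80038005800f,
    0x7ffd7ffe80027ffe800180007fff80027fff80028001800080007fff80008001800080017fff80007ffe800280037ffc8006,
    0x7ffd8001800380078001800080007fff7fff7fff80007fff8001800080037ffe80018000800280017fff800380008005800f,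
    0x800680027fff7fff800280007fff800380007ffe8000800180007fff80007fff7fff8000800180037fff7fff80037ffb800f,
    0x800280017ffe80047ffe7fff8001800080007fff80008000800180017fff8001800080007fff7ffe7ffe800480057ff68014,
    0x80037fff7ffc7ff67fff80007fff7ffe800180018000800080017fff80037fff8000800080017ffe800080028003800a801e,
    0x7ffd80017ffd80078001800080007fff7fff8001800080017fff800080037ffe800180007ffe7fff8001800380007ffb800f,
    0x7ff8800080008000800080018000800080007ffe80018000800080007ffe800080007fff7ffe800080008000800480108040,
    0x80067fff7ffe7ffc800280008001800080008001800080007fff80017ffd7fff80008000800180027ffe80047ffd800a803c,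
    0x80037fff80047ff67fff800080017ffe80017fff800080007fff7fff80037fff800080007fff80028000800280037ff6801e,
    0x80008000800380098000800080007ffd800080007fff800180008000800080007fff800180007ffd7fff7ffd800080098051,
    0x7ff97ffe8000800480017fff8000800480018000800080008000800280027ffe800080008000800080007ffc800280008014,
    0x7ff88000800080008000800180008000800080027fff8000800080007ffe800080007fff800280008000800080047ff08040,
    0x80067fff80027ffc800280007fff800080007fff80008000800180017ffd7fff800080007fff7ffe800280047ffd7ff6803c,
    0x8009800080007ffa7ffd8000800080027fff8000800080008000800080008000800280008000800080007ffa80008000805a,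
    0x80067fff800080088002800080008000800080017fff8000800180008003800280007fff7ffe800480008000800080048018,
    0x7ff6800280007ff080027fff80008000800080008000800080008000800280028000800080008000800080007ffc80008050,
    0x7ffd80008000800c7ffd800080008004800180008000800080007ffe800080008000800080008000800080047ffa8000803c,
    0x800080007ffd80098000800080007ffd8000800080017fff80008000800080007fff80018000800380017ffd80007ff78051,
    0x80067fff80008008800280008000800080007fff800180007fff80008003800280007fff80027ffc8000800080007ffc8018,
    0x8001800080007ffa7ffd8001800080027fff80008000800080008002800480007ffe800080008000800080027ffe8000800a]
/-- certificates for `E_6` -/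
def certs6 : List (List ℕ) :=
  [[67174400],
    [67174401],
    [67174402, 66977802],
    [67174405, 67043338, 67043340],
    [67174406, 67043338, 66977804],
    [67177483],
    [67174403, 67043338, 67043341],
    [67177995],
    [67177739],
    [67174404, 67043338, 67043340, 67043344, 67043341],
    [67178507],
    [67177740, 67043340, 67043341, 67043347],
    [67178508, 67043347],
    [67179275],
    [67174408, 66977804, 66977806, 66977805, 66977811, 66977813],
    [67177996, 67043340, 67043349],
    [67177743, 67043343, 67043346, 67043351],
    [67178511, 67043351],
    [67177742, 67043342, 67043341, 67043347, 67043349, 67043352],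
    [67177741, 67043338, 67043340, 67043342, 67043344, 66977805, 67043347, 67043350, 66977813, 67043352],
    [67178510, 67043349, 67043352],
    [67177744, 67043344, 67043341, 67043350, 67043349, 67043352],
    [67179279, 67043348, 67043346, 67043354],
    [67174407, 67043342, 66977808, 66977805, 67043347, 67043350, 67043359, 66977813, 66912280],
    [67179280, 67043340, 66977811, 67043350, 67043349, 66977822, 67043356]]
/-- data for `E_6` -/
def dat6 : Dat where
  m := 25
  N := 51840
  wd := [0x1, 0x8, 0x5a, 0x4d, 0x2ca, 0x21d, 0x265, 0x1053, 0x1063, 0x12a3, 0x10ac, 0x1055, 0xd8d0, 0x96ac, 0x82d5,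
    0x9425, 0x50b19, 0x4a6a3, 0x29ab19, 0x16506a5, 0x165466c650, 0x12994e329c, 0x94194e329c, 0x4a0ca76329c,
    0x16538cab1941a8cd8d0]
  cent := [51840, 1440, 216, 192, 32, 96, 36, 10, 16, 36, 108, 24, 12, 8, 10, 36, 12, 96, 12, 9, 72, 1152, 96, 36, 648]
  bs := [0x10504030201009ec3, 0x105040302010074d649, 0x1050403020100cda9, 0x10504030201006d, 0x10504030201000c550a,
    0x1050403020100dd30, 0x105040302010053, 0x105040302010039, 0x1050403020100a5, 0x1050403020100d4991e,
    0x10504030201001da8, 0x10504030201001703cb, 0x105040302010058ae, 0x1050403020100cb097f, 0x1050403020100a256,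
    0x1050403020100e8, 0x1050403020100ca, 0x10504030201002173dc, 0x105040302010086, 0x1050403020100301bea,
    0x10504030201006094d1, 0x105040302010091d2, 0x1050403020100e476, 0x105040302010071ed86, 0x1050403020100dcd5]
  cols := [0x800000000000000000000000000000000000000000000000000000000000,
    0x400000000000000000000000000000000000000000000000000000000000,
    0x3fffeccc8842000000000000000000000000000000000000000000000000,
    0x122265318d28a2460810204000000000000000000000000000000000,
    0x111128c629651214608102040000000000000000000000000000000, 0x80000000000000000000000000000000,
    0x10410c98b1e7cf9f3f00000000000010410c98b1e7cf9f3f, 0x80, 0x111128c629651214608102040,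
    0x122265318d28a2460810204000, 0x3fffeccc8842000000000000000000, 0x400000000000000000000000000000,
    0x800000000000000000000000000000]
  mA := 0x10410c98b1e7cf9f3f00000000000010410c98b1e7cf9f3f
  mB := 0x3fffeccc8842000000000000000000000000000000000000000000000000
  rows := rows6
  certs := certs6

theorem chkTab6 : chkTab dat6 = true := by decide +kernel
theorem chkNorm6 : chkNorm dat6 = true := by decide +kernel
theorem chkReg6 : chkReg dat6 = true := by decide +kernel
theorem chkMasks6 : chkMasks dat6 6 = true := by decide +kernel
theorem chkRows6 : chkRows dat6 dat6.certs 10 = true := by decide +kernel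
theorem chkCls6 : allN 25 (fun c => chkCls dat6 6 c) = true := by decide +kernel

/-! ### The table for `E_7` -/

/-- data for `E_7` -/
def rows7 : List ℕ :=
  [0x800180018001800180018001800180018001800180018001800180018001800180018001800180018001800180018001800180018001800180018001800180018001800180018001800180018001800180018001800180018001800180018001800180018001800180018001800180018001800180018001,
    0x7fff7fff7fff7fff80017fff80017fff7fff80017fff8001800180017fff7fff7fff800180017fff80017fff8001800180017fff7fff7fff800180018001800180018001800180017fff7fff7fff7fff7fff7fff7fff7fff7fff80018001800180018001800180017fff7fff7fff7fff800180017fff8001,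
    0x7ffa80007ffe7ffd7ffc7fff7fff8003800080007fff7ffe7fff80007ffe80028000800080038001800280018002800180028002800080037fff8000800080008001800180018004800280017fff800180008002800180008002800280008002800180028003800380028003800280048004800580068008,
    0x803f80038003800f801f800080008000800180038003800780078003800f80008007800f8000800080018000800180018000800380008001800180008001800180008000800180038003800380038001800380018001800180018003800780078003800380038003800f800780078007800f800f801f803f,
    0x80008000800080008002800080008000800080028000800080028000800480008002800680008000800280008002800080008004800080028000800080008000800080008002800680068004800080008002800280028000800280048006800c80028006800680068018800c8008800e801a801e803c807e,
    0x8000800080008000800080008002800080008000800080008000800280008000800480088002800080008000800080008002800080008004800080008000800080028000800080088000800080008002800080028000800280048004800080008004800280068008800080088008800c8010801480208038,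
    0x800e7fff800280028004800180018005800080007fff80007ffe7fff7ffe80027ffe7ffc80057fff8001800080028000800180027fff8004800080007ffe7fff7fff80007fff800880017ffe7ffe7fff7ffe800180007fff800080007ffc80007ffe8001800380027ffe80027ffe80068004800a800e801c,
    0x87a180037ffd806981c18000800080007fff7ffd80038011801180038051800080118051800080007fff80007fff7fff80007ffd80007fff7fff80007fff7fff800080007fff7ffd80037ffd7ffd7fff7ffd7fff7fff7fff7fff7ffd7ff980117ffd800380037ffd805180117ff980118051806981c187a1,
    0x7fe47fff7ffc7ff67fe47fff80017fff80007ffc7ffd7ff87ff680017fe480008000800480017fff7fff800080007ffe80017ffc7fff80067ffe80007ffc7fff800180007ffd801c7fff7ff67ff67fff7ff880017ffe8001800480007fe47ff87ffe8001800f80167fe4801680048040806480be81e48604,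
    0x8054800080047ffd7ffa80008000800c800080027fff7ffe7ffd80007ff4800280007ffa800c7ffe80008000800280018000800480008009800180007ffe80007ffe80007fff802280007ffd7ffd7fff80008000800180007ffc7ffe7ffa7ffe7ffd800080037ffd7ff47ffd7ff480107ffa802d8054817a,
    0x800180018001800180018001800180018001800180018001800180018001800180018001800180018001800180018001800180018001800180018001800180018001800180018001800180018001800180018001800180018001800180018001800180018001800180018001800180018001800180018001,
    0x7fff7fff7fff7fff80017fff80017fff7fff80017fff8001800180017fff7fff7fff800180017fff80017fff8001800180017fff7fff7fff800180018001800180018001800180017fff7fff7fff7fff7fff7fff7fff7fff7fff80018001800180018001800180017fff7fff7fff7fff800180017fff8001,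
    0x7ff97fff7ffd7ffc7ffb7ffe7ffe80027fff7fff7ffe7ffd7ffe7fff7ffd80017fff7fff800280008001800080018000800180017fff80027ffe7fff7fff7fff8000800080008003800180007ffe80007fff800180007fff800180017fff8001800080018002800280018002800180038003800480058007,
    0x80158000800580068009800380038003800180018001800380008000800180017fff7ffd80037fff80008000800180008000800180008002800280017fff80007fff80007fff800580007ffe80007fff7fff8000800080007fff7fff7ffd7fff7ffe8000800180007ffd80007ffd80038001800680098015,
    0x80078001800380047ffb80027ffe7ffe80017fff80027ffd7ffe7fff80037fff80017fff80028000800180008001800080017fff80017ffe7ffe7fff7fff7fff80008000800080037fff80008002800080017fff800080017fff80017fff800180008001800280027fff7ffe7fff7ffd800380047ffb8007,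
    0x801b800080038009800f8000800080007fff7fff800280058003800080077fff800180038000800080007fff7fff7fff80007fff8000800180017fff8001800080007fff800080038000800180038000800180007fff800080018001800380018001800080028003800380038003800580078009800f801b,
    0x7feb80007ffb7ffa80097ffd80037ffd7fff80017fff8003800080007fff7fff80017ffd80038001800080008001800080007fff80007ffe800280017fff80007fff80007fff80058000800280008001800180008000800080017fff7ffd7fff7ffe8000800180008003800080037ffd800180067ff78015,
    0x7feb80007fff7ffa7ff5800180037ffd800180017fff7ffd7ffe80027ffb7fff800380057fff7fff7ffe80007fff800080007fff80008000800080017fff8000800180007fff80017ffe7ffe7ffe80017fff800080008002800180017ffd7ffd80028000800180027ffb80028003800380058006800b8015,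
    0x802380027fff8005800f7fff7fff7fff800180038000800180038002800780008005800b7fff7fff80008000800180017fff80037fff7fff7fff80007fff80007fff800080007fff800280017fff800080018000800180007fff8001800380058001800280007fff800b80038003800180078005800f8023,
    0x7fe580007ffd7ff7800f80008000800080017fff7ffe8005800380007ff980017fff800380008000800080017fff7fff8000800180007fff80017fff8001800080007fff8000800380007fff7ffd80007fff8000800180007fff80018003800180018000800280037ffd7ffd7ffd7ffb800780097ff1801b,
    0x7fc87ffe80007ff57fe8800280027ffe800080007fff7ffc7ffd7ffe7ff87fff7ffc7ff87ffe80008000800080007fff7fff800080017fff80018001800080008000800080018000800280017fff7fff800080008001800080008000800080047fff80028001800180088003800080048008800b80188038,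
    0x80158000800180067ff57fff800380037fff800180017ffd7ffe8002800580017ffd80057fff80017ffe80007fff80008000800180008000800080017fff8000800180007fff80018002800280027fff8001800080007ffe7fff80017ffd7ffd800280008001800280057ffe7ffd7ffd800580067ff58015,
    0x7fdd7ffe80017ffb800f80017fff80017fff800380008001800380027ff980007ffb800b7fff800180008000800180017fff7ffd800180017fff80007fff80007fff800080007fff7ffe7fff800180007fff80007fff800080018001800380058001800280007fff7ff57ffd7ffd7fff800780057ff18023,
    0x807880008000800f80287ffe7ffa7ffa800080008000800480017ffe800880007ffc7ff87ffe80007ffe8001800080018000800080007fff7fff80008000800080008001800080007ffe7fff800180008000800080017ffe8000800080007ffc7fff8000800080017ff88001800080048008800f80288078,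
    0x7f88800080007ff1802880027ffa8006800080008000800480017ffe7ff8800080047ff87ffe80007ffe7fff8000800180008000800080017fff8000800080008000800180008000800280017fff8000800080007fff80028000800080007ffc7fff80008000800180087fff80007ffc8008800f7fd88078,
    0x7f9780037ffb7ff17fdd7fff7ffd80038001800180007ffb800180017ffb80008001800180018001800180007fff800180007fff800080017fff8000800180017fff8000800080057fff80017fff800080017fff7fff7fff7fff7fff80017fff7fff7ffd800080017fff7fff7fff80058005800f80238069,
    0x7f43800080037ff77fcd8000800080007fff7ffd800180017ffd80007ff380017fff7ffd8000800080008000800180018000800380007fff80017fff80018000800080007fff7ffd80007fff800380017fff80007fff80007fff80017ffd8001800180007fff7ffd8003800380037fff800d8009803380bd,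
    0x803880028000800b7fe87ffe800280028000800080017ffc7ffd7ffe8008800180047ff87ffe80008000800080007fff7fff80007fff8001800180018000800080008000800180007ffe7fff80018001800080007fff800080008000800080047fff8002800180017ff87ffd80007ffc8008800b7fe88038,
    0x80d280007ffe800f80327fff8003800380007ffe800080027fff800280028000800280027fff80018002800080007fff80007ffe80007fff7fff8000800080008001800080007ffe80027fff7fff80007ffe80007fff800280007ffe7ffa80027fff800080007fff80027fff7ffa80028002800f803280d2,
    0x7f2e800080027ff18032800180037ffd80007ffe800080027fff80027ffe80007ffe80027fff7fff8002800080007fff80008002800080017fff8000800080008001800080007ffe7ffe8001800180008002800080017ffe80007ffe7ffa80027fff800080007fff7ffe800180067ffe8002800f7fce80d2,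
    0x7f43800080037ff77fd98000800080007fff800180017fff800380007fff800180058015800080008000800080017fff80007fff80007fff80017fff7fff80008000800080017ffd80007fff7ffd7fff800180008001800080017fff7ffd7ffb800180007fff80037feb7ffd8003800180018009802780bd,
    0x7fdd7ffe7ff97ffb7ffb7ffd7fff80017fff7fff80007fff80018000800580008001800380037fff7ffe800080017fff7fff8001800180017fff800080018000800180008000800780007fff8003800080018000800180027fff7fff80037fff8001800280007ffd7ffd7fff7ffd80017ffb800580058023,
    0x80697ffd8005800f7fdd80017ffd7ffd7fff800180007ffb80018001800580007fff800180017fff800180007fff80018000800180007fff7fff8000800180017fff80008000800580017fff800180007fff80018001800180017fff80017fff7fff7ffd800080018001800180017ffb8005800f7fdd8069,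
    0x80bd80008009800980158000800080007fff80017fff80017ffd80007ff57fff80017ffd80008000800080007fff8001800080018000800180017fff7fff80008000800080018009800080017ffd800180018000800180007fff80017ffd8001800180007fff7ffd7ffd7ffd7ffd80017ff58009801580bd,
    0x7f4380007ff77ff7801580008000800080018001800180017ffd8000800b80017fff7ffd80008000800080007fff800180007fff80007fff80017fff7fff8000800080008001800980007fff80037fff7fff80007fff8000800180017ffd8001800180007fff7ffd8003800380037fff7ff580097feb80bd,
    0x80a87ffd800080068028800280068006800080007ffe80007ffe7fff800880018000800880028000800180008000800080008000800080008000800180007fff80008000800080007fff80028002800080007fff80008001800080008008800080027ffd7ffe800280087ffe8008800080088006802880a8,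
    0x80bd80007ffd80097fcd80008000800080017ffd7fff80017ffd8000800d7fff80017ffd80008000800080008001800180007ffd8000800180017fff80018000800080007fff7ffd800080017ffd7fff8001800080018000800180017ffd8001800180007fff7ffd7ffd7ffd7ffd8001800d80097fcd80bd,
    0x819580007ffd8000802d8000800080008001800580007ffd800080007ffd80007ffd7fe58000800080007fff800180008000800580008000800080008001800080007fff80007ffd80008000800080008001800080008000800180017ffd7ffd80008000800080007fe580007ffd7ffd7ffd8000802d8195,
    0x7e6b800080038000802d8000800080007fff800580007ffd800080008003800080037fe580008000800080018001800080007ffb80008000800080008001800080007fff80007ffd80008000800080007fff8000800080007fff80017ffd7ffd8000800080008000801b8000800380037ffd80007fd38195,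
    0x7ee87fff80007ff67fd88002800a7ff68000800080008000800280018008800080007ff87ffe80007fff800080008000800180007fff80008000800080007fff80008000800080007fff800280028000800080018000800180008000800880007ffe800180007ffe80087ffe7ff880007ff8800a80288118,
    0x7f58800380007ffa80287ffe80067ffa80008000800280007ffe7fff7ff87fff8000800880028000800180008000800080008000800080008000800180007fff800080008000800080017ffe7ffe80008000800180007fff800080008008800080027ffd7ffe80027ff880027ff88000800880067fd880a8,
    0x80238002800780057ffb80037fff7fff80017fff80007fff800180007ffb80007fff8003800380017ffe800080017fff7fff7fff7fff7fff7fff8000800180008001800080008007800080017ffd80007fff80007fff7ffe80017fff80037fff8001800280007ffd8003800180037fff7ffb80057ffb8023,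
    0x811880018000800a7fd87ffe800a800a8000800080008000800280017ff8800080007ff87ffe80007fff80008000800080018000800180008000800080007fff800080008000800080017ffe7ffe800080007fff80007fff80008000800880007ffe800180007ffe7ff88002800880007ff8800a7fd88118,
    0x80bd80007ffd80097fd9800080008000800180017fff7fff8003800080017fff7ffb8015800080008000800080017fff800080018000800180017fff7fff80008000800080017ffd80008001800380017fff80007fff80007fff7fff7ffd7ffb800180007fff8003801580037ffd7fff800180097fd980bd,
    0x7eb0800080007ffa7ff080027ffa8006800080007fff800080027ffe80107fff800080107ffe8000800280008000800080008000800080008000800180008000800080007fff800080027ffe800280018000800080007ffe80008000800080008002800080017ffe7ff07ffe800080007ff0800680108150,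
    0x806980037ffd800080198002800680067fff7ffd80007ffd80047fff800980007ffd7ff980028000800180007fff800080007ffd80008000800080007fff80018000800080007ffd7fff80007ffc800080018001800080017fff800180017ffd8000800380007ffc7ff9800480017ffd8009800080198069,
    0x7f977ffd8003800080197ffe80067ffa80017ffd80007ffd80047fff7ff7800080037ff980028000800180007fff80008000800380008000800080007fff80018000800080007ffd80018000800480007fff7fff80007fff8001800180017ffd8000800380007ffc80077ffc7fff8003800980007fe78069,
    0x7ec58000800580007fd37ffd7ff780098001800380008003800080007ffd80007ffd7feb80037fff800080007fff800080007ffd80008000800080007fff80008001800080007ffb8000800080008000800180008000800080017fff800380038000800080008000801580007ffd7ffd80038000802d813b,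
    0x81a480037ffc8000801480017ffd7ffd80007ffc800080007ffc80017ff480008000800480017fff7fff80008000800080007ffc8000800080008000800080017fff800080007ffc80018000800480008000800180007fff8000800080048000800080038000800480047ffc800480007ff48000801481a4,
    0x7e5c7ffd8004800080147fff7ffd800380007ffc800080007ffc8001800c800080008004800180017fff800080008000800080048000800080008000800080017fff800080007ffc7fff80007ffc800080007fff80008001800080008004800080008003800080047ffc80047ffc80007ff480007fec81a4,
    0x7e8680007ffa80097fe280008000800080007ffe80028002800380007ffe7fff7ffe7ffa800080008000800080007fff80008002800080017fff8001800080008000800080008006800080017ffd80007ffe800080018000800080027ffa80027fff80007ffe800380067ffd80067ffe80027ff7801e817a,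
    0x81508000800080067ff07ffe7ffa7ffa800080008001800080027ffe7ff08001800080107ffe8000800280008000800080008000800080008000800180008000800080007fff80007ffe80027ffe7fff800080008000800280008000800080008002800080017ffe80108002800080007ff080067ff08150,
    0x81187ffe80007ffb802880007ff87ff88000800080007ffc800180008008800080048018800080007ffe800080007fff80018000800180018001800080008000800080008000800080007fff7ffd8000800080007fff7ffe80008000800080047fff7ffe80007ffd8018800180007ffc80087ffb80288118,
    0x7ee8800280008005802880007ff880088000800080007ffc800180007ff880007ffc8018800080007ffe800080007fff800180007fff7fff800180008000800080008000800080008000800180038000800080008001800280008000800080047fff7ffe80007ffd7fe87fff8000800480087ffb7fd88118,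
    0x813b80007ffb80007fd380037ff77ff77fff800380008003800080008003800080037feb80038001800080007fff80008000800380008000800080007fff80008001800080007ffb80008000800080007fff8000800080007fff7fff8003800380008000800080007feb800080038003800380007fd3813b,
    0x7fba7fff7ffe80057ff6800180077ff980008002800080027fff7fff7ffa80007ffe7ff67fff80017fff800080007fff80017ffe7fff80017fff8000800080017fff80008000800280017ffd8001800080027fff8001800180007ffe7ffe80028003800180007fff800a800180027ffe80067ffb800a8046,
    0x817a800080067ff77fe280008000800080007ffe7ffe8002800380008002800180027ffa800080008000800080007fff80007ffe80007fff7fff800180008000800080008000800680007fff80038000800280007fff8000800080027ffa80027fff80007ffe80037ffa80037ffa800280027ff77fe2817a,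
    0x7e008004800080108000800080087ff8800080007ffe80008000800080008001800080008000800080007fff800080007fff80008001800080007fff80008000800080018000800080008000800080008000800080008000800080008000800080007ffc80028000800080008000800080007ff080008200,
    0x82007ffc80007ff0800080008008800880008000800280008000800080007fff800080008000800080008001800080007fff80007fff800080007fff80008000800080018000800080008000800080008000800080008000800080008000800080007ffc80028000800080008000800080007ff080008200,
    0x806980037ffd800080058002800680067fff800180007fff80027fff7ffd800080038011800280007fff80007fff800280008001800080008000800080017fff8000800080007ffd7fff8000800280007fff7fff80027fff80017fff7ff980038000800380008002801180027ff97fff7ffd800080058069,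
    0x80d2800380067ff1800a7ffe7ffa7ffa80007ffe80007ffe80018001800a80007ffe7ff27ffe8000800180008000800180007ffe800080018001800080007fff800080008000800680018001800180007ffe7fff8001800180007ffe80027ffe80018003800080017ff2800180027ffe800a7ff1800a80d2,
    0x7f2e7ffd7ffa800f800a80027ffa800680007ffe80007ffe800180017ff6800080027ff27ffe800080018000800080018000800280007fff8001800080007fff80008000800080067fff7fff7fff8000800280017fff7fff80007ffe80027ffe8001800380008001800e7fff7ffe8002800a7ff17ff680d2,
    0x8046800180027ffb7ff67fff8007800780008002800080027fff7fff8006800080027ff67fff7fff7fff800080007fff8001800280017fff7fff8000800080017fff8000800080027fff80037fff80007ffe80017fff7fff80007ffe7ffe80028003800180007fff7ff67fff7ffe800280067ffb7ff68046,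
    0x7f288000800080097fe8800080008000800080007fff80047ffd80007ff87fff8004801880008000800080018000800180008000800080017fff80018000800080007fff800180008000800180037fff800080007fff80008000800080007ffc7fff800080017ffd7fe8800380007ffc80087ff7801880d8,
    0x80d8800080007ff77fe880008000800080008000800180047ffd8000800880017ffc80188000800080007fff800080018000800080007fff7fff80018000800080007fff8001800080007fff7ffd800180008000800180008000800080007ffc7fff800080017ffd80187ffd8000800480087ff77fe880d8,
    0x7f977ffd8003800080057ffe80067ffa8001800180007fff80027fff800380007ffd8011800280007fff80007fff800280007fff800080008000800080017fff8000800080007ffd800180007ffe8000800180017ffe80017fff7fff7ff9800380008003800080027fef7ffe800780017ffd80007ffb8069,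
    0x7ff17ffd800180007ffb7fff7ffd800380018003800080017ffe80017ffd8000800380078001800180017fff7fff7ffe80007ffd800080008000800080017fff7fff800180007fff7fff8000800280007fff800180027fff7fff80017fff7ffd8000800380007ffe7ff9800280017fff800380008005800f,
    0x8054800380047ffa80047fff80038003800080047fff80007ffe7fff80047fff800080147fff80018001800080008000800080048000800080007fff80008001800180007fff80047fff7ffe80027fff800080018000800180008000800480007ffe80037fff800280147ffe8004800080047ffa80048054,
    0x800f80037fff80007ffb80017ffd7ffd7fff8003800080017ffe8001800380007ffd800780017fff800180017fff7ffe80008003800080008000800080017fff7fff800180007fff800180007ffe800080017fff7ffe8001800180017fff7ffd8000800380007ffe80077ffe7fff8001800380007ffb800f,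
    0x7fac7ffd7ffc80068004800180037ffd80008004800180007ffe7fff7ffc8001800080147fff7fff800180008000800080007ffc8000800080007fff80008001800180007fff8004800180027ffe800180007fff80007fff80008000800480007ffe80037fff80027fec80027ffc800080047ffa7ffc8054]
/-- certificates for `E_7` -/
def certs7 : List (List ℕ) :=
  [[67174400],
    [67174401],
    [67174402, 67043338],
    [67174406, 67043340],
    [67177483],
    [67177484, 67043338, 67043341],
    [67177739],
    [67174405, 67043338, 67043340, 67043343],
    [67174403, 67043338, 67043343],
    [67177996, 67043339, 67043344],
    [67174404, 67043338, 67043340, 67043343, 67043346],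
    [67178763],
    [67179019],
    [67178764, 67043343],
    [67178766, 67043347],
    [67178252, 67043340, 67043345, 67043348],
    [67179020, 67043348],
    [67179531],
    [67179532, 67043343, 67043346, 67043351],
    [67179534, 67043347, 67043350, 67043352],
    [67174408, 66912268, 66912273, 66977805, 66977807, 66977812, 66977817, 66977815, 67043354, 66977820],
    [67177740, 67043340, 67043353],
    [67178254, 67043342, 67043349, 67043355],
    [67178253, 67043341, 67043343, 67043351, 67043356],
    [67178256, 67043344, 67043347, 67043352, 67043357],
    [67178255, 67043338, 67043341, 66977807, 67043346, 66977815, 67043356],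
    [67179022, 67043355],
    [67179021, 67043351, 67043356],
    [67179024, 67043352, 67043357],
    [67177745, 67043348, 67043353],
    [67179279, 67043339, 67043344, 66977811, 67043350, 66977816, 67043357],
    [67177742, 67043342, 67043360],
    [67178513, 67043355, 67043360],
    [67179281, 67043342, 67043349, 67043355, 67043360, 67043364],
    [67179533, 67043345, 67043348, 67043353, 67043354, 67043358, 67043367],
    [67179537, 67043341, 67043343, 66977815, 67043363, 67043356, 67043365],
    [67179541, 67043344, 67043347, 66977816, 67043368, 67043357, 67043366],
    [67179535, 67043340, 67043345, 66977812, 66977817, 66977818, 67043358, 67043367],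
    [67182092, 67043351, 67043363, 67043356, 67043365],
    [67182094, 67043352, 67043368, 67043357, 67043366],
    [67182349, 67043340, 67043344, 67043359, 67043353, 67043362],
    [67182353, 67043361, 67043356],
    [67179023, 67043343, 67043346, 67043373, 67043351, 67043363, 67043356],
    [67179027, 67043347, 67043350, 67043374, 67043352, 67043368, 67043357],
    [67179539, 67043342, 67043349, 66977819, 66977824, 67043371, 66977828, 67043370],
    [67179538, 67043340, 66977812, 67043353, 66977818, 67043367, 66977839, 67043378],
    [67183116, 67043369, 67043360, 67043361, 67043370, 67043379],
    [67182093, 67043348, 67043353, 66977818, 67043358, 66977831, 66977839, 67043372, 67043378, 67043366, 67043377],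
    [67185676, 67043361, 67043356, 67043370, 67043379, 67043365, 67043376],
    [67174407, 67043341, 66977807, 66977810, 67043373, 66977815, 67043363, 66912284, 66977844],
    [67180306, 67043341, 67043343, 66977837, 66912279, 66977827, 67043361, 66977820, 67043380, 66912293, 67043376,
    67043386],
    [67180562, 67043344, 67043347, 66977838, 66912280, 66977832, 67043362, 66977821, 67043381, 66912294, 67043377,
    67043385],
    [67179542, 67043342, 66977819, 67043360, 66977828, 67043370, 66977846, 67043384],
    [67181069, 67043348, 67043353, 66977818, 66977822, 66977831, 66977839, 67043372, 67043378, 67043377, 67043385],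
    [67181072, 67043355, 67043360, 66977835, 66977828, 66977834, 66977846, 67043379, 67043384, 67043376, 67043386],
    [67181839, 67043344, 67043347, 67043350, 67043374, 66912280, 66977832, 66977826, 66846749, 66977845, 67043372,
    66912294, 66977841, 67043385],
    [67179025, 67043345, 67043353, 67043354, 67043358, 67043391],
    [67179026, 67043338, 67043343, 66977810, 67043387, 67043363, 67043356, 66977844],
    [67180049, 67043349, 67043360, 67043371, 67043364, 67043392],
    [67180050, 67043339, 67043347, 66977814, 67043393, 67043368, 67043357, 66977845]]
/-- data for `E_7` -/
def dat7 : Dat where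
  m := 60
  N := 2903040
  wd := [0x1, 0xe, 0x42, 0x66, 0x363, 0x20c, 0x2f5, 0x266, 0x18ca, 0x16ac, 0x16b5, 0x1426, 0x1666, 0x12a6, 0x1566,
    0x9423, 0x82b5, 0x94f5, 0xb535, 0x88ce, 0x82d6, 0x82a6, 0xb2a6, 0x972e, 0x4b29c, 0x595ac, 0x427ac, 0x4c685,
    0x41b1e, 0x414e6, 0x4266e, 0x4a12e, 0x20a663, 0x20a8f5, 0x2a329e, 0x12d08ec, 0x128331e, 0x14cc66e, 0x85ac653,
    0x598ec656, 0x2e3363435, 0x1519563283, 0x12994e329c, 0xa654653b19, 0xa0ca1633ac, 0x94ca7194e6, 0x42654653b19,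
    0x532a329eb19, 0x4a6a328351e, 0x25351941ab1e, 0x14ca8ca72c675, 0x84ca8ca72c675, 0x8299423b19d6329c,
    0x14e329cb1941a8cd8d0, 0xa7194e6b1941a8cd8d0, 0x4a6538ca72c6539758ca72e, 0x20a6538ca72c6539758ca72e,
    0x966329cb1941a8cdd6328352e, 0x2506538ca763283519b1a1ac6506a33634358ca,
    0x20a0ca0d46506a3363283519b1a1ac6506a33634358ca72e]
  cent := [2903040, 46080, 4320, 3072, 384, 768, 288, 9216, 288, 60, 216, 96, 384, 768, 64, 32, 72, 48, 24, 64, 20, 288,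
    96, 72, 768, 20, 14, 24, 24, 32, 30, 48, 48, 18, 256, 18, 48, 32, 14, 72, 24, 144, 9216, 384, 30, 3072, 72,
    288, 384, 60, 256, 32, 1296, 1296, 144, 46080, 4320, 768, 216, 2903040]
  bs := [0x106020003010504, 0x101020003060405, 0x100060204050103, 0x101060205040003, 0x106030500020104,
    0x104010500030602, 0x106050403020100, 0x101040605000302, 0x106050403020100, 0x106000403050201,
    0x106050403020100, 0x106050403020100, 0x106050403020100, 0x101040206050003, 0x106050403020100,
    0x106050403020100, 0x106050403020100, 0x102010500040306, 0x102040305010006, 0x101060304000205,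
    0x106050403020100, 0x106000104050203, 0x106050403020100, 0x106050403020100, 0x104020600010503,
    0x106050403020100, 0x104060301020500, 0x106050403020100, 0x106050403020100, 0x106050403020100,
    0x105000301020406, 0x106050403020100, 0x106050403020100, 0x106020005040103, 0x104060301050200,
    0x106050403020100, 0x106040105000203, 0x101030602040005, 0x106050103040200, 0x104060501020300,
    0x1060504030201001608, 0x104010205000306, 0x103040102000506, 0x106050403020100, 0x103060205040001,
    0x106040302010005, 0x106050403020100, 0x106020405010003, 0x104020600010503, 0x102060401050003,
    0x102040503000601, 0x106000201050403, 0x106050403020100, 0x102040301050006, 0x101000605030204,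
    0x1060504030201003c23, 0x101060004050302, 0x100060205040103, 0x106050403020100, 0x106040503010002]
  cols := [0x800000000000000000000000000000000000000000000000000000000000,
    0x7ffffeeeed738d28a2460810204080000000000000000000000000000000,
    0x111128c72d75db9f7efdfbf7f00000111128c72d75db9f7efdfbf7f, 0x7ffffeeeed738d28a2460810204080,
    0x800000000000000000000000000000]
  mA := 0x111128c72d75db9f7efdfbf7f00000111128c72d75db9f7efdfbf7f
  mB := 0x7ffffeeeed738d28a2460810204080000000000000000000000000000000
  rows := rows7
  certs := certs7

theorem chkTab7 : chkTab dat7 = true := by decide +kernel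
theorem chkNorm7 : chkNorm dat7 = true := by decide +kernel
theorem chkReg7 : chkReg dat7 = true := by decide +kernel
theorem chkMasks7 : chkMasks dat7 7 = true := by decide +kernel
theorem chkRows7 : chkRows dat7 dat7.certs 10 = true := by decide +kernel
theorem chkCls7 : allN 60 (fun c => chkCls dat7 7 c) = true := by decide +kernel

/-! ### The table for `E_8` -/

/-- data for `E_8` -/
def rows8 : List ℕ :=
  [0x8001800180018001800180018001800180018001800180018001800180018001800180018001800180018001800180018001800180018001800180018001800180018001800180018001800180018001800180018001800180018001800180018001800180018001800180018001800180018001800180018001800180018001800180018001800180018001800180018001800180018001800180018001800180018001800180018001800180018001800180018001800180018001800180018001800180018001800180018001800180018001800180018001800180018001,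
    0x8001800180018001800180017fff80018001800180018001800180017fff800180017fff80017fff7fff80018001800180017fff7fff80018001800180017fff7fff800180017fff7fff8001800180017fff7fff7fff7fff800180018001800180017fff7fff7fff7fff8001800180017fff7fff800180017fff7fff7fff7fff800180018001800180017fff7fff7fff7fff7fff7fff7fff7fff7fff7fff8001800180018001800180018001800180018001800180017fff7fff7fff7fff7fff7fff7fff7fff8001800180018001800180017fff7fff7fff800180017fff8001,
    0x7ff87fff7ffd7ffc7ffc7ffb7ffa7fff80007ffe7ffe800080008001800080047ffe7ffe7ffd7ffd7ffc7ffc80007fff7ffe7ffd7fff80027fff800080028000800380007fff7fff80007ffe800180007ffe7ffe7ffd7fff7ffe7ffd7fff800180007ffe8001800280008000800380008001800180008002800080008001800180017fff8001800280027ffe7fff80007fff7fff80027fff8000800080038000800180007ffe80007fff800180007fff80008001800480018000800080017fff8001800280028002800280008001800380038003800280048005800480068008,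
    0x8078800080038000800c8024804080038000800080068001800080038004800080028004800a80108014802080008000800080018001800080038000800080008001800080018002800280038000800480048006800680048008800c800880008006801080018001800c8000800380188000800180008002800080018000800180008000800280028003800180008000800180008004800180008001800680008001800080028001800280028002800280028003800c800480048004800480048002800480068006800880088008800a800c8010801080148024802080408078,
    0x8000800080008000800080008002800080008000800080008000800080028000800080028000800280008004800080008000800080028000800680008000800080028000800080008002800080008004800080008000800280028000800480008006800680008002800c8000800680188000800280008004800080008000800280008000800280048006800080008000800080008006800080008002800c8000800280008000800280028004800280008002800680188006800680048006800280048008800c800c800e8008800c80148018801e801a80288048803c807e80f0,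
    0x8000800080008000800080008002800080008000800080008000800080028000800080028000800280008004800080008000800080028000800680008000800080028000800080008002800080008004800080008000800280028000800480008006800680008002800c8000800680188000800280008004800080008000800280008000800280048006800080008000800080008006800080008002800c8000800280008000800280028004800280008002800680188006800680048006800280048008800c800c800e8008800c80148018801e801a80288048803c807e80f0,
    0x801c80028005800a8008800a800e7fff8004800380018000800280017fff800a800280028003800280068004800080018002800580018003800180018002800280057ffe8000800080008001800080008001800080047fff800080027ffe80017fff7ffe800180027ffe7fff80057ffc80007fff8000800180017fff80018000800280008000800280018002800180007fff8000800280007fff7fff80047fff800080008001800080007fff7ffe7fff7fff7fff80087fff7fff7ffe7ffe7ffe800080018000800180007ffc7ffe8003800280027ffe8006800a8004800e801c,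
    0x9be47ffa80038000803c827687c480037fc48000800f8000800080038005800080007ffc802d806e80b881c48000800080007fff7fff800080037ffd80007ff07fff800080007ffe8000800380007ffc8005800c800e800380108036800e8000800f80447fff800080388000800380e480007fff80007fff7fff7fff7fff80007ffa80007ffe8000800380007fff80007fff80007ffc80007fff7fff800e7ffd80007ffc7fff80007ffe7ffd7ffc7ffd7fff8003803c800380057ff87ff67ff67ffe8005800c800f80107fe4800e802d8036806e804480b8827681c487c49be4,
    0x7f8880007ffd80007ff47fdc7f8a7ffd800080007ffa7fff80007ffd7ffc80007ffe7ff67ff67fde7fe27f908000800080007ffd7fff8000800f800080007ffe7fff80007fff7ffa80007ffd80007ffc7ffa7ff47ffa7ff87fe47fdc7fe48000800c7f9a7ffd8001802a8000800f80a880007fff8000800280007ffd80008001800080007ffc8006800f7fff800080007ffd800080067fff7ffe7fff80427ffa80017ffc7ffa80017ffc7ffe7ff67ff67ffc800f81148008800c7fea7fee7fde8002801a803c804280447fa8802480be80fc819e80da830289fc86909e8af008,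
    0x817a8001800c802d8022802d80547ffe7ffa8003800080007ffd80008000802d8002800480037ffd80107ffa7ffe80008001800c800080038000800080018000800c7ffd80008001800080008000800280007ffc80097fff7ffe7ffd7ffd800080007ff48000800280007fff800c7ffa7fff7ffe800180008000800080018000800180008001800280008002800180007ffe7fff800480008000800080098000800080028000800080017fff7ffe7fff80007ffe80227fff800080007ffd7ffd800180007ffc80007ffe7ffa7ffd80037ffd7ffd7ff48010802d7ffa8054817a,
    0x8001800180018001800180018001800180018001800180018001800180018001800180018001800180018001800180018001800180018001800180018001800180018001800180018001800180018001800180018001800180018001800180018001800180018001800180018001800180018001800180018001800180018001800180018001800180018001800180018001800180018001800180018001800180018001800180018001800180018001800180018001800180018001800180018001800180018001800180018001800180018001800180018001800180018001,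
    0x8001800180018001800180017fff80018001800180018001800180017fff800180017fff80017fff7fff80018001800180017fff7fff80018001800180017fff7fff800180017fff7fff8001800180017fff7fff7fff7fff800180018001800180017fff7fff7fff7fff8001800180017fff7fff800180017fff7fff7fff7fff800180018001800180017fff7fff7fff7fff7fff7fff7fff7fff7fff7fff8001800180018001800180018001800180018001800180017fff7fff7fff7fff7fff7fff7fff7fff8001800180018001800180017fff7fff7fff800180017fff8001,
    0x7ff87fff7ffd7ffc7ffc7ffb7ffa7fff80007ffe7ffe800080008001800080047ffe7ffe7ffd7ffd7ffc7ffc80007fff7ffe7ffd7fff80027fff800080028000800380007fff7fff80007ffe800180007ffe7ffe7ffd7fff7ffe7ffd7fff800180007ffe8001800280008000800380008001800180008002800080008001800180017fff8001800280027ffe7fff80007fff7fff80027fff8000800080038000800180007ffe80007fff800180007fff80008001800480018000800080017fff8001800280028002800280008001800380038003800280048005800480068008,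
    0x801c80028005800a8008800a800e7fff8004800380018000800280017fff800a800280028003800280068004800080018002800580018003800180018002800280057ffe8000800080008001800080008001800080047fff800080027ffe80017fff7ffe800180027ffe7fff80057ffc80007fff8000800180017fff80018000800280008000800280018002800180007fff8000800280007fff7fff80047fff800080008001800080007fff7ffe7fff7fff7fff80087fff7fff7ffe7ffe7ffe800080018000800180007ffc7ffe8003800280027ffe8006800a8004800e801c,
    0x815e7fff80078023801a802380467fff7ff680007fff80007ffb7fff800180238000800280007ffb800a7ff67ffe7fff7fff80077fff80007fff7fff7fff7ffe80077fff8000800180007fff800080027fff7ffc800580007ffe7ffb7fff7fff80017ff67fff80008002800080077ffe7fff7fff80017fff7fff8001800080007fff8000800180007fff8000800080007fff7fff800280008001800180058001800080027fff8000800180008000800080017fff801a8000800180027fff7fff80017fff7ffc7fff7ffe7ffe7fff80007ffb7ffb7ff6800a80237ff68046815e,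
    0x7ff87fff7ffd7ffc7ffc7ffb80067fff80007ffe7ffe800080008001800080047ffe80027ffd800380047ffc80007fff7ffe8003800180027fff8000800280007ffd80007fff800180007ffe8001800080028002800380017ffe7ffd7fff8001800080027fff7ffe80008000800380007fff7fff80008002800080007fff7fff80017fff800180028002800280018000800180017ffe8001800080007ffd8000800180007ffe80007fff800180007fff8000800180047fff800080007fff80017fff7ffe7ffe8002800280008001800380037ffd7ffe7ffc800580047ffa8008,
    0x801c80028005800a8008800a7ff27fff8004800380018000800280018001800a80027ffe80037ffe7ffa80048000800180027ffb7fff80038001800180027ffe7ffb7ffe8000800080008001800080007fff80007ffc8001800080027ffe80017fff80027fff7ffe80027fff80057ffc80008001800080017fff80017fff8000800280008000800280017ffe7fff8000800180007ffe8000800180017ffc7fff800080008001800080007fff7ffe7fff7fff7fff80088001800180028002800280007fff8000800180007ffc7ffe800380027ffe80027ffa800a80047ff2801c,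
    0x80237ffe800380058007800e801580017ffb800080027fff7ffd7fff8000800580018001800580068009800b7fff7fff800180037fff80007fff7ffe80017ffd80038001800080007fff800280007fff80028003800480018003800680027fff800080057fff80018001800080038003800080017fff80027ffe80007fff80007ffe800080008001800280017fff7fff8001800080018000800080008004800080007fff80027fff800080018001800180008001800780018000800180028002800080028003800280038003800280058006800680058009800e800b80158023,
    0x805480017fff7ffa80048015802a800180047fff800380018002800380037ffa8000800280048009800a8014800080007ffe7ffd80017fff800380017ffe80027ffd7ffe80008001800280007fff8004800180028001800280048005800580008005800a80017fff800a7fff7fff80147fff7fff80007fff800180008000800080017fff8001800080007fff800080007fff7fff800280007fff800080017fff800080007fff80018001800080008000800180018004800280038002800180018001800180028003800480048005800480058009800a800a80158014802a8054,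
    0x80237ffe800380058007800e7feb80017ffb800080027fff7ffd7fff8000800580017fff80057ffa7ff7800b7fff7fff80017ffd800180007fff7ffe800180037ffd8001800080008001800280007fff7ffe7ffd7ffc7fff8003800680027fff80007ffb80017fff7fff80008003800380007fff7fff800280028000800180007ffe80008000800180027fff800180017fff80007fff8000800080007ffc800080007fff80027fff80008001800180018000800180077fff80007fff7ffe7ffe80007ffe7ffd8002800380038002800580067ffa7ffb7ff7800e800b7feb8023,
    0x815e7fff80078023801a80237fba7fff7ff680007fff80007ffb7fff7fff802380007ffe800080057ff67ff67ffe7fff7fff7ff9800180007fff7fff7fff80027ff97fff80007fff80007fff80008002800180047ffb80007ffe7ffb7fff7fff8001800a800180007ffe800080077ffe8001800180017fff80017fff800080007fff8000800180007fff800080008000800180017ffe80007fff7fff7ffb8001800080027fff8000800180008000800080017fff801a80007fff7ffe800180017fff800180047fff7ffe7ffe7fff80007ffb8005800a7ff680237ff67fba815e,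
    0x82377ffd80008000800f805180bd80007ff77ffd8000800180008000800080007fff7ffd80078009801d8027800380008000800080007ffd8000800080007ffd8000800080007fff8001800080007fff8000800180037fff7fff80097ffd800080007ffd80007fff7ffd800180007ff78001800080008000800080007fff80007ffd80007fff7fff80007fff7fff8001800080017ffd8000800080008003800080007fff800080017fff7fff7fff7fff80008000800f7fff80007ffd7ffd7ffd7fff8000800180007fff7ff77ffd8007800980097ffd801d8051802780bd8237,
    0x7f908001800080047ff87fe17fc87ffe800080027ffc7fff80007ffc7ffe7ffc800080007ff97ff57ff07fe8800080018002800280027ffe800480007ffe80007ffe800080007fff80007fff7fff80007ffe7ffc7ffd7fff7ffc7ff77ffd7fff80007ff87ffe7fff80008000800080007fff80008000800080007fff7fff80007fff80017fff800080018001800180008000800180008000800080018003800080008000800080018001800180007fff80008002800880018002800080017fff800180028004800480048000800380078009800b80088010801f801880388070,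
    0x82377ffd80008000800f80517f4380007ff77ffd8000800180008000800080007fff800380077ff77fe38027800380008000800080007ffd800080008000800380008000800080017fff800080007fff80007fff7ffd80017fff80097ffd800080008003800080018003800180007ff77fff80008000800080008000800180007ffd80007fff7fff8000800180017fff80007fff80038000800080007ffd800080007fff800080017fff7fff7fff7fff80008000800f80018000800380038003800180007fff80007fff7ff77ffd800780097ff780037fe3805180277f438237,
    0x805480017fff7ffa800480157fd6800180047fff80038001800280037ffd7ffa80007ffe80047ff77ff68014800080007ffe80037fff7fff800380017ffe7ffe80037ffe80007fff7ffe80007fff80047fff7ffe7fff7ffe800480058005800080057ff67fff80017ff67fff7fff80148001800180007fff7fff80008000800080017fff800180008000800180008000800180017ffe8000800180007fff7fff800080007fff800180018000800080008001800180047ffe7ffd7ffe7fff7fff7fff7fff7ffe8003800480048005800480057ff77ff67ff6801580147fd68054,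
    0x7f6080027ffa7fec7ff07fde7fc0800280008000800280018000800280028014800080007ffb7ffc7ff07ff0800080017ffe7ff8800080007ffe800080028000800880008001800280007fff80008000800080007ffa800180007ffa80027fff800080008000800180008000800680008000800080008002800080017fff7fff7ffe80008000800080017fff80018000800080008000800180007fff800680007fff80007ffe7fff80007fff8000800180007ffe80107fff7ffe8000800080007ffe800080007ffe800080007ffe8005800680048000801080228010804080a0,
    0x7dd07ffe800380147ff87fb67f3c8001800080007ffe80018000800780027fec80007ffc7ffb7ff07fe87fc880007fff800280077ffd80007ff980007ffe80007ff980008000800080008001800080008000800080007fff7ffc7ffa7ffe800180007ff480037fff800080007ffd800080007fff80007ffe800080018001800080028000800280007fff80017fff8000800180008004800080007fff800080008000800080027fff7ffe7fff8000800180007fff800880017ffe8000800080008000800080008002800480008002800580068010800c8018804a803880c48230,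
    0x7f908001800080047ff87fe180387ffe800080027ffc7fff80007ffc80027ffc800080007ff9800b80107fe88000800180027ffe7ffe7ffe800480007ffe8000800280008000800180007fff7fff800080028004800380017ffc7ff77ffd7fff80008008800280018000800080008000800180008000800080008001800180007fff80017fff800080017fff7fff800080007fff8000800080007fff7ffd800080008000800080018001800180007fff8000800280087fff7ffe80007fff80017fff7ffe7ffc8004800480008003800780097ff57ff87ff0801f80187fc88070,
    0x80d280037ffe7ff18006802780548000800a800080037fff80017ffa7ffd7ff180008000800580098010801a7ffe80007ffd7ffa7ffe80007ffa80017ffd80047ffa8001800080017ffe800080007ffe8001800280017fff800280077fff80007ffb80047ffe7fff7ff880007ffe7ff27fff800080017fff8001800080018000800380007fff800080007fff8001800080007fff800080008001800080018001800080027fff7fff7fff8001800080017fff800080067fff7ffd8000800180018001800180028003800280027fff800580078009800480108027801a805480d2,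
    0x80d280037ffe7ff1800680277fac8000800a800080037fff80017ffa80037ff18000800080057ff77ff0801a7ffe80007ffd8006800280007ffa80017ffd7ffc8006800180007fff8002800080007ffe7fff7ffe7fff8001800280077fff80007ffb7ffc80028001800880007ffe7ff28001800080017fff7fff80007fff8000800380007fff8000800080017fff800080008001800080007fff80007fff8001800080027fff7fff7fff8001800080017fff800080068001800380007fff7fff7fff7fff7ffe8003800280027fff800580077ff77ffc7ff08027801a7fac80d2,
    0x7fc87ffd7ffa7ff07ff47ff57ff2800080007ffc7ffe7fff80007ffe7ffe80107ffe7ffe7fff80017ffc800480007fff80007ffc8000800480028000800080008004800080007fff800080017fff8000800080027ffd80018002800380018001800080068000800180008000800680007fff7ffe80007ffe80007fff80018000800380017fff80027fff7fff7fff800080028001800280008000800180038000800080008002800180017fff8000800180008000800c7fff800280007ffd8003800180007ffe80027ffe80007fff80017ffd7fff7ffa8004800b7ffc800e8038,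
    0x7f6080027ffa7fec7ff07fde804080028000800080028001800080027ffe8014800080007ffb800480107ff0800080017ffe8008800080007ffe8000800280007ff8800080017ffe80007fff800080008000800080067fff80007ffa80027fff8000800080007fff8000800080068000800080008000800280007fff800180017ffe800080008000800180017fff80008000800080007fff800080017ffa80007fff80007ffe7fff80007fff8000800180007ffe8010800180028000800080008002800080007ffe800080007ffe800580067ffc80007ff0802280107fc080a0,
    0x812c80028003801e8008801e805a7fff801480007ffa8000800680038000801e7ffe7ffe80008000800a80148000800080028009800180008003800280028006800980027fff7ffe80008000800080007ffe80008002800080008006800280008000800a80018000800280008003800c80008001800080028002800080007fff8002800080007ffe8000800080008000800180007ffe7fff80008000800280007fff800080028000800080008002800080007fff8008800080008002800480047ffe7ffe80007ffa8000800c8002800080068000800a800a801e8014805a812c,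
    0x7dd07ffe800380147ff87fb680c48001800080007ffe8001800080077ffe7fec800080047ffb801080187fc880007fff80027ff9800380007ff980007ffe80008007800080008000800080018000800080008000800080017ffc7ffa7ffe80018000800c7ffd8001800080007ffd80008000800180007ffe80007fff7fff800080028000800280007fff7fff800180007fff80007ffc800080008001800080008000800080027fff7ffe7fff8000800180007fff80087fff80028000800080008000800080008002800480008002800580067ff07ff47fe8804a80387f3c8230,
    0x862780027ffd7fd3800b805a813b7fff800f8000800080008003800980007fd38001800780008000800f800f7fff80007fff7ff780038000800980007fff80037ff7800380008000800180008000800380007ffd800080007fff7ffa7ffa800080007feb800380007ff780007ffd7fc7800080017fff8000800080008000800080028000800280018000800080007fff8001800080078000800080008000800080007fff80008000800280008001800080007fff800b800080007fff80008000800080007ffd80007fff7ff77ffa80007ffa80007feb800f805a800f813b8627,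
    0x862780027ffd7fd3800b805a7ec57fff800f8000800080008003800980007fd380017ff9800080007ff1800f7fff80007fff80097ffd8000800980007fff7ffd80098003800080007fff80008000800380008003800080007fff7ffa7ffa8000800080157ffd8000800980007ffd7fc780007fff7fff80008000800080008000800280008002800180008000800080017fff80007ff98000800080008000800080007fff80008000800280008001800080007fff800b8000800080018000800080008000800380007fff7ff77ffa80007ffa800080157ff1805a800f7ec58627,
    0x812c80028003801e8008801e7fa67fff801480007ffa8000800680038000801e7ffe8002800080007ff680148000800080027ff77fff80008003800280027ffa7ff780027fff80028000800080008000800280007ffe8000800080068002800080007ff67fff80007ffe80008003800c80007fff800080027ffe8000800080018002800080007ffe80008000800080007fff800080028001800080007ffe80007fff800080028000800080008002800080007fff8008800080007ffe7ffc7ffc8002800280007ffa8000800c80028000800680007ff67ff6801e80147fa6812c,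
    0x7c107ffe800380247ff87fa67f04800180007ffe8000800080007ff780007fdc800080047ffd80007fe87fe8800080008002800980038002800980007ffe80007ff78000800080008000800080018000800080008000800380047ffa800680008000800c7ffd8000800080007ffd80008000800180008000800080008001800080027fff7ffe8000800080007fff80007fff80007ffc8000800080008000800080008000800080008002800180007fff80007fff80087ffd800080008000800080008000800080007ffc80007ffa8003800680007ff48018805a801880fc83f0,
    0x8046800280068013800e800a80008002800680058004800080037ffe80008013800280008000800080007ff6800280017fff8000800080057ffe80007fff8000800080038000800080007ffe7fff7ffe80008000800080007ffe7ffa8002800180008000800080008000800180068006800080007fff7ffc800080008000800080027fff7ffe80027ffe8000800080008000800080008000800080008000800080007ffe7ffc80007ffe80008002800080008002800e8000800080008000800080008000800080047ffe8006800280007ffa800080008000800a7ff680008046,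
    0x7fc87ffd7ffa7ff07ff47ff5800e800080007ffc7ffe7fff80007ffe800280107ffe80027fff7fff8004800480007fff800080048000800480028000800080007ffc800080008001800080017fff800080007ffe80037fff800280038001800180007ffa80007fff80008000800680008001800280007ffe800080017fff8000800380017fff80027fff8001800180007ffe7fff7ffe800080007fff7ffd8000800080008002800180017fff8000800180008000800c80017ffe800080037ffd7fff8000800280027ffe80007fff80017ffd800180067ffc800b7ffc7ff28038,
    0x7af08003800080007fe87faf7f2880008000800680007fff8000800080008000800080007fff80097ff08018800080008000800080007ffa8000800080008000800080007fff7fff8000800080008000800080047ffd7fff80048009800380008000801880007fff80008000800080008001800080008000800080007fff80017ffd800080018000800080018001800080007fff80007fff800080008003800080018000800080017fff7fff800080018000800080188001800080007ffd8003800180007ffc80007ffc80007ffd80017ff77ff77fe8801080517fe880d88510,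
    0x7a88800180007fd880047fa17ea27ffe8000800080048000800080047ffe80288002800680007ffb7fec7fc480007fff7ffc7ff67ffe80007ffc800080048000800a800080008001800080018000800080027ffe8003800080027ff77ffd800180007ff6800280008000800080008000800180008000800080007fff800080007fff80007fff7ffe7fff80008000800080007fff7ffa8000800080017ffd800080008000800080008001800080008000800080027ffc8000800280007fff80017fff7ffe80027ffc7ffe80008003800080098005800a8014805f803c815e8578,
    0x7c107ffe800380247ff87fa680fc800180007ffe8000800080007ff780007fdc80007ffc7ffd800080187fe88000800080027ff77ffd8002800980007ffe8000800980008000800080008000800180008000800080007ffd80047ffa8006800080007ff480038000800080007ffd800080007fff80008000800080007fff800080027fff7ffe800080008000800180008001800080048000800080008000800080008000800080008002800180007fff80007fff80088003800080008000800080008000800080007ffc80007ffa800380068000800c7fe8805a80187f0483f0,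
    0x7af08003800080007fe87faf80d880008000800680007fff8000800080008000800080007fff7ff780108018800080008000800080007ffa8000800080008000800080007fff8001800080008000800080007ffc80038001800480098003800080007fe88000800180008000800080007fff8000800080008000800080017fff7ffd80008001800080007fff7fff80008000800180008001800080007ffd800080018000800080017fff7fff800080018000800080187fff8000800080037ffd7fff8000800480007ffc80007ffd80017ff7800980187ff080517fe87f288510,
    0x7a88800180007fd880047fa1815e7ffe8000800080048000800080048002802880027ffa8000800580147fc480007fff7ffc800a800280007ffc8000800480007ff6800080007fff80008001800080007ffe80027ffd800080027ff77ffd80018000800a7ffe800080008000800080007fff80008000800080008001800080007fff80007fff7ffe7fff800080008000800080018006800080007fff8003800080008000800080008001800080008000800080027ffc80007ffe800080017fff800180027ffe7ffc7ffe80008003800080097ffb7ff67fec805f803c7ea28578,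
    0x7cb87ffb7ffd7fc47fec7feb7f8280018000800080067fff80007ffd8000803c80027ffe800580097ffc7ffc8000800080027ff780018000800380007ffe80008009800080007fff8000800080008000800280027ffd7fff7ffe7ffd7fff800080007ff67fff7fff80008000800380007fff80018000800280008000800180008005800080017ffe800080017fff80007fff8001800280008000800080038000800080007ffe80017fff800180007fff80007fff801480018000800080057ffb80017ffe7ffe7ffa8002800080017ffb80037ff7800a800480158004807e8348,
    0x7e4080047ffa7fd47fe07fe480007ffe80007ffe7ffc8002800080028000802c8000800080028000800080208000800180028000800080027ffe80007ffe80008000800080008000800080028001800080008000800080008000800c7ffc7fff800080008000800080008000800680008000800080007ffc80008000800080007ffc7fff800080007ffe800080008000800080008000800080008000800080008000800080047ffe8000800280007ffe8000800280208000800080008000800080008000800080048000800080047ffe7ff4800080008000801c7fe0800081c0,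
    0x76a07ffc8003803c7ff07fc47f887fff800080007ffa8000800080037ffa7fc480007ff88000800080008050800080007ffe80037ffd80007ffd8000800280007ffd800080018000800080008000800080008000800080008000800c7ffc80008000801880038000800080007ffd800080008001800080028000800080007fff800480008000800080008000800080007fff80008008800180008000800080007fff80007ffe8000800080008000800080008001801080008006800080008000800080008000800680008000800480007ff480007fe88000803c7fb080788960,
    0x846e800080008051801e800080008000801e80048000800080098000800080517ffe80007ffa800080007fee800280007ffd800080008004800080007ffd800080007ffd800080008000800080017ffe8000800080008000800680008000800080008000800080008000800080007fee800080007fff800080008000800080008000800180007ffe80008000800080008000800080008000800080008000800080007ffe80008000800080027ffe800280008000801e80008000800080008000800080008000800080067fee80007ffa800080008000800080007fee8000846e,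
    0x86907ffc7ffe80068020803c800080027ff07ffb800680007ffe800680008006800080008000800080007fb0800080008002800080007ffb800680028002800080008002800080008000800080018000800080008000800080007fec800480007ffe80008000800080007fff7ffe80108000800080007ffe80008000800080007ffc800180008000800080008000800080008000800080008000800080007ffe800080007ffe800080008000800080007ffe8002802080008000800080008000800080008000800680008010800480007fec800080008000803c7fb080008690,
    0x7cb87ffb7ffd7fc47fec7feb807e80018000800080067fff80007ffd8000803c8002800280057ff780047ffc80008000800280097fff8000800380007ffe80007ff780008000800180008000800080007ffe7ffe800380017ffe7ffd7fff80008000800a80018001800080008003800080017fff80008002800080007fff80008005800080017ffe80007fff8001800080017fff7ffe8000800080007ffd8000800080007ffe80017fff800180007fff80007fff80147fff800080007ffb80057fff800280027ffa8002800080017ffb800380097ff67ffc801580047f828348,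
    0x834880047fff801e80107fe8805480017fd88000800380017ff680038003801e800080047ffb7ffa7ffc8018800080007ffe80037fff800080037fff7ffe7ffc800380028000800280008000800080007fff800080027fff80008008800080007fff80147fff7fff7ffc80007fff800880008001800080037fff800080018000800480008000800080007fff8001800080018000800480007fff800080027fff800080008003800180007fff80007fff7fff800180107fff80037ffc8002800280027fff800080038000800880007ffb80087ffa80147ffc7fe8801880548348,
    0x76a07ffc8003803c7ff07fc480787fff800080007ffa80008000800380067fc4800080088000800080008050800080007ffe7ffd800380007ffd8000800280008003800080018000800080008000800080008000800080008000800c7ffc800080007fe87ffd8000800080007ffd800080007fff80008002800080008000800180048000800080008000800080008000800180007ff87fff80008000800080007fff80007ffe8000800080008000800080008001801080007ffa800080008000800080008000800680008000800480007ff4800080188000803c7fb07f888960,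
    0x883480037ffe7fc4800c804b80d28000801480008003800080047ffa80037fc480007ffa80007ff1800a7fc48000800080007ffa7ffe80007ffa7fff800080027ffa7ffc800080017ffe800080007ffc80017ffe800180007ffc7ffb8003800080017ff27ffe8000800a80007ffe803480018000800080038001800080008000800380007fff80008000800080008000800080017ffa80007fff80008001800180008000800380007fff80008000800080018000800c80008003800280018001800180017ffe80037ffc8004800380007ffb7ff17ff2800a804b7fc480d28834,
    0x883480037ffe7fc4800c804b7f2e8000801480008003800080047ffa7ffd7fc4800080068000800f7ff67fc48000800080008006800280007ffa7fff80007ffe80067ffc80007fff8002800080007ffc7fff80027fff80007ffc7ffb800380008001800e800280007ff680007ffe80347fff8000800080037fff800080008000800380007fff8000800080008000800080007fff80068000800180007fff800180008000800380007fff80008000800080018000800c80007ffd7ffe7fff7fff7fff7fff800280037ffc8004800380007ffb800f800e7ff6804b7fc47f2e8834,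
    0x9000800080008040800080408200800080007ffc7ff87fff80007ff87ffc8040800080007ffc7ff080008000800080018000800880007ffc7ff88000800080008008800080018000800080017fff8000800080008000800280008000800080018000800080007fff8000800080008000800080008000800080007fff8000800180007fff8000800080017fff80008000800080008000800180007fff800080008001800080007fff800080008000800080008000800080027ffc8000800080008000800080007ff88000800080007ffc80007ff0800080008040800082009000,
    0x9000800080008040800080407e00800080007ffc7ff87fff80007ff880048040800080007ffc8010800080008000800180007ff880007ffc7ff88000800080007ff8800080018000800080017fff80008000800080007ffe80008000800080018000800080008001800080008000800080008000800080008000800180007fff80007fff8000800080018001800080008000800080007fff80008001800080008001800080007fff80008000800080008000800080007ffe80048000800080008000800080007ff88000800080007ffc8000801080008000804080007e009000,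
    0x834880047fff801e80107fe87fac80017fd88000800380017ff680037ffd801e80007ffc7ffb800680048018800080007ffe7ffd8001800080037fff7ffe80047ffd800280007ffe8000800080008000800180007ffe800180008008800080007fff7fec80018001800480007fff800880007fff80008003800180007fff80008004800080008000800080017fff80007fff80007ffc8000800180007ffe7fff800080008003800180007fff80007fff7fff8001801080017ffd80047ffe7ffe7ffe8001800080038000800880007ffb800880067fec80047fe880187fac8348,
    0x854080007ffe7fe88000805481508000800080047ffa7fff7ff87ffa80007fe8800080007fff8006801080408000800080007ffa7ffe80047ffa8000800080007ffa800080007ffe80008000800180007ffe80007ffe80018000800480048000800480107ffe8001801080007ffe80408000800080007ffe7ffe800080018000800080018000800080008001800180008000800080008000800080007ffe7ffe800080007ffe7fff80007fff80007fff8000800080008001800080007ffe7ffe7ffe7ffe80007ffa8000800080047fff80048006801080108054804081508540,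
    0x854080007ffe7fe8800080547eb08000800080047ffa7fff7ff87ffa80007fe8800080007fff7ffa7ff080408000800080008006800280047ffa800080008000800680008000800280008000800180008002800080027fff800080048004800080047ff080027fff7ff080007ffe80408000800080007ffe800280007fff8000800080018000800080007fff7fff800080008000800080008000800080027ffe800080007ffe7fff80007fff80007fff8000800080007fff80008000800280028002800280007ffa8000800080047fff80047ffa7ff07ff0805480407eb08540,
    0x700080008000804080007fc07e00800080007ffc800880018000800880047fc08000800080048010800080008000800180008008800080047ff88000800080007ff880007fff800080007fff7fff80008000800080007ffe8000800080007fff80008000800080018000800080008000800080008000800080007fff80007fff800080018000800080017fff80008000800080008000800180008001800080008001800080007fff800080008000800080008000800080027ffc8000800080008000800080007ff88000800080007ffc80007ff0800080008040800082009000,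
    0x700080008000804080007fc08200800080007ffc80088001800080087ffc7fc08000800080047ff0800080008000800180007ff8800080047ff8800080008000800880007fff800080007fff7fff800080008000800080028000800080007fff8000800080007fff800080008000800080008000800080008000800180008001800080018000800080018001800080008000800080007fff80007fff800080008001800080007fff80008000800080008000800080007ffe80048000800080008000800080007ff88000800080007ffc8000801080008000804080007e009000,
    0x7ac0800480067fc47fe0803c80007ffe80007ffa7ff48000800080068000803c800080008006800080007fe08000800080028000800080067ffa80007ffe800080008000800080008000800080008000800080008000800080007ff4800480008000800080008000800080007ffa8000800080008000800480008000800080007ffc800080008000800080008000800080008000800080008000800080008000800080007ffc800080007ffe8000800280008002802080008000800080008000800080008000800c800080007ffc7ffa800c8000800080007fc4802080008540,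
    0x6a20800280067f9c7ff0800a80008002800080008004800080007ffe8000806480008000800080008000805080007fff7ffe8000800080008002800080028000800080008000800080007ffe8000800080008000800080007ff88006800280018000800080008000800080007ffa80008000800080007ffc80008000800080007ffe80007ffe80008002800080008000800080008000800080008000800080008000800080048000800280008000800080007ffe8010800080008000800080008000800080007ffc800880007ffe80007ffa8000800080007ff67fb0800095e0,
    0x9626800080007faf800680008000800080068005800080007ff7800080007faf7ffe80008000800080007fa67ffe8000800380008000800580008000800380008000800380008000800080007fff80068000800080008000800680008000800080008000800080008000800180007fa68000800080018000800080008000800080007fff80007ffe80008000800080008000800080008000800080008000800080007ffe80008000800080007ffe80008000800080068000800080008000800080008000800080008006800680008000800080008000800080007fa680009626,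
    0x82bc7fff7fff800a7ffc803780d27fff7fec800080048000800280078000800a800080028000800f800a803c80008001800280038003800080077ffe80027ffa80037ffe800080017ffe7ffe80007ffc80007ffe7ffd800080047fff800380017ffc8012800380007ffa80007fff7ffc80017fff8000800080008000800080007fff8000800180007ffe8000800080007fff800180028000800080007ffd80028000800080008000800180008000800080007fff7ffc80008000800280038003800180007ffe80048004800c800380007fff800f8012800a8037803c80d282bc,
    0x82bc7fff7fff800a7ffc80377f2e7fff7fec800080048000800280078000800a80007ffe80007ff17ff6803c8000800180027ffd7ffd800080077ffe800280067ffd7ffe80007fff80027ffe80007ffc800080028003800080047fff800380017ffc7fee7ffd8000800680007fff7ffc7fff80018000800080008000800080007fff8000800180007ffe80008000800080017fff7ffe800080008000800380028000800080008000800180008000800080007fff7ffc800080007ffe7ffd7ffd7fff8000800280048004800c800380007fff7ff17fee7ff68037803c7f2e82bc,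
    0x7358800380008000800c7faf7dae80008000800080007fff80008000800080007ffe7ffa80057ff780047fac80008000800080008000800080008000800080008000800080018001800080008000800080008002800380017ffe80098003800080007ffa8000800180008000800080007fff800080008000800080007fff80017ffd80008001800280007fff800180008000800180067fff800080007ffd80007fff8000800080017fff800180007fff800080007ff47fff8000800080037ffd7fff80007ffe8000800280007ffd7ffb7ff7800980067ffc8051805482528ca8,
    0x7358800380008000800c7faf825280008000800080007fff80008000800080007ffe8006800580097ffc7fac80008000800080008000800080008000800080008000800080017fff800080008000800080007ffe7ffd7fff7ffe8009800380008000800680007fff800080008000800080018000800080008000800080017fff7ffd800080018002800080017fff800080007fff7ffa800180008000800380007fff8000800080017fff800180007fff800080007ff48001800080007ffd80038001800080028000800280007ffd7ffb7ff77ff77ffa8004805180547dae8ca8,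
    0x88dc7ffd800080007ff48051817a80007fdc800380008001800080008000800080007ffa7ffe7ff7800a800c8000800080008000800080038000800080007ffa80008000800080018002800080008004800080027ffd7ffe7ffc80097ffd800080007ffa800080017ffa7fff80007fdc7fff80008000800080008000800080007ffd80007fff8000800080018000800080007fff7ffa8000800080007ffd800080008000800080017fff800280008002800080007ff47ffe800080028003800380018000800280007ffc800c7ffd7ffe80097ff77ffa800a8051800c817a88dc,
    0x88dc7ffd800080007ff480517e8680007fdc8003800080018000800080008000800080067ffe80097ff6800c80008000800080008000800380008000800080068000800080007fff7ffe80008000800480007ffe800380027ffc80097ffd80008000800680007fff80067fff80007fdc800180008000800080008000800080007ffd80007fff800080007fff800080008000800180068000800080008003800080008000800080017fff800280008002800080007ff4800280007ffe7ffd7ffd7fff80007ffe80007ffc800c7ffd7ffe8009800980067ff68051800c7e8688dc,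
    0x6e487ffd800080007ff480517e868000800080068000800180008000800080007ffe7ffa8004800980147fc4800080008000800080007ffa80008000800080008000800080007fff800080008000800080007ffe7ffd800280027ff77ffd800080007fe280007fff800080008000800080018000800080008000800080008000800380007fff8002800080018000800080007fff8006800080008000800380008000800080007fff800180008000800080008000800c7ffe800080007ffd800380018000800280007ffe800080037ffc80097ff7801e7fec7faf803c817a91b8,
    0x6e487ffd800080007ff48051817a8000800080068000800180008000800080007ffe800680047ff77fec7fc4800080008000800080007ffa8000800080008000800080008000800180008000800080008000800280037ffe80027ff77ffd80008000801e8000800180008000800080007fff8000800080008000800080008000800380007fff800280007fff80008000800080017ffa8000800080007ffd80008000800080007fff800180008000800080008000800c80028000800080037ffd7fff80007ffe80007ffe800080037ffc800980097fe280147faf803c7e8691b8,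
    0x97bb8000800080007ff78000819580007fd3800080008000800080008000800080018009800080007ff17fd38003800080008000800080008000800080007ffd800080007fff80007fff800080007fff8000800380008000800380008000800080007fe580008000800980008000801b80008000800080008000800080007fff800080008000800180008000800080018000800080097fff80008000800080007fff8003800080008000800080018000800080007ff780008000800180008000800080008003800080037feb80008000800080007fe57ff180007fd3819597bb,
    0x97bb8000800080007ff780007e6b80007fd3800080008000800080008000800080017ff780008000800f7fd38003800080008000800080008000800080008003800080007fff80008001800080007fff80007ffd8000800080038000800080008000801b800080007ff780008000801b8000800080008000800080008000800180008000800080018000800080007fff800080007ff7800180008000800080007fff8003800080008000800080018000800080007ff7800080007fff80008000800080007ffd800080037feb8000800080008000801b800f80007fd37e6b97bb,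
    0x6a2080047ffd801480107fec7ee88001800080007ffe800080007ff57ffc7fec80008008800080148000805080007fff800280017fff8000800b80007ffe80007fff80008000800080008001800080007ffe80008000800080007ff47ffc800180007ff880018000800080008003800080007fff8000800280008001800080007ffc8000800080007fff800080008000800180007ff8800080007fff80008000800080007ffe8000800080008000800080007fff7ff080008004800080047ffc80008002800080028000800080048000800c7fec8008800080147fb0811895e0,
    0x6a2080047ffd801480107fec81188001800080007ffe800080007ff580047fec80007ff880007fec8000805080007fff80027fff80018000800b80007ffe800080018000800080008000800180008000800280008000800080007ff47ffc8001800080087fff80008000800080038000800080018000800280007fff800080007ffc8000800080007fff8000800080007fff8000800880008000800180008000800080007ffe8000800080008000800080007fff7ff080007ffc80007ffc800480007ffe800080028000800080048000800c80147ff8800080147fb07ee895e0,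
    0x7e4080008000801080007ff07f90800080007ffe80027fff80007ff07ffc7ff08000800080027ffc80007fe080008001800080048004800280108000800080007ffc80008000800080007fff800180008002800080007ffe800080007ff87fff80007ff07ffc800180008000800080008000800080007ffe800080018000800080007fff8000800080017fff80008000800080008000800080007fff80008000800080008002800180007ffe800080028000800080008002800480007ffc800480007ffe80007ffe8000800080087ffe800080048010800080108020807081c0,
    0x7e4080008000801080007ff08070800080007ffe80027fff80007ff080047ff0800080008002800480007fe08000800180007ffc7ffc80028010800080008000800480008000800080007fff800180007ffe800080008002800080007ff87fff8000801080047fff80008000800080008000800080007ffe80007fff8000800080007fff80008000800180018000800080008000800080008000800180008000800080008002800180007ffe800080028000800080007ffe7ffc800080047ffc8000800280007ffe8000800080087ffe80007ffc7ff08000801080207f9081c0,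
    0x75107ffd80007fb080187fc97ee88000800080007ff6800080008008800280508000800080008005800080288000800180007ff8800080007ff88000800080008008800080007ffd80007fff8000800080007ffc8003800080047ff780017fff800080188000800080008000800080007fff800080007ffe800080018000800080038000800180008001800080008000800080018000800080007fff7ffd800080008000800280007fff800080008000800080007fe880007ffe80007ffd8003800380008004800a7ffc80007fff800080097ffb7fe8800080377fd881188af0,
    0x75107ffd80007fb080187fc981188000800080007ff68000800080087ffe80508000800080007ffb800080288000800180008008800080007ff88000800080007ff880008000800380007fff80008000800080047ffd800080047ff780017fff80007fe88000800080008000800080008001800080007ffe80007fff800080008003800080018000800180008000800080007fff80008000800080018003800080008000800280007fff800080008000800080007fe880008002800080037ffd7ffd80007ffc800a7ffc80007fff8000800980058018800080377fd87ee88af0,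
    0x7820800280067fdc7ff0805a8000800280007ffc8000800080007fee80008024800080007ffa800080007fd0800080007ffe80008000800480128000800280008000800080008000800080007fff80008000800080008000800880067ffa80008000800080008000800080007ffa8000800080008000800080008000800080007ffe80018002800080008000800080008000800080008000800080008000800080008000800080007ffe800280007ffe80007ffe80108000800080008000800080008000800080007ff88000800680067ffa8000800080007fa68030800087e0,
    0x7e707fff80007fec80087fe77f888002800080007ff6800080007ffc800080148000800080007ff180007fd8800080017ffe7ffa800280008004800080028000800680007fff7ffd80008002800080007ffe8004800380007ffc80097fff7fff80007ff87ffe8000800080008000800080018000800080028000800080007fff800180007fff80007ffe80008000800080007fff80008001800080007ffd8000800180007ffe8000800180008000800080007ffe7ff880008000800080017fff800380027ffc800a80048000800180007ff7800f800880008019802880788190,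
    0x7e707fff80007fec80087fe780788002800080007ff6800080007ffc80008014800080008000800f80007fd8800080017ffe80067ffe800080048000800280007ffa80007fff8003800080028000800080027ffc7ffd80007ffc80097fff7fff800080088002800080008000800080007fff8000800080028000800080008001800180007fff80007ffe8000800080008000800180007fff8000800080038000800180007ffe8000800180008000800080007ffe7ff88000800080007fff80017ffd7ffe8004800a80048000800180007ff77ff17ff88000801980287f888190,
    0x72e07ffe80007fc4801080067eb07ffe800080008006800180007ff48000803c800080007ffb7ffa80107ff08000800080027ffa80028000800c80007ffe8000800680008000800480008000800080007ffe800080007fff8000801280028000800080107ffe7fff8000800080008000800080008000800280008000800180008002800080008000800080017fff800080008000800080008000800080008000800080007ffe7fff80007fff80008001800080027ff08001800080007ffe80027ffc800280007ffa800080007ffe80057fee80067ff07ff07ffa801081508d20,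
    0x72e07ffe80007fc48010800681507ffe800080008006800180007ff48000803c800080007ffb80067ff07ff080008000800280067ffe8000800c80007ffe80007ffa800080007ffc80008000800080008002800080008001800080128002800080007ff08002800180008000800080008000800080008002800080007fff8000800280008000800080007fff8001800080008000800080008000800080008000800080007ffe7fff80007fff80008001800080027ff07fff8000800080027ffe80047ffe80007ffa800080007ffe80057fee7ffa801080107ffa80107eb08d20,
    0x6400800080008010800080808000800080007ffe80087ffe8000802080007ff0800080007ff88000800080008000800180008000800080027fe08000800080008000800080008000800080028001800080008000800080008000800080007fff800080008000800080008000800080008000800080008000800080008000800080007fff800080007ffe8000800080008000800080008000800080008000800080008000800080028000800080008000800080008000800080008000800080008000800080007ff8800080008000800880008000800080007f80800080009c00,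
    0x88c0800080027fd880007ffc81508000800080008002800180087ff680007fd8800080007ffb80067ff0804080007fff80007ffa7ffe80007ff68000800080007ffa80008000800280008002800080007ffe80008002800180007ffc80047fff7ffc80107ffe80017ff0800080027fc08000800080007ffe800280007fff80008000800080008000800280017fff800080008000800080008000800080028002800080007ffe800180007fff80007fff8000800080008001800080007ffe7ffe80027ffe800080028000800080047ffb7ffc800680107ff07ffc8040815088c0,
    0x88c0800080027fd880007ffc7eb08000800080008002800180087ff680007fd8800080007ffb7ffa8010804080007fff80008006800280007ff68000800080008006800080007ffe8000800280008000800280007ffe7fff80007ffc80047fff7ffc7ff080027fff8010800080027fc08000800080007ffe7ffe800080018000800080008000800080027fff800180008000800080008000800080007ffe8002800080007ffe800180007fff80007fff8000800080007fff80008000800280027ffe8002800080028000800080047ffb7ffc7ffa7ff080107ffc80407eb088c0,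
    0x6f987fff7ffd803c7ffc804b7f2e7fff800080007ffa800080007ff180007fc48002800280007ff180147fec800080007ffe800380018000800f8000800280007ffd800080007fff800080008000800080027ffe7ffd80007ffe7ffd800780008000801a7fff8000800080008003800080017fff80007ffe80008000800080008001800080017ffe800080008000800080017fff7ffe8000800080008003800080008000800280007fff80008000800080008001800480008000800080057ffb80017ffe80028006800280007ff980008003800f7fe67fec7fb5801480d29068,
    0x6f987fff7ffd803c7ffc804b80d27fff800080007ffa800080007ff180007fc480027ffe8000800f7fec7fec800080007ffe7ffd7fff8000800f800080028000800380008000800180008000800080007ffe8002800380007ffe7ffd8007800080007fe68001800080008000800380007fff800180007ffe80008000800080008001800080017ffe80008000800080007fff800180028000800080007ffd800080008000800280007fff8000800080008000800180048000800080007ffb80057fff80027ffe8006800280007ff9800080037ff1801a80147fb580147f2e9068,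
    0x7a8880017ffd8014800480197f2e8001800080007ff880008000800d80007fec8002800a80007ff180147fc480007fff800280037ffd80007ff380007ffe80007ffd800080007fff80007ffe80008000800080027ffd80008002800f7ffd800180007ffa8003800080008000800380007fff80018000800080008000800080007fff80007fff7ffe80028000800080007fff80017ff6800080008000800380008000800080008000800180008000800080007fff7ffc8000800080007ffd8003800180007ffe80087ffe8000800380007ff1800f80067fec7fe7803c80d28578,
    0x7a8880017ffd80148004801980d28001800080007ff880008000800d80007fec80027ff68000800f7fec7fc480007fff80027ffd800380007ff380007ffe8000800380008000800180007ffe8000800080007ffe800380008002800f7ffd8001800080067ffd8000800080008003800080017fff8000800080008000800080007fff80007fff7ffe800280008000800080017fff800a8000800080007ffd80008000800080008000800180008000800080007fff7ffc80008000800080037ffd7fff8000800280087ffe8000800380007ff17ff17ffa80147fe7803c7f2e8578,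
    0x820d80028000801e7ff9801e8069800280058000800380008006800c8003801e7fff7ffd80008000800580057ffd80008002800680028000800c7fff8002800180068002800080027fff8000800080017fff80037ffe80007ffd80068002800080037ff980028000800d80008000802d8000800080007fff80018000800080008002800080007fff8000800080007fff800080007ffd8000800180007ffe8003800080017fff8000800080007fff80007fff80027ff9800080037ffd7ffc7ffc80027fff800380037ffd7fed80028000800680007ff98005801e80058069820d,
    0x841a7fff8001800f7ff6800f80d27fff7fe280008006800080077ffd8000800f80007ffe8000800f7ff680327ffe80007fff80037fff80007ffd80007fff7ffa8003800380007fff8000800080007ffe80027ffc7fff800080027fef7fff8000800480027fff8000800e80008001803a7fff80018001800280028000800080007fff80007fff8000800080008000800080017fff7ffe8000800080007fff7ffe80007ffe800280007fff80008000800080007fff7ff6800080007ffe7fff7fff7fff80027ffc800680027ffa7fff80007fef800f80027ff6800f803280d2841a,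
    0x85788002800080327ff080328118800280288000800580007ffa7ffc80018032800080008000800a8000802880007fff8002800a7ffe80007ffc800180028008800a7ffe8000800080007fff80008000800180007ffc800080007ffa7ffe7fff7ffd7ff87ffe80007ff0800080007fb880008000800080017fff80018000800080028000800080007fff80008000800080008000800080007fff80017ffc7ffd80008000800180008000800080008000800180027ff08000800180007ffe7ffe800080018000800580007ff87ffe80007ffa800a7ff880008032802881188578,
    0x820d80028000801e7ff9801e7f97800280058000800380008006800c7ffd801e7fff8003800080007ffb80057ffd800080027ffa7ffe8000800c7fff80027fff7ffa800280007ffe800180008000800180017ffd800280007ffd800680028000800380077ffe80007ff380008000802d8000800080007fff7fff8000800080008002800080007fff800080008000800180008000800380007fff800080028003800080017fff8000800080007fff80007fff80027ff980007ffd8003800480047ffe80017ffd80037ffd7fed800280008006800080077ffb801e80057f97820d,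
    0x85788002800080327ff080327ee8800280288000800580007ffa7ffc7fff80328000800080007ff68000802880007fff80027ff6800280007ffc800180027ff87ff67ffe8000800080007fff800080007fff80008004800080007ffa7ffe7fff7ffd8008800280008010800080007fb8800080008000800180017fff8000800080028000800080007fff800080008000800080008000800080017fff80047ffd80008000800180008000800080008000800180027ff080007fff80008002800280007fff8000800580007ff87ffe80007ffa7ff680088000803280287ee88578,
    0x90687ffe80037fe27ff87fe281a48001802880007ffd80007ffa800f80037fe280007ffc800080007fec8028800080007ffe7ffd80018000800f80017ffe80047ffd7ffe80007ffe8000800080007ff8800180008002800080007ffa7ffe800080038004800180007ffc800080037fe880007fff800080017fff8000800080007ffe80008000800080008000800080007fff80007ffc80008001800080028003800080008001800080008000800080007fff80017ff8800080037ffc800480047ffe800180007ffd800080087ffe80007ffa800080047fec7fe2802881a49068,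
    0x80328001800080057ffe800580147ffe800a8000800580007ffd7ffc7fff800580008000800080058000800a80027fff800180027ffe80007ffc800180018004800280018001800380027fff8000800680017ffe7fff800080027ffd80017fff800380047ffe80008008800080008012800180007fff80017fff7fff80007fff800180007fff80007fff8000800080008000800180007fff80017fff7fff800380018002800180007fff8000800080007fff7ffe7ffe80007fff800080018001800380017ffe800580028002800180007ffd8005800480008005800a80148032,
    0x88347ffe8002801e7fec801e80007ffe80148000800c80007ff67ffa8000801e800080008000800080007fc4800080007ffe8000800080007ffa80027ffe800080008002800080008000800080007ffc80008000800080007ffc800e800680007ffc8000800080008000800080028074800080008000800080008000800080007ffe80008002800080008000800080008000800080008000800080008000800280007ffc80008000800280008000800080007ffe7fec80008000800080008000800080008000800c7ffc7ff480068000800e800080008000801e7fc480008834,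
    0x841a7fff8001800f7ff6800f7f2e7fff7fe280008006800080077ffd8000800f8000800280007ff1800a80327ffe80007fff7ffd800180007ffd80007fff80067ffd8003800080018000800080007ffe7ffe80048001800080027fef7fff800080047ffe800180007ff280008001803a80017fff800180027ffe8000800080007fff80007fff800080008000800080007fff8001800280008000800080017ffe80007ffe800280007fff80008000800080007fff7ff68000800080028001800180017ffe8004800680027ffa7fff80007fef7ff17ffe800a800f80327f2e841a,
    0x83cc8000800080008000800080a2800080247ffd800080008000800080008000800280067ffd80007ffa8024800080008000800080007ffd8000800080008006800080007fff800080008000800080088000800080007ffd80008000800080008000801280008000801280018000806c8000800080008000800080007fff80018000800080008002800080007fff8000800080008006800180008000800080007fff800080008000800080017ffe80018000800080007ffd800080028000800080008000800080008000800c80007ffd8000800080127ffa8000802480a283cc,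
    0x90687ffe80037fe27ff87fe27e5c8001802880007ffd80007ffa800f7ffd7fe2800080048000800080148028800080007ffe80037fff8000800f80017ffe7ffc80037ffe800080028000800080007ff87fff80007ffe800080007ffa7ffe800080037ffc7fff80008004800080037fe8800080018000800180018000800080007ffe800080008000800080008000800080018000800480007fff80007ffe8003800080008001800080008000800080007fff80017ff880007ffd80047ffc7ffc80027fff80007ffd800080087ffe80007ffa80007ffc80147fe280287e5c9068,
    0x8c80800080027fd880007fd880a08000800080007ffc80008008800e7ffe7fd88000800080007fec8000800080007fff80007ffe80028000800e8000800080007ffe80008001800080007fff8000800080028000800080008000800880007fff7ffc802080028000800080008002808080008000800080008000800180007fff80008000800080007fff8000800080008000800080007fff8000800180007ffc8001800080008000800080008000800080008000800080007ffe80007ffc7ffc8000800280007ffc800080008000800080087fec802080007fd8800080a08c80,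
    0x80328001800080057ffe80057fec7ffe800a8000800580007ffd7ffc800180058000800080007ffb8000800a80027fff80017ffe800280007ffc800180017ffc7ffe800180017ffd7ffe7fff800080067fff80028001800080027ffd80017fff80037ffc800280007ff88000800080127fff80007fff80018001800180008001800180007fff80007fff80008000800080007fff800080017fff80018001800380018002800180007fff8000800080007fff7ffe7ffe8000800180007fff7fff7ffd7fff8002800580028002800180007ffd7ffb7ffc80008005800a7fec8032,
    0x8c80800080027fd880007fd87f608000800080007ffc80008008800e80027fd880008000800080148000800080007fff800080027ffe8000800e800080008000800280008001800080007fff800080007ffe8000800080008000800880007fff7ffc7fe07ffe80008000800080028080800080008000800080007fff8000800180008000800080007fff800080008000800080008000800180007fff80007ffc800180008000800080008000800080008000800080008000800280008004800480007ffe80007ffc8000800080008000800880147fe080007fd880007f608c80,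
    0x857880047ffe80417ff8801480007ffe80288000800880008001800e80008041800080008000800080007fd880047fff8001800080008000800e7ffe8001800080008001800080008000800280007ff88000800080008000800080047ffc7fff8004800080008000800080007ffe7ff88000800080017ffc80008000800080008004800080008000800280008000800080008000800080008000800080007ffe800080007ffc8000800080008000800080007ffe7ff8800080008000800080008000800080008008800080187ffc8000800480008000800080147fd880008578,
    0x80af7fff80017ffb7fff7ffb80237fff800f8000800480007ffb800d80027ffb7fff7ffb800080057ffb800f7fff80017fff7fff80038000800d80007fff80037fff8003800080017fff800180007fff80007fff800180007fff7ffb800380017ffe8003800380007ffb800080017fef7fff80017fff80007ffe7fff800080007fff80007fff7fff800180008000800180017fff7ffb800080007fff80017ffe80008003800080007fff80007fff800080027fff7fff8000800280037ffd7ffd800180007fff80047fff7fff800380007ffb800580037ffb7ffb800f802380af,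
    0x91b88000800080517fe88000800080007fe88001800080008009800080008051800080008006800080007fb87ffc80007ffd800080008001800080007ffd800080007ffd8000800080008000800180088000800080008000800080008000800080008000800080008000800180007fb8800080007fff800080008000800080008000800180008000800080008000800080008000800080008000800080008000800080008000800080007ffe80007ffe800080007fe88000800080008000800080008000800080008000801880008006800080008000800080007fb8800091b8,
    0x8b1380038000800080037faf80bd80007fd3800080007fff80008000800080007fff7ffd800580097fed80338003800080008000800080008000800080007ffd8000800080007fff80018000800080038000800180037fff7ffb7ff78003800080007ffd80007fff7ffd800080007fd3800180008000800080008000800180008003800080017fff80007fff80017fff800080017ffd8000800080008003800080007fff80007fff800180017fff80018000800080037fff800080057ffd7ffd7fff8000800180007ffb8003800380057ff780097ffd7fed7faf803380bd8b13,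
    0x83cc800080008000800080007f5e800080247ffd80008000800080008000800080027ffa7ffd800080068024800080008000800080007ffd8000800080007ffa800080007fff800080008000800080088000800080008003800080008000800080007fee800080007fee80018000806c80008000800080008000800080017fff80008000800080028000800080018000800080007ffa7fff80008000800080007fff800080008000800080017ffe8001800080008000800380007ffe8000800080008000800080008000800c80007ffd800080007fee8006800080247f5e83cc,
    0x9180800080047fd480007fb08000800080407ffb8004800080047fec80007fd4800080008000800080008000800080018000800080007ffb7fec7ffe80008000800080048000800080007ffe8001800080008000800080008000801080008001800480008000800080007fff80047f808000800080008000800080008000800080008001800080007ffe80008000800080008000800080008000800080007ffe80008000800080008000800080008000800080008000800080008000800080008000800080008004800080008000800080108000800080007fb0800080009180,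
    0x8a8080007ffc803c80007fd080008000804080037ff480027ffc7ff48000803c8000800080088000800080008000800080008000800080037ff47ffe8000800080008004800080008000800080008000800080008000800080007ff0800080007ffc80008000800080007fff7ffc808080008000800080008000800080008000800080008000800080008000800080008000800080008000800080008000800280008000800080028000800080008000800080008000800080008000800080008000800080007ff480008000800080087ff08000800080007fd0800080008a80,
    0x82bc800080027fec80007fec8046800080148000800780007ffc7ffe7ffb7fec7ffe7ffa8000800a7ff680148000800180007ffe800280007ffe7fff800080027ffe7ffc8000800280008001800080087fff80008002800080007ffc7ffc80017fff7ff680028000800e80008002805c8000800080007fff7fff8001800080008000800080007ffe8001800080008000800080007ffa80007fff800180027fff800080007fff800080008000800280007fff8000800080007ffb7ffe8002800280027fff8000800780007ffc7ffc80007ffc800a7ff67ff67fec8014804682bc,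
    0x8c4e7ffe7ffa802d80167fa680007ffe801e8000800080007ffd80128000802d80028000800080008000801e7ffe80008001800080008000801280008001800080007ffd80008000800080008000800680008000800080007ffe8006800680008000800080008000800080007ffa7f8e800080008001800080008000800080007ffe80007ffe800280008000800080008000800080008000800080008000800080007ffe800080007ffe80008002800080007ffe80168000800080008000800080008000800080007ffe7fee8006800080068000800080007fa6801e80008c4e,
    0x8b1380038000800080037faf7f4380007fd3800080007fff80008000800080007fff800380057ff780138033800380008000800080008000800080008000800380008000800080017fff80008000800380007fff7ffd80017ffb7ff78003800080008003800080018003800080007fd37fff800080008000800080007fff80008003800080017fff800080017fff800180007fff80038000800080007ffd800080007fff80007fff800180017fff8001800080008003800180007ffb80038003800180007fff80007ffb8003800380057ff77ff7800380137faf80337f438b13,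
    0x80af7fff80017ffb7fff7ffb7fdd7fff800f8000800480007ffb800d7ffe7ffb7fff800580007ffb8005800f7fff80017fff80017ffd8000800d80007fff7ffd8001800380007fff8001800180007fff800080017fff80007fff7ffb800380017ffe7ffd7ffd80008005800080017fef80017fff7fff800080028001800080007fff80007fff7fff8001800080007fff7fff800180058000800080017fff7ffe80008003800080007fff80007fff800080027fff7fff80007ffe7ffd800380037fff8000800180047fff7fff800380007ffb7ffb7ffd80057ffb800f7fdd80af,
    0x906880007ffc800f80187f88800080007fd88000800680007fff7ff48000800f8000800080008000800080287ffc800080038000800080007ff480028003800080007fff800080008000800080007ff88000800080008000800080087ff880008002800080008000800080007ffc8068800080007fff7ffe80008000800080008000800080008000800080008000800080008000800080008000800080008002800080007ffe80008000800080008000800280008018800080008000800080008000800080008006800080087ff8800080088000800080007f88802880009068,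
    0x82bc800080027fec80007fec7fba800080148000800780007ffc7ffe80057fec7ffe800680007ff6800a801480008001800080027ffe80007ffe7fff80007ffe80027ffc80007ffe8000800180008008800180007ffe800080007ffc7ffc80017fff800a7ffe80007ff280008002805c8000800080007fff80017fff800080008000800080007ffe8001800080008000800080008006800080017fff7ffe7fff800080007fff800080008000800280007fff800080008000800580027ffe7ffe7ffe80018000800780007ffc7ffc80007ffc7ff6800a800a7fec80147fba82bc,
    0x81a47ffa7ffc8018800c7fe280008000802480058006800080087ff4800080188000800080008000800080148000800080008000800080057ff48000800080008000800080008000800080007fff7ffc80008000800080007ffc8002800280008002800080008000800080017ffc7fe4800080008000800280008000800080007ffa7fff80028000800080008000800080008000800080008000800080007ffc800080048002800080028000800080007ffe8000800c8000800080008000800080008000800080067ffc80048002800080028000800080007fe28014800081a4,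
    0x80a87ffc7ffe800f80087ff4800080028018800380067ffe800780068000800f800080007ffe800080008008800480007fff800080008003800680007fff8000800080038000800080008000800080088000800080008000800080047ffc80007ffe80008000800080007fff7ffe8028800080008001800280008000800080007ffc8000800080008000800080008000800080008000800080008000800080048000800080027ffe80007ffe80007ffe800280028008800080008000800080008000800080008006800080087ffc7ffe80048000800080007ff48008800080a8]
/-- certificates for `E_8` -/
def certs8 : List (List ℕ) :=
  [[67174400],
    [67174401],
    [67174402],
    [67174406],
    [67174409, 67043341],
    [67177483],
    [67177739],
    [67177484, 67043338, 67043341],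
    [67174403, 67043338, 67043345],
    [67178763],
    [67177995],
    [67178765, 67043341, 67043345, 67043342],
    [67174404, 67043338, 67043340, 67043345, 67043346],
    [67178768, 67043344, 67043347, 67043348],
    [67179019],
    [67178764, 67043340, 67043350],
    [67179020, 67043350],
    [67180043],
    [67180044, 67043345, 67043346, 67043349],
    [67180047, 67043347, 67043352, 67043351],
    [67177740, 67043340, 67043353],
    [67178767, 67043343, 67043355],
    [67178769, 67043338, 67043341, 67043345, 67043346, 67043356, 67043349],
    [67179023, 67043355],
    [67179021, 67043356, 67043349],
    [67179024, 67043357, 67043351],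
    [67179281, 67043339, 67043344, 67043347, 67043352, 67043357, 67043351],
    [67181580, 67043350, 67043354],
    [67177741, 67043338, 67043341, 67043345, 67043360, 67043342],
    [67178508, 67043343, 67043359],
    [67180045, 67043350, 67043353, 67043354, 67043365],
    [67180049, 67043340, 66977814, 67043353, 66977818, 67043365],
    [67181836, 67043355, 67043361],
    [67180048, 67043355, 67043359, 67043361, 67043370],
    [67180051, 67043343, 66977819, 67043359, 66977825, 67043370],
    [67180817, 67043340, 67043358, 67043350, 66977817, 67043354, 67043365, 67043368, 67043369],
    [67182097, 67043358, 67043353, 67043368],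
    [67179038, 67043365, 67043368],
    [67184141, 67043341, 67043344, 67043366, 67043342, 67043348],
    [67184145, 67043366, 67043342, 67043348],
    [67177999, 67043367, 67043359, 67043374, 67043371],
    [67182110, 67043338, 67043341, 67043344, 67043345, 67043366, 67043360, 67043342, 67043348, 67043376],
    [67180574, 67043370, 67043371],
    [67180062, 67043342, 67043349, 67043362, 67043377],
    [67181342, 67043348, 67043351, 67043363, 67043377],
    [67180830, 67043341, 67043345, 67043366, 67043360, 66977806, 67043348, 67043349, 67043376, 67043377],
    [67182366, 67043344, 67043347, 67043366, 67043364, 67043342, 66977812, 67043351, 67043376, 67043377],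
    [67184414, 67043339, 67043341, 67043344, 67043347, 67043366, 67043364, 67043342, 67043348, 67043376],
    [67181581, 67043346, 67043356, 67043349, 67043362, 67043381],
    [67181837, 67043352, 67043357, 67043351, 67043363, 67043382],
    [67181598, 67043354, 67043365, 67043368, 67043375, 67043380],
    [67181854, 67043361, 67043370, 67043371, 67043375, 67043380],
    [67184158, 67043340, 67043343, 67043358, 67043367, 67043353, 67043359, 67043374, 67043373, 67043378],
    [67180838, 67043358, 67043367, 67043353, 67043359, 66977838, 67043373, 67043378, 67043368, 67043371],
    [67181606, 67043362, 67043363, 67043377, 67043381, 67043382],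
    [67179025, 67043345, 67043346, 67043356, 67043349, 67043386],
    [67179027, 67043347, 67043352, 67043357, 67043351, 67043387],
    [67181069, 67043350, 66977818, 66977829, 67043368, 67043369, 67043375, 67043388],
    [67181072, 67043355, 66977825, 66977834, 67043371, 67043372, 67043380, 67043389],
    [67183884, 67043356, 67043349, 67043386, 67043362, 67043381],
    [67183887, 67043357, 67043351, 67043387, 67043363, 67043382],
    [67178014, 67043340, 67043358, 67043367, 67043350, 66977817, 67043359, 66977838, 66977837, 67043378, 67043368,
    67043371, 67043390, 67043369, 67043391],
    [67179550, 67043343, 67043358, 67043367, 67043355, 67043353, 66977823, 66977838, 67043373, 66977842, 67043368,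
    67043371, 67043390, 67043372, 67043391],
    [67186444, 67043362, 67043377, 67043381, 67043382, 67043392],
    [67186447, 67043363, 67043377, 67043381, 67043382, 67043392],
    [67187980, 67043365, 67043368, 67043375, 67043380, 67043388],
    [67188236, 67043370, 67043371, 67043375, 67043380, 67043389],
    [67181593, 66977814, 67043353, 66912282, 66912293, 66977832, 66977833, 67043375, 66977859, 66977852, 67043403],
    [67181849, 66977819, 67043359, 66912289, 66912298, 66977835, 66977836, 67043380, 66977860, 66977853, 67043404],
    [67183889, 67043350, 67043353, 66977818, 66912293, 66977832, 66977833, 67043375, 66977859, 66977852, 67043403],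
    [67183891, 67043355, 67043359, 66977825, 66912298, 66977835, 66977836, 67043380, 66977860, 66977853, 67043404],
    [67186214, 67043340, 67043343, 67043358, 67043367, 67043350, 67043355, 66977817, 66977823, 66977838, 66977837,
    66977842, 67043368, 67043371, 66912318, 67043369, 67043372, 67043399, 67043400, 67043391],
    [67191052, 67043354, 67043369, 67043395],
    [67191308, 67043361, 67043372, 67043396],
    [67179798, 67043340, 67043358, 66912278, 66912281, 67043410, 67043405, 66781210, 67043373, 66781221, 66912296,
    66781225, 67043375, 66977871, 66846787, 66912316, 67043403],
    [67180310, 67043343, 67043367, 66912283, 66912287, 67043411, 67043406, 66781217, 67043378, 66781226, 66912299,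
    66781228, 67043380, 66977872, 66846788, 66912317, 67043404],
    [67190285, 67043374, 67043373, 67043378, 66912318, 66977873, 67043399, 67043400, 66977855],
    [67194124, 67043386],
    [67194380, 67043387],
    [67194125, 67043365, 67043395, 67043388],
    [67194381, 67043370, 67043396, 67043389],
    [67194129, 67043405, 67043354, 67043369, 67043395, 67043388, 67043399],
    [67194385, 67043406, 67043361, 67043372, 67043396, 67043389, 67043400],
    [67174408, 67059981, 66846732, 66912269, 66912273, 66912274, 66650134, 66912281, 66912284, 67043410, 67043405,
    66781210, 66781205, 66977829, 66977850, 66912297, 67174469, 67043395, 67174455, 67174473],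
    [67174407, 67043341, 66977809, 66977810, 67043356, 67043421, 66912277, 67043393, 66977850],
    [67179793, 67043341, 67043345, 67043346, 66977820, 67043360, 67043342, 67043421, 66912277, 67043393, 66977850,
    66977826, 67043381, 67043397, 67043383],
    [67198219],
    [67179795, 67043344, 67043347, 67043352, 66977821, 67043364, 67043348, 67043424, 66912279, 67043394, 66977851,
    66977827, 67043382, 67043398, 67043384],
    [67179794, 67043341, 67043345, 67043346, 66977820, 67043360, 67043342, 67043421, 66846741, 66977857, 67043422,
    66912314, 66977887, 66912290, 67043381, 67043415, 66912325, 66977847, 67043401],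
    [67195404, 67043393, 67043422, 67043423],
    [67198225, 67043421, 67043349, 67043386, 67043423, 67043397, 67043383, 67043401],
    [67198475],
    [67179026, 67043338, 67043345, 67043427, 66977810, 67043360, 67043421, 67043349, 67043393, 67043422, 66977850],
    [67180306, 67043344, 67043347, 67043352, 66977821, 67043364, 67043348, 67043424, 66846743, 66977858, 67043429,
    66912315, 66977889, 66912291, 67043382, 67043416, 66912326, 66977848, 67043402],
    [67178012, 67043356, 67043342, 66977813, 67043393, 66977850, 66912290, 66977841, 66912309, 67043382, 67043415,
    66977861, 66977847, 67043426, 66977856, 66977865, 67043402],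
    [67195660, 67043394, 67043429, 67043425],
    [67194142, 67043362, 67043381, 67043397, 67043426, 67043392, 67043401],
    [67184227, 67043428],
    [67181667, 67043356, 67043393, 67043423, 67043362, 67043415, 67043426],
    [67178083, 67043421, 67043397, 67043383, 67043401],
    [67179875, 67043349, 67043393, 67043422, 67043386, 67043423, 67043362, 67043415, 67043397, 67043383, 67043426,
    67043401],
    [67180562, 67043339, 67043347, 67043433, 66977816, 67043364, 67043424, 67043351, 67043394, 67043429, 66977851],
    [67183897, 67043345, 66977810, 66912284, 67043360, 67043342, 67043421, 66781205, 66912321, 67043430, 67043422,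
    66715706, 66977887, 66715682, 66977841, 66781237, 67043428, 67043382, 66912343, 66781253, 66977896, 66781239,
    66912354, 67043437, 66912320, 66846793, 67043402],
    [67184926, 67043360, 67043342, 67043421, 67043349, 67043393, 67043422, 67043376, 67043386, 66977887, 67043435,
    67043362, 67043377, 67043381, 67043428, 66977861, 66912311, 67043384, 67043426, 66977901, 67043392, 66977865,
    67043402],
    [67195414, 67043427, 67043346, 67043436, 67043356, 67043349, 66912321, 67043430, 66912350, 66977850, 66977887,
    66977826, 66977879, 67043397, 67043438, 67043383, 66977890, 67043401],
    [67194134, 67043346, 67043436, 67043360, 67043421, 67043349, 66977857, 67043379, 67043430, 67043422, 66977850,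
    67043423, 67043362, 66977879, 67043397, 67043438, 67043432, 66977847, 66977890, 67043401],
    [67198480, 67043394, 67043429, 67043425, 67043416, 67043398, 67043384, 67043431, 67043437, 67043402],
    [67181923, 67043357, 67043394, 67043425, 67043363, 67043416, 67043431],
    [67191139, 67043345, 67043356, 67043349, 66977857, 67043379, 67043422, 67043386, 67043423, 66977879, 67043397,
    67043438, 67043383, 67043426, 67043401],
    [67202064, 67043431],
    [67186477, 67043346, 67043352, 67043436, 67043445, 66912284, 66977821, 67043360, 67043364, 66977806, 67043348,
    66977885, 67043424, 66781205, 66912279, 66846785, 66781298, 66846839, 66912322, 66846771, 66846777, 66715750,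
    66781295, 66715742, 66846821, 66846768, 66388026, 66584635, 66650207, 66781291, 66846817, 66125858, 66453539,
    66388017, 65929269, 66453604, 66125878, 66060375, 66256984, 66125893, 66388038, 66257009, 65994862, 66125940,
    66060403, 65798248, 65798250, 65536055, 65863736, 65339490, 65601654, 65601639, 65339504, 65667181, 64684096,
    64618569, 65011786],
    [67183949, 67043341, 67043436, 67043356, 66977824, 66977806, 66912349, 66846741, 66846785, 66977906, 66977843,
    67043385, 66912358, 66846814, 66977840, 66781242, 66715743, 66912363, 66650146, 66977841, 66846773, 66977892,
    66781271, 66584645, 66912369, 66781294, 67043444, 66846835, 66781288, 66912362, 66388023, 67043384, 66453602,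
    66781302, 66977895, 66846832, 66715757, 66715712, 66322505, 66912330]]
/-- data for `E_8` -/
def dat8 : Dat where
  m := 112
  N := 696729600
  wd := [0x1, 0xe, 0x45, 0x77, 0x31a, 0x21d, 0x217, 0x12a3, 0x1684, 0x1285, 0x1066, 0x177e, 0x1437, 0x94ec, 0x97ac,
    0x84f5, 0x82a6, 0x98d7, 0x82e7, 0x8567, 0x99af, 0x4a6a3, 0x5942c, 0x43fac, 0x4a9f5, 0x418d6, 0x4ab1e,
    0x4a12e, 0x5a13e, 0x4153e, 0x5077e, 0x547af, 0x4a8f7, 0x213519, 0x283335, 0x2635f5, 0x20b9f5, 0x2994e6,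
    0x28333e, 0x20c6af, 0x2147af, 0x2ca177, 0x20a977, 0x128351d, 0x12cc6ae, 0x15194ef, 0x16509af, 0x129a8f7,
    0x84ceb19, 0x94d7d63, 0xb42c657, 0x86a32b7, 0x4c76329e, 0x632835af, 0x20c76329e, 0x2cc7ac657, 0x12994e329c,
    0x10ca16329c, 0x1663b1943e, 0xa6a3283519, 0x82e328352e, 0x96846858d7, 0x94ca7194e7, 0x53563283519,
    0x5a16343eb19, 0x4a8ca7ac653, 0x4a6538ca73e, 0x4b29c6506a7, 0x25351941a8ee, 0x20a6538ca73e, 0x254653d6329f,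
    0x2594ec6506a7, 0x12ca8ca72c6b5, 0x16508ca1759f5, 0x1054653d6329f, 0x82ca8ca72c6b5, 0x96546539635f5,
    0x12994f59f58ca0e5, 0x18ca0d5d632835f5, 0x841cb1941ad6329c, 0x971956329cbac6be, 0x420e58ca0d7d6329c,
    0x4171956329cbac6be, 0x109941a8d58ca0d466c, 0x105328352c7ac653fac, 0x84ca0d46b58ca0d466c,
    0x86538cab1941a8cd8d7, 0x4329c656b1941a8cd8d7, 0x141a163283d67d63283519, 0x6328352cd6328353eb1941a,
    0x4a6538ca72c6539758ca72e, 0x25329c6539ac65397eb194e5, 0x20a6538ca72c6539758ca72e,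
    0x14ca8ca76329cd6328397eb19, 0x82ca71941cb194e5d6328352e, 0x4a65071956329cd6328351dfac,
    0x10506506a58f58ca0d4bbeb1941a8ec, 0xa0d09632835ac6506a3367d63283519, 0x50684b1941ad633f58ca0d466c686b19,
    0x10832a58ca0d46758feb1941a8cd8d6b19, 0x10e3d632835f58ca0d466c686b194feb1a,
    0x105a8ca72c6539758ca0d466efac653977, 0x105328351d8d6b1941a8eefac6506a3363d67,
    0x16538d0b1941a8ecd6328353eb1941a8cd8d0d633f58d0, 0x416506a32ac650d63283519b37d63283519b1a1ac657d63,
    0x20a0ca0d46506a3363283519b1a1ac6506a33634358ca72e, 0x10506506a3283519b1941a8cd8d0d63283519b1a1ac65397e,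
    0x420ca11a163283519d6329cfac6506a33634358ca72fd6329c,
    0x10506506a3b194f58ca0d466c686b3eb1941a8cd8d0d6329cbbeb1941a8ec,
    0x4141a8ca0d466c6506a33635ac6506a33634358d7d63283519b1a1ac653977d6328351d,
    0x10834232ac6506a3b358ca0d466c686b1afac6506a33634358ca72efac6506a33634358ca72e,
    0x10506506a3283519b1941a8cd8d0d63283519b1a1ac653977d63283519b1a1ac653977d63283519b1a1ac653977]
  cent := [696729600, 5806080, 184320, 311040, 15360, 18432, 8640, 6912, 1200, 1152, 6144, 768, 2592, 384, 144, 192,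
    576, 576, 256, 432, 120, 18432, 144, 48, 80, 64, 80, 96, 60, 288, 128, 28, 216, 576, 36, 24, 28, 1536, 48,
    48, 16, 40, 60, 108, 128, 96, 30, 576, 28, 40, 36, 72, 288, 24, 48, 48, 221184, 864, 20, 4608, 60, 288,
    18432, 432, 54, 1152, 6912, 768, 120, 576, 384, 144, 1024, 30, 108, 64, 192, 28, 288, 2592, 768, 288, 72,
    7776, 600, 288, 2592, 288, 54, 192, 184320, 15360, 8640, 1200, 1536, 128, 155520, 432, 7776, 1728, 60, 2592,
    600, 46080, 144, 5806080, 311040, 18432, 155520, 864, 576, 696729600]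
  bs := [0x1070605040302010092b3, 0x10200040506010307, 0x10706040503010002, 0x10607020003010405, 0x10706050403020100,
    0x10603040507000201, 0x10600040205010307, 0x10706050403020100, 0x10706050403020100, 0x10107060204050003,
    0x10701040006050302, 0x10607020003010405, 0x10700020301050406, 0x10006010302070405, 0x10006030204050701,
    0x10706050403020100, 0x10204000103050607, 0x10706050403020100, 0x10706000102030405, 0x10706050403020100,
    0x10706050403020100, 0x10703040206010500, 0x10706050403020100, 0x10706050403020100, 0x10706050403020100,
    0x10706050403020100, 0x10300060105070204, 0x10706050403020100, 0x10007060302040501, 0x10602040105000703,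
    0x10706050403020100, 0x10305000106040702, 0x10200040301070605, 0x10706050403020100, 0x10102000306040705,
    0x10306050401020007, 0x10706050403020100, 0x10407020500010306, 0x10401070300050206, 0x10302000604010507,
    0x1070605040302010076, 0x1070605040302010045, 0x10706050403020100, 0x10706050403020100, 0x10201050600030704,
    0x10501030006020704, 0x10501070406000203, 0x10002040105060703, 0x10706050403020100, 0x10207000501030406,
    0x10706050403020100, 0x10706050403020100, 0x10706050403020100, 0x10207030001060405, 0x10706050403020100ddcb,
    0x10402050003010607, 0x10706050403020100eccd7e, 0x10706050403020100, 0x107060504030201009a,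
    0x10406010203050007, 0x10002010604030705, 0x10107000506020304, 0x107060504030201003947b4,
    0x10706050403020100, 0x10007060502040103, 0x10706050403020100, 0x10206010304000507, 0x10207000401060503,
    0x10706050403020100, 0x10200070304010506, 0x10706050403020100, 0x10702000106030405, 0x10602070105030004,
    0x10001030705040602, 0x10706050403020100, 0x10706050200040103, 0x10301070500040602, 0x10003020601070504,
    0x10706050403020100, 0x10706050403020100, 0x10706050403020100, 0x10706050403020100, 0x10706050403020100,
    0x10701060200050403, 0x10706050403020100, 0x10500030402060107, 0x10706050403020100, 0x10706050403020100,
    0x10105040207000603, 0x10706050403020100, 0x10604010502030700, 0x10702010304000506, 0x10302040001060507,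
    0x10706050403020100, 0x10106020007050304, 0x10706050403020100ba5e, 0x10706050403020100, 0x10207060405010003,
    0x10706050403020100, 0x10706050403020100, 0x10100070206030405, 0x10706050403020100, 0x10706050403020100,
    0x10600050107030402, 0x10704060200050301, 0x107060504030201009b87, 0x10607020004030501, 0x10706050403020100,
    0x10706050403020100, 0x10706050403020100, 0x10706050403020100, 0x10200030106070405]
  cols := []
  mA := 0xffffffffffffffffffffffffffffffffffffffffffffffffffffffffffff
  mB := 0xffffffffffffffffffffffffffffffffffffffffffffffffffffffffffff
  rows := rows8
  certs := certs8

theorem chkTab8 : chkTab dat8 = true := by decide +kernel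
theorem chkNorm8 : chkNorm dat8 = true := by decide +kernel
theorem chkReg8 : chkReg dat8 = true := by decide +kernel
theorem chkMasks8 : chkMasks dat8 8 = true := by decide +kernel
theorem chkRows8 : chkRows dat8 dat8.certs 10 = true := by decide +kernel
theorem chkCls8 : allN 112 (fun c => chkCls dat8 8 c) = true := by decide +kernel

/-! ### Conclusion -/

theorem subE6 : SubE CoxeterMatrix.E₆ (Fin.castLE (by norm_num : 6 ≤ 8)) := by
  refine ⟨Fin.castLE_injective _, fun i j h => ?_⟩
  fin_cases i <;> fin_cases j <;>
    first | exact absurd rfl h | exact Or.inl ⟨rfl, rfl⟩ | exact Or.inr ⟨rfl, rfl⟩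

theorem subE7 : SubE CoxeterMatrix.E₇ (Fin.castLE (by norm_num : 7 ≤ 8)) := by
  refine ⟨Fin.castLE_injective _, fun i j h => ?_⟩
  fin_cases i <;> fin_cases j <;>
    first | exact absurd rfl h | exact Or.inl ⟨rfl, rfl⟩ | exact Or.inr ⟨rfl, rfl⟩

theorem subE8 : SubE CoxeterMatrix.E₈ (Fin.castLE (le_refl 8)) := by
  refine ⟨Fin.castLE_injective _, fun i j h => ?_⟩
  fin_cases i <;> fin_cases j <;>
    first | exact absurd rfl h | exact Or.inl ⟨rfl, rfl⟩ | exact Or.inr ⟨rfl, rfl⟩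

theorem main6 : numIrr WE6 = 25 ∧ ∀ l, numDefectZero l WE6 = cntD dat6 l :=
  main_tab (by norm_num) subE6 dat6 chkTab6 chkNorm6 chkReg6 chkMasks6 chkRows6 chkCls6

theorem main7 : numIrr WE7 = 60 ∧ ∀ l, numDefectZero l WE7 = cntD dat7 l :=
  main_tab (by norm_num) subE7 dat7 chkTab7 chkNorm7 chkReg7 chkMasks7 chkRows7 chkCls7

theorem main8 : numIrr WE8 = 112 ∧ ∀ l, numDefectZero l WE8 = cntD dat8 l :=
  main_tab (by norm_num) subE8 dat8 chkTab8 chkNorm8 chkReg8 chkMasks8 chkRows8 chkCls8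

theorem cnt65 : cntD dat6 5 = 15 := by decide +kernel
theorem cnt75 : cntD dat7 5 = 30 := by decide +kernel
theorem cnt77 : cntD dat7 7 = 46 := by decide +kernel
theorem cnt87 : cntD dat8 7 = 84 := by decide +kernel

/-- For `(n,ℓ) ∈ {(6,5), (7,5), (7,7), (8,7)}` the Weyl group `W(E_n)` has `25`, `60`,
`60`, `112` irreducible characters respectively, and in each case `|Irr(W)|` equals
the sum of the numbers of `ℓ`-defect-zero characters of the three outer automizer
groups `Out_F(S)`, `Out_F(T)`, `Out_F(E)` listed in Table 4 of the paper. -/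
theorem weyl_E_weight_counts :
    -- (n, ℓ) = (6, 5) : automizers C₄ × C₂, W(E₆), SL₂(5).2 with counts 8, 15, 2
    (numIrr WE6 = 25 ∧
      numDefectZero 5 (Multiplicative (ZMod 4 × ZMod 2)) = 8 ∧
      numDefectZero 5 WE6 = 15 ∧
      (∀ (X : Type) [Group X] [Finite X], IsExtSL2 5 X → numDefectZero 5 X = 2) ∧
      8 + 15 + 2 = 25) ∧
    -- (n, ℓ) = (7, 5) : automizers C₄ × C₂ × S₃, W(E₇), SL₂(5).2 × S₃
    (numIrr WE7 = 60 ∧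
      numDefectZero 5 (Multiplicative (ZMod 4 × ZMod 2) × Equiv.Perm (Fin 3)) = 24 ∧
      numDefectZero 5 WE7 = 30 ∧
      (∀ (X : Type) [Group X] [Finite X], IsExtSL2 5 X →
        numDefectZero 5 (X × Equiv.Perm (Fin 3)) = 6) ∧
      24 + 30 + 6 = 60) ∧
    -- (n, ℓ) = (7, 7) : automizers C₆ × C₂, W(E₇), SL₂(7).2
    (numIrr WE7 = 60 ∧
      numDefectZero 7 (Multiplicative (ZMod 6 × ZMod 2)) = 12 ∧
      numDefectZero 7 WE7 = 46 ∧
      (∀ (X : Type) [Group X] [Finite X], IsExtSL2 7 X → numDefectZero 7 X = 2) ∧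
      12 + 46 + 2 = 60) ∧
    -- (n, ℓ) = (8, 7) : automizers C₆ × C₂², W(E₈), SL₂(7).2 × C₂
    (numIrr WE8 = 112 ∧
      numDefectZero 7 (Multiplicative (ZMod 6 × ZMod 2 × ZMod 2)) = 24 ∧
      numDefectZero 7 WE8 = 84 ∧
      (∀ (X : Type) [Group X] [Finite X], IsExtSL2 7 X →
        numDefectZero 7 (X × Multiplicative (ZMod 2)) = 4) ∧
      24 + 84 + 4 = 112) := by
  exact ⟨⟨main6.1, small_6_5, (main6.2 5).trans cnt65, claim_6_5, by norm_num⟩,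
    ⟨main7.1, small_7_5, (main7.2 5).trans cnt75, claim_7_5, by norm_num⟩,
    ⟨main7.1, small_7_7, (main7.2 7).trans cnt77, claim_7_7, by norm_num⟩,
    ⟨main8.1, small_8_7, (main8.2 7).trans cnt87, claim_8_7, by norm_num⟩⟩
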